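/- The Duflo map D : S(g) → U(g) is multiplicative on invariants: for all P, Q ∈ S(g)^g one has D(PQ) = D(P)·D(Q) in U(g). -/

import Mathlib

noncomputable section

open scoped BigOperators

/-- Formal exponential of a power series (intended for series with zero constant term). -/
def expPS (F : PowerSeries ℚ) : PowerSeries ℚ :=
  PowerSeries.mk fun n =>
    ∑ k ∈ Finset.range (n + 1), ((k.factorial : ℚ))⁻¹ * PowerSeries.coeff n (F ^ k)

/-- The power series of sinh(x/2)/(x/2) = Σ_{k≥0} x^{2k} / (4^k (2k+1)!). -/
def sinhHalfSeries : PowerSeries ℚ :=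
  PowerSeries.mk fun n => if n % 2 = 0 then ((4 ^ (n / 2) * (n + 1).factorial : ℚ))⁻¹ else 0

variable {K : Type} [Field K] [CharZero K]
variable {L : Type} [LieRing L] [LieAlgebra K L]
variable {m : ℕ}

/-- The polynomial function x ↦ Tr((ad_x)^n) on g, written in the coordinates given by the
basis `b` (the variable `X i` is the `i`-th coordinate, i.e. the dual basis vector `bᵢ*`). -/
def adTracePoly (b : Module.Basis (Fin m) K L) (n : ℕ) : MvPolynomial (Fin m) K :=
  ∑ f : Fin n → Fin m,
    (LinearMap.trace K L (List.ofFn fun j => (LieAlgebra.ad K L (b (f j)) : Module.End K L)).prod) •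
      ∏ j, MvPolynomial.X (f j)

/-- The degree-`r` homogeneous component `δ_r` of the formal series
`exp (Σ_{n ≥ 1} 2 c_{2n} T_{2n})` in S(g*). -/
def dufloSymbol (b : Module.Basis (Fin m) K L) (c : ℕ → ℚ) (r : ℕ) : MvPolynomial (Fin m) K :=
  MvPolynomial.homogeneousComponent r
    (∑ k ∈ Finset.range (r + 1), ((k.factorial : K))⁻¹ •
      (∑ n ∈ Finset.Icc 1 r, ((2 * c (2 * n) : ℚ) : K) • adTracePoly b (2 * n)) ^ k)

/-- Symmetrization of the monomial with exponent vector `α`: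
`(1/d!) Σ_{σ ∈ S_d} x_{σ(1)} ⋯ x_{σ(d)}` in U(g). -/
def symmMonomial (b : Module.Basis (Fin m) K L) (α : Fin m →₀ ℕ) : UniversalEnvelopingAlgebra K L :=
  ((α.toMultiset.toList.length.factorial : K))⁻¹ •
    ∑ σ : Equiv.Perm (Fin α.toMultiset.toList.length),
      (List.ofFn fun j =>
        UniversalEnvelopingAlgebra.ι K (b (α.toMultiset.toList.get (σ j)))).prod

/-- The symmetrization map β : S(g) → U(g). -/
def symmetrization (b : Module.Basis (Fin m) K L) (P : MvPolynomial (Fin m) K) :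
    UniversalEnvelopingAlgebra K L :=
  ∑ α ∈ P.support, MvPolynomial.coeff α P • symmMonomial b α

/-- The differential operator `∂^α = ∏ᵢ (∂/∂bᵢ)^(α i)` on S(g). -/
def diffOpMon (α : Fin m →₀ ℕ) : Module.End K (MvPolynomial (Fin m) K) :=
  ((List.finRange m).map fun i =>
    (((MvPolynomial.pderiv i).toLinearMap : Module.End K (MvPolynomial (Fin m) K)) ^ (α i))).prod

/-- The constant-coefficient differential operator `δ(∂)` applied to `P`; each dual basis
vector `bᵢ*` occurring in `δ` is replaced by `∂/∂bᵢ`. -/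
def diffOp (δ P : MvPolynomial (Fin m) K) : MvPolynomial (Fin m) K :=
  ∑ α ∈ δ.support, MvPolynomial.coeff α δ • diffOpMon (K := K) α P

/-- The Duflo map `D(P) = Σ_r β(δ_r(∂) P)` (a finite sum). -/
def duflo (b : Module.Basis (Fin m) K L) (c : ℕ → ℚ) (P : MvPolynomial (Fin m) K) :
    UniversalEnvelopingAlgebra K L :=
  ∑ r ∈ Finset.range (P.totalDegree + 1), symmetrization b (diffOp (dufloSymbol b c r) P)

/-- The degree-one polynomial representing `y ∈ g` in the coordinates given by `b`. -/
def linPoly (b : Module.Basis (Fin m) K L) (y : L) : MvPolynomial (Fin m) K :=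
  ∑ j, b.repr y j • MvPolynomial.X j

/-- The adjoint action of `x ∈ g` on S(g), extended from g as a derivation. -/
def adS (b : Module.Basis (Fin m) K L) (x : L) :
    MvPolynomial (Fin m) K →ₗ[K] MvPolynomial (Fin m) K :=
  (MvPolynomial.mkDerivation K fun i => linPoly b ⁅x, b i⁆).toLinearMap

end

noncomputable section

set_option linter.unusedSectionVars false
set_option linter.unusedSimpArgs false

open Filter Topology

namespace Duflo

/-- The plane cut along `[1, ∞)`. -/
def cutPlane : Set ℂ := {z | 1 - z ∈ Complex.slitPlane}

lemma isOpen_cutPlane : IsOpen cutPlane :=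
  Complex.isOpen_slitPlane.preimage (by fun_prop)

lemma starConvex_cutPlane : StarConvex ℝ 0 cutPlane := by
  rw [starConvex_zero_iff]
  intro z hz a ha0 ha1
  have h := (starConvex_iff_segment_subset.1 Complex.starConvex_one_slitPlane) hz
  have h2 : (1 - a) • (1 : ℂ) + a • (1 - z) ∈ segment ℝ (1 : ℂ) (1 - z) :=
    ⟨1 - a, a, by linarith, ha0, by ring, rfl⟩
  have h3 := h h2
  have h4 : (1 - a) • (1 : ℂ) + a • (1 - z) = 1 - a • z := by
    simp only [Complex.real_smul]; push_cast; ring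
  rw [h4] at h3
  exact h3

lemma zero_mem_cutPlane : (0 : ℂ) ∈ cutPlane := by simp [cutPlane]

lemma one_notMem_cutPlane : (1 : ℂ) ∉ cutPlane := by simp [cutPlane]

lemma ne_one_of_mem_cutPlane {z : ℂ} (hz : z ∈ cutPlane) : z - 1 ≠ 0 := by
  rintro h
  rw [sub_eq_zero.1 h] at hz
  exact one_notMem_cutPlane hz

section Primitive

variable {E : Type*} [NormedAddCommGroup E] [NormedSpace ℂ E] [CompleteSpace E]

/-- A primitive of a holomorphic function on an open set that is star-shaped about `0`. -/
def starPrimitive (f : ℂ → E) (z : ℂ) : E := z • ∫ t in (0 : ℝ)..1, f (t * z)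

lemma starPrimitive_zero (f : ℂ → E) : starPrimitive f 0 = 0 := by simp [starPrimitive]

variable {U : Set ℂ}

lemma mul_mem_of_starConvex (hs : StarConvex ℝ 0 U) {z : ℂ} (hz : z ∈ U) {t : ℝ}
    (ht : t ∈ Set.Icc (0 : ℝ) 1) : (t : ℂ) * z ∈ U := by
  have := (starConvex_zero_iff.1 hs) hz ht.1 ht.2
  rwa [Complex.real_smul] at this

lemma hasDerivAt_starPrimitive (hU : IsOpen U) (hs : StarConvex ℝ 0 U) {f : ℂ → E}
    (hf : DifferentiableOn ℂ f U) {z : ℂ} (hz : z ∈ U) :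
    HasDerivAt (starPrimitive f) (f z) z := by
  have hmem : ∀ w ∈ U, ∀ t ∈ Set.Icc (0 : ℝ) 1, (t : ℂ) * w ∈ U :=
    fun w hw t ht => mul_mem_of_starConvex hs hw ht
  have hfd : ∀ w ∈ U, HasDerivAt f (deriv f w) w := fun w hw =>
    (hf.differentiableAt (hU.mem_nhds hw)).hasDerivAt
  have hdc : ContinuousOn (deriv f) U := (hf.deriv hU).continuousOn
  obtain ⟨ε, hε, hball⟩ := Metric.nhds_basis_closedBall.mem_iff.1 (hU.mem_nhds hz)
  have hcont : ∀ w ∈ U, ContinuousOn (fun t : ℝ => (t : ℂ) * w) (Set.Icc 0 1) :=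
    fun w _ => by fun_prop
  have hcF : ∀ w ∈ U, ContinuousOn (fun t : ℝ => f (t * w)) (Set.Icc 0 1) := fun w hw =>
    hf.continuousOn.comp (hcont w hw) (fun t ht => hmem w hw t ht)
  have hcF' : ∀ w ∈ U, ContinuousOn (fun t : ℝ => (t : ℂ) • deriv f (t * w)) (Set.Icc 0 1) :=
    fun w hw => (Complex.continuous_ofReal.continuousOn).smul
      (hdc.comp (hcont w hw) (fun t ht => hmem w hw t ht))
  have hK : IsCompact ((fun p : ℝ × ℂ => (p.1 : ℂ) * p.2) ''
      (Set.Icc 0 1 ×ˢ Metric.closedBall z ε)) :=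
    (isCompact_Icc.prod (isCompact_closedBall z ε)).image (by fun_prop)
  have hKU : ((fun p : ℝ × ℂ => (p.1 : ℂ) * p.2) ''
      (Set.Icc 0 1 ×ˢ Metric.closedBall z ε)) ⊆ U := by
    rintro _ ⟨⟨t, w⟩, ⟨ht, hw⟩, rfl⟩
    exact hmem w (hball hw) t ht
  obtain ⟨C, hC⟩ := hK.exists_bound_of_continuousOn (hdc.mono hKU)
  have h01 : Set.uIoc (0 : ℝ) 1 ⊆ Set.Icc 0 1 := by
    rw [Set.uIoc_of_le zero_le_one]; exact Set.Ioc_subset_Icc_self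
  have huIcc : Set.uIcc (0 : ℝ) 1 = Set.Icc 0 1 := Set.uIcc_of_le zero_le_one
  have key := intervalIntegral.hasDerivAt_integral_of_dominated_loc_of_deriv_le
    (μ := MeasureTheory.volume) (a := (0 : ℝ)) (b := 1)
    (F := fun w (t : ℝ) => f (t * w)) (F' := fun w (t : ℝ) => (t : ℂ) • deriv f (t * w))
    (x₀ := z) (bound := fun _ => C) (Metric.closedBall_mem_nhds z hε)
    (by
      filter_upwards [hU.mem_nhds hz] with w hw
      exact ((hcF w hw).mono h01).aestronglyMeasurable measurableSet_uIoc)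
    ((hcF z hz).mono huIcc.subset).intervalIntegrable
    (((hcF' z hz).mono h01).aestronglyMeasurable measurableSet_uIoc)
    (by
      refine Eventually.of_forall fun t ht w hw => ?_
      have ht' := h01 ht
      rw [norm_smul]
      have h1 : ‖(t : ℂ)‖ ≤ 1 := by
        rw [Complex.norm_real, Real.norm_of_nonneg ht'.1]; exact ht'.2
      have h2 := hC _ ⟨(t, w), ⟨ht', hw⟩, rfl⟩
      calc ‖(t : ℂ)‖ * ‖deriv f (t * w)‖ ≤ 1 * ‖deriv f (t * w)‖ := by gcongr
        _ ≤ C := by simpa using h2)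
    intervalIntegrable_const
    (by
      refine Eventually.of_forall fun t ht w hw => ?_
      have h1 : HasDerivAt (fun w : ℂ => (t : ℂ) * w) (t : ℂ) w := by
        simpa using (hasDerivAt_id w).const_mul (t : ℂ)
      exact (hfd _ (hmem w (hball hw) t (h01 ht))).scomp w h1)
  have hprod := (hasDerivAt_id z).smul key.2
  have hval : (id z • ∫ t in (0 : ℝ)..1, (t : ℂ) • deriv f (t * z))
      + (1 : ℂ) • ∫ t in (0 : ℝ)..1, f (t * z) = f z := by
    have hftc := intervalIntegral.integral_eq_sub_of_hasDerivAt
      (f := fun t : ℝ => (t : ℂ) • f (t * z))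
      (f' := fun t : ℝ => z • (t : ℂ) • deriv f (t * z) + f (t * z)) (a := 0) (b := 1)
      (by
        intro t ht
        rw [huIcc] at ht
        have h1 : HasDerivAt (fun t : ℝ => (t : ℂ) * z) z t := by
          simpa using (Complex.ofRealCLM.hasDerivAt (x := t)).mul_const z
        have h2 : HasDerivAt (fun t : ℝ => f (t * z)) (z • deriv f (t * z)) t :=
          (hfd _ (hmem z hz t ht)).scomp t h1
        have h3 := (Complex.ofRealCLM.hasDerivAt (x := t)).smul h2
        refine h3.congr_deriv ?_
        rw [smul_comm]
        simp)
      ((ContinuousOn.add (continuousOn_const.smul (hcF' z hz)) (hcF z hz)).mono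
        huIcc.subset).intervalIntegrable
    rw [intervalIntegral.integral_add, intervalIntegral.integral_smul] at hftc
    · simpa using hftc
    · exact ((continuousOn_const.smul (hcF' z hz)).mono huIcc.subset).intervalIntegrable
    · exact ((hcF z hz).mono huIcc.subset).intervalIntegrable
  rw [hval] at hprod
  exact hprod

lemma starPrimitive_mem_ker {F : Type*} [NormedAddCommGroup F] [NormedSpace ℂ F] [CompleteSpace F]
    (hs : StarConvex ℝ 0 U) {f : ℂ → E}
    (hf : ContinuousOn f U) (γ : E →L[ℂ] F) (hγ : ∀ z ∈ U, γ (f z) = 0) {z : ℂ} (hz : z ∈ U) :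
    γ (starPrimitive f z) = 0 := by
  have huIcc : Set.uIcc (0 : ℝ) 1 = Set.Icc 0 1 := Set.uIcc_of_le zero_le_one
  have hc : ContinuousOn (fun t : ℝ => f (t * z)) (Set.Icc 0 1) :=
    hf.comp (by fun_prop) (fun t ht => mul_mem_of_starConvex hs hz ht)
  rw [starPrimitive, map_smul, ← ContinuousLinearMap.intervalIntegral_comp_comm]
  · rw [intervalIntegral.integral_congr (g := fun _ => 0)]
    · simp
    · intro t ht
      rw [huIcc] at ht
      exact hγ _ (mul_mem_of_starConvex hs hz ht)
  · exact (hc.mono huIcc.subset).intervalIntegrable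

end Primitive

section ODE

variable {E : Type*} [NormedAddCommGroup E] [NormedSpace ℂ E]

/-- `h` solves `h' = (α/z + β/(z-1)) h` on the cut plane and is holomorphic at `0`. -/
structure IsSol (α β : E →L[ℂ] E) (h : ℂ → E) : Prop where
  diff : DifferentiableOn ℂ h cutPlane
  eqn : ∀ z ∈ cutPlane, z ≠ 0 → HasDerivAt h (z⁻¹ • α (h z) + (z - 1)⁻¹ • β (h z)) z

lemma IsSol.sub {α β : E →L[ℂ] E} {h k : ℂ → E} (hh : IsSol α β h) (hk : IsSol α β k) :
    IsSol α β (fun z => h z - k z) where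
  diff := hh.diff.sub hk.diff
  eqn z hz hz0 := by
    refine ((hh.eqn z hz hz0).sub (hk.eqn z hz hz0)).congr_deriv ?_
    simp only [map_sub, smul_sub]
    abel

variable [CompleteSpace E]

/-- One step of the Picard iteration. -/
def picardStep (α β : E →L[ℂ] E) (f : ℂ → E) : ℂ → E :=
  starPrimitive fun z => dslope (fun w => α (f w)) 0 z + (z - 1)⁻¹ • β (f z)

lemma picard_integrand_diff (α β : E →L[ℂ] E) {f : ℂ → E} (hf : DifferentiableOn ℂ f cutPlane) :
    DifferentiableOn ℂ (fun z => dslope (fun w => α (f w)) 0 z + (z - 1)⁻¹ • β (f z))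
      cutPlane := by
  refine DifferentiableOn.add ?_ ?_
  · rw [Complex.differentiableOn_dslope (isOpen_cutPlane.mem_nhds zero_mem_cutPlane)]
    exact α.differentiable.comp_differentiableOn hf
  · refine DifferentiableOn.smul ?_ (β.differentiable.comp_differentiableOn hf)
    exact DifferentiableOn.inv (by fun_prop) fun z hz => ne_one_of_mem_cutPlane hz

lemma hasDerivAt_picardStep (α β : E →L[ℂ] E) {f : ℂ → E} (hf : DifferentiableOn ℂ f cutPlane)
    {z : ℂ} (hz : z ∈ cutPlane) :
    HasDerivAt (picardStep α β f)
      (dslope (fun w => α (f w)) 0 z + (z - 1)⁻¹ • β (f z)) z :=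
  hasDerivAt_starPrimitive isOpen_cutPlane starConvex_cutPlane (picard_integrand_diff α β hf) hz

lemma picardStep_diff (α β : E →L[ℂ] E) {f : ℂ → E} (hf : DifferentiableOn ℂ f cutPlane) :
    DifferentiableOn ℂ (picardStep α β f) cutPlane := fun _ hz =>
  (hasDerivAt_picardStep α β hf hz).differentiableAt.differentiableWithinAt

lemma picardStep_ker (α β γ : E →L[ℂ] E) {f : ℂ → E} (hf : DifferentiableOn ℂ f cutPlane)
    (h1 : ∀ z ∈ cutPlane, γ (α (f z)) = 0) (h2 : ∀ z ∈ cutPlane, γ (β (f z)) = 0) :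
    ∀ z ∈ cutPlane, γ (picardStep α β f z) = 0 := by
  intro z hz
  refine starPrimitive_mem_ker starConvex_cutPlane
    (picard_integrand_diff α β hf).continuousOn γ ?_ hz
  intro w hw
  rw [map_add, map_smul, h2 w hw, smul_zero, add_zero]
  by_cases hw0 : w = 0
  · subst hw0
    rw [dslope_same]
    have hd : DifferentiableAt ℂ (fun w => α (f w)) 0 :=
      (α.differentiable.comp_differentiableOn hf).differentiableAt
        (isOpen_cutPlane.mem_nhds zero_mem_cutPlane)
    have e1 : HasDerivAt (fun w => γ (α (f w))) (γ (deriv (fun w => α (f w)) 0)) 0 :=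
      γ.hasFDerivAt.comp_hasDerivAt 0 hd.hasDerivAt
    have e2 : HasDerivAt (fun w => γ (α (f w))) 0 0 := by
      refine (hasDerivAt_const (0 : ℂ) (0 : E)).congr_of_eventuallyEq ?_
      filter_upwards [isOpen_cutPlane.mem_nhds zero_mem_cutPlane] with w hw using h1 w hw
    exact e1.unique e2
  · rw [dslope_of_ne _ hw0, slope_def_module, map_smul, map_sub, h1 w hw,
      h1 0 zero_mem_cutPlane]
    simp

/-- Picard iterates of a constant. -/
def picardIter (α β : E →L[ℂ] E) (h0 : E) : ℕ → ℂ → E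
  | 0 => fun _ => h0
  | k + 1 => picardStep α β (picardIter α β h0 k)

lemma picardIter_diff (α β : E →L[ℂ] E) (h0 : E) (k : ℕ) :
    DifferentiableOn ℂ (picardIter α β h0 k) cutPlane := by
  induction k with
  | zero => exact differentiableOn_const _
  | succ k ih => exact picardStep_diff α β ih

lemma picardIter_ker (α β : E →L[ℂ] E) (h0 : E) (N : ℕ)
    (hnil : ∀ l : List Bool, l.length = N → (l.map fun b => cond b α β).prod = 0) (k : ℕ) :
    ∀ l : List Bool, l.length + k = N → ∀ z ∈ cutPlane,
      (l.map fun b => cond b α β).prod (picardIter α β h0 k z) = 0 := by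
  induction k with
  | zero => intro l hl z _; rw [hnil l (by simpa using hl)]; rfl
  | succ k ih =>
    intro l hl
    refine picardStep_ker α β _ (picardIter_diff α β h0 k) ?_ ?_
    · intro z hz
      have := ih (l ++ [true]) (by simp; omega) z hz
      simpa using this
    · intro z hz
      have := ih (l ++ [false]) (by simp; omega) z hz
      simpa using this

theorem exists_isSol (α β : E →L[ℂ] E) (h0 : E) (hα : α h0 = 0) (N : ℕ)
    (hnil : ∀ l : List Bool, l.length = N → (l.map fun b => cond b α β).prod = 0) :
    ∃ h, IsSol α β h ∧ h 0 = h0 := by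
  refine ⟨fun z => ∑ k ∈ Finset.range (N + 1), picardIter α β h0 k z, ⟨?_, ?_⟩, ?_⟩
  · exact DifferentiableOn.fun_sum fun k _ => picardIter_diff α β h0 k
  · intro z hz hz0
    have hα0 : ∀ k, α (picardIter α β h0 k 0) = 0 := by
      rintro (_ | k)
      · exact hα
      · simp [picardIter, picardStep, starPrimitive_zero]
    have hlast : picardIter α β h0 N z = 0 := by
      simpa using picardIter_ker α β h0 N hnil N [] (by simp) z hz
    have hstep : ∀ k, HasDerivAt (picardIter α β h0 (k + 1))
        (z⁻¹ • α (picardIter α β h0 k z) + (z - 1)⁻¹ • β (picardIter α β h0 k z)) z := by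
      intro k
      refine (hasDerivAt_picardStep α β (picardIter_diff α β h0 k) hz).congr_deriv ?_
      rw [dslope_of_ne _ hz0, slope_def_module, hα0 k]
      simp
    have hsum : HasDerivAt (fun w => ∑ k ∈ Finset.range N, picardIter α β h0 (k + 1) w
        + picardIter α β h0 0 w)
        (∑ k ∈ Finset.range N, (z⁻¹ • α (picardIter α β h0 k z)
          + (z - 1)⁻¹ • β (picardIter α β h0 k z)) + 0) z :=
      (HasDerivAt.fun_sum fun k _ => hstep k).add (hasDerivAt_const z h0)
    simp only [Finset.sum_range_succ' _ N]
    refine hsum.congr_deriv ?_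
    rw [← Finset.sum_range_succ' (fun k => picardIter α β h0 k z), Finset.sum_range_succ, hlast,
      add_zero, add_zero, map_sum, map_sum, Finset.smul_sum, Finset.smul_sum,
      Finset.sum_add_distrib]
  · beta_reduce
    rw [Finset.sum_range_succ']
    simp [picardIter, picardStep, starPrimitive_zero]

theorem IsSol.eq_zero {α β : E →L[ℂ] E} {h : ℂ → E} (hh : IsSol α β h) (hα : ‖α‖ < 1)
    (h0 : h 0 = 0) : ∀ z ∈ cutPlane, h z = 0 := by
  have hnhds := isOpen_cutPlane.mem_nhds zero_mem_cutPlane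
  have hpre : IsPreconnected cutPlane :=
    (starConvex_cutPlane.isPathConnected zero_mem_cutPlane).isConnected.isPreconnected
  have han : AnalyticOnNhd ℂ h cutPlane := hh.diff.analyticOnNhd isOpen_cutPlane
  suffices hev : ∀ᶠ z in 𝓝 (0 : ℂ), h z = 0 from
    fun z hz => han.eqOn_zero_of_preconnected_of_eventuallyEq_zero hpre zero_mem_cutPlane hev hz
  by_contra hne
  obtain ⟨n, g, hg, hg0, hev⟩ :=
    (han 0 zero_mem_cutPlane).exists_eventuallyEq_pow_smul_nonzero_iff.2 hne
  simp only [sub_zero] at hev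
  have hn : n ≠ 0 := by
    rintro rfl
    have := hev.self_of_nhds
    simp [h0] at this
    exact hg0 this.symm
  have hgd := hg.eventually_analyticAt
  -- the differential equation, divided by `z ^ n`
  have heq : ∀ᶠ z in 𝓝[≠] (0 : ℂ), (n : ℂ) • g z + z • deriv g z
      = α (g z) + (z * (z - 1)⁻¹) • β (g z) := by
    have e1 : ∀ᶠ z in 𝓝[≠] (0 : ℂ), ∀ᶠ w in 𝓝 z, h w = w ^ n • g w :=
      (eventually_eventually_nhds.2 hev).filter_mono nhdsWithin_le_nhds
    filter_upwards [e1, hgd.filter_mono nhdsWithin_le_nhds, self_mem_nhdsWithin,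
      nhdsWithin_le_nhds hnhds] with z hz1 hz2 hz0 hzU
    have hz0 : z ≠ 0 := hz0
    have d1 : HasDerivAt h (z ^ n • deriv g z + ((n : ℂ) * z ^ (n - 1)) • g z) z :=
      ((hasDerivAt_pow n z).smul hz2.differentiableAt.hasDerivAt).congr_of_eventuallyEq hz1
    have d2 := d1.unique (hh.eqn z hzU hz0)
    rw [hz1.self_of_nhds, map_smul, map_smul] at d2
    have hzn : z ^ n ≠ 0 := pow_ne_zero _ hz0
    have d3 := congrArg (fun v => (z * (z ^ n)⁻¹) • v) d2
    simp only [smul_add, smul_smul] at d3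
    have c1 : z * (z ^ n)⁻¹ * z ^ n = z := by field_simp
    have c2 : z * (z ^ n)⁻¹ * (n * z ^ (n - 1)) = n := by
      obtain ⟨m, rfl⟩ := Nat.exists_eq_succ_of_ne_zero hn
      simp only [Nat.succ_eq_add_one, Nat.add_sub_cancel]
      field_simp
      ring
    have c3 : z * (z ^ n)⁻¹ * (z⁻¹ * z ^ n) = 1 := by field_simp
    have c4 : z * (z ^ n)⁻¹ * ((z - 1)⁻¹ * z ^ n) = z * (z - 1)⁻¹ := by
      field_simp
    rw [c1, c2, c3, c4, one_smul] at d3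
    rw [← d3, add_comm]
  have hcg : ContinuousAt g 0 := hg.continuousAt
  have hcd : ContinuousAt (deriv g) 0 := hg.deriv.continuousAt
  have l1 : ContinuousAt (fun z : ℂ => (n : ℂ) • g z + z • deriv g z) 0 := by fun_prop
  have l2 : ContinuousAt (fun z : ℂ => α (g z) + (z * (z - 1)⁻¹) • β (g z)) 0 := by
    have : ContinuousAt (fun z : ℂ => (z - 1)⁻¹) 0 :=
      ContinuousAt.inv₀ (by fun_prop) (by norm_num)
    fun_prop
  have l3 := tendsto_nhds_unique (l1.tendsto.mono_left nhdsWithin_le_nhds)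
    ((l2.tendsto.mono_left nhdsWithin_le_nhds).congr' (heq.mono fun _ h => h.symm))
  simp only [zero_smul, add_zero, zero_mul] at l3
  have hpos : 0 < ‖g 0‖ := norm_pos_iff.2 hg0
  have l4 : (n : ℝ) * ‖g 0‖ ≤ ‖α‖ * ‖g 0‖ := by
    calc (n : ℝ) * ‖g 0‖ = ‖(n : ℂ) • g 0‖ := by rw [norm_smul]; simp
      _ = ‖α (g 0)‖ := by rw [l3]
      _ ≤ _ := α.le_opNorm _
  have hn1 : (1 : ℝ) ≤ n := by exact_mod_cast Nat.one_le_iff_ne_zero.2 hn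
  nlinarith

theorem IsSol.eqOn {α β : E →L[ℂ] E} {h k : ℂ → E} (hh : IsSol α β h) (hk : IsSol α β k)
    (hα : ‖α‖ < 1) (h0 : h 0 = k 0) : ∀ z ∈ cutPlane, h z = k z := fun z hz =>
  sub_eq_zero.1 ((hh.sub hk).eq_zero hα (by simp [h0]) z hz)

end ODE

end Duflo

namespace Duflo

lemma inv_mem_slitPlane {z : ℂ} (hz : z ∈ Complex.slitPlane) : z⁻¹ ∈ Complex.slitPlane := by
  have hpos : 0 < Complex.normSq z := Complex.normSq_pos.2 (Complex.slitPlane_ne_zero hz)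
  rcases hz with h | h
  · left
    rw [Complex.inv_re]
    positivity
  · right
    rw [Complex.inv_im]
    exact div_ne_zero (neg_ne_zero.2 h) hpos.ne'

section KZ

variable {𝒜 : Type*} [NormedRing 𝒜] [NormedAlgebra ℂ 𝒜] [CompleteSpace 𝒜]

/-- `exp (t x)`. -/
def ex (t : ℂ) (x : 𝒜) : 𝒜 := NormedSpace.exp (t • x)

lemma ex_zero (x : 𝒜) : ex 0 x = 1 := by simp [ex]

lemma ex_zero_right (t : ℂ) : ex t (0 : 𝒜) = 1 := by simp [ex]

lemma hasDerivAt_ex (x : 𝒜) (t : ℂ) : HasDerivAt (fun u => ex u x) (x * ex t x) t :=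
  hasDerivAt_exp_smul_const' x t

lemma ex_add (s t : ℂ) (x : 𝒜) : ex (s + t) x = ex s x * ex t x := by
  let _ : NormedAlgebra ℚ 𝒜 := NormedAlgebra.restrictScalars ℚ ℂ 𝒜
  rw [ex, add_smul, NormedSpace.exp_add_of_commute]
  · rfl
  · exact ((Commute.refl x).smul_left s).smul_right t

lemma ex_neg_mul (t : ℂ) (x : 𝒜) : ex (-t) x * ex t x = 1 := by
  rw [← ex_add]; simp [ex_zero]

lemma ex_mul_neg (t : ℂ) (x : 𝒜) : ex t x * ex (-t) x = 1 := by
  rw [← ex_add]; simp [ex_zero]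

lemma ex_comm (t : ℂ) (x : 𝒜) : ex t x * x = x * ex t x :=
  (((Commute.refl x).smul_left t).exp_left).eq

lemma ex_neg (t : ℂ) (x : 𝒜) : ex t (-x) = ex (-t) x := by simp [ex]

/-- `z ^ x` for `z` in the slit plane. -/
def zp (z : ℂ) (x : 𝒜) : 𝒜 := ex (Complex.log z) x

/-- `z ^ (-x)` for `z` in the slit plane. -/
def zn (z : ℂ) (x : 𝒜) : 𝒜 := ex (-Complex.log z) x

lemma zp_mul_zn (z : ℂ) (x : 𝒜) : zp z x * zn z x = 1 := ex_mul_neg _ _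

lemma zn_mul_zp (z : ℂ) (x : 𝒜) : zn z x * zp z x = 1 := ex_neg_mul _ _

lemma zn_comm (z : ℂ) (x : 𝒜) : zn z x * x = x * zn z x := ex_comm _ _

lemma hasDerivAt_zp (x : 𝒜) {z : ℂ} (hz : z ∈ Complex.slitPlane) :
    HasDerivAt (fun u => zp u x) (z⁻¹ • (x * zp z x)) z :=
  (hasDerivAt_ex x _).scomp z (Complex.hasDerivAt_log hz)

lemma hasDerivAt_zn (x : 𝒜) {z : ℂ} (hz : z ∈ Complex.slitPlane) :
    HasDerivAt (fun u => zn u x) (-(z⁻¹ • (x * zn z x))) z := by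
  rw [← neg_smul]
  exact (hasDerivAt_ex x _).scomp z (Complex.hasDerivAt_log hz).neg

/-- Left multiplication as a continuous linear map. -/
abbrev mL (x : 𝒜) : 𝒜 →L[ℂ] 𝒜 := ContinuousLinearMap.mul ℂ 𝒜 x

/-- Right multiplication as a continuous linear map. -/
abbrev mR (x : 𝒜) : 𝒜 →L[ℂ] 𝒜 := (ContinuousLinearMap.mul ℂ 𝒜).flip x

/-- The inner derivation given by the commutator. -/
def cm (x : 𝒜) : 𝒜 →L[ℂ] 𝒜 := mL x - mR x

lemma cm_apply (x u : 𝒜) : cm x u = x * u - u * x := rfl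

lemma norm_cm_lt {x : 𝒜} (hx : ‖x‖ ≤ 1 / 100) : ‖cm x‖ < 1 := by
  have h1 : ‖mL x‖ ≤ ‖x‖ := ContinuousLinearMap.opNorm_mul_apply_le ℂ 𝒜 x
  have h2 : ‖mR x‖ ≤ ‖x‖ := by
    refine ContinuousLinearMap.opNorm_le_bound _ (norm_nonneg _) fun u => ?_
    rw [mul_comm]
    exact norm_mul_le u x
  calc ‖cm x‖ ≤ ‖mL x‖ + ‖mR x‖ := norm_sub_le _ _
    _ < 1 := by linarith

/-- Two small elements generating a nilpotent (non-unital) algebra. -/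
structure Good (A B : 𝒜) : Prop where
  nA : ‖A‖ ≤ 1 / 100
  nB : ‖B‖ ≤ 1 / 100
  nAB : ‖A + B‖ ≤ 1 / 100
  nil : ∃ (N : ℕ) (F : ℕ → Submodule ℂ 𝒜), F 0 = ⊤ ∧ F N = ⊥ ∧
    ∀ k, ∀ u ∈ F k, A * u ∈ F (k + 1) ∧ u * A ∈ F (k + 1) ∧ B * u ∈ F (k + 1) ∧ u * B ∈ F (k + 1)

lemma Good.symm {A B : 𝒜} (h : Good A B) : Good B A where
  nA := h.nB
  nB := h.nA
  nAB := by rw [add_comm]; exact h.nAB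
  nil := by
    obtain ⟨N, F, h0, h1, h2⟩ := h.nil
    exact ⟨N, F, h0, h1, fun k u hu =>
      ⟨(h2 k u hu).2.2.1, (h2 k u hu).2.2.2, (h2 k u hu).1, (h2 k u hu).2.1⟩⟩

lemma Good.third {A B : 𝒜} (h : Good A B) : Good A (-A - B) where
  nA := h.nA
  nB := by rw [← neg_add', norm_neg]; exact h.nAB
  nAB := by
    have : A + (-A - B) = -B := by abel
    rw [this, norm_neg]
    exact h.nB
  nil := by
    obtain ⟨N, F, h0, h1, h2⟩ := h.nil
    refine ⟨N, F, h0, h1, fun k u hu => ⟨(h2 k u hu).1, (h2 k u hu).2.1, ?_, ?_⟩⟩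
    · rw [sub_mul, neg_mul]
      exact (F (k + 1)).sub_mem ((F (k + 1)).neg_mem (h2 k u hu).1) (h2 k u hu).2.2.1
    · rw [mul_sub, mul_neg]
      exact (F (k + 1)).sub_mem ((F (k + 1)).neg_mem (h2 k u hu).2.1) (h2 k u hu).2.2.2

lemma nil_of_filtration {E : Type*} [NormedAddCommGroup E] [NormedSpace ℂ E] {α β : E →L[ℂ] E}
    {N : ℕ} {F : ℕ → Submodule ℂ E} (h0 : F 0 = ⊤) (h1 : F N = ⊥)
    (h : ∀ k, ∀ u ∈ F k, α u ∈ F (k + 1) ∧ β u ∈ F (k + 1)) (l : List Bool)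
    (hl : l.length = N) : (l.map fun b => cond b α β).prod = 0 := by
  have key : ∀ (l : List Bool) (u : E), (l.map fun b => cond b α β).prod u ∈ F l.length := by
    intro l
    induction l with
    | nil => intro u; simp [h0]
    | cons b l ih =>
      intro u
      have := h _ _ (ih u)
      cases b
      · simpa using this.2
      · simpa using this.1
  ext u
  have := key l u
  rw [hl, h1, Submodule.mem_bot] at this
  simpa using this

lemma Good.exists_H {A B : 𝒜} (h : Good A B) : ∃ H, IsSol (cm A) (mL B) H ∧ H 0 = 1 := by
  obtain ⟨N, F, h0, h1, h2⟩ := h.nil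
  exact exists_isSol _ _ 1 (by simp [cm_apply]) N (nil_of_filtration h0 h1 fun k u hu =>
    ⟨(F (k + 1)).sub_mem (h2 k u hu).1 (h2 k u hu).2.1, (h2 k u hu).2.2.1⟩)

lemma Good.exists_K {A B : 𝒜} (h : Good A B) : ∃ H, IsSol (cm A) (-mR B) H ∧ H 0 = 1 := by
  obtain ⟨N, F, h0, h1, h2⟩ := h.nil
  exact exists_isSol _ _ 1 (by simp [cm_apply]) N (nil_of_filtration h0 h1 fun k u hu =>
    ⟨(F (k + 1)).sub_mem (h2 k u hu).1 (h2 k u hu).2.1,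
      (F (k + 1)).neg_mem (h2 k u hu).2.2.2⟩)

open Classical in
/-- The regular part of the solution of the KZ equation at `0`. -/
def solH (A B : 𝒜) : ℂ → 𝒜 :=
  if h : ∃ H, IsSol (cm A) (mL B) H ∧ H 0 = 1 then h.choose else fun _ => 1

open Classical in
/-- The inverse of `solH`. -/
def solK (A B : 𝒜) : ℂ → 𝒜 :=
  if h : ∃ H, IsSol (cm A) (-mR B) H ∧ H 0 = 1 then h.choose else fun _ => 1

variable {A B : 𝒜}

lemma Good.H_sol (h : Good A B) : IsSol (cm A) (mL B) (solH A B) := by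
  rw [solH, dif_pos h.exists_H]; exact h.exists_H.choose_spec.1

lemma Good.H_zero (h : Good A B) : solH A B 0 = 1 := by
  rw [solH, dif_pos h.exists_H]; exact h.exists_H.choose_spec.2

lemma Good.K_sol (h : Good A B) : IsSol (cm A) (-mR B) (solK A B) := by
  rw [solK, dif_pos h.exists_K]; exact h.exists_K.choose_spec.1

lemma Good.K_zero (h : Good A B) : solK A B 0 = 1 := by
  rw [solK, dif_pos h.exists_K]; exact h.exists_K.choose_spec.2

lemma isSol_const_one (A : 𝒜) : IsSol (cm A) 0 (fun _ => (1 : 𝒜)) where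
  diff := differentiableOn_const _
  eqn z _ _ := by
    refine (hasDerivAt_const z (1 : 𝒜)).congr_deriv ?_
    simp [cm_apply]

lemma Good.K_mul_H (h : Good A B) : ∀ z ∈ cutPlane, solK A B z * solH A B z = 1 := by
  have hs : IsSol (cm A) 0 (fun z => solK A B z * solH A B z) :=
    { diff := h.K_sol.diff.mul h.H_sol.diff
      eqn := fun z hz hz0 => by
        refine ((h.K_sol.eqn z hz hz0).mul (h.H_sol.eqn z hz hz0)).congr_deriv ?_
        simp only [cm_apply, neg_apply, ContinuousLinearMap.flip_apply,
          ContinuousLinearMap.mul_apply', zero_apply, smul_zero, add_zero,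
          add_mul, mul_add, smul_mul_assoc, mul_smul_comm, sub_mul, mul_sub, smul_sub, smul_neg,
          neg_mul, mul_assoc]
        abel }
  exact hs.eqOn (isSol_const_one A) (norm_cm_lt h.nA) (by simp [h.K_zero, h.H_zero])

lemma Good.H_mul_K (h : Good A B) : ∀ z ∈ cutPlane, solH A B z * solK A B z = 1 := by
  have hs : IsSol (cm A) (cm B) (fun z => solH A B z * solK A B z) :=
    { diff := h.H_sol.diff.mul h.K_sol.diff
      eqn := fun z hz hz0 => by
        refine ((h.H_sol.eqn z hz hz0).mul (h.K_sol.eqn z hz hz0)).congr_deriv ?_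
        simp only [cm_apply, neg_apply, ContinuousLinearMap.flip_apply,
          ContinuousLinearMap.mul_apply',
          add_mul, mul_add, smul_mul_assoc, mul_smul_comm, sub_mul, mul_sub, smul_sub, smul_neg,
          mul_neg, mul_assoc]
        abel }
  have h1 : IsSol (cm A) (cm B) (fun _ => (1 : 𝒜)) :=
    { diff := differentiableOn_const _
      eqn := fun z _ _ => by
        refine (hasDerivAt_const z (1 : 𝒜)).congr_deriv ?_
        simp [cm_apply] }
  exact hs.eqOn h1 (norm_cm_lt h.nA) (by simp [h.K_zero, h.H_zero])

/-- The fundamental solution at `0`. -/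
def solG (A B : 𝒜) (z : ℂ) : 𝒜 := solH A B z * zp z A

/-- The inverse of the fundamental solution at `0`. -/
def solGi (A B : 𝒜) (z : ℂ) : 𝒜 := zn z A * solK A B z

lemma Good.G_mul_Gi (h : Good A B) {z : ℂ} (hz : z ∈ cutPlane) :
    solG A B z * solGi A B z = 1 := by
  rw [solG, solGi, mul_assoc, ← mul_assoc (zp z A), zp_mul_zn, one_mul, h.H_mul_K z hz]

lemma Good.Gi_mul_G (h : Good A B) {z : ℂ} (hz : z ∈ cutPlane) :
    solGi A B z * solG A B z = 1 := by
  rw [solG, solGi, mul_assoc, ← mul_assoc (solK A B z), h.K_mul_H z hz, one_mul, zn_mul_zp]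

lemma Good.hasDerivAt_G (h : Good A B) {z : ℂ} (hz : z ∈ cutPlane) (hz' : z ∈ Complex.slitPlane) :
    HasDerivAt (solG A B) ((z⁻¹ • A + (z - 1)⁻¹ • B) * solG A B z) z := by
  have hz0 : z ≠ 0 := Complex.slitPlane_ne_zero hz'
  refine ((h.H_sol.eqn z hz hz0).mul (hasDerivAt_zp A hz')).congr_deriv ?_
  simp only [solG, cm_apply, ContinuousLinearMap.mul_apply', add_mul, smul_mul_assoc,
    mul_smul_comm, sub_mul, smul_sub, mul_assoc]
  abel

lemma Good.hasDerivAt_Gi (h : Good A B) {z : ℂ} (hz : z ∈ cutPlane)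
    (hz' : z ∈ Complex.slitPlane) :
    HasDerivAt (solGi A B) (-(solGi A B z * (z⁻¹ • A + (z - 1)⁻¹ • B))) z := by
  have hz0 : z ≠ 0 := Complex.slitPlane_ne_zero hz'
  refine ((hasDerivAt_zn A hz').mul (h.K_sol.eqn z hz hz0)).congr_deriv ?_
  simp only [solGi, cm_apply, neg_apply, ContinuousLinearMap.flip_apply,
    ContinuousLinearMap.mul_apply', mul_add, smul_mul_assoc, ← zn_comm,
    mul_smul_comm, mul_sub, smul_sub, mul_assoc, neg_mul, smul_neg, mul_neg, neg_add]
  abel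

/-- The plane cut along `(-∞, 0]` and `[1, ∞)`. -/
def cutPlane₂ : Set ℂ := {z | z ∈ Complex.slitPlane ∧ 1 - z ∈ Complex.slitPlane}

lemma isOpen_cutPlane₂ : IsOpen cutPlane₂ :=
  Complex.isOpen_slitPlane.inter isOpen_cutPlane

lemma half_mem : (1 / 2 : ℂ) ∈ cutPlane₂ := by
  constructor <;> left <;> norm_num

lemma isPreconnected_cutPlane₂ : IsPreconnected cutPlane₂ := by
  have : StarConvex ℝ (1 / 2 : ℂ) cutPlane₂ := by
    refine StarConvex.inter (t := {z | 1 - z ∈ Complex.slitPlane}) ?_ ?_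
    · have := Complex.starConvex_ofReal_slitPlane (x := 1 / 2) (by norm_num)
      simpa using this
    · have := Complex.starConvex_ofReal_slitPlane (x := 1 / 2) (by norm_num)
      rw [starConvex_iff_segment_subset] at this ⊢
      intro y hy
      rintro w ⟨a, b, ha, hb, hab, rfl⟩
      refine this hy ⟨a, b, ha, hb, hab, ?_⟩
      have hab' : (a : ℂ) + b = 1 := by exact_mod_cast hab
      simp only [Complex.real_smul]
      push_cast
      linear_combination -(1 - 1 : ℂ) * hab' + hab'
  exact (this.isPathConnected half_mem).isConnected.isPreconnected

lemma cutPlane₂_symm {z : ℂ} (hz : z ∈ cutPlane₂) : 1 - z ∈ cutPlane₂ :=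
  ⟨hz.2, by simpa using hz.1⟩

/-- The KZ associator. -/
def assoc (A B : 𝒜) : 𝒜 := solGi B A (1 / 2) * solG A B (1 / 2)

lemma Good.assoc_eq (h : Good A B) {z : ℂ} (hz : z ∈ cutPlane₂) :
    solGi B A (1 - z) * solG A B z = assoc A B := by
  have hder : ∀ w ∈ cutPlane₂, HasDerivAt (fun w => solGi B A (1 - w) * solG A B w) 0 w := by
    intro w hw
    have hw' := cutPlane₂_symm hw
    have h1 : HasDerivAt (fun w : ℂ => 1 - w) (-1) w := by
      simpa using (hasDerivAt_id w).const_sub 1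
    have h2 := (h.symm.hasDerivAt_Gi hw'.2 hw'.1).scomp w h1
    refine (h2.mul (h.hasDerivAt_G hw.2 hw.1)).congr_deriv ?_
    have e1 : (1 - w)⁻¹ = -(w - 1)⁻¹ := by rw [← inv_neg]; ring
    have e2 : (1 - w - 1)⁻¹ = -w⁻¹ := by rw [← inv_neg]; ring
    simp only [Function.comp, e1, e2, neg_smul, one_smul, neg_neg]
    noncomm_ring
  have := isOpen_cutPlane₂.is_const_of_deriv_eq_zero isPreconnected_cutPlane₂
    (f := fun w => solGi B A (1 - w) * solG A B w)
    (fun w hw => (hder w hw).differentiableAt.differentiableWithinAt)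
    (fun w hw => (hder w hw).deriv) hz half_mem
  have e : (1 - 1 / 2 : ℂ) = 1 / 2 := by norm_num
  simp only [e] at this
  exact this

lemma Good.assoc_mul (h : Good A B) : assoc A B * assoc B A = 1 := by
  rw [assoc, assoc, mul_assoc, ← mul_assoc (solG A B _), h.G_mul_Gi half_mem.2, one_mul,
    h.symm.Gi_mul_G half_mem.2]

lemma Good.G_eq (h : Good A B) {z : ℂ} (hz : z ∈ cutPlane₂) :
    solG A B z = solG B A (1 - z) * assoc A B := by
  rw [← h.assoc_eq hz, ← mul_assoc, h.symm.G_mul_Gi (cutPlane₂_symm hz).2, one_mul]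

lemma Good.pfaff (h : Good A B) : ∀ z ∈ cutPlane,
    solH A B z = solH A (-A - B) (z / (z - 1)) * zn (1 - z) A := by
  have hmap : ∀ z ∈ cutPlane, z / (z - 1) ∈ cutPlane := by
    intro z hz
    have h1 := ne_one_of_mem_cutPlane hz
    have e : 1 - z / (z - 1) = (1 - z)⁻¹ := by
      have : (1 - z) ≠ 0 := by rw [← neg_sub]; exact neg_ne_zero.2 h1
      field_simp
      ring
    change 1 - z / (z - 1) ∈ Complex.slitPlane
    rw [e]
    exact inv_mem_slitPlane hz
  have hdm : ∀ z ∈ cutPlane, HasDerivAt (fun z : ℂ => z / (z - 1)) (-((z - 1) ^ 2)⁻¹) z := by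
    intro z hz
    have h1 := ne_one_of_mem_cutPlane hz
    refine ((hasDerivAt_id z).div ((hasDerivAt_id z).sub_const 1) h1).congr_deriv ?_
    simp only [id]
    field_simp
    ring
  have hdz : ∀ z ∈ cutPlane, HasDerivAt (fun u => zn (1 - u) A)
      ((1 - z)⁻¹ • (A * zn (1 - z) A)) z := by
    intro z hz
    have h1 : HasDerivAt (fun w : ℂ => 1 - w) (-1) z := by
      simpa using (hasDerivAt_id z).const_sub 1
    refine ((hasDerivAt_zn A hz).scomp z h1).congr_deriv ?_
    simp
  refine h.H_sol.eqOn (k := fun z => solH A (-A - B) (z / (z - 1)) * zn (1 - z) A)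
    ⟨?_, ?_⟩ (norm_cm_lt h.nA) ?_
  · refine DifferentiableOn.mul ?_ ?_
    · exact h.third.H_sol.diff.comp
        (fun z hz => (hdm z hz).differentiableAt.differentiableWithinAt) hmap
    · exact fun z hz => (hdz z hz).differentiableAt.differentiableWithinAt
  · intro z hz hz0
    have h1 := ne_one_of_mem_cutPlane hz
    have h2 := (h.third.H_sol.eqn _ (hmap z hz) (div_ne_zero hz0 h1)).scomp z (hdm z hz)
    refine (h2.mul (hdz z hz)).congr_deriv ?_
    have e1 : -((z - 1) ^ 2)⁻¹ * (z / (z - 1))⁻¹ = z⁻¹ - (z - 1)⁻¹ := by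
      field_simp
      ring
    have e2 : -((z - 1) ^ 2)⁻¹ * (z / (z - 1) - 1)⁻¹ = -(z - 1)⁻¹ := by
      have : z / (z - 1) - 1 = (z - 1)⁻¹ := by field_simp; ring
      rw [this]
      field_simp
    have e3 : (1 - z)⁻¹ = -(z - 1)⁻¹ := by rw [← inv_neg]; ring
    set X := solH A (-A - B) (z / (z - 1)) with hX
    simp only [Function.comp, smul_add, smul_smul, e1, e2, e3, cm_apply,
      ContinuousLinearMap.mul_apply', ← hX]
    generalize (z - 1)⁻¹ = s
    generalize z⁻¹ = t
    have hc := zn_comm (1 - z) A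
    simp only [mul_sub, sub_mul, mul_add, add_mul, smul_mul_assoc, mul_smul_comm, mul_assoc, hc,
      neg_mul, mul_neg, sub_smul, neg_smul, smul_sub, smul_add, smul_neg]
    abel
  · simp [h.H_zero, h.third.H_zero, zn, ex_zero]

/-- The sixth roots of unity `exp (± π i / 3)`. -/
def root6 (ε : ℂ) : ℂ := Complex.exp (ε * (Real.pi / 3 * Complex.I))

lemma root6_eq {ε : ℂ} (hε : ε = 1 ∨ ε = -1) :
    root6 ε = 1 / 2 + ε * (Real.sqrt 3 / 2 * Complex.I) := by
  have h : root6 ε = Complex.cos (ε * (Real.pi / 3)) +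
      Complex.sin (ε * (Real.pi / 3)) * Complex.I := by
    rw [root6, ← mul_assoc, Complex.exp_mul_I]
  have hc : Complex.cos (Real.pi / 3) = 1 / 2 := by
    rw [show (Real.pi / 3 : ℂ) = ((Real.pi / 3 : ℝ) : ℂ) by push_cast; rfl, ← Complex.ofReal_cos,
      Real.cos_pi_div_three]
    norm_num
  have hs : Complex.sin (Real.pi / 3) = Real.sqrt 3 / 2 := by
    rw [show (Real.pi / 3 : ℂ) = ((Real.pi / 3 : ℝ) : ℂ) by push_cast; rfl, ← Complex.ofReal_sin,
      Real.sin_pi_div_three]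
    norm_num
  rcases hε with rfl | rfl
  · rw [h, one_mul, hc, hs]; ring
  · rw [h, neg_one_mul, Complex.cos_neg, Complex.sin_neg, hc, hs]; ring

lemma root6_mem {ε : ℂ} (hε : ε = 1 ∨ ε = -1) : root6 ε ∈ cutPlane₂ := by
  rw [root6_eq hε]
  constructor <;> left <;> rcases hε with rfl | rfl <;> norm_num

lemma one_sub_root6 {ε : ℂ} (hε : ε = 1 ∨ ε = -1) : 1 - root6 ε = root6 (-ε) := by
  rw [root6_eq hε, root6_eq (by rcases hε with rfl | rfl <;> simp)]
  ring

lemma log_root6 {ε : ℂ} (hε : ε = 1 ∨ ε = -1) :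
    Complex.log (root6 ε) = ε * (Real.pi / 3 * Complex.I) := by
  have hpi := Real.pi_pos
  apply Complex.log_exp
  · rcases hε with rfl | rfl <;> simp <;> linarith
  · rcases hε with rfl | rfl <;> simp <;> linarith

lemma root6_div {ε : ℂ} (hε : ε = 1 ∨ ε = -1) :
    root6 ε / (root6 ε - 1) = root6 (-ε) := by
  have h1 := one_sub_root6 hε
  have h2 : root6 ε - 1 ≠ 0 := ne_one_of_mem_cutPlane (root6_mem hε).2
  have hs : (Real.sqrt 3 : ℂ) ^ 2 = 3 := by
    exact_mod_cast Real.sq_sqrt (show (0 : ℝ) ≤ 3 by norm_num)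
  have he : ε ^ 2 = 1 := by rcases hε with rfl | rfl <;> norm_num
  rw [div_eq_iff h2, ← h1, root6_eq hε]
  linear_combination ((Real.sqrt 3 : ℂ) ^ 2 * ε ^ 2 / 4) * Complex.I_sq - ε ^ 2 / 4 * hs -
    3 / 4 * he

/-- `exp (s π i x)`. -/
def expi (s : ℂ) (x : 𝒜) : 𝒜 := ex (s * (Real.pi * Complex.I)) x

lemma expi_add (s t : ℂ) (x : 𝒜) : expi (s + t) x = expi s x * expi t x := by
  rw [expi, add_mul, ex_add]; rfl

lemma expi_mul_neg (s : ℂ) (x : 𝒜) : expi s x * expi (-s) x = 1 := by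
  rw [← expi_add]; simp [expi, ex_zero]

lemma expi_neg_mul (s : ℂ) (x : 𝒜) : expi (-s) x * expi s x = 1 := by
  rw [← expi_add]; simp [expi, ex_zero]

lemma expi_neg (s : ℂ) (x : 𝒜) : expi s (-x) = expi (-s) x := by
  rw [expi, expi, ex_neg]; congr 1; ring

lemma Good.step (h : Good A B) {ε : ℂ} (hε : ε = 1 ∨ ε = -1) :
    solH A B (root6 ε) =
      solH B (-A - B) (root6 ε) * (expi (-ε * (2 / 3)) B * assoc A B * expi (-ε * (1 / 3)) A) := by
  have hε' : -ε = 1 ∨ -ε = -1 := by rcases hε with rfl | rfl <;> simp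
  have hG := h.G_eq (root6_mem hε)
  have hP := h.symm.pfaff _ (root6_mem hε').2
  have hz : ∀ x : 𝒜, zp (root6 ε) x = expi (ε * (1 / 3)) x := fun x => by
    rw [zp, log_root6 hε, expi]; congr 1; ring
  have hz' : ∀ x : 𝒜, zp (root6 (-ε)) x = expi (-ε * (1 / 3)) x := fun x => by
    rw [zp, log_root6 hε', expi]; congr 1; ring
  have hn : ∀ x : 𝒜, zn (root6 ε) x = expi (-ε * (1 / 3)) x := fun x => by
    rw [zn, log_root6 hε, expi]; congr 1; ring
  rw [root6_div hε', one_sub_root6 hε', neg_neg, hn, show -B - A = -A - B by abel] at hP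
  rw [one_sub_root6 hε, solG, solG, hP, hz, hz'] at hG
  have e1 := congrArg (· * expi (-ε * (1 / 3)) A) hG
  simp only [mul_assoc] at e1
  rw [neg_mul, expi_mul_neg, mul_one, ← neg_mul] at e1
  rw [e1]
  have e2 : expi (-ε * (2 / 3)) B = expi (-ε * (1 / 3)) B * expi (-ε * (1 / 3)) B := by
    rw [← expi_add]; congr 1; ring
  rw [e2]
  simp only [mul_assoc]

theorem Good.hexagon (h : Good A B) {ε : ℂ} (hε : ε = 1 ∨ ε = -1) :
    assoc (-A - B) A * expi (-ε) (-A - B) * assoc B (-A - B) * expi (-ε) B * assoc A B *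
      expi (-ε) A = 1 := by
  have hBC : Good B (-A - B) := by
    have := h.symm.third
    rwa [show -B - A = -A - B by abel] at this
  have hCA : Good (-A - B) A := h.third.symm
  have s1 := h.step hε
  have s2 := hBC.step hε
  have s3 := hCA.step hε
  rw [show -B - (-A - B) = A by abel] at s2
  rw [show -(-A - B) - A = B by abel] at s3
  have hinv := h.K_mul_H _ (root6_mem hε).2
  have hc : ∀ x : 𝒜, expi (-ε) x = expi (-ε * (1 / 3)) x * expi (-ε * (2 / 3)) x := fun x => by
    rw [← expi_add]; congr 1; ring
  have hc' : expi (-ε) A = expi (-ε * (2 / 3)) A * expi (-ε * (1 / 3)) A := by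
    rw [← expi_add]; congr 1; ring
  rw [s2, s3] at s1
  have t1 := congrArg (fun x => solK A B (root6 ε) * x) s1
  simp only [← mul_assoc, hinv, one_mul] at t1
  -- `t1 : 1 = exp(..A) * M * exp(..A)`
  have t2 := congrArg (fun x => expi (ε * (2 / 3)) A * x * expi (-ε * (2 / 3)) A) t1
  simp only [mul_one, ← mul_assoc] at t2
  rw [neg_mul, expi_mul_neg, one_mul, ← neg_mul] at t2
  rw [hc (-A - B), hc B, show expi (-ε) A = expi (-ε * (1 / 3)) A * expi (-ε * (2 / 3)) A from hc A]
  simp only [← mul_assoc]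
  exact t2.symm

theorem Good.hexagon_conj (h : Good A B) {ε : ℂ} (hε : ε = 1 ∨ ε = -1) :
    expi (2 * ε) (A + B) * assoc B (-A - B) = assoc B (-A - B) * expi ε B * assoc A B *
      expi (2 * ε) A * assoc B A * expi ε B := by
  have hε' : -ε = 1 ∨ -ε = -1 := by rcases hε with rfl | rfl <;> simp
  have hBC : Good B (-A - B) := by
    have := h.symm.third
    rwa [show -B - A = -A - B by abel] at this
  have h1 := h.hexagon hε
  have h2 := h.hexagon hε'
  rw [neg_neg] at h2
  set p := assoc (-A - B) A
  set q := assoc B (-A - B)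
  set C := -A - B with hC
  have hZ : expi (2 * ε) (A + B) = expi (-ε) C * expi (-ε) C := by
    rw [← expi_add, show A + B = -C by rw [hC]; abel, expi_neg]; congr 1; ring
  have hA : expi (2 * ε) A = expi ε A * expi ε A := by
    rw [← expi_add]; congr 1; ring
  -- inverses
  have iC : expi ε C * expi (-ε) C = 1 := expi_mul_neg _ _
  set u := q * expi ε B * assoc A B * expi ε A with hu
  set v := q * expi (-ε) B * assoc A B * expi (-ε) A with hv
  have h1' : p * expi (-ε) C * v = 1 := by rw [hv]; simp only [mul_assoc] at h1 ⊢; exact h1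
  have h2' : p * expi ε C * u = 1 := by rw [hu]; simp only [mul_assoc] at h2 ⊢; exact h2
  -- right inverse of `v`
  have hqi : q * assoc C B = 1 := hBC.assoc_mul
  set w := expi ε A * assoc B A * expi ε B * assoc C B with hw
  have iA : expi (-ε) A * expi ε A = 1 := expi_neg_mul _ _
  have iB : expi (-ε) B * expi ε B = 1 := expi_neg_mul _ _
  have hvw : v * w = 1 := by
    calc v * w = q * (expi (-ε) B * (assoc A B * (expi (-ε) A * expi ε A) * assoc B A) * expi ε B)
          * assoc C B := by rw [hv, hw]; noncomm_ring
      _ = 1 := by rw [iA, mul_one, h.assoc_mul, mul_one, iB, mul_one, hqi]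
  have hpC : p * expi (-ε) C = w := by
    calc p * expi (-ε) C = p * expi (-ε) C * (v * w) := by rw [hvw, mul_one]
      _ = w := by rw [← mul_assoc, h1', one_mul]
  have hui : u * (p * expi ε C) = 1 := by
    -- `u` has a right inverse, hence its left inverse is two-sided
    have hux : ∃ x, u * x = 1 := by
      refine ⟨expi (-ε) A * assoc B A * expi (-ε) B * assoc C B, ?_⟩
      calc u * (expi (-ε) A * assoc B A * expi (-ε) B * assoc C B)
          = q * (expi ε B * (assoc A B * (expi ε A * expi (-ε) A) * assoc B A) * expi (-ε) B)
          * assoc C B := by rw [hu]; noncomm_ring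
        _ = 1 := by
          rw [expi_mul_neg, mul_one, h.assoc_mul, mul_one, expi_mul_neg, mul_one, hqi]
    obtain ⟨x, hx⟩ := hux
    have : p * expi ε C = x := by
      calc p * expi ε C = p * expi ε C * (u * x) := by rw [hx, mul_one]
        _ = x := by rw [← mul_assoc, h2', one_mul]
    rw [this, hx]
  have hfin : expi (2 * ε) (A + B) = u * w := by
    calc expi (2 * ε) (A + B) = u * (p * expi ε C) * (expi (-ε) C * expi (-ε) C) := by
          rw [hui, one_mul, hZ]
      _ = u * (p * (expi ε C * expi (-ε) C) * expi (-ε) C) := by noncomm_ring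
      _ = u * w := by rw [iC, mul_one, hpC]
  have hqi' : assoc C B * q = 1 := hBC.symm.assoc_mul
  rw [hfin, hu, hw, hA]
  calc _ = q * expi ε B * assoc A B * (expi ε A * expi ε A) * assoc B A * expi ε B *
        (assoc C B * q) := by noncomm_ring
    _ = _ := by rw [hqi', mul_one]

end KZ

end Duflo

namespace Duflo

section Adjoint

variable {𝒜 : Type*} [NormedRing 𝒜] [NormedAlgebra ℂ 𝒜] [CompleteSpace 𝒜]

lemma norm_cm_le (x : 𝒜) : ‖cm x‖ ≤ 2 * ‖x‖ := by
  refine ContinuousLinearMap.opNorm_le_bound _ (by positivity) fun u => ?_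
  rw [cm_apply]
  calc ‖x * u - u * x‖ ≤ ‖x * u‖ + ‖u * x‖ := norm_sub_le _ _
    _ ≤ ‖x‖ * ‖u‖ + ‖u‖ * ‖x‖ := add_le_add (norm_mul_le _ _) (norm_mul_le _ _)
    _ = _ := by ring

/-- Two-sided multiplication `u ↦ x u y`. -/
def lr (x y : 𝒜) : 𝒜 →L[ℂ] 𝒜 := mL x * mR y

lemma lr_apply (x y u : 𝒜) : lr x y u = x * u * y := by simp [lr, mul_assoc]

lemma lr_mul (x y x' y' : 𝒜) : lr x y * lr x' y' = lr (x * x') (y' * y) := by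
  ext u; simp [lr_apply, mul_assoc]

lemma lr_one : lr (1 : 𝒜) 1 = 1 := by ext u; simp [lr_apply]

lemma HasDerivAt.lr {f g : ℂ → 𝒜} {f' g' : 𝒜} {z : ℂ} (hf : HasDerivAt f f' z)
    (hg : HasDerivAt g g' z) :
    HasDerivAt (fun z => lr (f z) (g z)) (lr f' (g z) + lr (f z) g') z :=
  ((ContinuousLinearMap.mul ℂ 𝒜).hasFDerivAt.comp_hasDerivAt z hf).mul
    ((ContinuousLinearMap.mul ℂ 𝒜).flip.hasFDerivAt.comp_hasDerivAt z hg)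

lemma ex_cm (t : ℂ) (x : 𝒜) : ex t (cm x) = lr (ex t x) (ex (-t) x) := by
  have hder : ∀ t, HasDerivAt (fun t => ex (-t) (cm x) * lr (ex t x) (ex (-t) x)) 0 t := by
    intro t
    have h0 : HasDerivAt (fun t : ℂ => -t) (-1) t := (hasDerivAt_id t).neg
    have h1 := (hasDerivAt_ex (cm x) (-t)).scomp t h0
    have h2 := HasDerivAt.lr (hasDerivAt_ex x t) ((hasDerivAt_ex x (-t)).scomp t h0)
    refine (h1.mul h2).congr_deriv ?_
    simp only [Function.comp, neg_smul, one_smul, neg_mul, ← ex_comm, mul_assoc]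
    ext u
    simp only [ContinuousLinearMap.add_apply, lr_apply, ContinuousLinearMap.mul_apply, cm_apply,
      neg_apply, ContinuousLinearMap.zero_apply]
    rw [← map_neg, ← map_add]
    refine (congrArg _ ?_).trans (map_zero (ex (-t) (cm x)))
    have c1 := ex_comm t x
    have c2 := ex_comm (-t) x
    generalize ex t x = E at *
    generalize ex (-t) x = F at *
    simp only [c1, mul_assoc, c2]
    noncomm_ring
  have := is_const_of_deriv_eq_zero (fun t => (hder t).differentiableAt)
    (fun t => (hder t).deriv) t 0
  simp only [neg_zero, ex_zero, lr_one, mul_one] at this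
  calc ex t (cm x) = ex t (cm x) * (ex (-t) (cm x) * lr (ex t x) (ex (-t) x)) := by
        rw [this, mul_one]
    _ = _ := by rw [← mul_assoc, ex_mul_neg, one_mul]

lemma map_ex {ℬ : Type*} [NormedRing ℬ] [NormedAlgebra ℂ ℬ] [CompleteSpace ℬ]
    (ρ : 𝒜 →ₐ[ℂ] ℬ) (hρ : Continuous ρ) (t : ℂ) (x : 𝒜) : ρ (ex t x) = ex t (ρ x) := by
  let _ : NormedAlgebra ℚ 𝒜 := NormedAlgebra.restrictScalars ℚ ℂ 𝒜
  let _ : NormedAlgebra ℚ ℬ := NormedAlgebra.restrictScalars ℚ ℂ ℬ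
  rw [ex, NormedSpace.map_exp ρ hρ, map_smul]
  rfl

/-- A continuous algebra homomorphism to `End 𝒜` that is the adjoint action on `A` and `B`. -/
structure AdRep (A B : 𝒜) (ρ : 𝒜 →ₐ[ℂ] (𝒜 →L[ℂ] 𝒜)) : Prop where
  cont : Continuous ρ
  mapA : ρ A = cm A
  mapB : ρ B = cm B

variable {A B : 𝒜} {ρ : 𝒜 →ₐ[ℂ] (𝒜 →L[ℂ] 𝒜)}

lemma AdRep.symm (hρ : AdRep A B ρ) : AdRep B A ρ := ⟨hρ.cont, hρ.mapB, hρ.mapA⟩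

lemma AdRep.map_H (hρ : AdRep A B ρ) (h : Good A B) : ∀ z ∈ cutPlane,
    ρ (solH A B z) = lr (solH A B z) (solK A B z) := by
  have hnorm : ‖cm (cm A)‖ < 1 := by
    have h1 := norm_cm_le (cm A)
    have h2 := norm_cm_le A
    have h3 := h.nA
    linarith
  let ρ' : 𝒜 →L[ℂ] (𝒜 →L[ℂ] 𝒜) := ⟨ρ.toLinearMap, hρ.cont⟩
  have s1 : IsSol (cm (cm A)) (mL (cm B)) (fun z => ρ (solH A B z)) :=
    { diff := ρ'.differentiable.comp_differentiableOn h.H_sol.diff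
      eqn := fun z hz hz0 => by
        refine (ρ'.hasFDerivAt.comp_hasDerivAt z (h.H_sol.eqn z hz hz0)).congr_deriv ?_
        change ρ _ = _
        simp only [map_add, map_smul, cm_apply, map_sub, map_mul, hρ.mapA, hρ.mapB,
          ContinuousLinearMap.mul_apply'] }
  have s2 : IsSol (cm (cm A)) (mL (cm B)) (fun z => lr (solH A B z) (solK A B z)) := by
    refine ⟨?_, fun z hz hz0 => ?_⟩
    · intro z hz
      refine DifferentiableAt.differentiableWithinAt ?_
      exact (HasDerivAt.lr
        ((h.H_sol.diff.differentiableAt (isOpen_cutPlane.mem_nhds hz)).hasDerivAt)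
        ((h.K_sol.diff.differentiableAt (isOpen_cutPlane.mem_nhds hz)).hasDerivAt)).differentiableAt
    · refine (HasDerivAt.lr (h.H_sol.eqn z hz hz0) (h.K_sol.eqn z hz hz0)).congr_deriv ?_
      ext u
      simp only [ContinuousLinearMap.add_apply, lr_apply, ContinuousLinearMap.mul_apply,
        ContinuousLinearMap.smul_apply, ContinuousLinearMap.sub_apply,
        cm_apply, ContinuousLinearMap.mul_apply', neg_apply,
        ContinuousLinearMap.flip_apply, mul_add, add_mul, mul_sub, sub_mul, mul_smul_comm,
        smul_mul_assoc, smul_sub, smul_neg, mul_neg, mul_assoc]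
      abel
  exact s1.eqOn s2 hnorm (by simp [h.H_zero, h.K_zero, lr_one])

lemma AdRep.map_K (hρ : AdRep A B ρ) (h : Good A B) {z : ℂ} (hz : z ∈ cutPlane) :
    ρ (solK A B z) = lr (solK A B z) (solH A B z) := by
  have h1 : ρ (solK A B z) * ρ (solH A B z) = 1 := by rw [← map_mul, h.K_mul_H z hz, map_one]
  rw [hρ.map_H h z hz] at h1
  calc ρ (solK A B z) = ρ (solK A B z) * lr (solH A B z) (solK A B z) *
        lr (solK A B z) (solH A B z) := by
        rw [mul_assoc, lr_mul, h.H_mul_K z hz, lr_one, mul_one]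
    _ = _ := by rw [h1, one_mul]

lemma AdRep.map_zp (hρ : AdRep A B ρ) (z : ℂ) : ρ (zp z A) = lr (zp z A) (zn z A) := by
  rw [zp, map_ex ρ hρ.cont, hρ.mapA, ex_cm, zn]

lemma AdRep.map_zn (hρ : AdRep A B ρ) (z : ℂ) : ρ (zn z A) = lr (zn z A) (zp z A) := by
  rw [zn, map_ex ρ hρ.cont, hρ.mapA, ex_cm, neg_neg, zp]

lemma AdRep.map_G (hρ : AdRep A B ρ) (h : Good A B) {z : ℂ} (hz : z ∈ cutPlane) :
    ρ (solG A B z) = lr (solG A B z) (solGi A B z) := by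
  rw [solG, map_mul, hρ.map_H h z hz, hρ.map_zp, lr_mul, solGi]

lemma AdRep.map_Gi (hρ : AdRep A B ρ) (h : Good A B) {z : ℂ} (hz : z ∈ cutPlane) :
    ρ (solGi A B z) = lr (solGi A B z) (solG A B z) := by
  rw [solGi, map_mul, hρ.map_K h hz, hρ.map_zn, lr_mul, solG]

theorem AdRep.map_assoc (hρ : AdRep A B ρ) (h : Good A B) :
    ρ (assoc A B) = lr (assoc A B) (assoc B A) := by
  rw [assoc, map_mul, hρ.map_G h half_mem.2, hρ.symm.map_Gi h.symm half_mem.2, lr_mul, assoc]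

end Adjoint

section Derivation

variable {𝒜 : Type*} [NormedRing 𝒜] [NormedAlgebra ℂ 𝒜] [CompleteSpace 𝒜]

/-- The integrand of the derivative of the associator. -/
def assocR (A B : 𝒜) (s : ℝ) : 𝒜 :=
  ((s : ℂ) - 1)⁻¹ • (solGi B A (1 - s) - zn (1 - s) B)

/-- The moments of the integrand. -/
def assocQ (A B : 𝒜) (n : ℕ) : 𝒜 := ∫ s in (0 : ℝ)..1, (s : ℂ) ^ n • assocR A B s

lemma norm_ex_le [NormOneClass 𝒜] (t : ℂ) (x : 𝒜) : ‖ex t x‖ ≤ Real.exp (‖t‖ * ‖x‖) := by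
  rw [ex, NormedSpace.exp_eq_tsum ℂ]
  have hs := NormedSpace.expSeries_div_hasSum_exp (‖t‖ * ‖x‖)
  rw [← Real.exp_eq_exp_ℝ] at hs
  refine tsum_of_norm_bounded hs fun n => ?_
  rw [norm_smul, norm_inv, Complex.norm_natCast, div_eq_inv_mul]
  gcongr
  calc ‖(t • x) ^ n‖ ≤ ‖t • x‖ ^ n := norm_pow_le _ _
    _ = _ := by rw [norm_smul]

lemma ofReal_mem_cutPlane₂ {s : ℝ} (hs : s ∈ Set.Ioo (0 : ℝ) 1) : (s : ℂ) ∈ cutPlane₂ := by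
  constructor
  · exact Complex.ofReal_mem_slitPlane.2 hs.1
  · left
    simpa using hs.2

lemma norm_zp_le [NormOneClass 𝒜] {x : 𝒜} (hx : ‖x‖ ≤ 1 / 100) {s : ℝ}
    (hs : s ∈ Set.Ioo (0 : ℝ) 1) : ‖zp (s : ℂ) x‖ ≤ s ^ (-(1 / 100) : ℝ) ∧
      ‖zn (s : ℂ) x‖ ≤ s ^ (-(1 / 100) : ℝ) := by
  have hl : ‖Complex.log s‖ = -Real.log s := by
    rw [← Complex.ofReal_log hs.1.le, Complex.norm_real, Real.norm_eq_abs,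
      abs_of_neg (Real.log_neg hs.1 hs.2)]
  have key : Real.exp (‖Complex.log s‖ * ‖x‖) ≤ s ^ (-(1 / 100) : ℝ) := by
    rw [Real.rpow_def_of_pos hs.1, hl]
    apply Real.exp_le_exp.2
    have := Real.log_neg hs.1 hs.2
    nlinarith
  constructor
  · exact (norm_ex_le _ _).trans key
  · refine (norm_ex_le _ _).trans ?_
    rwa [norm_neg]

variable {A B : 𝒜}

/-- Near the segment `[0, 1/2]` the solutions are bounded, and `1 + O(s)`. -/
lemma exists_bound {E : Type*} [NormedAddCommGroup E] [NormedSpace ℂ E] {f : ℂ → E}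
    (hf : DifferentiableOn ℂ f cutPlane) (h0 : f 0 = 0) :
    ∃ C, 0 ≤ C ∧ ∀ s ∈ Set.Icc (0 : ℝ) (1 / 2), ‖f s‖ ≤ C * s := by
  have hseg : ∀ s ∈ Set.Icc (0 : ℝ) (1 / 2), (s : ℂ) ∈ cutPlane := by
    intro s hs
    left
    have := hs.2
    simp
    linarith
  have hcont : ContinuousOn (dslope f 0) cutPlane :=
    (continuousOn_dslope (isOpen_cutPlane.mem_nhds zero_mem_cutPlane)).2
      ⟨hf.continuousOn, hf.differentiableAt (isOpen_cutPlane.mem_nhds zero_mem_cutPlane)⟩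
  have hc2 : ContinuousOn (fun s : ℝ => dslope f 0 (s : ℂ)) (Set.Icc 0 (1 / 2)) :=
    hcont.comp Complex.continuous_ofReal.continuousOn hseg
  obtain ⟨C, hC⟩ := isCompact_Icc.exists_bound_of_continuousOn hc2
  refine ⟨C, (norm_nonneg _).trans (hC 0 ⟨le_rfl, by norm_num⟩), fun s hs => ?_⟩
  have h1 := sub_smul_dslope f 0 (s : ℂ)
  rw [h0, sub_zero, sub_zero] at h1
  rw [← h1, norm_smul, Complex.norm_real, Real.norm_of_nonneg hs.1, mul_comm]
  exact mul_le_mul_of_nonneg_right (hC s hs) hs.1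

end Derivation

end Duflo

namespace Duflo

section Derivation

variable {𝒜 : Type*} [NormedRing 𝒜] [NormedAlgebra ℂ 𝒜] [CompleteSpace 𝒜] [NormOneClass 𝒜]
variable {A B : 𝒜}

lemma rpow_small_le {s : ℝ} (hs : s ∈ Set.Ioo (0 : ℝ) 1) {c d : ℝ} (h : c ≤ d) :
    s ^ d ≤ s ^ c := Real.rpow_le_rpow_of_exponent_ge hs.1 hs.2.le h

/-- Integrable majorant on `(0, 1)`. -/
def major (s : ℝ) : ℝ := s ^ (-(1 / 4) : ℝ) + (1 - s) ^ (-(1 / 4) : ℝ)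

lemma tendsto_conj_zero {X : 𝒜} (hX : ‖X‖ ≤ 1 / 100) {f : ℂ → 𝒜}
    (hf : DifferentiableOn ℂ f cutPlane) (h0 : f 0 = 0) :
    Tendsto (fun s : ℝ => zn (s : ℂ) X * f s * zp (s : ℂ) X) (𝓝[>] 0) (𝓝 0) := by
  obtain ⟨C, hC0, hC⟩ := exists_bound hf h0
  have hlim : Tendsto (fun s : ℝ => C * s ^ (1 / 2 : ℝ)) (𝓝[>] 0) (𝓝 0) := by
    have : Tendsto (fun s : ℝ => C * s ^ (1 / 2 : ℝ)) (𝓝 0) (𝓝 (C * 0 ^ (1 / 2 : ℝ))) :=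
      ((Real.continuous_rpow_const (by norm_num)).tendsto 0).const_mul C
    rw [Real.zero_rpow (by norm_num), mul_zero] at this
    exact this.mono_left nhdsWithin_le_nhds
  refine squeeze_zero_norm' ?_ hlim
  have hmem : Set.Ioo (0 : ℝ) (1 / 2) ∈ 𝓝[>] (0 : ℝ) := Ioo_mem_nhdsGT (by norm_num)
  filter_upwards [hmem] with s hs
  have hs' : s ∈ Set.Ioo (0 : ℝ) 1 := ⟨hs.1, by linarith [hs.2]⟩
  obtain ⟨e1, e2⟩ := norm_zp_le hX hs'
  calc ‖zn (s : ℂ) X * f s * zp (s : ℂ) X‖ ≤ ‖zn (s : ℂ) X‖ * ‖f s‖ * ‖zp (s : ℂ) X‖ :=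
        (norm_mul_le _ _).trans (mul_le_mul_of_nonneg_right (norm_mul_le _ _) (norm_nonneg _))
    _ ≤ s ^ (-(1 / 100) : ℝ) * (C * s) * s ^ (-(1 / 100) : ℝ) := by
        have := hC s ⟨hs.1.le, hs.2.le⟩
        have := Real.rpow_nonneg hs.1.le (-(1 / 100) : ℝ)
        have := hs.1
        gcongr
    _ = C * s ^ (1 + -(1 / 100) + -(1 / 100) : ℝ) := by
        rw [Real.rpow_add hs.1, Real.rpow_add hs.1, Real.rpow_one]; ring
    _ ≤ C * s ^ (1 / 2 : ℝ) := by
        exact mul_le_mul_of_nonneg_left (rpow_small_le hs' (by norm_num)) hC0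

lemma Good.Gi_eq (h : Good A B) {z : ℂ} (hz : z ∈ cutPlane₂) :
    solGi B A (1 - z) = assoc A B * solGi A B z := by
  rw [← h.assoc_eq hz, mul_assoc, h.G_mul_Gi hz.2, mul_one]

lemma one_sub_mem_Ioo {s : ℝ} (hs : s ∈ Set.Ioo (0 : ℝ) 1) : 1 - s ∈ Set.Ioo (0 : ℝ) 1 :=
  ⟨by linarith [hs.2], by linarith [hs.1]⟩

lemma Good.norm_assocR_le (h : Good A B) :
    ∃ C, 0 ≤ C ∧ ∀ s ∈ Set.Ioo (0 : ℝ) 1, ‖assocR A B s‖ ≤ C * major s := by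
  have hd1 : DifferentiableOn ℂ (fun z => solK A B z - 1) cutPlane :=
    h.K_sol.diff.sub_const 1
  have hd2 : DifferentiableOn ℂ (fun z => solK B A z - 1) cutPlane :=
    h.symm.K_sol.diff.sub_const 1
  obtain ⟨C₁, p1, b1⟩ := exists_bound hd1 (by rw [h.K_zero, sub_self])
  obtain ⟨C₂, p2, b2⟩ := exists_bound hd2 (by rw [h.symm.K_zero, sub_self])
  refine ⟨2 * (‖assoc A B‖ * (C₁ + 1)) + 4 + C₂, by positivity, fun s hs => ?_⟩
  have hs1 := one_sub_mem_Ioo hs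
  have hcast : ((1 - s : ℝ) : ℂ) = 1 - (s : ℂ) := by push_cast; rfl
  have m1 : s ^ (-(1 / 100) : ℝ) ≤ s ^ (-(1 / 4) : ℝ) := rpow_small_le hs (by norm_num)
  have m2 : (1 - s) ^ (-(1 / 100) : ℝ) ≤ (1 - s) ^ (-(1 / 4) : ℝ) :=
    rpow_small_le hs1 (by norm_num)
  have n1 := Real.rpow_nonneg hs.1.le (-(1 / 4) : ℝ)
  have n2 := Real.rpow_nonneg hs1.1.le (-(1 / 4) : ℝ)
  have zB := (norm_zp_le h.nB hs1).2
  have zA := (norm_zp_le h.nA hs).2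
  rw [hcast] at zB
  have hn : ‖((s : ℂ) - 1)⁻¹‖ = (1 - s)⁻¹ := by
    rw [norm_inv, ← norm_neg, neg_sub, ← hcast, Complex.norm_real, Real.norm_of_nonneg hs1.1.le]
  rw [assocR, norm_smul, hn]
  have nΦ := norm_nonneg (assoc A B)
  rcases le_total s (1 / 2) with hh | hh
  · have hinv : (1 - s)⁻¹ ≤ 2 := by
      rw [inv_le_comm₀ hs1.1 (by norm_num)]; linarith
    have hK : ‖solK A B s‖ ≤ C₁ + 1 := by
      have := b1 s ⟨hs.1.le, hh⟩
      calc ‖solK A B s‖ = ‖(solK A B s - 1) + 1‖ := by rw [sub_add_cancel]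
        _ ≤ ‖solK A B s - 1‖ + ‖(1 : 𝒜)‖ := norm_add_le _ _
        _ ≤ C₁ * s + 1 := by rw [norm_one]; gcongr
        _ ≤ C₁ + 1 := by nlinarith [hs.2]
    have hU : ‖solGi B A (1 - s)‖ ≤ ‖assoc A B‖ * (C₁ + 1) * s ^ (-(1 / 4) : ℝ) := by
      rw [h.Gi_eq (ofReal_mem_cutPlane₂ hs), solGi]
      calc ‖assoc A B * (zn (s : ℂ) A * solK A B s)‖
          ≤ ‖assoc A B‖ * (‖zn (s : ℂ) A‖ * ‖solK A B s‖) :=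
            (norm_mul_le _ _).trans (mul_le_mul_of_nonneg_left (norm_mul_le _ _) nΦ)
        _ ≤ ‖assoc A B‖ * (s ^ (-(1 / 4) : ℝ) * (C₁ + 1)) := by
            gcongr; exact zA.trans m1
        _ = _ := by ring
    calc (1 - s)⁻¹ * ‖solGi B A (1 - s) - zn (1 - s) B‖
        ≤ 2 * (‖assoc A B‖ * (C₁ + 1) * s ^ (-(1 / 4) : ℝ) + (1 - s) ^ (-(1 / 4) : ℝ)) := by
          gcongr
          exact (norm_sub_le _ _).trans (add_le_add hU (zB.trans m2))
      _ ≤ _ := by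
          rw [major]
          have : 0 ≤ ‖assoc A B‖ * (C₁ + 1) := by positivity
          nlinarith [mul_nonneg this n2, mul_nonneg p2 n1, mul_nonneg p2 n2]
  · have hU : ‖solGi B A (1 - s) - zn (1 - s) B‖ ≤ (1 - s) ^ (-(1 / 4) : ℝ) * (C₂ * (1 - s)) := by
      have := b2 (1 - s) ⟨hs1.1.le, by linarith⟩
      rw [hcast] at this
      calc ‖solGi B A (1 - s) - zn (1 - s) B‖ = ‖zn (1 - (s : ℂ)) B * (solK B A (1 - s) - 1)‖ := by
            rw [solGi, mul_sub, mul_one]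
        _ ≤ ‖zn (1 - (s : ℂ)) B‖ * ‖solK B A (1 - s) - 1‖ := norm_mul_le _ _
        _ ≤ _ := by gcongr; exact zB.trans m2
    calc (1 - s)⁻¹ * ‖solGi B A (1 - s) - zn (1 - s) B‖
        ≤ (1 - s)⁻¹ * ((1 - s) ^ (-(1 / 4) : ℝ) * (C₂ * (1 - s))) := by
          have := hs1.1
          gcongr
      _ = C₂ * (1 - s) ^ (-(1 / 4) : ℝ) := by
          have := hs1.1.ne'
          field_simp
      _ ≤ _ := by
          rw [major]
          have : 0 ≤ ‖assoc A B‖ * (C₁ + 1) := by positivity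
          nlinarith [mul_nonneg this n2, mul_nonneg this n1, mul_nonneg p2 n1, mul_nonneg p2 n2]

lemma intervalIntegrable_rpow_one_sub {r : ℝ} (hr : -1 < r) :
    IntervalIntegrable (fun s : ℝ => (1 - s) ^ r) MeasureTheory.volume 0 1 := by
  have := (intervalIntegral.intervalIntegrable_rpow' (a := 1) (b := 0) hr).comp_sub_left 1
  simpa using this

lemma intervalIntegrable_major : IntervalIntegrable major MeasureTheory.volume 0 1 :=
  (intervalIntegral.intervalIntegrable_rpow' (by norm_num)).add
    (intervalIntegrable_rpow_one_sub (by norm_num))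

lemma intervalIntegrable_of_le_major {E : Type*} [NormedAddCommGroup E] [NormedSpace ℝ E]
    {f : ℝ → E} (hf : ContinuousOn f (Set.Ioo 0 1)) {C : ℝ}
    (hC : ∀ s ∈ Set.Ioo (0 : ℝ) 1, ‖f s‖ ≤ C * major s) :
    IntervalIntegrable f MeasureTheory.volume 0 1 := by
  rw [intervalIntegrable_iff_integrableOn_Ioo_of_le zero_le_one]
  have hm := (intervalIntegrable_iff_integrableOn_Ioo_of_le zero_le_one).1
    (intervalIntegrable_major.const_mul C)
  refine MeasureTheory.Integrable.mono' hm (hf.aestronglyMeasurable measurableSet_Ioo) ?_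
  exact (MeasureTheory.ae_restrict_iff' measurableSet_Ioo).2 (Eventually.of_forall hC)

lemma Good.continuousOn_assocR (h : Good A B) :
    ContinuousOn (assocR A B) (Set.Ioo 0 1) := by
  have hc : ContinuousOn (fun s : ℝ => (1 - (s : ℂ))) (Set.Ioo 0 1) := by fun_prop
  have hm : ∀ s ∈ Set.Ioo (0 : ℝ) 1, 1 - (s : ℂ) ∈ cutPlane₂ :=
    fun s hs => cutPlane₂_symm (ofReal_mem_cutPlane₂ hs)
  have h1 : ContinuousOn (solGi B A) cutPlane₂ := fun z hz =>
    (h.symm.hasDerivAt_Gi hz.2 hz.1).continuousAt.continuousWithinAt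
  have h2 : ContinuousOn (fun z => zn z B) cutPlane₂ := fun z hz =>
    (hasDerivAt_zn B hz.1).continuousAt.continuousWithinAt
  have h3 : ContinuousOn (fun s : ℝ => ((s : ℂ) - 1)⁻¹) (Set.Ioo 0 1) := by
    refine ContinuousOn.inv₀ (by fun_prop) fun s hs => ?_
    exact ne_one_of_mem_cutPlane (ofReal_mem_cutPlane₂ hs).2
  exact h3.smul ((h1.comp hc hm).sub (h2.comp hc hm))

lemma Good.intervalIntegrable_assocR (h : Good A B) (n : ℕ) :
    IntervalIntegrable (fun s : ℝ => (s : ℂ) ^ n • assocR A B s) MeasureTheory.volume 0 1 := by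
  obtain ⟨C, hC, hb⟩ := h.norm_assocR_le
  refine intervalIntegrable_of_le_major
    (ContinuousOn.smul (by fun_prop) h.continuousOn_assocR) (C := C) fun s hs => ?_
  rw [norm_smul, norm_pow, Complex.norm_real, Real.norm_of_nonneg hs.1.le]
  calc s ^ n * ‖assocR A B s‖ ≤ 1 * ‖assocR A B s‖ := by
        gcongr
        exact pow_le_one₀ hs.1.le hs.2.le
    _ ≤ _ := by rw [one_mul]; exact hb s hs

/-- A continuous derivation. -/
def IsDer (D : 𝒜 →L[ℂ] 𝒜) : Prop := ∀ x y, D (x * y) = D x * y + x * D y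

lemma IsDer.map_one {D : 𝒜 →L[ℂ] 𝒜} (hD : IsDer D) : D 1 = 0 := by
  have := hD 1 1
  simpa using this

lemma IsDer.map_ex {D : 𝒜 →L[ℂ] 𝒜} (hD : IsDer D) {x : 𝒜} (hx : D x = 0) (t : ℂ) :
    D (ex t x) = 0 := by
  have hder : ∀ t, HasDerivAt (fun t => ex (-t) x * D (ex t x)) 0 t := by
    intro t
    have h0 : HasDerivAt (fun t : ℂ => -t) (-1) t := (hasDerivAt_id t).neg
    have h1 := (hasDerivAt_ex x (-t)).scomp t h0
    have h2 := D.hasFDerivAt.comp_hasDerivAt t (hasDerivAt_ex x t)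
    refine (h1.mul h2).congr_deriv ?_
    simp only [Function.comp, hD x, hx, zero_mul, zero_add, neg_smul, one_smul]
    rw [← ex_comm (-t)]
    noncomm_ring
  have := is_const_of_deriv_eq_zero (fun t => (hder t).differentiableAt)
    (fun t => (hder t).deriv) t 0
  simp only [ex_zero, hD.map_one, mul_zero] at this
  calc D (ex t x) = ex t x * (ex (-t) x * D (ex t x)) := by
        rw [← mul_assoc, ex_mul_neg, one_mul]
    _ = 0 := by rw [this, mul_zero]

lemma IsDer.inv {D : 𝒜 →L[ℂ] 𝒜} (hD : IsDer D) {x y : 𝒜} (hxy : x * y = 1) (hyx : y * x = 1) :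
    D y = -(y * D x * y) := by
  have := hD y x
  rw [hyx, hD.map_one] at this
  calc D y = D y * x * y := by rw [mul_assoc, hxy, mul_one]
    _ = _ := by rw [eq_neg_of_add_eq_zero_left this.symm]; noncomm_ring

variable {ρ : 𝒜 →ₐ[ℂ] (𝒜 →L[ℂ] 𝒜)}

lemma AdRep.map_R (hρ : AdRep A B ρ) (h : Good A B) {s : ℝ} (hs : s ∈ Set.Ioo (0 : ℝ) 1) (u : 𝒜) :
    ρ (assocR A B s) u = ((s : ℂ) - 1)⁻¹ • (solGi B A (1 - s) * u * solG B A (1 - s)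
      - zn (1 - s) B * u * zp (1 - s) B) := by
  have hm := cutPlane₂_symm (ofReal_mem_cutPlane₂ hs)
  rw [assocR, map_smul, map_sub, hρ.symm.map_Gi h.symm hm.2, hρ.symm.map_zn]
  simp [lr_apply]

lemma AdRep.map_Q (hρ : AdRep A B ρ) (h : Good A B) (u : 𝒜) :
    ρ (assocQ A B 0) u = ∫ s in (0 : ℝ)..1, ρ (assocR A B s) u := by
  let ev : 𝒜 →L[ℂ] 𝒜 := (ContinuousLinearMap.apply ℂ 𝒜 u).comp ⟨ρ.toLinearMap, hρ.cont⟩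
  have := ev.intervalIntegral_comp_comm (h.intervalIntegrable_assocR 0)
  simp only [pow_zero, one_smul] at this
  rw [assocQ]
  simp only [pow_zero, one_smul]
  exact this.symm

/-- The logarithmic derivative of the associator along a derivation killing the first letter. -/
theorem AdRep.der_assoc (hρ : AdRep A B ρ) (h : Good A B) {D : 𝒜 →L[ℂ] 𝒜} (hD : IsDer D)
    (hA : D A = 0) : D (assoc A B) * assoc B A = ρ (assocQ A B 0) (D B) := by
  set Φ := assoc A B with hΦ
  set Ψ := assoc B A with hΨ
  have hΦΨ : Φ * Ψ = 1 := h.assoc_mul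
  have hΨΦ : Ψ * Φ = 1 := h.symm.assoc_mul
  let F : ℝ → 𝒜 := fun s => Φ * (solGi A B s * D (solG A B s)) * Ψ
    - zn (1 - s) B * D (zp (1 - s) B)
  have hder : ∀ s ∈ Set.Ioo (0 : ℝ) 1, HasDerivAt F (ρ (assocR A B s) (D B)) s := by
    intro s hs
    have hm := ofReal_mem_cutPlane₂ hs
    have hm' := cutPlane₂_symm hm
    have h0 : HasDerivAt (fun w : ℂ => 1 - w) (-1) (s : ℂ) := by
      simpa using (hasDerivAt_id (s : ℂ)).const_sub 1
    have g1 := h.hasDerivAt_G hm.2 hm.1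
    have g2 := h.hasDerivAt_Gi hm.2 hm.1
    have p1 := (hasDerivAt_zp B hm'.1).scomp (s : ℂ) h0
    have p2 := (hasDerivAt_zn B hm'.1).scomp (s : ℂ) h0
    have g3 := D.hasFDerivAt.comp_hasDerivAt _ g1
    have p3 := D.hasFDerivAt.comp_hasDerivAt _ p1
    have key := ((((g2.mul g3).const_mul Φ).mul_const Ψ).sub (p2.mul p3)).scomp s
      (Complex.ofRealCLM.hasDerivAt (x := s))
    refine key.congr_deriv ?_
    rw [Complex.ofRealCLM_apply, Complex.ofReal_one, one_smul]
    rw [hρ.map_R h hs, h.Gi_eq hm, h.symm.G_eq hm']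
    have e0 : (1 : ℂ) - (1 - s) = s := by ring
    have e1 : (1 - (s : ℂ))⁻¹ = -((s : ℂ) - 1)⁻¹ := by rw [← inv_neg]; ring
    rw [e0, ← hΦ, ← hΨ]
    simp only [Function.comp, map_neg, map_smul, map_add, hD _ (solG A B s), hD _ (zp (1 - (s : ℂ)) B), hA,
      smul_zero, zero_add, e1, neg_smul, one_smul, smul_neg, neg_neg, hD B]
    generalize ((s : ℂ) - 1)⁻¹ = t
    generalize (s : ℂ)⁻¹ = t'
    have c1 := zn_comm (1 - (s : ℂ)) B
    generalize zn (1 - (s : ℂ)) B = n at *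
    generalize zp (1 - (s : ℂ)) B = p at *
    generalize solG A B s = g at *
    generalize solGi A B s = g' at *
    simp only [add_mul, mul_add, smul_add, smul_sub, mul_assoc, smul_mul_assoc, mul_smul_comm,
      neg_mul, mul_neg, ← c1]
    have c2 : n * (B * D p) = B * (n * D p) := by rw [← mul_assoc, c1, mul_assoc]
    rw [c2]
    abel
  have hii : IntervalIntegrable (fun s => ρ (assocR A B s) (D B)) MeasureTheory.volume 0 1 := by
    let ev : 𝒜 →L[ℂ] 𝒜 := (ContinuousLinearMap.apply ℂ 𝒜 (D B)).comp ⟨ρ.toLinearMap, hρ.cont⟩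
    have := h.intervalIntegrable_assocR 0
    simp only [pow_zero, one_smul] at this
    exact ⟨ev.integrable_comp this.1, ev.integrable_comp this.2⟩
  have hDzp : ∀ z, D (zp z A) = 0 := fun z => hD.map_ex hA _
  have haux : ∀ {A B : 𝒜}, Good A B → DifferentiableOn ℂ (fun z => solK A B z * D (solH A B z)) cutPlane ∧
      solK A B 0 * D (solH A B 0) = 0 := fun h =>
    ⟨h.K_sol.diff.mul (D.differentiable.comp_differentiableOn h.H_sol.diff), by
      rw [h.H_zero, hD.map_one, mul_zero]⟩
  have hl0 : Tendsto F (𝓝[>] 0) (𝓝 (Φ * 0 * Ψ - 0)) := by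
    refine Tendsto.sub ?_ ?_
    · refine ((tendsto_conj_zero h.nA (haux h).1 (haux h).2).const_mul Φ |>.mul_const Ψ).congr ?_
      intro s
      rw [solG, solGi, hD, hDzp]
      noncomm_ring
    · have hcz : ContinuousAt (fun z : ℂ => zn z B * D (zp z B)) 1 :=
        (hasDerivAt_zn B Complex.one_mem_slitPlane).continuousAt.mul
          (D.continuous.continuousAt.comp
            (hasDerivAt_zp B Complex.one_mem_slitPlane).continuousAt)
      have hct : Tendsto (fun s : ℝ => 1 - (s : ℂ)) (𝓝[>] 0) (𝓝 1) := by
        have : Continuous (fun s : ℝ => 1 - (s : ℂ)) := by fun_prop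
        have := this.tendsto 0
        simp only [Complex.ofReal_zero, sub_zero] at this
        exact this.mono_left nhdsWithin_le_nhds
      have := hcz.tendsto.comp hct
      have e : zn (1 : ℂ) B * D (zp 1 B) = 0 := by simp [zp, ex_zero, hD.map_one]
      rwa [e] at this
  have hl1 : Tendsto F (𝓝[<] 1) (𝓝 (0 + D Φ * Ψ)) := by
    have ht : Tendsto (fun s : ℝ => 1 - s) (𝓝[<] 1) (𝓝[>] 0) := by
      refine tendsto_nhdsWithin_iff.2 ⟨?_, ?_⟩
      · have : Continuous (fun s : ℝ => 1 - s) := by fun_prop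
        have := this.tendsto 1
        rw [sub_self] at this
        exact this.mono_left nhdsWithin_le_nhds
      · filter_upwards [self_mem_nhdsWithin] with s hs
        simpa using hs
    have := ((tendsto_conj_zero h.nB (haux h.symm).1 (haux h.symm).2).comp ht).add_const (D Φ * Ψ)
    refine this.congr' ?_
    filter_upwards [Ioo_mem_nhdsLT (zero_lt_one' ℝ)] with s hs
    have hm := ofReal_mem_cutPlane₂ hs
    have hm' := cutPlane₂_symm hm
    have e1 : solGi A B s = Ψ * solGi B A (1 - s) := by
      have := h.symm.Gi_eq hm'
      rwa [sub_sub_cancel] at this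
    simp only [F, Function.comp]
    rw [e1, h.G_eq hm, ← hΦ, hD, solG, hD, solGi]
    push_cast
    have k1 := zn_mul_zp (1 - (s : ℂ)) B
    have k2 := h.symm.K_mul_H _ hm'.2
    generalize zn (1 - (s : ℂ)) B = n at *
    generalize zp (1 - (s : ℂ)) B = p at *
    generalize solK B A (1 - s) = k at *
    generalize solH B A (1 - s) = g at *
    generalize D p = dp
    generalize D g = dg
    generalize D Φ = dΦ
    calc n * (k * dg) * p + dΦ * Ψ = 1 * (n * (k * dg) * p * 1) + 1 * (n * 1 * dp * 1)
          + 1 * (n * 1 * p * dΦ * Ψ) - n * dp := by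
          rw [mul_one n, k1]; noncomm_ring
      _ = Φ * Ψ * (n * (k * dg) * p * (Φ * Ψ)) + (Φ * Ψ) * (n * (k * g) * dp * (Φ * Ψ))
          + (Φ * Ψ) * (n * (k * g) * p * dΦ * Ψ) - n * dp := by rw [hΦΨ, k2]
      _ = _ := by noncomm_ring
  have := intervalIntegral.integral_eq_sub_of_hasDerivAt_of_tendsto zero_lt_one hder hii hl0 hl1
  rw [hρ.map_Q h, this]
  simp

/-- The general logarithmic derivative of the associator. -/
theorem AdRep.der_assoc_right (hρ : AdRep A B ρ) (h : Good A B) {D : 𝒜 →L[ℂ] 𝒜} (hD : IsDer D)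
    (hB : D B = 0) : D (assoc A B) * assoc B A = -ρ (assoc A B * assocQ B A 0) (D A) := by
  have h1 := hρ.symm.der_assoc h.symm hD hB
  rw [map_mul, ContinuousLinearMap.mul_apply, ← h1, hρ.map_assoc h, lr_apply,
    hD.inv h.symm.assoc_mul h.assoc_mul]
  noncomm_ring

/-- Trace functionals do not see the action of `assocQ`. -/
theorem AdRep.trace_map_Q (hρ : AdRep A B ρ) (h : Good A B) (tr : 𝒜 →L[ℂ] ℂ)
    (htr : ∀ x y, tr (x * y) = tr (y * x)) (u : 𝒜) : tr (ρ (assocQ A B 0) u) = 0 := by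
  let ev : 𝒜 →L[ℂ] 𝒜 := (ContinuousLinearMap.apply ℂ 𝒜 u).comp ⟨ρ.toLinearMap, hρ.cont⟩
  have hi := h.intervalIntegrable_assocR 0
  simp only [pow_zero, one_smul] at hi
  have := (tr.comp ev).intervalIntegral_comp_comm hi
  have e : assocQ A B 0 = ∫ s in (0 : ℝ)..1, assocR A B s := by simp [assocQ]
  rw [e]
  refine this.symm.trans ?_
  rw [intervalIntegral.integral_congr_Ioo_of_le (g := fun _ => 0) zero_le_one]
  · simp
  intro s hs
  have hm := cutPlane₂_symm (ofReal_mem_cutPlane₂ hs)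
  change tr (ρ (assocR A B s) u) = 0
  rw [hρ.map_R h hs, map_smul, map_sub, htr, ← mul_assoc, h.symm.G_mul_Gi hm.2, one_mul, htr,
    ← mul_assoc, zp_mul_zn, one_mul, sub_self, smul_zero]

end Derivation

end Duflo

namespace Duflo

section LogDer

variable {𝒜 : Type*} [Ring 𝒜] {S : Type*} [AddCommGroup S]

/-- The trace of the logarithmic derivative. -/
def ld (tr : 𝒜 →+ S) (D : 𝒜 →+ 𝒜) (u : 𝒜) : S := tr (Ring.inverse u * D u)

lemma ld_mul {tr : 𝒜 →+ S} (htr : ∀ x y, tr (x * y) = tr (y * x)) {D : 𝒜 →+ 𝒜}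
    (hD : ∀ x y, D (x * y) = D x * y + x * D y) {u v : 𝒜} (hu : IsUnit u) (hv : IsUnit v) :
    ld tr D (u * v) = ld tr D u + ld tr D v := by
  obtain ⟨u, rfl⟩ := hu
  obtain ⟨v, rfl⟩ := hv
  have e : Ring.inverse ((u : 𝒜) * v) = (↑v⁻¹ : 𝒜) * ↑u⁻¹ := by
    rw [← Units.val_mul, Ring.inverse_unit, mul_inv_rev, Units.val_mul]
  rw [ld, e, hD, mul_add, map_add, ld, ld, Ring.inverse_unit, Ring.inverse_unit]
  congr 1
  · rw [← mul_assoc, htr, mul_assoc, ← mul_assoc (v : 𝒜), Units.mul_inv, one_mul]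
  · rw [mul_assoc, ← mul_assoc (↑u⁻¹ : 𝒜), Units.inv_mul, one_mul]

lemma ld_eq {tr : 𝒜 →+ S} {D : 𝒜 →+ 𝒜} {u v : 𝒜} (huv : u * v = 1) (hvu : v * u = 1) :
    ld tr D u = tr (v * D u) := by
  rw [ld, show Ring.inverse u = v from Ring.inverse_unit ⟨u, v, huv, hvu⟩]

end LogDer

section Trace

variable {𝒜 : Type*} [NormedRing 𝒜] [NormedAlgebra ℂ 𝒜] [CompleteSpace 𝒜] [NormOneClass 𝒜]
variable {A B : 𝒜}

lemma integral_pow_mul_major_le (n : ℕ) :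
    ∃ f : ℝ → ℝ, IntervalIntegrable f MeasureTheory.volume 0 1 ∧
      (∀ s ∈ Set.Ioo (0 : ℝ) 1, s ^ n * major s ≤ f s) ∧
      ∫ s in (0 : ℝ)..1, f s ≤ 5 * (Real.sqrt (n + 1))⁻¹ := by
  set l := Real.sqrt (n + 1) with hl
  have hl0 : 0 < l := Real.sqrt_pos.2 (by positivity)
  have hll : l * l = n + 1 := Real.mul_self_sqrt (by positivity)
  have i1 : IntervalIntegrable (fun s : ℝ => s ^ (-(1 / 2) : ℝ)) MeasureTheory.volume 0 1 :=
    intervalIntegral.intervalIntegrable_rpow' (by norm_num)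
  have i2 : IntervalIntegrable (fun s : ℝ => (1 - s) ^ (-(1 / 2) : ℝ)) MeasureTheory.volume 0 1 :=
    intervalIntegrable_rpow_one_sub (by norm_num)
  have i3 : IntervalIntegrable (fun s : ℝ => l * s ^ (2 * n)) MeasureTheory.volume 0 1 :=
    (by fun_prop : Continuous fun s : ℝ => l * s ^ (2 * n)).intervalIntegrable _ _
  have v1 : ∫ s in (0 : ℝ)..1, s ^ (-(1 / 2) : ℝ) = 2 := by
    rw [integral_rpow (Or.inl (by norm_num))]; norm_num
  have v2 : ∫ s in (0 : ℝ)..1, (1 - s) ^ (-(1 / 2) : ℝ) = 2 := by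
    have := intervalIntegral.integral_comp_sub_left (fun s : ℝ => s ^ (-(1 / 2) : ℝ)) 1 (a := 0) (b := 1)
    rw [this]; simpa using v1
  have v3 : ∫ s in (0 : ℝ)..1, l * s ^ (2 * n) = l * (2 * n + 1 : ℝ)⁻¹ := by
    rw [intervalIntegral.integral_const_mul, integral_pow]; simp
  refine ⟨fun s => l * s ^ (2 * n) + l⁻¹ * (s ^ (-(1 / 2) : ℝ) + (1 - s) ^ (-(1 / 2) : ℝ)),
    i3.add ((i1.add i2).const_mul _), ?_, ?_⟩
  · intro s hs
    have hs1 := one_sub_mem_Ioo hs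
    have p1 := Real.rpow_nonneg hs.1.le (-(1 / 4) : ℝ)
    have p2 := Real.rpow_nonneg hs1.1.le (-(1 / 4) : ℝ)
    have e1 : s ^ (-(1 / 2) : ℝ) = s ^ (-(1 / 4) : ℝ) * s ^ (-(1 / 4) : ℝ) := by
      rw [← Real.rpow_add hs.1]; norm_num
    have e2 : (1 - s) ^ (-(1 / 2) : ℝ) = (1 - s) ^ (-(1 / 4) : ℝ) * (1 - s) ^ (-(1 / 4) : ℝ) := by
      rw [← Real.rpow_add hs1.1]; norm_num
    beta_reduce
    rw [e1, e2, major, pow_mul']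
    set x := s ^ (-(1 / 4) : ℝ)
    set y := (1 - s) ^ (-(1 / 4) : ℝ)
    set u := s ^ n
    have key : 0 ≤ l⁻¹ * ((l * u - x) ^ 2 + (l * u - y) ^ 2) := by positivity
    have : l⁻¹ * ((l * u - x) ^ 2 + (l * u - y) ^ 2)
        = 2 * l * u ^ 2 + l⁻¹ * (x * x + y * y) - 2 * (u * (x + y)) := by
      field_simp; ring
    have h0 : 0 ≤ l⁻¹ * (x * x + y * y) := by positivity
    nlinarith
  · rw [intervalIntegral.integral_add i3 ((i1.add i2).const_mul _),
      intervalIntegral.integral_const_mul l⁻¹, intervalIntegral.integral_add i1 i2, v1, v2, v3]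
    have : l * (2 * n + 1 : ℝ)⁻¹ ≤ l⁻¹ := by
      rw [← div_eq_mul_inv, div_le_iff₀ (by positivity), inv_mul_eq_div, le_div_iff₀ hl0, hll]
      have : (0 : ℝ) ≤ n := by positivity
      linarith
    linarith

lemma Good.norm_assocQ_le (h : Good A B) :
    ∃ C, 0 ≤ C ∧ ∀ n : ℕ, ‖assocQ A B n‖ ≤ C * (Real.sqrt (n + 1))⁻¹ := by
  obtain ⟨C, hC, hb⟩ := h.norm_assocR_le
  refine ⟨C * 5, by positivity, fun n => ?_⟩
  obtain ⟨f, hf, hle, hii⟩ := integral_pow_mul_major_le n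
  calc ‖assocQ A B n‖ ≤ ∫ s in (0 : ℝ)..1, C * f s := by
        refine intervalIntegral.norm_integral_le_of_norm_le zero_le_one ?_ (hf.const_mul C)
        filter_upwards [MeasureTheory.Measure.ae_ne MeasureTheory.volume (1 : ℝ)] with s hne hs
        have hs' : s ∈ Set.Ioo (0 : ℝ) 1 := ⟨hs.1, lt_of_le_of_ne hs.2 hne⟩
        rw [norm_smul, norm_pow, Complex.norm_real, Real.norm_of_nonneg hs.1.le]
        have h1 := hb s hs'
        have h2 := hle s hs'
        have := pow_nonneg hs.1.le n
        calc s ^ n * ‖assocR A B s‖ ≤ s ^ n * (C * major s) := by gcongr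
          _ = C * (s ^ n * major s) := by ring
          _ ≤ _ := by gcongr
    _ = C * ∫ s in (0 : ℝ)..1, f s := intervalIntegral.integral_const_mul _ _
    _ ≤ C * (5 * (Real.sqrt (n + 1))⁻¹) := by gcongr
    _ = _ := by ring

/-- The moments of `(1 - s)^{-b}`. -/
def betaM (B : 𝒜) (n : ℕ) : 𝒜 := ∫ s in (0 : ℝ)..1, (s : ℂ) ^ n • zn (1 - (s : ℂ)) B

lemma norm_zn_one_sub_le (hB : ‖B‖ ≤ 1 / 100) {s : ℝ} (hs : s ∈ Set.Ioo (0 : ℝ) 1) :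
    ‖zn (1 - (s : ℂ)) B‖ ≤ (1 - s) ^ (-(1 / 4) : ℝ) := by
  have := (norm_zp_le hB (one_sub_mem_Ioo hs)).2
  push_cast at this
  exact this.trans (rpow_small_le (one_sub_mem_Ioo hs) (by norm_num))

lemma hasDerivAt_zn_one_sub {s : ℝ} (hs : s ∈ Set.Ioo (0 : ℝ) 1) :
    HasDerivAt (fun s : ℝ => zn (1 - (s : ℂ)) B) (-((s : ℂ) - 1)⁻¹ • (zn (1 - (s : ℂ)) B * B)) s := by
  have hm' := cutPlane₂_symm (ofReal_mem_cutPlane₂ hs)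
  have h0 : HasDerivAt (fun w : ℂ => 1 - w) (-1) (s : ℂ) := by
    simpa using (hasDerivAt_id (s : ℂ)).const_sub 1
  have := ((hasDerivAt_zn B hm'.1).scomp (s : ℂ) h0).scomp s (Complex.ofRealCLM.hasDerivAt (x := s))
  refine this.congr_deriv ?_
  have e1 : (1 - (s : ℂ))⁻¹ = -((s : ℂ) - 1)⁻¹ := by rw [← inv_neg]; ring
  rw [Complex.ofRealCLM_apply, Complex.ofReal_one, one_smul, e1, zn_comm]
  simp

lemma intervalIntegrable_betaM (hB : ‖B‖ ≤ 1 / 100) (n : ℕ) :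
    IntervalIntegrable (fun s : ℝ => (s : ℂ) ^ n • zn (1 - (s : ℂ)) B) MeasureTheory.volume 0 1 := by
  refine intervalIntegrable_of_le_major (C := 1) ?_ fun s hs => ?_
  · refine ContinuousOn.smul (by fun_prop) fun s hs => ?_
    exact (hasDerivAt_zn_one_sub hs).continuousAt.continuousWithinAt
  · rw [norm_smul, norm_pow, Complex.norm_real, Real.norm_of_nonneg hs.1.le]
    calc s ^ n * ‖zn (1 - (s : ℂ)) B‖ ≤ 1 * (1 - s) ^ (-(1 / 4) : ℝ) := by
          gcongr
          · exact pow_le_one₀ hs.1.le hs.2.le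
          · exact norm_zn_one_sub_le hB hs
      _ ≤ _ := by
          have := Real.rpow_nonneg hs.1.le (-(1 / 4) : ℝ)
          rw [major]; linarith

lemma tendsto_rpow_one_sub {r : ℝ} (hr : 0 < r) :
    Tendsto (fun s : ℝ => (1 - s) ^ r) (𝓝[<] 1) (𝓝 0) := by
  have : Continuous fun s : ℝ => (1 - s) ^ r :=
    (Real.continuous_rpow_const hr.le).comp (by fun_prop)
  have := this.tendsto 1
  rw [sub_self, Real.zero_rpow hr.ne'] at this
  exact this.mono_left nhdsWithin_le_nhds

lemma tendsto_pow_mul_zn_zero (n : ℕ) :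
    Tendsto (fun s : ℝ => (s : ℂ) ^ n • zn (1 - (s : ℂ)) B) (𝓝[>] 0) (𝓝 ((0 : ℂ) ^ n • 1)) := by
  have hcz : ContinuousAt (fun z : ℂ => zn z B) 1 :=
    (hasDerivAt_zn B Complex.one_mem_slitPlane).continuousAt
  have hct : Tendsto (fun s : ℝ => 1 - (s : ℂ)) (𝓝[>] 0) (𝓝 1) := by
    have : Continuous (fun s : ℝ => 1 - (s : ℂ)) := by fun_prop
    have := this.tendsto 0
    simp only [Complex.ofReal_zero, sub_zero] at this
    exact this.mono_left nhdsWithin_le_nhds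
  have h1 := hcz.tendsto.comp hct
  have e : zn (1 : ℂ) B = 1 := by simp [zn, ex_zero]
  rw [e] at h1
  have h2 : Tendsto (fun s : ℝ => (s : ℂ) ^ n) (𝓝[>] 0) (𝓝 ((0 : ℂ) ^ n)) := by
    have : Continuous (fun s : ℝ => (s : ℂ) ^ n) := by fun_prop
    have := this.tendsto 0
    rw [Complex.ofReal_zero] at this
    exact this.mono_left nhdsWithin_le_nhds
  exact h2.smul h1

lemma tendsto_one_sub_mul_zn (hB : ‖B‖ ≤ 1 / 100) (n : ℕ) :
    Tendsto (fun s : ℝ => ((s : ℂ) ^ n * (1 - s)) • zn (1 - (s : ℂ)) B) (𝓝[<] 1) (𝓝 0) := by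
  refine squeeze_zero_norm' ?_ (tendsto_rpow_one_sub (by norm_num : (0 : ℝ) < 3 / 4))
  filter_upwards [Ioo_mem_nhdsLT (zero_lt_one' ℝ)] with s hs
  have hs1 := one_sub_mem_Ioo hs
  have hcast : (1 - (s : ℂ)) = ((1 - s : ℝ) : ℂ) := by push_cast; rfl
  have hz := norm_zn_one_sub_le hB hs
  rw [norm_smul, norm_mul, norm_pow, Complex.norm_real, Real.norm_of_nonneg hs.1.le]
  have e : ‖(1 - (s : ℂ))‖ = 1 - s := by
    rw [hcast, Complex.norm_real, Real.norm_of_nonneg hs1.1.le]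
  rw [e]
  calc s ^ n * (1 - s) * ‖zn (1 - (s : ℂ)) B‖ ≤ 1 * (1 - s) * (1 - s) ^ (-(1 / 4) : ℝ) := by
        have := hs1.1
        gcongr
        exact pow_le_one₀ hs.1.le hs.2.le
    _ = (1 - s) ^ (3 / 4 : ℝ) := by
        have : (3 / 4 : ℝ) = 1 + -(1 / 4) := by norm_num
        rw [this, Real.rpow_add hs1.1, Real.rpow_one, one_mul]

lemma integral_mul_const {f : ℝ → 𝒜} (hf : IntervalIntegrable f MeasureTheory.volume 0 1) (x : 𝒜) :
    ∫ s in (0 : ℝ)..1, f s * x = (∫ s in (0 : ℝ)..1, f s) * x :=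
  (mR x).intervalIntegral_comp_comm hf

lemma hasDerivAt_ofReal_pow (n : ℕ) (s : ℝ) :
    HasDerivAt (fun s : ℝ => (s : ℂ) ^ n) (n * (s : ℂ) ^ (n - 1)) s :=
  (hasDerivAt_pow n (s : ℂ)).comp_ofReal

lemma intervalIntegrable_mul_const {f : ℝ → 𝒜} (hf : IntervalIntegrable f MeasureTheory.volume 0 1)
    (x : 𝒜) : IntervalIntegrable (fun s => f s * x) MeasureTheory.volume 0 1 :=
  ⟨(mR x).integrable_comp hf.1, (mR x).integrable_comp hf.2⟩

lemma betaM_zero (hB : ‖B‖ ≤ 1 / 100) : betaM B 0 * (1 - B) = 1 := by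
  rw [betaM, ← integral_mul_const (intervalIntegrable_betaM hB 0)]
  have hder : ∀ s ∈ Set.Ioo (0 : ℝ) 1, HasDerivAt
      (fun s : ℝ => -(((s : ℂ) ^ 0 * (1 - s)) • zn (1 - (s : ℂ)) B))
      ((s : ℂ) ^ 0 • zn (1 - (s : ℂ)) B * (1 - B)) s := by
    intro s hs
    have h1 : HasDerivAt (fun s : ℝ => (s : ℂ) ^ 0 * (1 - s)) (-1) s := by
      have := ((hasDerivAt_id (s : ℂ)).const_sub 1).comp_ofReal
      simpa using this
    refine (h1.smul (hasDerivAt_zn_one_sub hs)).neg.congr_deriv ?_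
    have hne := ne_one_of_mem_cutPlane (ofReal_mem_cutPlane₂ hs).2
    simp only [pow_zero, one_mul, one_smul, smul_smul, mul_sub, mul_one]
    have : (1 - (s : ℂ)) * -((s : ℂ) - 1)⁻¹ = 1 := by
      rw [mul_neg, ← neg_mul, neg_sub, mul_inv_cancel₀ hne]
    rw [this, one_smul, neg_one_smul]; abel
  have hl0 := (tendsto_pow_mul_zn_zero (B := B) 0).sub (tendsto_pow_mul_zn_zero (B := B) 1)
  have hl1 := (tendsto_one_sub_mul_zn hB 0).neg
  have hl0' := (hl0.neg).congr (f₂ := fun s : ℝ => -(((s : ℂ) ^ 0 * (1 - s)) • zn (1 - (s : ℂ)) B))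
    (fun s => by rw [← sub_smul]; simp)
  have := intervalIntegral.integral_eq_sub_of_hasDerivAt_of_tendsto zero_lt_one hder
    (intervalIntegrable_mul_const (intervalIntegrable_betaM hB 0) _) hl0' hl1
  rw [this]; simp

lemma betaM_succ (hB : ‖B‖ ≤ 1 / 100) (k : ℕ) :
    betaM B (k + 1) * ((k + 2 : ℂ) • 1 - B) = (k + 1 : ℂ) • betaM B k := by
  rw [betaM, betaM, ← integral_mul_const (intervalIntegrable_betaM hB _),
    ← intervalIntegral.integral_smul, ← sub_eq_zero,
    ← intervalIntegral.integral_sub (intervalIntegrable_mul_const (intervalIntegrable_betaM hB _) _)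
      (show IntervalIntegrable (fun s : ℝ => (k + 1 : ℂ) • (s : ℂ) ^ k • zn (1 - (s : ℂ)) B) _ _ _
        from (intervalIntegrable_betaM hB k).smul (k + 1 : ℂ))]
  have hder : ∀ s ∈ Set.Ioo (0 : ℝ) 1, HasDerivAt
      (fun s : ℝ => -(((s : ℂ) ^ (k + 1) * (1 - s)) • zn (1 - (s : ℂ)) B))
      ((s : ℂ) ^ (k + 1) • zn (1 - (s : ℂ)) B * ((k + 2 : ℂ) • 1 - B) -
        (k + 1 : ℂ) • (s : ℂ) ^ k • zn (1 - (s : ℂ)) B) s := by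
    intro s hs
    have h1 : HasDerivAt (fun s : ℝ => (s : ℂ) ^ (k + 1) * (1 - s))
        ((k + 1 : ℕ) * (s : ℂ) ^ k * (1 - s) + (s : ℂ) ^ (k + 1) * (-1)) s := by
      have := ((hasDerivAt_id (s : ℂ)).const_sub 1).comp_ofReal
      exact (hasDerivAt_ofReal_pow (k + 1) s).mul this
    refine (h1.smul (hasDerivAt_zn_one_sub hs)).neg.congr_deriv ?_
    have hne := ne_one_of_mem_cutPlane (ofReal_mem_cutPlane₂ hs).2
    have : (s : ℂ) ^ (k + 1) * (1 - (s : ℂ)) * -((s : ℂ) - 1)⁻¹ = (s : ℂ) ^ (k + 1) := by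
      field_simp; ring
    rw [smul_smul, this]
    simp only [smul_smul, mul_sub, smul_mul_assoc, mul_smul_comm, mul_one]
    push_cast
    module
  have hl0 := (tendsto_pow_mul_zn_zero (B := B) (k + 1)).sub (tendsto_pow_mul_zn_zero (B := B) (k + 2))
  have hl1 := (tendsto_one_sub_mul_zn hB (k + 1)).neg
  have hl0' := (hl0.neg).congr (f₂ := fun s : ℝ => -(((s : ℂ) ^ (k + 1) * (1 - s)) • zn (1 - (s : ℂ)) B))
    (fun s => by rw [← sub_smul]; ring_nf)
  have := intervalIntegral.integral_eq_sub_of_hasDerivAt_of_tendsto zero_lt_one hder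
    ((intervalIntegrable_mul_const (intervalIntegrable_betaM hB _) _).sub
      ((intervalIntegrable_betaM hB k).smul (k + 1 : ℂ))) hl0' hl1
  refine this.trans ?_; simp

lemma Good.assocQ_succ (h : Good A B) (k : ℕ) :
    assocQ A B (k + 1) * ((k + 1 : ℂ) • 1 - A - B) - assocQ A B k * ((k + 1 : ℂ) • 1 - A)
      = betaM B k * A := by
  have I1 := h.intervalIntegrable_assocR (k + 1)
  have I2 := h.intervalIntegrable_assocR k
  have I3 := intervalIntegrable_betaM h.nB k
  rw [assocQ, assocQ, betaM, ← integral_mul_const I1, ← integral_mul_const I2,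
    ← integral_mul_const I3,
    ← intervalIntegral.integral_sub (intervalIntegrable_mul_const I1 _)
      (intervalIntegrable_mul_const I2 _), ← sub_eq_zero,
    ← intervalIntegral.integral_sub ((intervalIntegrable_mul_const I1 _).sub
      (intervalIntegrable_mul_const I2 _)) (intervalIntegrable_mul_const I3 _)]
  have hder : ∀ s ∈ Set.Ioo (0 : ℝ) 1, HasDerivAt
      (fun s : ℝ => (s : ℂ) ^ (k + 1) • (assoc A B * solGi A B s - zn (1 - (s : ℂ)) B))
      ((s : ℂ) ^ (k + 1) • assocR A B s * ((k + 1 : ℂ) • 1 - A - B)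
        - (s : ℂ) ^ k • assocR A B s * ((k + 1 : ℂ) • 1 - A)
        - (s : ℂ) ^ k • zn (1 - (s : ℂ)) B * A) s := by
    intro s hs
    have hm := ofReal_mem_cutPlane₂ hs
    have h1 := (((h.hasDerivAt_Gi hm.2 hm.1).const_mul (assoc A B)).scomp s
      (Complex.ofRealCLM.hasDerivAt (x := s))).sub (hasDerivAt_zn_one_sub (B := B) hs)
    refine ((hasDerivAt_ofReal_pow (k + 1) s).smul h1).congr_deriv ?_
    have hne := ne_one_of_mem_cutPlane hm.2
    have hs0 : (s : ℂ) ≠ 0 := Complex.slitPlane_ne_zero hm.1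
    simp only [Pi.sub_apply, Function.comp, Complex.ofRealCLM_apply, Complex.ofReal_one, one_smul]
    rw [assocR, h.Gi_eq hm, Nat.add_sub_cancel]
    simp only [mul_neg, ← mul_assoc]
    generalize assoc A B * solGi A B s = U
    generalize zn (1 - (s : ℂ)) B = e
    simp only [mul_add, mul_sub, sub_mul, smul_mul_assoc, mul_smul_comm, mul_one, smul_sub, smul_smul]
    push_cast
    match_scalars <;> field_simp <;> ring
  have hl0 : Tendsto (fun s : ℝ => (s : ℂ) ^ (k + 1) • (assoc A B * solGi A B s - zn (1 - (s : ℂ)) B))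
      (𝓝[>] 0) (𝓝 (0 - (0 : ℂ) ^ (k + 1) • 1)) := by
    have hz := tendsto_pow_mul_zn_zero (B := B) (k + 1)
    have hf : DifferentiableOn ℂ (fun z => z ^ (k + 1) • solK A B z) cutPlane :=
      (differentiable_id.pow _).differentiableOn.smul h.K_sol.diff
    have hc := tendsto_conj_zero h.nA hf (by simp)
    obtain ⟨C, hC0, hC⟩ := exists_bound hf (by simp)
    have hlim : Tendsto (fun s : ℝ => ‖assoc A B‖ * (C * s ^ (1 / 2 : ℝ))) (𝓝[>] 0) (𝓝 0) := by
      have : Continuous (fun s : ℝ => ‖assoc A B‖ * (C * s ^ (1 / 2 : ℝ))) :=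
        ((Real.continuous_rpow_const (by norm_num)).const_mul C).const_mul _
      have := this.tendsto 0
      rw [Real.zero_rpow (by norm_num), mul_zero, mul_zero] at this
      exact this.mono_left nhdsWithin_le_nhds
    have hb : Tendsto (fun s : ℝ => (s : ℂ) ^ (k + 1) • (assoc A B * solGi A B s)) (𝓝[>] 0) (𝓝 0) := by
      refine squeeze_zero_norm' ?_ hlim
      filter_upwards [Ioo_mem_nhdsGT (by norm_num : (0 : ℝ) < 1 / 2)] with s hs
      have hs' : s ∈ Set.Ioo (0 : ℝ) 1 := ⟨hs.1, by linarith [hs.2]⟩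
      have e2 := (norm_zp_le h.nA hs').2
      have e3 := hC s ⟨hs.1.le, hs.2.le⟩
      have e : (s : ℂ) ^ (k + 1) • (assoc A B * solGi A B s)
          = assoc A B * (zn (s : ℂ) A * ((s : ℂ) ^ (k + 1) • solK A B s)) := by
        rw [solGi]; simp [mul_assoc]
      rw [e]
      refine (norm_mul_le _ _).trans (mul_le_mul_of_nonneg_left ?_ (norm_nonneg _))
      calc ‖zn (s : ℂ) A * ((s : ℂ) ^ (k + 1) • solK A B s)‖
          ≤ ‖zn (s : ℂ) A‖ * ‖(s : ℂ) ^ (k + 1) • solK A B s‖ := norm_mul_le _ _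
        _ ≤ s ^ (-(1 / 100) : ℝ) * (C * s) := by
          have := hs.1
          gcongr
        _ = C * s ^ (1 + -(1 / 100) : ℝ) := by
          rw [Real.rpow_add hs.1, Real.rpow_one]; ring
        _ ≤ _ := mul_le_mul_of_nonneg_left (rpow_small_le hs' (by norm_num)) hC0
    exact (hb.sub hz).congr fun s => (smul_sub _ _ _).symm
  have hl1 : Tendsto (fun s : ℝ => (s : ℂ) ^ (k + 1) • (assoc A B * solGi A B s - zn (1 - (s : ℂ)) B))
      (𝓝[<] 1) (𝓝 0) := by
    obtain ⟨C, hC0, hC⟩ := h.norm_assocR_le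
    have hlim : Tendsto (fun s : ℝ => C * (2 * (1 - s) ^ (1 / 2 : ℝ))) (𝓝[<] 1) (𝓝 0) := by
      simpa using ((tendsto_rpow_one_sub (by norm_num : (0 : ℝ) < 1 / 2)).const_mul 2).const_mul C
    refine squeeze_zero_norm' ?_ hlim
    filter_upwards [Ioo_mem_nhdsLT (by norm_num : (1 / 2 : ℝ) < 1)] with s hs
    have hs' : s ∈ Set.Ioo (0 : ℝ) 1 := ⟨by linarith [hs.1], hs.2⟩
    have hs1 := one_sub_mem_Ioo hs'
    have hm := ofReal_mem_cutPlane₂ hs'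
    have hne := ne_one_of_mem_cutPlane hm.2
    have e : assoc A B * solGi A B s - zn (1 - (s : ℂ)) B = ((s : ℂ) - 1) • assocR A B s := by
      rw [assocR, h.Gi_eq hm, smul_smul, mul_inv_cancel₀ hne, one_smul]
    have hn : ‖(s : ℂ) - 1‖ = 1 - s := by
      have : (s : ℂ) - 1 = ((s - 1 : ℝ) : ℂ) := by push_cast; rfl
      rw [this, Complex.norm_real, Real.norm_of_nonpos (by linarith [hs.2]), neg_sub]
    rw [e, norm_smul, norm_smul, norm_pow, Complex.norm_real, Real.norm_of_nonneg hs'.1.le, hn]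
    have hsm : s ^ (-(1 / 4) : ℝ) ≤ (1 - s) ^ (-(1 / 4) : ℝ) :=
      Real.rpow_le_rpow_of_nonpos hs1.1 (by linarith [hs.1]) (by norm_num)
    calc s ^ (k + 1) * ((1 - s) * ‖assocR A B s‖)
        ≤ 1 * ((1 - s) * (C * (2 * (1 - s) ^ (-(1 / 4) : ℝ)))) := by
          have := hs1.1
          gcongr
          · exact pow_le_one₀ hs'.1.le hs'.2.le
          · refine (hC s hs').trans ?_
            gcongr
            rw [major]; linarith
      _ = C * (2 * (1 - s) ^ (1 + -(1 / 4) : ℝ)) := by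
          rw [Real.rpow_add hs1.1, Real.rpow_one]; ring
      _ ≤ _ := by
          have := rpow_small_le hs1 (by norm_num : (1 / 2 : ℝ) ≤ 1 + -(1 / 4))
          gcongr C * (2 * ?_)
  have := intervalIntegral.integral_eq_sub_of_hasDerivAt_of_tendsto zero_lt_one hder
    (((intervalIntegrable_mul_const I1 _).sub
      (intervalIntegrable_mul_const I2 _)).sub (intervalIntegrable_mul_const I3 _)) hl0 hl1
  refine this.trans ?_
  simp

end Trace

end Duflo

namespace Duflo

section TraceFormula

variable {𝒜 : Type*} [NormedRing 𝒜] [NormedAlgebra ℂ 𝒜] [CompleteSpace 𝒜] [NormOneClass 𝒜]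
variable {A B : 𝒜}

/-- The factor `1 - x / (k + 1)`. -/
def lin (x : 𝒜) (k : ℕ) : 𝒜 := 1 - (k + 1 : ℂ)⁻¹ • x

/-- The product `∏_{j ≤ k} (1 - b / j)`. -/
def linProd (B : 𝒜) : ℕ → 𝒜
  | 0 => 1
  | k + 1 => lin B k * linProd B k

lemma commute_lin {x y : 𝒜} (h : Commute x y) (k : ℕ) : Commute (lin x k) y :=
  (Commute.one_left y).sub_left (h.smul_left _)

lemma commute_linProd {y : 𝒜} (h : Commute B y) (k : ℕ) : Commute (linProd B k) y := by
  induction k with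
  | zero => exact Commute.one_left y
  | succ k ih => exact (commute_lin h k).mul_left ih

lemma commute_betaM (hB : ‖B‖ ≤ 1 / 100) (n : ℕ) : Commute B (betaM B n) := by
  have hi := intervalIntegrable_betaM hB n
  have h1 := (mL B).intervalIntegral_comp_comm hi
  have h2 := (mR B).intervalIntegral_comp_comm hi
  refine h1.symm.trans (Eq.trans ?_ h2)
  congr 1
  ext s
  simp [mL, mR, zn_comm]

lemma betaM_mul_linProd (hB : ‖B‖ ≤ 1 / 100) (k : ℕ) :
    betaM B k * linProd B (k + 1) = (k + 1 : ℂ)⁻¹ • 1 := by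
  induction k with
  | zero => simpa [linProd, lin] using betaM_zero hB
  | succ k ih =>
    have h1 := betaM_succ hB k
    have hk : (k + 2 : ℂ) ≠ 0 := by exact_mod_cast (by omega : k + 2 ≠ 0)
    have hk1 : (k + 1 : ℂ) ≠ 0 := by exact_mod_cast (by omega : k + 1 ≠ 0)
    have e : lin B (k + 1) = (k + 2 : ℂ)⁻¹ • ((k + 2 : ℂ) • 1 - B) := by
      rw [lin, smul_sub, smul_smul, inv_mul_cancel₀ hk, one_smul]
      push_cast; congr 3; ring
    rw [linProd, ← mul_assoc, e, mul_smul_comm, h1, smul_mul_assoc, smul_mul_assoc, ih, smul_smul,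
      smul_smul, mul_inv_cancel_right₀ hk1]
    push_cast; congr 2; ring

/-- Interpolation between `1 + b q₀` and `1`. -/
def interp (A B : 𝒜) (k : ℕ) : 𝒜 := 1 + linProd B k * B * assocQ A B k

lemma Good.interp_succ (h : Good A B) (k : ℕ) :
    interp A B (k + 1) * lin (A + B) k = lin B k * interp A B k * lin A k := by
  have hk1 : (k + 1 : ℂ) ≠ 0 := by exact_mod_cast (by omega : k + 1 ≠ 0)
  have h1 := h.assocQ_succ k
  have h2 := betaM_mul_linProd h.nB k
  have c1 : linProd B (k + 1) * B = B * linProd B (k + 1) :=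
    (commute_linProd (Commute.refl B) (k + 1)).eq
  have c2 : linProd B (k + 1) * betaM B k = betaM B k * linProd B (k + 1) :=
    (commute_linProd (commute_betaM h.nB k) (k + 1)).eq
  have el : ∀ x : 𝒜, lin x k = (k + 1 : ℂ)⁻¹ • ((k + 1 : ℂ) • 1 - x) := fun x => by
    rw [lin, smul_sub, smul_smul, inv_mul_cancel₀ hk1, one_smul]
  have key : linProd B (k + 1) * B * assocQ A B (k + 1) * ((k + 1 : ℂ) • 1 - A - B)
      = linProd B (k + 1) * B * assocQ A B k * ((k + 1 : ℂ) • 1 - A) + (k + 1 : ℂ)⁻¹ • (B * A) := by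
    rw [mul_assoc _ (assocQ A B (k + 1)), ← sub_add_cancel (assocQ A B (k + 1) * _), h1, mul_add,
      add_comm, mul_assoc _ (assocQ A B k)]
    congr 1
    rw [c1, mul_assoc, ← mul_assoc _ (betaM B k), c2, h2]
    simp
  rw [interp, interp, el (A + B), el A, mul_smul_comm, mul_smul_comm]
  congr 1
  rw [add_mul, one_mul, ← sub_sub, key, mul_add, add_mul, mul_one, linProd]
  simp only [lin, mul_assoc, sub_mul, mul_sub, add_mul, mul_add, one_mul, mul_one, smul_mul_assoc,
    mul_smul_comm, smul_sub, smul_add, smul_smul, mul_inv_cancel₀ hk1, inv_mul_cancel₀ hk1, one_smul]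
  abel

lemma norm_linProd_le (hB : ‖B‖ ≤ 1 / 100) (k : ℕ) : ‖linProd B k‖ ^ 4 ≤ k + 1 := by
  induction k with
  | zero => simp [linProd]
  | succ k ih =>
    have hk : (0 : ℝ) < k + 1 := by positivity
    have hl : ‖lin B k‖ ≤ 1 + (k + 1 : ℝ)⁻¹ / 100 := by
      refine (norm_sub_le _ _).trans ?_
      rw [norm_one, norm_smul, norm_inv]
      have : ‖(k + 1 : ℂ)‖ = k + 1 := by
        have := Complex.norm_natCast (k + 1)
        push_cast at this
        exact this
      rw [this, div_eq_mul_one_div]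
      gcongr
    have hx0 : 0 < (k + 1 : ℝ)⁻¹ := by positivity
    have hx1 : (k + 1 : ℝ)⁻¹ ≤ 1 := inv_le_one_of_one_le₀ (by linarith [(Nat.cast_nonneg k : (0 : ℝ) ≤ k)])
    calc ‖linProd B (k + 1)‖ ^ 4 ≤ (‖lin B k‖ * ‖linProd B k‖) ^ 4 := by
          gcongr; exact norm_mul_le _ _
      _ = ‖lin B k‖ ^ 4 * ‖linProd B k‖ ^ 4 := by ring
      _ ≤ (1 + (k + 1 : ℝ)⁻¹ / 100) ^ 4 * (k + 1) := by gcongr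
      _ ≤ (1 + (k + 1 : ℝ)⁻¹) * (k + 1) := by
          gcongr
          generalize (k + 1 : ℝ)⁻¹ = x at *
          have h2 : x ^ 2 ≤ x := by nlinarith
          have h3 : x ^ 3 ≤ x := by nlinarith [mul_nonneg hx0.le hx0.le]
          have h4 : x ^ 4 ≤ x := by nlinarith [mul_nonneg hx0.le hx0.le, mul_nonneg (mul_nonneg hx0.le hx0.le) hx0.le]
          ring_nf
          nlinarith
      _ = _ := by push_cast; field_simp

lemma Good.tendsto_interp (h : Good A B) : Tendsto (interp A B) atTop (𝓝 1) := by
  obtain ⟨C, hC, hq⟩ := h.norm_assocQ_le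
  have hlim : Tendsto (fun n : ℕ => C * ((n : ℝ) + 1) ^ (-(1 / 4) : ℝ)) atTop (𝓝 0) := by
    have := (tendsto_rpow_neg_atTop (by norm_num : (0 : ℝ) < 1 / 4)).comp
      (tendsto_atTop_add_const_right _ (1 : ℝ) tendsto_natCast_atTop_atTop)
    simpa using this.const_mul C
  have : Tendsto (fun n => linProd B n * B * assocQ A B n) atTop (𝓝 0) := by
    refine squeeze_zero_norm (fun n => ?_) hlim
    have hn : (0 : ℝ) < n + 1 := by positivity
    have h1 : ‖linProd B n‖ ≤ ((n : ℝ) + 1) ^ (1 / 4 : ℝ) := by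
      have e : ((n : ℝ) + 1) = (((n : ℝ) + 1) ^ (1 / 4 : ℝ)) ^ 4 := by
        rw [← Real.rpow_natCast, ← Real.rpow_mul hn.le]; norm_num
      have := norm_linProd_le h.nB n
      rw [e] at this
      exact le_of_pow_le_pow_left₀ (by norm_num) (by positivity) this
    have hB1 : ‖B‖ ≤ 1 := h.nB.trans (by norm_num)
    calc ‖linProd B n * B * assocQ A B n‖ ≤ ‖linProd B n‖ * ‖B‖ * ‖assocQ A B n‖ :=
          (norm_mul_le _ _).trans (mul_le_mul_of_nonneg_right (norm_mul_le _ _) (norm_nonneg _))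
      _ ≤ ((n : ℝ) + 1) ^ (1 / 4 : ℝ) * 1 * (C * (Real.sqrt (n + 1))⁻¹) := by
          gcongr; exact hq n
      _ = _ := by
          rw [Real.sqrt_eq_rpow, ← Real.rpow_neg hn.le]
          have : (-(1 / 4) : ℝ) = 1 / 4 + -(1 / 2) := by norm_num
          rw [this, Real.rpow_add hn]; ring
  have h2 := this.const_add 1
  rw [add_zero] at h2
  exact h2

lemma geom_nilpotent {x : 𝒜} {N : ℕ} (hx : x ^ N = 0) (k : ℕ) :
    lin x k * ∑ i ∈ Finset.range N, ((k + 1 : ℂ)⁻¹ • x) ^ i = 1 ∧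
    (∑ i ∈ Finset.range N, ((k + 1 : ℂ)⁻¹ • x) ^ i) * lin x k = 1 := by
  have : ((k + 1 : ℂ)⁻¹ • x) ^ N = 0 := by rw [smul_pow, hx, smul_zero]
  rw [lin, mul_neg_geom_sum, geom_sum_mul_neg, this, sub_zero]
  exact ⟨rfl, rfl⟩

lemma isUnit_lin {x : 𝒜} {N : ℕ} (hx : x ^ N = 0) (k : ℕ) : IsUnit (lin x k) :=
  ⟨⟨_, _, (geom_nilpotent hx k).1, (geom_nilpotent hx k).2⟩, rfl⟩

lemma ld_lin {x : 𝒜} {N : ℕ} (hx : x ^ N = 0) (k : ℕ) {D : 𝒜 →L[ℂ] 𝒜} (hD : IsDer D)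
    (tr : 𝒜 →L[ℂ] ℂ) :
    ld (tr : 𝒜 →+ ℂ) (D : 𝒜 →+ 𝒜) (lin x k)
      = -∑ i ∈ Finset.range N, (1 / ((k : ℂ) + 1) ^ (i + 1)) * tr (x ^ i * D x) := by
  rw [ld_eq (geom_nilpotent hx k).1 (geom_nilpotent hx k).2]
  have e : D (lin x k) = -((k + 1 : ℂ)⁻¹ • D x) := by
    rw [lin, map_sub, hD.map_one, map_smul, zero_sub]
  simp only [AddMonoidHom.coe_coe, e, mul_neg, map_neg, mul_smul_comm, map_smul, Finset.sum_mul,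
    map_sum, smul_pow, smul_mul_assoc, Finset.smul_sum, smul_eq_mul]
  congr 1
  refine Finset.sum_congr rfl fun i _ => ?_
  rw [pow_succ, one_div, mul_inv, inv_pow]
  ring

/-- The value `ζ(i + 1)` (for `i ≥ 1`). -/
def zt (i : ℕ) : ℂ := ∑' k : ℕ, 1 / ((k : ℂ) + 1) ^ (i + 1)

lemma hasSum_zt {i : ℕ} (hi : 1 ≤ i) : HasSum (fun k : ℕ => 1 / ((k : ℂ) + 1) ^ (i + 1)) (zt i) := by
  refine Summable.hasSum ?_
  have h1 : Summable fun k : ℕ => 1 / ((k : ℂ)) ^ (i + 1) := by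
    rw [← summable_norm_iff]
    simp only [norm_div, norm_one, norm_pow, Complex.norm_natCast]
    exact Real.summable_one_div_nat_pow.2 (by omega)
  have := (summable_nat_add_iff 1).2 h1
  simpa using this

lemma Good.isUnit_interp (h : Good A B) {N : ℕ} (hA : A ^ N = 0) (hB : B ^ N = 0)
    (hAB : (A + B) ^ N = 0) (k : ℕ) :
    IsUnit (interp A B k) := by
  have hev : ∀ᶠ n in atTop, IsUnit (interp A B n) :=
    h.tendsto_interp.eventually (Units.isOpen.mem_nhds isUnit_one)
  obtain ⟨n, hn, hkn⟩ := (hev.and (eventually_ge_atTop k)).exists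
  by_contra hk
  have : ∀ j, ¬ IsUnit (interp A B (k + j)) := by
    intro j
    induction j with
    | zero => exact hk
    | succ j ih =>
      intro hu
      apply ih
      have h1 := hu.mul (isUnit_lin hAB (k + j))
      have h2 := h.interp_succ (k + j)
      rw [add_assoc] at h2
      rw [h2] at h1
      obtain ⟨a, ha⟩ := isUnit_lin hA (k + j)
      obtain ⟨b, hb⟩ := isUnit_lin hB (k + j)
      rw [← ha, ← hb] at h1
      exact (Units.isUnit_units_mul b _).1 ((Units.isUnit_mul_units _ a).1 h1)
  obtain ⟨j, rfl⟩ := Nat.exists_eq_add_of_le hkn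
  exact this j hn

lemma tendsto_ld {D : 𝒜 →L[ℂ] 𝒜} (hD : IsDer D) (tr : 𝒜 →L[ℂ] ℂ) {f : ℕ → 𝒜}
    (hf : Tendsto f atTop (𝓝 1)) :
    Tendsto (fun n => ld (tr : 𝒜 →+ ℂ) (D : 𝒜 →+ 𝒜) (f n)) atTop (𝓝 0) := by
  have h1 : Tendsto (fun n => Ring.inverse (f n)) atTop (𝓝 (Ring.inverse 1)) := by
    have := NormedRing.inverse_continuousAt (1 : 𝒜ˣ)
    rw [Units.val_one] at this
    exact this.tendsto.comp hf
  have h2 : Tendsto (fun n => D (f n)) atTop (𝓝 (D 1)) := (D.continuous.tendsto 1).comp hf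
  have h3 := (tr.continuous.tendsto _).comp (h1.mul h2)
  simpa [hD.map_one, ld, Function.comp_def] using h3

/-- The trace formula for the logarithmic derivative of `1 + b q₀`. -/
theorem Good.trace_formula (h : Good A B) {N : ℕ} (hA : A ^ N = 0) (hB : B ^ N = 0)
    (hAB : (A + B) ^ N = 0) {D : 𝒜 →L[ℂ] 𝒜} (hD : IsDer D) (tr : 𝒜 →L[ℂ] ℂ)
    (htr : ∀ x y, tr (x * y) = tr (y * x)) :
    IsUnit (1 + B * assocQ A B 0) ∧
    ld (tr : 𝒜 →+ ℂ) (D : 𝒜 →+ 𝒜) (1 + B * assocQ A B 0)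
      = ∑ i ∈ Finset.Ico 1 N, zt i *
        (tr (A ^ i * D A) + tr (B ^ i * D B) - tr ((A + B) ^ i * D (A + B))) := by
  have e0 : interp A B 0 = 1 + B * assocQ A B 0 := by simp [interp, linProd]
  have hu := h.isUnit_interp hA hB hAB
  refine ⟨e0 ▸ hu 0, ?_⟩
  rw [← e0]
  set l : 𝒜 → ℂ := ld (tr : 𝒜 →+ ℂ) (D : 𝒜 →+ 𝒜) with hl
  have hm : ∀ u v : 𝒜, IsUnit u → IsUnit v → l (u * v) = l u + l v := fun u v hu hv =>
    ld_mul (tr := (tr : 𝒜 →+ ℂ)) (D := (D : 𝒜 →+ 𝒜)) htr hD hu hv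
  set g : ℕ → ℂ := fun k => ∑ i ∈ Finset.range N, (1 / ((k : ℂ) + 1) ^ (i + 1)) *
        (tr (A ^ i * D A) + tr (B ^ i * D B) - tr ((A + B) ^ i * D (A + B))) with hg
  have step : ∀ k, l (interp A B k) - l (interp A B (k + 1)) = g k := by
    intro k
    have h1 := congrArg l (h.interp_succ k)
    rw [hm _ _ (hu _) (isUnit_lin hAB k),
      hm _ _ ((isUnit_lin hB k).mul (hu k)) (isUnit_lin hA k), hm _ _ (isUnit_lin hB k) (hu k)] at h1
    simp only [hl, ld_lin hA k hD, ld_lin hB k hD, ld_lin hAB k hD] at h1 ⊢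
    simp only [hg, mul_sub, mul_add, Finset.sum_sub_distrib, Finset.sum_add_distrib]
    linear_combination (-1 : ℂ) * h1
  have g' : ∀ k, g k = ∑ i ∈ Finset.Ico 1 N, (1 / ((k : ℂ) + 1) ^ (i + 1)) *
        (tr (A ^ i * D A) + tr (B ^ i * D B) - tr ((A + B) ^ i * D (A + B))) := by
    intro k
    rw [hg]
    rcases N with - | N
    · simp
    · simp only [Finset.range_eq_Ico]
      rw [Finset.sum_eq_sum_Ico_succ_bot (Nat.succ_pos N)]
      simp
  have h1 : Tendsto (fun n => ∑ k ∈ Finset.range n, g k) atTop (𝓝 (l (interp A B 0))) := by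
    have e : ∀ n, ∑ k ∈ Finset.range n, g k = l (interp A B 0) - l (interp A B n) := fun n => by
      rw [← Finset.sum_range_sub' (fun k => l (interp A B k)) n]
      exact Finset.sum_congr rfl fun k _ => (step k).symm
    simp only [e]
    simpa using (tendsto_ld hD tr h.tendsto_interp).const_sub (l (interp A B 0))
  refine tendsto_nhds_unique h1 (HasSum.tendsto_sum_nat ?_)
  rw [funext g']
  exact hasSum_sum fun i hi => (hasSum_zt (Finset.mem_Ico.1 hi).1).mul_right _

end TraceFormula

end Duflo

namespace Duflo

section Augmentation

variable {𝒜 : Type*} [NormedRing 𝒜] [NormedAlgebra ℂ 𝒜] [CompleteSpace 𝒜]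
variable {A B : 𝒜}

lemma chi_isSol {χ : 𝒜 →L[ℂ] ℂ} {α β : 𝒜 →L[ℂ] 𝒜} (hα : ∀ u, χ (α u) = 0) (hβ : ∀ u, χ (β u) = 0)
    {H : ℂ → 𝒜} (hH : IsSol α β H) (h0 : χ (H 0) = 1) {z : ℂ} (hz : z ∈ cutPlane) : χ (H z) = 1 := by
  have h1 : IsSol (0 : ℂ →L[ℂ] ℂ) 0 (fun z => χ (H z)) :=
    { diff := χ.differentiable.comp_differentiableOn hH.diff
      eqn := fun z hz hz0 => by
        refine (χ.hasFDerivAt.comp_hasDerivAt z (hH.eqn z hz hz0)).congr_deriv ?_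
        simp [hα, hβ] }
  have h2 : IsSol (0 : ℂ →L[ℂ] ℂ) 0 (fun _ => 1) :=
    { diff := differentiableOn_const _
      eqn := fun z hz hz0 => by simpa using hasDerivAt_const z (1 : ℂ) }
  exact h1.eqOn h2 (by simp) h0 z hz

lemma Good.map_assoc_eq_one (h : Good A B) (χ : 𝒜 →ₐ[ℂ] ℂ) (hχ : Continuous χ) (hA : χ A = 0)
    (hB : χ B = 0) : χ (assoc A B) = 1 := by
  obtain ⟨χ', hχ'⟩ : ∃ χ' : 𝒜 →L[ℂ] ℂ, ∀ u, χ' u = χ u := ⟨⟨χ.toLinearMap, hχ⟩, fun u => rfl⟩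
  have key : ∀ {A B : 𝒜}, Good A B → χ A = 0 → χ B = 0 →
      χ (solG A B (1 / 2)) = 1 ∧ χ (solGi A B (1 / 2)) = 1 := by
    intro A B h hA hB
    have e : ∀ t, χ (ex t A) = 1 := fun t => by rw [map_ex χ hχ, hA, ex_zero_right]
    have h1 := chi_isSol (χ := χ') (by simp [cm_apply, hA, hχ']) (by simp [hB, hχ'])
      h.H_sol (by simp [h.H_zero, hχ']) half_mem.2
    have h2 := chi_isSol (χ := χ') (by simp [cm_apply, hA, hχ']) (by simp [hB, hχ'])
      h.K_sol (by simp [h.K_zero, hχ']) half_mem.2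
    rw [hχ'] at h1 h2
    rw [solG, solGi, map_mul, map_mul, h1, h2, zp, zn, e, e]
    simp
  rw [assoc, map_mul, (key h hA hB).1, (key h.symm hB hA).2, one_mul]

end Augmentation

end Duflo

namespace Duflo

/-- Words of length `M + 1` vanish. -/
inductive TRel (M : ℕ) : FreeAlgebra ℂ (Fin 4) → FreeAlgebra ℂ (Fin 4) → Prop
  | mk (l : List (Fin 4)) (h : l.length = M + 1) : TRel M (l.map (FreeAlgebra.ι ℂ)).prod 0

/-- The free associative algebra on four letters, truncated in degrees above `M`. -/
def TA (M : ℕ) : Type := RingQuot (TRel M)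

namespace TA

variable {M : ℕ}

instance : Ring (TA M) := inferInstanceAs (Ring (RingQuot (TRel M)))
instance : Algebra ℂ (TA M) := inferInstanceAs (Algebra ℂ (RingQuot (TRel M)))

/-- The quotient map. -/
def mk : FreeAlgebra ℂ (Fin 4) →ₐ[ℂ] TA M := RingQuot.mkAlgHom ℂ (TRel M)

lemma mk_surjective : Function.Surjective (mk (M := M)) := RingQuot.mkAlgHom_surjective ℂ (TRel M)

/-- The letters. -/
def gen (i : Fin 4) : TA M := mk (FreeAlgebra.ι ℂ i)

lemma prod_gen (l : List (Fin 4)) : (l.map (gen (M := M))).prod = mk (l.map (FreeAlgebra.ι ℂ)).prod := by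
  rw [map_list_prod, List.map_map]; rfl

lemma prod_gen_eq_zero {l : List (Fin 4)} (h : M < l.length) : (l.map (gen (M := M))).prod = 0 := by
  rw [← List.take_append_drop (M + 1) l, List.map_append, List.prod_append, prod_gen (l.take (M + 1))]
  have : mk (M := M) ((l.take (M + 1)).map (FreeAlgebra.ι ℂ)).prod = 0 := by
    rw [← map_zero (mk (M := M))]
    exact RingQuot.mkAlgHom_rel ℂ (TRel.mk _ (by simp; omega))
  rw [this, zero_mul]

section Lift

variable {T : Type*} [Ring T] [Algebra ℂ T]

/-- The universal property. -/
def lift (t : Fin 4 → T) (h : ∀ l : List (Fin 4), l.length = M + 1 → (l.map t).prod = 0) :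
    TA M →ₐ[ℂ] T :=
  RingQuot.liftAlgHom ℂ ⟨FreeAlgebra.lift ℂ t, fun x y hxy => by
    obtain ⟨l, hl⟩ := hxy
    rw [map_zero, map_list_prod, List.map_map]
    rw [show (⇑(FreeAlgebra.lift ℂ t) ∘ FreeAlgebra.ι ℂ) = t from funext fun i => by simp]
    exact h l hl⟩

lemma lift_gen (t : Fin 4 → T) (h : ∀ l : List (Fin 4), l.length = M + 1 → (l.map t).prod = 0)
    (i : Fin 4) : lift t h (gen i) = t i := by
  have := RingQuot.liftAlgHom_mkAlgHom_apply (S := ℂ) (s := TRel M) (FreeAlgebra.lift ℂ t) (fun x y hxy => by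
    obtain ⟨l, hl⟩ := hxy
    rw [map_zero, map_list_prod, List.map_map]
    rw [show (⇑(FreeAlgebra.lift ℂ t) ∘ FreeAlgebra.ι ℂ) = t from funext fun i => by simp]
    exact h l hl) (FreeAlgebra.ι ℂ i)
  rw [FreeAlgebra.lift_ι_apply] at this
  exact this

end Lift

lemma adjoin_gen : Algebra.adjoin ℂ (Set.range (gen (M := M))) = ⊤ := by
  have h : Set.range (gen (M := M)) = mk (M := M) '' Set.range (FreeAlgebra.ι ℂ) := by
    rw [← Set.range_comp]; rfl
  rw [h, ← AlgHom.map_adjoin, FreeAlgebra.adjoin_range_ι, Algebra.map_top,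
    AlgHom.range_eq_top]
  exact mk_surjective

/-- The span of the words of length at least `k`. -/
def filt (k : ℕ) : Submodule ℂ (TA M) :=
  Submodule.span ℂ {x | ∃ l : List (Fin 4), k ≤ l.length ∧ (l.map gen).prod = x}

lemma filt_zero : filt (M := M) 0 = ⊤ := by
  rw [← Algebra.top_toSubmodule, ← adjoin_gen, Algebra.adjoin_eq_span, filt]
  congr 1
  ext x
  constructor
  · rintro ⟨l, -, rfl⟩
    exact Submonoid.list_prod_mem _ fun y hy => by
      obtain ⟨i, -, rfl⟩ := List.mem_map.1 hy
      exact Submonoid.subset_closure ⟨i, rfl⟩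
  · intro hx
    induction hx using Submonoid.closure_induction with
    | mem x hx => obtain ⟨i, rfl⟩ := hx; exact ⟨[i], by simp⟩
    | one => exact ⟨[], by simp⟩
    | mul x y _ _ hx hy =>
      obtain ⟨l, -, rfl⟩ := hx
      obtain ⟨l', -, rfl⟩ := hy
      exact ⟨l ++ l', by simp⟩

lemma filt_top : filt (M := M) (M + 1) = ⊥ := by
  rw [filt, Submodule.span_eq_bot]
  rintro x ⟨l, hl, rfl⟩
  exact prod_gen_eq_zero hl

lemma gen_mul_mem {k : ℕ} {u : TA M} (hu : u ∈ filt k) (i : Fin 4) :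
    gen i * u ∈ filt (k + 1) := by
  induction hu using Submodule.span_induction with
  | mem x hx =>
    obtain ⟨l, hl, rfl⟩ := hx
    exact Submodule.subset_span ⟨i :: l, by simpa using hl, by simp⟩
  | zero => simp
  | add x y _ _ hx hy => rw [mul_add]; exact Submodule.add_mem _ hx hy
  | smul c x _ hx => rw [mul_smul_comm]; exact Submodule.smul_mem _ _ hx

lemma mul_gen_mem {k : ℕ} {u : TA M} (hu : u ∈ filt k) (i : Fin 4) :
    u * gen i ∈ filt (k + 1) := by
  induction hu using Submodule.span_induction with
  | mem x hx =>
    obtain ⟨l, hl, rfl⟩ := hx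
    exact Submodule.subset_span ⟨l ++ [i], by simpa using hl, by simp⟩
  | zero => simp
  | add x y _ _ hx hy => rw [add_mul]; exact Submodule.add_mem _ hx hy
  | smul c x _ hx => rw [smul_mul_assoc]; exact Submodule.smul_mem _ _ hx

instance : Module.Finite ℂ (TA M) := by
  have hfin : Set.Finite {x : TA M | ∃ l : List (Fin 4), l.length < M + 1 ∧ (l.map gen).prod = x} := by
    have : {x : TA M | ∃ l : List (Fin 4), l.length < M + 1 ∧ (l.map gen).prod = x}
        = (fun l : List (Fin 4) => (l.map gen).prod) '' {l | l.length < M + 1} := by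
      ext; simp
    rw [this]
    exact (List.finite_length_lt (Fin 4) (M + 1)).image _
  refine ⟨⟨hfin.toFinset, ?_⟩⟩
  rw [eq_top_iff, ← filt_zero, filt, Submodule.span_le, Set.Finite.coe_toFinset]
  rintro x ⟨l, -, rfl⟩
  by_cases hl : l.length < M + 1
  · exact Submodule.subset_span ⟨l, hl, rfl⟩
  · rw [prod_gen_eq_zero (by omega)]; exact Submodule.zero_mem _

/-- The augmentation. -/
def aug : TA M →ₐ[ℂ] ℂ := lift (fun _ => 0) (by
  intro l hl
  obtain ⟨i, l, rfl⟩ := List.exists_cons_of_length_eq_add_one hl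
  simp)

lemma aug_gen (i : Fin 4) : aug (gen (M := M) i) = 0 := lift_gen _ _ i

instance : Nontrivial (TA M) := (aug (M := M)).toRingHom.domain_nontrivial

/-- A faithful matrix representation. -/
def matRep : TA M →ₐ[ℂ] Matrix (Fin (Module.finrank ℂ (TA M))) (Fin (Module.finrank ℂ (TA M))) ℂ :=
  (LinearMap.toMatrixAlgEquiv (Module.finBasis ℂ (TA M))).toAlgHom.comp (Algebra.lmul ℂ (TA M))

lemma matRep_injective : Function.Injective (matRep (M := M)) :=
  (LinearMap.toMatrixAlgEquiv (Module.finBasis ℂ (TA M))).injective.comp Algebra.lmul_injective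

attribute [local instance] Matrix.linftyOpNormedRing Matrix.linftyOpNormedAlgebra
  Matrix.linfty_opNormOneClass

instance : NormedRing (TA M) := NormedRing.induced (TA M) _ (matRep (M := M)) matRep_injective

instance : NormedAlgebra ℂ (TA M) := NormedAlgebra.induced ℂ (TA M) _ (matRep (M := M))

instance : NormOneClass (TA M) := by
  have : Nonempty (Fin (Module.finrank ℂ (TA M))) := ⟨⟨0, Module.finrank_pos⟩⟩
  exact NormOneClass.induced (TA M) _ (matRep (M := M))

instance : CompleteSpace (TA M) := FiniteDimensional.complete ℂ (TA M)

/-- A small scaling factor. -/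
def sc (M : ℕ) : ℝ := (200 * (1 + ∑ i, ‖gen (M := M) i‖))⁻¹

lemma sc_pos : 0 < sc M := by
  have : 0 ≤ ∑ i, ‖gen (M := M) i‖ := Finset.sum_nonneg fun _ _ => norm_nonneg _
  unfold sc; positivity

lemma sc_ne : (sc M : ℂ) ≠ 0 := by exact_mod_cast sc_pos.ne'

/-- Small letters. -/
def lt (i : Fin 4) : TA M := (sc M : ℂ) • gen i

lemma norm_lt_le (i : Fin 4) : ‖lt (M := M) i‖ ≤ 1 / 200 := by
  rw [lt, norm_smul, Complex.norm_real, Real.norm_of_nonneg sc_pos.le, sc]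
  have h0 : 0 ≤ ∑ i, ‖gen (M := M) i‖ := Finset.sum_nonneg fun _ _ => norm_nonneg _
  have h1 : ‖gen (M := M) i‖ ≤ ∑ i, ‖gen (M := M) i‖ :=
    Finset.single_le_sum (fun _ _ => norm_nonneg _) (Finset.mem_univ i)
  rw [inv_mul_le_iff₀ (by positivity)]
  linarith

lemma gen_eq (i : Fin 4) : gen (M := M) i = (sc M : ℂ)⁻¹ • lt i := by
  rw [lt, smul_smul, inv_mul_cancel₀ sc_ne, one_smul]

lemma good_lt (i j : Fin 4) : Good (lt (M := M) i) (lt j) where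
  nA := (norm_lt_le i).trans (by norm_num)
  nB := (norm_lt_le j).trans (by norm_num)
  nAB := (norm_add_le _ _).trans (by linarith [norm_lt_le (M := M) i, norm_lt_le (M := M) j])
  nil := ⟨M + 1, filt, filt_zero, filt_top, fun k u hu => by
    simp only [lt, smul_mul_assoc, mul_smul_comm]
    exact ⟨Submodule.smul_mem _ _ (gen_mul_mem hu _), Submodule.smul_mem _ _ (mul_gen_mem hu _),
      Submodule.smul_mem _ _ (gen_mul_mem hu _), Submodule.smul_mem _ _ (mul_gen_mem hu _)⟩⟩

lemma induction_lt {p : TA M → Prop} (h1 : ∀ c : ℂ, p (algebraMap ℂ _ c)) (h2 : ∀ i, p (lt i))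
    (ha : ∀ x y, p x → p y → p (x + y)) (hm : ∀ x y, p x → p y → p (x * y)) (x : TA M) : p x := by
  have hx : x ∈ Algebra.adjoin ℂ (Set.range (gen (M := M))) := by rw [adjoin_gen]; trivial
  induction hx using Algebra.adjoin_induction with
  | mem x hx =>
    obtain ⟨i, rfl⟩ := hx
    rw [gen_eq, Algebra.smul_def]
    exact hm _ _ (h1 _) (h2 _)
  | algebraMap r => exact h1 r
  | add x y _ _ hx hy => exact ha _ _ hx hy
  | mul x y _ _ hx hy => exact hm _ _ hx hy

section Ev

variable {T : Type*} [Ring T] [Algebra ℂ T]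

/-- Evaluation of the small letters. -/
def ev (t : Fin 4 → T) (h : ∀ l : List (Fin 4), l.length = M + 1 → (l.map t).prod = 0) :
    TA M →ₐ[ℂ] T :=
  lift (fun i => (sc M : ℂ)⁻¹ • t i) fun l hl => by
    have : ∀ l : List (Fin 4), (l.map fun i => (sc M : ℂ)⁻¹ • t i).prod
        = (sc M : ℂ)⁻¹ ^ l.length • (l.map t).prod := by
      intro l
      induction l with
      | nil => simp
      | cons i l ih => simp [ih, pow_succ, smul_smul, mul_comm]
    rw [this, h l hl, smul_zero]

lemma ev_lt (t : Fin 4 → T) (h : ∀ l : List (Fin 4), l.length = M + 1 → (l.map t).prod = 0)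
    (i : Fin 4) : ev t h (lt i) = t i := by
  rw [lt, map_smul, ev, lift_gen, smul_smul, mul_inv_cancel₀ sc_ne, one_smul]

end Ev

lemma aug_lt (i : Fin 4) : aug (lt (M := M) i) = 0 := by rw [lt, map_smul, aug_gen, smul_zero]

/-- The adjoint representation. -/
def ad : TA M →ₐ[ℂ] (TA M →L[ℂ] TA M) :=
  ev (fun i => cm (lt i)) fun l hl => by
    have key : ∀ (l : List (Fin 4)) (u : TA M),
        (l.map fun i => cm (lt (M := M) i)).prod u ∈ filt (M := M) l.length := by
      intro l
      induction l with
      | nil => intro u; simp [filt_zero]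
      | cons i l ih =>
        intro u
        have h := ih u
        simp only [List.map_cons, List.prod_cons, List.length_cons]
        rw [ContinuousLinearMap.mul_apply, cm_apply]
        simp only [lt, smul_mul_assoc, mul_smul_comm]
        exact Submodule.sub_mem _ (Submodule.smul_mem _ _ (gen_mul_mem h _))
          (Submodule.smul_mem _ _ (mul_gen_mem h _))
    ext u
    have := key l u
    rw [hl, filt_top, Submodule.mem_bot] at this
    simpa using this

lemma ad_lt (i : Fin 4) : ad (lt (M := M) i) = cm (lt i) := ev_lt _ _ i

lemma adRep (i j : Fin 4) : AdRep (lt (M := M) i) (lt j) ad :=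
  ⟨ad.toLinearMap.continuous_of_finiteDimensional, ad_lt i, ad_lt j⟩

end TA

end Duflo

namespace Duflo

/-- The exponential series cut off after `N` terms. -/
def nexp {R : Type*} [Ring R] [Algebra ℂ R] (N : ℕ) (x : R) : R :=
  ∑ k ∈ Finset.range N, ((k.factorial : ℂ))⁻¹ • x ^ k

namespace TA

variable {M : ℕ}

lemma mul_mem_filt {j k : ℕ} {x y : TA M} (hx : x ∈ filt j) (hy : y ∈ filt k) :
    x * y ∈ filt (j + k) := by
  induction hx using Submodule.span_induction with
  | mem x hx =>
    obtain ⟨l, hl, rfl⟩ := hx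
    have : ∀ l : List (Fin 4), (l.map gen).prod * y ∈ filt (M := M) (l.length + k) := by
      intro l
      induction l with
      | nil => simpa using hy
      | cons i l ih =>
        simp only [List.map_cons, List.prod_cons, List.length_cons, mul_assoc]
        rw [show l.length + 1 + k = l.length + k + 1 by ring]
        exact gen_mul_mem ih i
    refine Submodule.span_mono ?_ (this l)
    rintro z ⟨l', h', rfl⟩
    exact ⟨l', by omega, rfl⟩
  | zero => simp
  | add x y _ _ hx hy => rw [add_mul]; exact Submodule.add_mem _ hx hy
  | smul c x _ hx => rw [smul_mul_assoc]; exact Submodule.smul_mem _ _ hx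

lemma lt_mem (i : Fin 4) : lt (M := M) i ∈ filt 1 :=
  Submodule.smul_mem _ _ (Submodule.subset_span ⟨[i], by simp, by simp⟩)

lemma pow_eq_zero_of_mem {x : TA M} (hx : x ∈ filt 1) : x ^ (M + 1) = 0 := by
  have : ∀ k, x ^ k ∈ filt (M := M) k := by
    intro k
    induction k with
    | zero => simp [filt_zero]
    | succ k ih => rw [pow_succ]; exact mul_mem_filt ih hx
  have h := this (M + 1)
  rwa [filt_top, Submodule.mem_bot] at h

section Der

/-- The homomorphism to dual numbers defining a derivation. -/
def derHom (e : Fin 4 → TA M) (he : ∀ i, e i ∈ filt 1) : TA M →ₐ[ℂ] DualNumber (TA M) :=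
  ev (fun i => TrivSqZeroExt.inl (lt i) + TrivSqZeroExt.inr (e i)) fun l hl => by
    have key : ∀ l : List (Fin 4),
        (l.map fun i => (TrivSqZeroExt.inl (lt i) + TrivSqZeroExt.inr (e i) : DualNumber (TA M))).prod.fst
          ∈ filt (M := M) l.length ∧
        (l.map fun i => (TrivSqZeroExt.inl (lt i) + TrivSqZeroExt.inr (e i) : DualNumber (TA M))).prod.snd
          ∈ filt (M := M) l.length := by
      intro l
      induction l with
      | nil => simp [filt_zero]
      | cons i l ih =>
        have h1 := mul_mem_filt (lt_mem i) ih.1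
        have h2 := mul_mem_filt (lt_mem i) ih.2
        have h3 := mul_mem_filt (he i) ih.1
        rw [add_comm] at h1 h2 h3
        simp only [List.map_cons, List.prod_cons, List.length_cons, TrivSqZeroExt.fst_mul,
          TrivSqZeroExt.snd_mul, TrivSqZeroExt.fst_add, TrivSqZeroExt.snd_add, TrivSqZeroExt.fst_inl,
          TrivSqZeroExt.fst_inr, TrivSqZeroExt.snd_inl, TrivSqZeroExt.snd_inr, add_zero, zero_add,
          smul_eq_mul, MulOpposite.smul_eq_mul_unop, MulOpposite.unop_op]
        exact ⟨h1, Submodule.add_mem _ h2 h3⟩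
    have h := key l
    rw [hl, filt_top, Submodule.mem_bot, Submodule.mem_bot] at h
    exact TrivSqZeroExt.ext h.1 h.2

lemma derHom_fst (e : Fin 4 → TA M) (he : ∀ i, e i ∈ filt 1) (x : TA M) :
    (derHom e he x).fst = x := by
  induction x using induction_lt with
  | h1 c => rw [AlgHom.commutes]; rfl
  | h2 i => rw [derHom, ev_lt]; simp
  | ha x y hx hy => rw [map_add, TrivSqZeroExt.fst_add, hx, hy]
  | hm x y hx hy => rw [map_mul, TrivSqZeroExt.fst_mul, hx, hy]

/-- The derivation with prescribed values on the letters. -/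
def der (e : Fin 4 → TA M) (he : ∀ i, e i ∈ filt 1) : TA M →L[ℂ] TA M :=
  LinearMap.toContinuousLinearMap
    { toFun := fun x => (derHom e he x).snd
      map_add' := fun x y => by simp
      map_smul' := fun c x => by rw [map_smul]; rfl }

lemma der_apply (e : Fin 4 → TA M) (he : ∀ i, e i ∈ filt 1) (x : TA M) :
    der e he x = (derHom e he x).snd := rfl

lemma isDer_der (e : Fin 4 → TA M) (he : ∀ i, e i ∈ filt 1) : IsDer (der e he) := by
  intro x y
  simp only [der_apply]
  rw [map_mul, TrivSqZeroExt.snd_mul, derHom_fst, derHom_fst, smul_eq_mul,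
    MulOpposite.smul_eq_mul_unop, MulOpposite.unop_op, add_comm]

lemma der_lt (e : Fin 4 → TA M) (he : ∀ i, e i ∈ filt 1) (i : Fin 4) : der e he (lt i) = e i := by
  rw [der_apply, derHom, ev_lt]; simp

lemma IsDer.map_algebraMap {D : TA M →L[ℂ] TA M} (hD : IsDer D) (c : ℂ) :
    D (algebraMap ℂ _ c) = 0 := by
  rw [Algebra.algebraMap_eq_smul_one, map_smul, hD.map_one, smul_zero]

lemma IsDer.ext {D D' : TA M →L[ℂ] TA M} (hD : IsDer D) (hD' : IsDer D')
    (h : ∀ i, D (lt i) = D' (lt i)) (x : TA M) : D x = D' x := by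
  induction x using induction_lt with
  | h1 c => rw [IsDer.map_algebraMap hD, IsDer.map_algebraMap hD']
  | h2 i => exact h i
  | ha x y hx hy => rw [map_add, map_add, hx, hy]
  | hm x y hx hy => rw [hD, hD', hx, hy]

end Der

/-- The span of the commutators. -/
def com (M : ℕ) : Submodule ℂ (TA M) := Submodule.span ℂ {x | ∃ a b : TA M, a * b - b * a = x}

lemma mem_com_of_trace {x : TA M}
    (h : ∀ tr : TA M →L[ℂ] ℂ, (∀ a b, tr (a * b) = tr (b * a)) → tr x = 0) : x ∈ com M := by
  by_contra hx
  obtain ⟨f, hf, hf'⟩ := Submodule.exists_le_ker_of_notMem hx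
  apply hf
  refine h (LinearMap.toContinuousLinearMap f) fun a b => ?_
  have : f (a * b - b * a) = 0 := hf' (Submodule.subset_span ⟨a, b, rfl⟩)
  rw [map_sub, sub_eq_zero] at this
  exact this

lemma trace_com {V : Type*} [AddCommGroup V] [Module ℂ V] (f : TA M →ₗ[ℂ] V)
    (hf : ∀ a b, f (a * b) = f (b * a)) {x : TA M} (hx : x ∈ com M) : f x = 0 := by
  induction hx using Submodule.span_induction with
  | mem x hx => obtain ⟨a, b, rfl⟩ := hx; rw [map_sub, hf, sub_self]
  | zero => simp
  | add x y _ _ hx hy => rw [map_add, hx, hy, add_zero]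
  | smul c x _ hx => rw [map_smul, hx, smul_zero]

/-- The Lie elements of degree one in the last two letters. -/
def lie1 (M : ℕ) : Submodule ℂ (TA M) :=
  Submodule.span ℂ {x | ∃ p : TA M, ad p (lt 2) = x ∨ ad p (lt 3) = x}

lemma ad_mem {x : TA M} (hx : x ∈ lie1 M) (p : TA M) : ad p x ∈ lie1 M := by
  induction hx using Submodule.span_induction with
  | mem x hx =>
    obtain ⟨q, rfl | rfl⟩ := hx
    · exact Submodule.subset_span ⟨p * q, Or.inl (by rw [map_mul]; rfl)⟩
    · exact Submodule.subset_span ⟨p * q, Or.inr (by rw [map_mul]; rfl)⟩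
  | zero => simp
  | add x y _ _ hx hy => rw [map_add]; exact Submodule.add_mem _ hx hy
  | smul c x _ hx => rw [map_smul]; exact Submodule.smul_mem _ _ hx

lemma lt2_mem : lt 2 ∈ lie1 M := Submodule.subset_span ⟨1, Or.inl (by rw [map_one]; rfl)⟩
lemma lt3_mem : lt 3 ∈ lie1 M := Submodule.subset_span ⟨1, Or.inr (by rw [map_one]; rfl)⟩

lemma expi_eq_nexp (s : ℂ) {x : TA M} (hx : x ∈ filt 1) :
    expi s x = nexp (M + 1) ((s * (Real.pi * Complex.I)) • x) := by
  have h0 : ((s * (Real.pi * Complex.I)) • x) ^ (M + 1) = 0 :=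
    pow_eq_zero_of_mem (Submodule.smul_mem _ _ hx)
  rw [expi, ex, NormedSpace.exp_eq_tsum ℂ, nexp]
  apply tsum_eq_sum
  intro k hk
  rw [pow_eq_zero_of_le (by simpa using hk) h0, smul_zero]

end TA
end Duflo

namespace Duflo
namespace TA

variable {M : ℕ}

lemma mem_of_functional (S : Submodule ℂ (TA M)) {x : TA M}
    (h : ∀ f : TA M →L[ℂ] ℂ, (∀ y ∈ S, f y = 0) → f x = 0) : x ∈ S := by
  by_contra hx
  obtain ⟨f, hf, hf'⟩ := Submodule.exists_le_ker_of_notMem hx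
  exact hf (h (LinearMap.toContinuousLinearMap f) fun y hy => hf' hy)

lemma mul_mul_sub_mem_com {g gi : TA M} (h : gi * g = 1) (x : TA M) : g * x * gi - x ∈ com M := by
  refine Submodule.subset_span ⟨g, x * gi, ?_⟩
  rw [mul_assoc x gi g, h, mul_one, mul_assoc]

lemma der_ex {D : TA M →L[ℂ] TA M} (hD : IsDer D) (x : TA M) (f : TA M →L[ℂ] ℂ) (c : ℂ)
    (hc : ∀ u : ℂ, f (ex (-u) x * D x * ex u x) = c) (t : ℂ) :
    f (ex (-t) x * D (ex t x)) = t * c := by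
  have h1 : ∀ u : ℂ, HasDerivAt (fun u => ex (-u) x * D (ex u x)) (ex (-u) x * D x * ex u x) u := by
    intro u
    have e1 := (hasDerivAt_ex x (-u)).scomp u (hasDerivAt_neg u)
    have e2 := D.hasFDerivAt.comp_hasDerivAt u (hasDerivAt_ex x u)
    refine (e1.mul e2).congr_deriv ?_
    simp only [Function.comp_apply]
    rw [hD, ← ex_comm]
    generalize ex (-u) x = p
    generalize ex u x = q
    generalize D x = r
    generalize D q = s
    simp only [neg_smul, one_smul, neg_mul, mul_add]
    noncomm_ring
  have h2 : ∀ u : ℂ, HasDerivAt (fun u => f (ex (-u) x * D (ex u x)) - u * c) 0 u := by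
    intro u
    have := (f.hasFDerivAt.comp_hasDerivAt u (h1 u)).sub ((hasDerivAt_id u).mul_const c)
    rw [hc, one_mul, sub_self] at this
    exact this
  have h3 := is_const_of_deriv_eq_zero (fun u => (h2 u).differentiableAt) (fun u => (h2 u).deriv) t 0
  simp only [ex_zero, hD.map_one, mul_zero, map_zero, zero_mul, sub_zero] at h3
  exact sub_eq_zero.1 h3

lemma ad_ex {x : TA M} (hx : ad x = cm x) (t : ℂ) : ad (ex t x) = lr (ex t x) (ex (-t) x) := by
  rw [map_ex ad ad.toLinearMap.continuous_of_finiteDimensional, hx, ex_cm]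

lemma inv_mul_der_ex_mem {D : TA M →L[ℂ] TA M} (hD : IsDer D) {x : TA M} (hx : ad x = cm x)
    (hDx : D x ∈ lie1 M) (t : ℂ) :
    ex (-t) x * D (ex t x) ∈ lie1 M ∧ ex (-t) x * D (ex t x) - t • D x ∈ com M := by
  constructor
  · refine mem_of_functional _ fun f hf => ?_
    rw [der_ex hD x f 0, mul_zero]
    intro u
    have := ad_mem hDx (ex (-u) x)
    rw [ad_ex hx, lr_apply, neg_neg] at this
    exact hf _ this
  · refine mem_of_functional _ fun f hf => ?_
    rw [map_sub, der_ex hD x f (f (D x)), map_smul, smul_eq_mul, sub_self]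
    intro u
    have := hf _ (mul_mul_sub_mem_com (ex_mul_neg u x) (D x))
    rwa [map_sub, sub_eq_zero] at this

lemma der_assoc_mem {X Y : TA M} (hXY : AdRep X Y ad) (h : Good X Y) {D D1 D2 : TA M →L[ℂ] TA M}
    (hD1 : IsDer D1) (hD2 : IsDer D2) (e : ∀ x, D x = D1 x + D2 x) (h1 : D1 X = 0) (h2 : D2 Y = 0)
    (h1' : D1 Y ∈ lie1 M) (h2' : D2 X ∈ lie1 M) :
    D (assoc X Y) * assoc Y X ∈ lie1 M ⊓ com M := by
  rw [e, add_mul, hXY.der_assoc h hD1 h1, hXY.der_assoc_right h hD2 h2]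
  refine ⟨Submodule.add_mem _ (ad_mem h1' _) (Submodule.neg_mem _ (ad_mem h2' _)),
    Submodule.add_mem _ ?_ (Submodule.neg_mem _ ?_)⟩
  · exact mem_com_of_trace fun tr htr => hXY.trace_map_Q h tr htr _
  · refine mem_com_of_trace fun tr htr => ?_
    rw [map_mul, ContinuousLinearMap.mul_apply, hXY.map_assoc h, lr_apply, htr, ← mul_assoc,
      h.symm.assoc_mul, one_mul]
    exact hXY.symm.trace_map_Q h.symm tr htr _

lemma conj_mem {g gi x : TA M} (hg : ad g = lr g gi) (h : gi * g = 1) (hx : x ∈ lie1 M ⊓ com M) :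
    g * x * gi ∈ lie1 M ⊓ com M := by
  constructor
  · have := ad_mem hx.1 g
    rwa [hg, lr_apply] at this
  · have := Submodule.add_mem _ (mul_mul_sub_mem_com h x) hx.2
    rwa [sub_add_cancel] at this

/-- The value of a derivation on letters. -/
def dval (p q : TA M) : Fin 4 → TA M := ![p, q, 0, 0]

lemma dval_mem {p q : TA M} (hp : p ∈ filt 1) (hq : q ∈ filt 1) (i : Fin 4) : dval p q i ∈ filt 1 := by
  fin_cases i <;> simp [dval, hp, hq]

/-- The universal derivation `A ↦ A'`, `B ↦ B'`. -/
def dG (M : ℕ) : TA M →L[ℂ] TA M := der (dval (lt 2) (lt 3)) (dval_mem (lt_mem 2) (lt_mem 3))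

/-- The derivation `A ↦ -B'`, `B ↦ B'`. -/
def d0 (M : ℕ) : TA M →L[ℂ] TA M :=
  der (dval (-lt 3) (lt 3)) (dval_mem (Submodule.neg_mem _ (lt_mem 3)) (lt_mem 3))

/-- The sum `A + B`. -/
def sm (M : ℕ) : TA M := lt 0 + lt 1

lemma sm_mem : sm M ∈ filt 1 := Submodule.add_mem _ (lt_mem 0) (lt_mem 1)

/-- The algebraic output of the hexagon relation. -/
theorem exists_geo (M : ℕ) {ε : ℂ} (hε : ε = 1 ∨ ε = -1) :
    ∃ a ai c ci q Ti : TA M, a * ai = 1 ∧ ai * a = 1 ∧ c * ci = 1 ∧ ci * c = 1 ∧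
      ad a = lr a ai ∧ ad ci = lr ci c ∧ aug a = 1 ∧ aug ci = 1 ∧
      nexp (M + 1) ((2 * ε * (Real.pi * Complex.I)) • sm M)
        = a * nexp (M + 1) ((2 * ε * (Real.pi * Complex.I)) • lt 0) * ai *
          (ci * nexp (M + 1) ((2 * ε * (Real.pi * Complex.I)) • lt 1) * c) ∧
      ai * dG M a ∈ lie1 M ∧ ai * dG M a - (ε * (Real.pi * Complex.I)) • lt 3 ∈ com M ∧
      c * dG M ci ∈ lie1 M ∧ c * dG M ci ∈ com M ∧
      d0 M c * ci = ad q (lt 3) ∧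
      (1 + lt 1 * q) * Ti = 1 ∧ Ti * (1 + lt 1 * q) = 1 ∧
      Ti * dG M (1 + lt 1 * q) - ∑ i ∈ Finset.Ico 1 (M + 1), zt i •
        ((-sm M) ^ i * dG M (-sm M) + lt 1 ^ i * dG M (lt 1) - (-lt 0) ^ i * dG M (-lt 0)) ∈ com M := by
  have hC : -lt 0 - lt 1 = -sm M := by rw [sm]; abel
  have hAB := good_lt (M := M) 0 1
  have hBC : Good (lt 1) (-sm M) := by
    have := hAB.symm.third
    rwa [show -lt 1 - lt 0 = -sm M by rw [sm]; abel] at this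
  have rAB := adRep (M := M) 0 1
  have rBC : AdRep (lt 1) (-sm M) ad := by
    refine ⟨rAB.cont, rAB.mapB, ?_⟩
    rw [sm, map_neg, map_add, rAB.mapA, rAB.mapB]
    ext u
    simp only [neg_apply, add_apply, cm_apply]
    noncomm_ring
  set φ := assoc (lt (M := M) 0) (lt 1) with hφ
  set φi := assoc (lt (M := M) 1) (lt 0) with hφi
  set ci := assoc (lt (M := M) 1) (-sm M) with hci
  set c := assoc (-sm M) (lt (M := M) 1) with hc
  set h := expi ε (lt (M := M) 1) with hh
  set hi := expi (-ε) (lt (M := M) 1) with hhi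
  have e1 : φ * φi = 1 := hAB.assoc_mul
  have e2 : φi * φ = 1 := hAB.symm.assoc_mul
  have e3 : ci * c = 1 := hBC.assoc_mul
  have e4 : c * ci = 1 := hBC.symm.assoc_mul
  have e5 : h * hi = 1 := expi_mul_neg _ _
  have e6 : hi * h = 1 := expi_neg_mul _ _
  have a1 : ad φ = lr φ φi := rAB.map_assoc hAB
  have a1' : ad φi = lr φi φ := rAB.symm.map_assoc hAB.symm
  have a2 : ad ci = lr ci c := rBC.map_assoc hBC
  have a2' : ad c = lr c ci := rBC.symm.map_assoc hBC.symm
  have a3 : ad h = lr h hi := by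
    rw [hh, expi, ad_ex (ad_lt 1), hhi, expi, neg_mul]
  have a3' : ad hi = lr hi h := by
    rw [hhi, expi, ad_ex (ad_lt 1), hh, expi, neg_mul, neg_neg]
  have augc : Continuous (aug (M := M)) := aug.toLinearMap.continuous_of_finiteDimensional
  have g1 : aug φ = 1 := hAB.map_assoc_eq_one aug augc (aug_lt 0) (aug_lt 1)
  have g2 : aug ci = 1 := hBC.map_assoc_eq_one aug augc (aug_lt 1) (by simp [sm, aug_lt])
  have g3 : aug h = 1 := by rw [hh, expi, map_ex aug augc, aug_lt, ex_zero_right]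
  have hd : IsDer (dG M) := isDer_der _ _
  have dA : dG M (lt 0) = lt 2 := der_lt _ _ _
  have dB : dG M (lt 1) = lt 3 := der_lt _ _ _
  have m1 : dG M φ * φi ∈ lie1 M ⊓ com M := by
    have z := dval_mem (M := M) (p := 0) (q := lt 3) (Submodule.zero_mem _) (lt_mem 3)
    have z' := dval_mem (M := M) (p := lt 2) (q := 0) (lt_mem 2) (Submodule.zero_mem _)
    refine der_assoc_mem rAB hAB (D1 := der _ z) (D2 := der _ z') (isDer_der _ _) (isDer_der _ _)
      ?_ ?_ ?_ ?_ ?_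
    · intro x
      have hs : IsDer (der _ z + der _ z') := by
        intro x y
        simp only [add_apply]
        rw [isDer_der, isDer_der]
        noncomm_ring
      refine IsDer.ext hd hs (fun i => ?_) x
      rw [add_apply, der_lt, der_lt, dG, der_lt]
      fin_cases i <;> simp [dval]
    · rw [der_lt]; rfl
    · rw [der_lt]; rfl
    · rw [der_lt]; exact lt3_mem
    · rw [der_lt]; exact lt2_mem
  have m2 : dG M ci * c ∈ lie1 M ⊓ com M := by
    have z := dval_mem (M := M) (p := lt 2 + lt 3) (q := 0)
      (Submodule.add_mem _ (lt_mem 2) (lt_mem 3)) (Submodule.zero_mem _)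
    refine der_assoc_mem rBC hBC (D1 := der _ z) (D2 := d0 M) (isDer_der _ _) (isDer_der _ _)
      ?_ ?_ ?_ ?_ ?_
    · intro x
      have hs : IsDer (der _ z + d0 M) := by
        intro x y
        simp only [add_apply, d0]
        rw [isDer_der, isDer_der]
        noncomm_ring
      refine IsDer.ext hd hs (fun i => ?_) x
      rw [add_apply, der_lt, d0, der_lt, dG, der_lt]
      fin_cases i <;> simp [dval]
    · rw [der_lt]; rfl
    · simp only [sm, map_neg, map_add, d0, der_lt]
      simp [dval]
    · simp only [sm, map_neg, map_add, der_lt]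
      simp only [dval, Matrix.cons_val_zero, Matrix.cons_val_one, add_zero]
      exact Submodule.neg_mem _ (Submodule.add_mem _ lt2_mem lt3_mem)
    · rw [d0, der_lt]; exact lt3_mem
  have m3 : c * dG M ci ∈ lie1 M ⊓ com M := by
    have := conj_mem a2' e3 m2
    rwa [show c * (dG M ci * c) * ci = c * dG M ci by
      rw [mul_assoc, mul_assoc (dG M ci), e4, mul_one]] at this
  have m4 : φi * dG M φ ∈ lie1 M ⊓ com M := by
    have := conj_mem a1' e1 m1
    rwa [show φi * (dG M φ * φi) * φ = φi * dG M φ by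
      rw [mul_assoc, mul_assoc (dG M φ), e2, mul_one]] at this
  have m5 := inv_mul_der_ex_mem hd (ad_lt 1) (dB ▸ lt3_mem) (ε * (Real.pi * Complex.I))
  have m5' : ex (-(ε * (Real.pi * Complex.I))) (lt (M := M) 1) = hi := by rw [hhi, expi, neg_mul]
  have m5'' : ex (ε * (Real.pi * Complex.I)) (lt (M := M) 1) = h := rfl
  rw [m5', m5'', dB] at m5
  have m6 := conj_mem a1' e1 (conj_mem a3' e5 m3)
  have m7 : φi * hi * c * dG M (ci * h * φ)
      = φi * (hi * (c * dG M ci) * h) * φ + φi * (hi * dG M h) * φ + φi * dG M φ := by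
    rw [hd, hd]
    calc φi * hi * c * ((dG M ci * h + ci * dG M h) * φ + ci * h * dG M φ)
        = φi * (hi * (c * dG M ci) * h) * φ + φi * (hi * ((c * ci) * dG M h)) * φ
          + φi * (hi * ((c * ci) * h)) * dG M φ := by
          generalize dG M ci = x
          generalize dG M h = y
          generalize dG M φ = z
          noncomm_ring
      _ = _ := by rw [e4, one_mul, one_mul, e6, mul_one]
  have tf := fun (tr : TA M →L[ℂ] ℂ) (htr : ∀ x y, tr (x * y) = tr (y * x)) =>
    hBC.symm.trace_formula (N := M + 1) (pow_eq_zero_of_mem (Submodule.neg_mem _ sm_mem))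
      (pow_eq_zero_of_mem (lt_mem 1))
      (pow_eq_zero_of_mem (Submodule.add_mem _ (Submodule.neg_mem _ sm_mem) (lt_mem 1))) hd tr htr
  have hu := (tf 0 (by simp)).1
  refine ⟨ci * h * φ, φi * hi * c, c, ci, assocQ (-sm M) (lt 1) 0,
    Ring.inverse (1 + lt 1 * assocQ (-sm M) (lt 1) 0), ?_, ?_, e4, e3, ?_, a2, ?_, g2, ?_, ?_, ?_,
    m3.1, m3.2, ?_, Ring.mul_inverse_cancel _ hu, Ring.inverse_mul_cancel _ hu, ?_⟩
  · calc ci * h * φ * (φi * hi * c) = ci * (h * (φ * φi) * hi) * c := by noncomm_ring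
      _ = 1 := by rw [e1, mul_one, e5, mul_one, e3]
  · calc φi * hi * c * (ci * h * φ) = φi * (hi * (c * ci) * h) * φ := by noncomm_ring
      _ = 1 := by rw [e4, mul_one, e6, mul_one, e2]
  · rw [map_mul, map_mul, a1, a2, a3, lr_mul, lr_mul]
    simp only [mul_assoc]
  · rw [map_mul, map_mul, g1, g2, g3, one_mul, one_mul]
  · have hx := hAB.hexagon_conj hε
    rw [hC, ← hφ, ← hφi, ← hci, ← hh] at hx
    rw [← expi_eq_nexp _ sm_mem, ← expi_eq_nexp _ (lt_mem 0), ← expi_eq_nexp _ (lt_mem 1), two_mul ε,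
      expi_add ε ε (lt 1), ← two_mul ε, ← hh]
    calc expi (2 * ε) (sm M) = expi (2 * ε) (sm M) * ci * c := by rw [mul_assoc, e3, mul_one]
      _ = ci * h * φ * expi (2 * ε) (lt 0) * φi * (hi * (c * ci) * h) * h * c := by
          rw [e4, mul_one, e6, mul_one, sm, hx]
      _ = _ := by
          generalize expi (2 * ε) (lt (M := M) 0) = x
          noncomm_ring
  · rw [m7]
    refine Submodule.add_mem _ (Submodule.add_mem _ m6.1 ?_) m4.1
    have := ad_mem m5.1 φi
    rwa [a1', lr_apply] at this
  · rw [m7]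
    have := Submodule.add_mem _ (Submodule.add_mem _ (Submodule.add_mem _ m6.2
      (mul_mul_sub_mem_com e1 (hi * dG M h))) m5.2) m4.2
    convert this using 1
    abel
  · have hd0 : IsDer (d0 M) := isDer_der _ _
    rw [rBC.symm.der_assoc hBC.symm hd0, d0, der_lt]
    · rfl
    · simp only [sm, map_neg, map_add, d0, der_lt]
      simp [dval]
  · refine mem_com_of_trace fun tr htr => ?_
    have := (tf tr htr).2
    rw [ld, show -sm M + lt 1 = -lt 0 by rw [sm]; abel] at this
    rw [map_sub, sub_eq_zero, map_sum]
    refine Eq.trans this (Finset.sum_congr rfl fun i _ => ?_)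
    rw [map_smul, map_sub, map_add, smul_eq_mul]

end TA
end Duflo

namespace Duflo

/-- Structure constants of a Lie algebra with a finite basis. -/
structure SC (Λ : Type*) [CommRing Λ] (m : ℕ) where
  /-- The coefficient of the `k`-th basis vector in the bracket of the `i`-th and the `j`-th. -/
  γ : Fin m → Fin m → Fin m → Λ
  anti : ∀ i j k, γ i j k = -γ j i k
  jac : ∀ i j k p, ∑ l, γ i j l * γ l k p = ∑ l, (γ i l p * γ j k l - γ j l p * γ i k l)

section Ad

variable {Λ 𝒪 : Type*} [CommRing Λ] [CommRing 𝒪] [Algebra Λ 𝒪] {m : ℕ} (s : SC Λ m)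

/-- The matrix of the adjoint action. -/
def adM : (Fin m → 𝒪) →ₗ[𝒪] Matrix (Fin m) (Fin m) 𝒪 where
  toFun v := Matrix.of fun k j => ∑ i, v i * algebraMap Λ 𝒪 (s.γ i j k)
  map_add' v w := by ext; simp [add_mul, Finset.sum_add_distrib]
  map_smul' c v := by ext; simp [mul_assoc, Finset.mul_sum]

lemma adM_apply (v : Fin m → 𝒪) (k j : Fin m) :
    adM s v k j = ∑ i, v i * algebraMap Λ 𝒪 (s.γ i j k) := rfl

lemma adM_antisymm (v w : Fin m → 𝒪) : (adM s v).mulVec w = -(adM s w).mulVec v := by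
  ext k
  simp only [Matrix.mulVec, dotProduct, adM_apply, Finset.sum_mul, Pi.neg_apply]
  rw [Finset.sum_comm, ← Finset.sum_neg_distrib]
  refine Finset.sum_congr rfl fun i _ => ?_
  rw [← Finset.sum_neg_distrib]
  refine Finset.sum_congr rfl fun j _ => ?_
  rw [s.anti i j k, map_neg]
  ring

/-- The matrix of the adjoint action of a basis vector. -/
def gm (i : Fin m) : Matrix (Fin m) (Fin m) 𝒪 := Matrix.of fun k j => algebraMap Λ 𝒪 (s.γ i j k)

lemma adM_eq_sum (v : Fin m → 𝒪) : adM s v = ∑ i, v i • gm s i := by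
  ext k j
  simp [adM_apply, gm, Matrix.sum_apply]

lemma gm_jacobi (i j : Fin m) :
    ∑ l, algebraMap Λ 𝒪 (s.γ i j l) • (gm s l : Matrix _ _ 𝒪) = gm s i * gm s j - gm s j * gm s i := by
  ext p k
  simp only [Matrix.sum_apply, Matrix.smul_apply, gm, Matrix.of_apply, Matrix.sub_apply,
    Matrix.mul_apply, smul_eq_mul, ← map_mul, ← map_sub, ← map_sum]
  rw [s.jac, Finset.sum_sub_distrib]

lemma adM_jacobi (v w : Fin m → 𝒪) :
    adM s ((adM s v).mulVec w) = adM s v * adM s w - adM s w * adM s v := by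
  have e : ∀ l, (adM s v).mulVec w l = ∑ i, ∑ j, (v i * w j) * algebraMap Λ 𝒪 (s.γ i j l) := by
    intro l
    simp only [Matrix.mulVec, dotProduct, adM_apply, Finset.sum_mul]
    rw [Finset.sum_comm]
    exact Finset.sum_congr rfl fun i _ => Finset.sum_congr rfl fun j _ => by ring
  calc adM s ((adM s v).mulVec w)
      = ∑ i, ∑ j, (v i * w j) • ∑ l, algebraMap Λ 𝒪 (s.γ i j l) • (gm s l : Matrix _ _ 𝒪) := by
        rw [adM_eq_sum]
        simp only [e, Finset.sum_smul, Finset.smul_sum, smul_smul]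
        rw [Finset.sum_comm]
        refine Finset.sum_congr rfl fun i _ => ?_
        rw [Finset.sum_comm]
    _ = ∑ i, ∑ j, (v i * w j) • (gm s i * gm s j) - ∑ i, ∑ j, (v i * w j) • (gm s j * gm s i) := by
        simp only [gm_jacobi, smul_sub, Finset.sum_sub_distrib]
    _ = _ := by
        simp only [adM_eq_sum, Finset.sum_mul_sum, smul_mul_smul_comm]
        congr 1
        rw [Finset.sum_comm]
        simp only [mul_comm]

lemma adM_map {𝒪' : Type*} [CommRing 𝒪'] [Algebra Λ 𝒪'] (f : 𝒪 →ₐ[Λ] 𝒪') (v : Fin m → 𝒪) :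
    (adM s v).map f = adM s (f ∘ v) := by
  ext k j
  simp [adM_apply]

lemma adM_der (D : Derivation Λ 𝒪 𝒪) (v : Fin m → 𝒪) : (adM s v).map D = adM s (D ∘ v) := by
  ext k j
  simp [adM_apply, mul_comm]

end Ad

section MatDer

variable {Λ 𝒪 : Type*} [CommRing Λ] [CommRing 𝒪] [Algebra Λ 𝒪] {m n : Type*} [Fintype m] [Fintype n]
  (D : Derivation Λ 𝒪 𝒪)

lemma map_der_mul (x y : Matrix m m 𝒪) : (x * y).map D = x.map D * y + x * y.map D := by
  ext i j
  simp only [Matrix.map_apply, Matrix.mul_apply, map_sum, Derivation.leibniz, smul_eq_mul,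
    Finset.sum_add_distrib, Matrix.add_apply]
  rw [add_comm]
  congr 1
  exact Finset.sum_congr rfl fun _ _ => mul_comm _ _

lemma map_der_mulVec (x : Matrix m n 𝒪) (v : n → 𝒪) :
    D ∘ (x.mulVec v) = (x.map D).mulVec v + x.mulVec (D ∘ v) := by
  ext i
  simp only [Function.comp_apply, Matrix.mulVec, dotProduct, map_sum, Derivation.leibniz, smul_eq_mul,
    Finset.sum_add_distrib, Pi.add_apply, Matrix.map_apply]
  rw [add_comm]
  congr 1
  exact Finset.sum_congr rfl fun _ _ => mul_comm _ _

lemma map_der_add (x y : Matrix m n 𝒪) : (x + y).map D = x.map D + y.map D := by ext; simp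

lemma map_der_smul (c : Λ) (x : Matrix m n 𝒪) : (c • x).map D = c • x.map D := by ext; simp

lemma map_der_one [DecidableEq m] : (1 : Matrix m m 𝒪).map D = 0 := by
  ext i j
  by_cases h : i = j <;> simp [h, Matrix.one_apply]

end MatDer

lemma prod_map_smul {Λ T : Type*} [CommRing Λ] [Ring T] [Algebra Λ T] (τ : Λ) (t : Fin 4 → T)
    (l : List (Fin 4)) : (l.map fun i => τ • t i).prod = τ ^ l.length • (l.map t).prod := by
  induction l with
  | nil => simp
  | cons i l ih => simp [ih, pow_succ, smul_smul, mul_comm]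

namespace TA

section Eval

variable {Λ 𝒪 : Type*} [CommRing Λ] [CommRing 𝒪] [Algebra Λ 𝒪] [Algebra ℂ Λ] [Algebra ℂ 𝒪]
  [IsScalarTower ℂ Λ 𝒪] {m : ℕ} (s : SC Λ m) {M : ℕ} {τ : Λ} (hτ : τ ^ M = 0) (X Y p q : Fin m → 𝒪)

/-- Evaluation of the letters in an algebra with a nilpotent scaling. -/
def evs {T : Type*} [Ring T] [Algebra Λ T] [Algebra ℂ T] (hτ : τ ^ M = 0) (t : Fin 4 → T) :
    TA M →ₐ[ℂ] T :=
  ev (fun i => τ • t i) fun l hl => by rw [prod_map_smul, hl, pow_succ, hτ, zero_mul, zero_smul]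

lemma evs_lt {T : Type*} [Ring T] [Algebra Λ T] [Algebra ℂ T] (t : Fin 4 → T) (i : Fin 4) :
    evs hτ t (lt i) = τ • t i := ev_lt _ _ i

/-- Evaluation of the letters by matrices. -/
def evM : TA M →ₐ[ℂ] Matrix (Fin m) (Fin m) 𝒪 := evs hτ ![adM s X, adM s Y, 0, 0]

/-- Evaluation of the letters by matrices to first order in the last two letters. -/
def ev2 : TA M →ₐ[ℂ] DualNumber (Matrix (Fin m) (Fin m) 𝒪) :=
  evs hτ ![TrivSqZeroExt.inl (adM s X), TrivSqZeroExt.inl (adM s Y),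
    TrivSqZeroExt.inr (adM s p), TrivSqZeroExt.inr (adM s q)]

lemma fst_ev2 (x : TA M) : (ev2 s hτ X Y p q x).fst = evM s hτ X Y x := by
  induction x using induction_lt with
  | h1 c => simp only [AlgHom.commutes]; rfl
  | h2 i =>
    rw [ev2, evM, evs_lt, evs_lt]
    fin_cases i <;> simp
  | ha x y hx hy => rw [map_add, TrivSqZeroExt.fst_add, hx, hy, map_add]
  | hm x y hx hy => rw [map_mul, TrivSqZeroExt.fst_mul, hx, hy, map_mul]

lemma snd_ev2_mul (x y : TA M) : (ev2 s hτ X Y p q (x * y)).snd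
    = evM s hτ X Y x * (ev2 s hτ X Y p q y).snd + (ev2 s hτ X Y p q x).snd * evM s hτ X Y y := by
  rw [map_mul, TrivSqZeroExt.snd_mul, fst_ev2, fst_ev2, smul_eq_mul, MulOpposite.smul_eq_mul_unop,
    MulOpposite.unop_op]

/-- The letters acting on columns. -/
def foxLt : Fin 4 → Module.End ℂ ((Fin m → 𝒪) × 𝒪) :=
  ![{ toFun := fun v => (τ • (adM s X).mulVec v.1, 0)
      map_add' := fun v w => by simp [Matrix.mulVec_add]
      map_smul' := fun c v => by
        simp only [Prod.smul_fst, Matrix.mulVec_smul, RingHom.id_apply, Prod.smul_mk, smul_zero]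
        rw [smul_comm] },
    { toFun := fun v => (τ • (adM s Y).mulVec v.1, 0)
      map_add' := fun v w => by simp [Matrix.mulVec_add]
      map_smul' := fun c v => by
        simp only [Prod.smul_fst, Matrix.mulVec_smul, RingHom.id_apply, Prod.smul_mk, smul_zero]
        rw [smul_comm] },
    { toFun := fun v => (v.2 • p, 0)
      map_add' := fun v w => by simp [add_smul]
      map_smul' := fun c v => by simp },
    { toFun := fun v => (v.2 • q, 0)
      map_add' := fun v w => by simp [add_smul]
      map_smul' := fun c v => by simp }]

lemma foxLt_prod (l : List (Fin 4)) (i : Fin 4) (v : (Fin m → 𝒪) × 𝒪) :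
    ∃ w, ((i :: l).map (foxLt s (τ := τ) X Y p q)).prod v = (τ ^ l.length • w, 0) := by
  induction l generalizing i with
  | nil => fin_cases i <;> simp [foxLt]
  | cons j l ih =>
    obtain ⟨w, hw⟩ := ih j
    rw [List.map_cons, List.prod_cons, Module.End.mul_apply, hw]
    fin_cases i
    · exact ⟨(adM s X).mulVec w, by simp [foxLt, Matrix.mulVec_smul, pow_succ', smul_smul]⟩
    · exact ⟨(adM s Y).mulVec w, by simp [foxLt, Matrix.mulVec_smul, pow_succ', smul_smul]⟩
    · exact ⟨0, by simp [foxLt]⟩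
    · exact ⟨0, by simp [foxLt]⟩

/-- The action on columns. -/
def fox : TA M →ₐ[ℂ] Module.End ℂ ((Fin m → 𝒪) × 𝒪) :=
  ev (foxLt s (τ := τ) X Y p q) fun l hl => by
    obtain ⟨i, l, rfl⟩ := List.exists_cons_of_length_eq_add_one hl
    refine LinearMap.ext fun v => ?_
    obtain ⟨w, hw⟩ := foxLt_prod s (τ := τ) X Y p q l i v
    rw [hw, show l.length = M by simpa using hl, hτ, zero_smul]
    rfl

/-- The last column. -/
def fx (x : TA M) : Fin m → 𝒪 := (fox s hτ X Y p q x (0, 1)).1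

lemma fox_apply (x : TA M) (v : Fin m → 𝒪) (c : 𝒪) : fox s hτ X Y p q x (v, c)
    = ((evM s hτ X Y x).mulVec v + c • fx s hτ X Y p q x, aug x • c) := by
  induction x using induction_lt generalizing v c with
  | h1 z =>
    simp only [fx, AlgHom.commutes]
    refine Prod.ext ?_ ?_
    · simp [Algebra.algebraMap_eq_smul_one, Matrix.smul_mulVec]
    · simp [Algebra.algebraMap_eq_smul_one]
  | h2 i =>
    rw [fx, fox, ev_lt, evM, evs_lt, aug_lt]
    fin_cases i <;> simp [foxLt, Matrix.smul_mulVec]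
  | ha x y hx hy =>
    simp only [fx, map_add, LinearMap.add_apply] at hx hy ⊢
    rw [hx, hy]
    refine Prod.ext ?_ ?_
    · simp [Matrix.add_mulVec]; abel
    · simp [add_smul]
  | hm x y hx hy =>
    have e : fx s hτ X Y p q (x * y)
        = (evM s hτ X Y x).mulVec (fx s hτ X Y p q y) + aug y • fx s hτ X Y p q x := by
      rw [fx, map_mul, Module.End.mul_apply, hy, hx]
      simp
    rw [e, map_mul, Module.End.mul_apply, hy, hx]
    refine Prod.ext ?_ ?_
    · simp [Matrix.mulVec_add, Matrix.mulVec_smul, mul_smul]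
      rw [smul_comm]; abel
    · simp [mul_smul]

lemma fx_mul (x y : TA M) : fx s hτ X Y p q (x * y)
    = (evM s hτ X Y x).mulVec (fx s hτ X Y p q y) + aug y • fx s hτ X Y p q x := by
  rw [fx, map_mul, Module.End.mul_apply, ← Prod.mk.eta (p := fox s hτ X Y p q y (0, 1)), fox_apply,
    fox_apply]
  simp

lemma fx_add (x y : TA M) : fx s hτ X Y p q (x + y) = fx s hτ X Y p q x + fx s hτ X Y p q y := by
  simp [fx]

lemma fx_smul (c : ℂ) (x : TA M) : fx s hτ X Y p q (c • x) = c • fx s hτ X Y p q x := by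
  simp [fx]

lemma fx_lt (i : Fin 4) : fx s hτ X Y p q (lt i) = (![0, 0, p, q] : Fin 4 → Fin m → 𝒪) i := by
  rw [fx, fox, ev_lt]
  fin_cases i <;> simp [foxLt]

end Eval
end TA
end Duflo

namespace Duflo
namespace TA

variable {M : ℕ}

/-- The algebraic output of the hexagon relation. -/
structure Geo (M : ℕ) (ε : ℂ) where
  (a ai c ci q Ti : TA M)
  a_ai : a * ai = 1
  ai_a : ai * a = 1
  c_ci : c * ci = 1
  ci_c : ci * c = 1
  ad_a : ad a = lr a ai
  ad_ci : ad ci = lr ci c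
  aug_a : aug a = 1
  aug_ci : aug ci = 1
  hexagon : nexp (M + 1) ((2 * ε * (Real.pi * Complex.I)) • sm M)
    = a * nexp (M + 1) ((2 * ε * (Real.pi * Complex.I)) • lt 0) * ai *
      (ci * nexp (M + 1) ((2 * ε * (Real.pi * Complex.I)) • lt 1) * c)
  da_mem : ai * dG M a ∈ lie1 M
  da_com : ai * dG M a - (ε * (Real.pi * Complex.I)) • lt 3 ∈ com M
  dc_mem : c * dG M ci ∈ lie1 M
  dc_com : c * dG M ci ∈ com M
  d0_c : d0 M c * ci = ad q (lt 3)
  mul_Ti : (1 + lt 1 * q) * Ti = 1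
  Ti_mul : Ti * (1 + lt 1 * q) = 1
  trace_T : Ti * dG M (1 + lt 1 * q) - ∑ i ∈ Finset.Ico 1 (M + 1), zt i •
    ((-sm M) ^ i * dG M (-sm M) + lt 1 ^ i * dG M (lt 1) - (-lt 0) ^ i * dG M (-lt 0)) ∈ com M

lemma isDer_dG : IsDer (dG M) := isDer_der _ _

lemma isDer_d0 : IsDer (d0 M) := isDer_der _ _

lemma dG_mul (x y : TA M) : dG M (x * y) = dG M x * y + x * dG M y := isDer_dG x y

lemma d0_mul (x y : TA M) : d0 M (x * y) = d0 M x * y + x * d0 M y := isDer_d0 x y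

lemma nonempty_geo (M : ℕ) {ε : ℂ} (hε : ε = 1 ∨ ε = -1) : Nonempty (Geo M ε) := by
  obtain ⟨a, ai, c, ci, q, Ti, h1, h2, h3, h4, h5, h6, h7, h8, h9, h10, h11, h12, h13, h14, h15, h16,
    h17⟩ := exists_geo M hε
  exact ⟨⟨a, ai, c, ci, q, Ti, h1, h2, h3, h4, h5, h6, h7, h8, h9, h10, h11, h12, h13, h14, h15, h16,
    h17⟩⟩

section Eval

variable {Λ 𝒪 : Type*} [CommRing Λ] [CommRing 𝒪] [Algebra Λ 𝒪] [Algebra ℂ Λ] [Algebra ℂ 𝒪]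
  [IsScalarTower ℂ Λ 𝒪] {m : ℕ} (s : SC Λ m) {τ : Λ} (hτ : τ ^ M = 0) (X Y : Fin m → 𝒪)
  (p q : Fin m → 𝒪)

/-- The first order part of the evaluation on matrices. -/
def sd : TA M →ₗ[ℂ] Matrix (Fin m) (Fin m) 𝒪 where
  toFun x := (ev2 s hτ X Y p q x).snd
  map_add' x y := by rw [map_add]; rfl
  map_smul' c x := by rw [map_smul]; rfl

lemma sd_mul (x y : TA M) : sd s hτ X Y p q (x * y)
    = evM s hτ X Y x * sd s hτ X Y p q y + sd s hτ X Y p q x * evM s hτ X Y y :=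
  snd_ev2_mul s hτ X Y p q x y

lemma evM_lt (i : Fin 4) : evM s hτ X Y (lt i) = τ • (![adM s X, adM s Y, 0, 0] : Fin 4 → _) i :=
  evs_lt hτ _ i

lemma sd_lt (i : Fin 4) : sd s hτ X Y p q (lt i) = τ • (![0, 0, adM s p, adM s q] : Fin 4 → _) i := by
  change (ev2 s hτ X Y p q (lt i)).snd = _
  rw [ev2, evs_lt]
  fin_cases i <;> simp

lemma trace_sd_comm (x y : TA M) : Matrix.trace (sd s hτ X Y p q (x * y))
    = Matrix.trace (sd s hτ X Y p q (y * x)) := by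
  rw [sd_mul, sd_mul, Matrix.trace_add, Matrix.trace_add, Matrix.trace_mul_comm,
    Matrix.trace_mul_comm (sd s hτ X Y p q x), add_comm]

lemma trace_sd_com {x : TA M} (hx : x ∈ com M) : Matrix.trace (sd s hτ X Y p q x) = 0 :=
  trace_com ((Matrix.traceLinearMap (Fin m) ℂ 𝒪).comp (sd s hτ X Y p q))
    (fun a b => trace_sd_comm s hτ X Y p q a b) hx

lemma evM_aug_ad {η : TA M} (h : evM s hτ X Y η = 0) (h' : aug η = 0)
    (hs : sd s hτ X Y p q η = τ • adM s (fx s hτ X Y p q η)) (x : TA M) :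
    evM s hτ X Y (ad x η) = 0 ∧ aug (ad x η) = 0 ∧
      sd s hτ X Y p q (ad x η) = τ • adM s (fx s hτ X Y p q (ad x η)) ∧
      fx s hτ X Y p q (ad x η) = (evM s hτ X Y x).mulVec (fx s hτ X Y p q η) := by
  induction x using induction_lt generalizing η with
  | h1 c =>
    have e : ad (algebraMap ℂ (TA M) c) η = c • η := by
      rw [AlgHom.commutes, Algebra.algebraMap_eq_smul_one]; rfl
    rw [e]
    refine ⟨by simp [h], by simp [h'], ?_, ?_⟩
    · rw [map_smul, hs, fx_smul, ← algebraMap_smul 𝒪 c (fx s hτ X Y p q η), map_smul,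
        algebraMap_smul, smul_comm]
    · rw [fx_smul, AlgHom.commutes, Algebra.algebraMap_eq_smul_one, Matrix.smul_mulVec,
        Matrix.one_mulVec]
  | h2 i =>
    have e : ad (lt i) η = lt i * η - η * lt i := by rw [ad_lt]; exact cm_apply _ _
    have hf : fx s hτ X Y p q (ad (lt i) η) = (evM s hτ X Y (lt i)).mulVec (fx s hτ X Y p q η) := by
      rw [e, sub_eq_add_neg, fx_add, ← neg_one_smul ℂ (η * lt i), fx_smul, fx_mul, fx_mul, h, h', aug_lt]
      simp
    refine ⟨by simp [e, h], by simp [e, h'], ?_, hf⟩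
    rw [hf, e, map_sub, sd_mul, sd_mul, h, evM_lt, hs, Matrix.smul_mulVec,
      ← algebraMap_smul 𝒪 τ (Matrix.mulVec _ _), map_smul, algebraMap_smul]
    simp only [mul_zero, zero_mul, add_zero, zero_add, smul_mul_smul_comm, ← smul_sub, smul_smul]
    congr 1
    fin_cases i <;> simp [adM_jacobi]
  | ha x y hx hy =>
    obtain ⟨a1, a2, a3, a4⟩ := hx h h' hs
    obtain ⟨b1, b2, b3, b4⟩ := hy h h' hs
    have e : ad (x + y) η = ad x η + ad y η := by rw [map_add]; rfl
    rw [e]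
    refine ⟨by simp [a1, b1], by simp [a2, b2], ?_, ?_⟩
    · rw [map_add, a3, b3, fx_add, map_add, smul_add]
    · rw [fx_add, a4, b4, map_add, Matrix.add_mulVec]
  | hm x y hx hy =>
    obtain ⟨b1, b2, b3, b4⟩ := hy h h' hs
    obtain ⟨a1, a2, a3, a4⟩ := hx b1 b2 b3
    have e : ad (x * y) η = ad x (ad y η) := by rw [map_mul]; rfl
    rw [e]
    refine ⟨a1, a2, a3, ?_⟩
    rw [a4, b4, map_mul, Matrix.mulVec_mulVec]

lemma base_lt2 : evM s hτ X Y (lt 2) = 0 ∧ aug (lt (M := M) 2) = 0 ∧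
    sd s hτ X Y p q (lt 2) = τ • adM s (fx s hτ X Y p q (lt 2)) := by
  rw [evM_lt, sd_lt, fx_lt, aug_lt]; simp

lemma base_lt3 : evM s hτ X Y (lt 3) = 0 ∧ aug (lt (M := M) 3) = 0 ∧
    sd s hτ X Y p q (lt 3) = τ • adM s (fx s hτ X Y p q (lt 3)) := by
  rw [evM_lt, sd_lt, fx_lt, aug_lt]; simp

lemma sd_lie1 {η : TA M} (hη : η ∈ lie1 M) :
    sd s hτ X Y p q η = τ • adM s (fx s hτ X Y p q η) := by
  induction hη using Submodule.span_induction with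
  | mem x hx =>
    obtain ⟨r, rfl | rfl⟩ := hx
    · obtain ⟨h1, h2, h3⟩ := base_lt2 s hτ X Y p q
      exact (evM_aug_ad s hτ X Y p q h1 h2 h3 r).2.2.1
    · obtain ⟨h1, h2, h3⟩ := base_lt3 s hτ X Y p q
      exact (evM_aug_ad s hτ X Y p q h1 h2 h3 r).2.2.1
  | zero => simp [fx]
  | add x y _ _ hx hy => rw [map_add, hx, hy, fx_add, map_add, smul_add]
  | smul c x _ hx =>
    rw [map_smul, hx, fx_smul, ← algebraMap_smul 𝒪 c (fx s hτ X Y p q x), map_smul,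
        algebraMap_smul, smul_comm]

lemma fx_ad_lt3 (x : TA M) : fx s hτ X Y p q (ad x (lt 3)) = (evM s hτ X Y x).mulVec q := by
  obtain ⟨h1, h2, h3⟩ := base_lt3 s hτ X Y p q
  rw [(evM_aug_ad s hτ X Y p q h1 h2 h3 x).2.2.2, fx_lt]
  simp

section Derivation

variable {D : TA M →L[ℂ] TA M} (hD : IsDer D) (δ : Derivation Λ 𝒪 𝒪)

include hD in
lemma evM_der (h : ∀ i, evM s hτ X Y (D (lt i)) = 0 ∧ aug (D (lt i)) = 0) (x : TA M) :
    evM s hτ X Y (D x) = 0 ∧ aug (D x) = 0 := by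
  induction x using induction_lt with
  | h1 c => rw [IsDer.map_algebraMap hD]; simp
  | h2 i => exact h i
  | ha x y hx hy => rw [map_add, map_add, map_add, hx.1, hy.1, hx.2, hy.2]; simp
  | hm x y hx hy => rw [hD, map_add, map_add]; simp [hx.1, hy.1, hx.2, hy.2]

lemma evM_dG (x : TA M) : evM s hτ X Y (dG M x) = 0 ∧ aug (dG M x) = 0 := by
  refine evM_der s hτ X Y (isDer_der _ _) (fun i => ?_) x
  rw [der_lt]
  fin_cases i <;> simp [dval, evM_lt, aug_lt]

lemma evM_d0 (x : TA M) : evM s hτ X Y (d0 M x) = 0 ∧ aug (d0 M x) = 0 := by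
  refine evM_der s hτ X Y (isDer_der _ _) (fun i => ?_) x
  rw [der_lt]
  fin_cases i <;> simp [dval, evM_lt, aug_lt]

lemma sd_dG (x : TA M) : sd s hτ X Y (δ ∘ X) (δ ∘ Y) (dG M x) = (evM s hτ X Y x).map δ := by
  induction x using induction_lt with
  | h1 c =>
    rw [IsDer.map_algebraMap isDer_dG, AlgHom.commutes, map_zero,
      Algebra.algebraMap_eq_smul_one, ← algebraMap_smul Λ c, map_der_smul, map_der_one, smul_zero]
  | h2 i =>
    rw [dG, der_lt, evM_lt, map_der_smul]
    fin_cases i <;> simp [dval, sd_lt, adM_der]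
  | ha x y hx hy => rw [map_add, map_add, hx, hy, map_add, map_der_add]
  | hm x y hx hy =>
    rw [dG_mul, map_add, sd_mul, sd_mul, hx, hy, map_mul, map_der_mul,
      (evM_dG s hτ X Y x).1, (evM_dG s hτ X Y y).1, zero_mul, mul_zero, zero_add, add_zero]

/-- The last column of the universal derivation. -/
def gx (x : TA M) : Fin m → 𝒪 := fx s hτ X Y p q (dG M x)

lemma gx_mul (x y : TA M) : gx s hτ X Y p q (x * y)
    = (evM s hτ X Y x).mulVec (gx s hτ X Y p q y) + aug y • gx s hτ X Y p q x := by
  rw [gx, dG_mul, fx_add, fx_mul, fx_mul, (evM_dG s hτ X Y x).1,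
    (evM_dG s hτ X Y y).2]
  simp [gx, add_comm]

lemma gx_add (x y : TA M) : gx s hτ X Y p q (x + y) = gx s hτ X Y p q x + gx s hτ X Y p q y := by
  simp [gx, fx_add]

lemma gx_smul (c : ℂ) (x : TA M) : gx s hτ X Y p q (c • x) = c • gx s hτ X Y p q x := by
  simp [gx, fx_smul]

lemma gx_algebraMap (c : ℂ) : gx s hτ X Y p q (algebraMap ℂ (TA M) c) = 0 := by
  rw [gx, IsDer.map_algebraMap isDer_dG]
  simp [fx]

lemma gx_one : gx s hτ X Y p q (1 : TA M) = 0 := by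
  rw [← map_one (algebraMap ℂ (TA M)), gx_algebraMap]

lemma gx_lt (i : Fin 4) : gx s hτ X Y p q (lt i) = (![p, q, 0, 0] : Fin 4 → Fin m → 𝒪) i := by
  rw [gx, dG, der_lt]
  fin_cases i <;> simp [dval, fx_lt]
  all_goals simp [fx]

lemma fx_d0 (x : TA M) : fx s hτ X Y p q (d0 M x) = gx s hτ X Y (-q) q x := by
  induction x using induction_lt with
  | h1 c => rw [gx_algebraMap, IsDer.map_algebraMap isDer_d0]; simp [fx]
  | h2 i =>
    rw [gx_lt, d0, der_lt]
    have h3 := fx_smul s hτ X Y p q (-1) (lt 3)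
    rw [neg_one_smul, fx_lt] at h3
    fin_cases i <;> simp [dval, fx_lt, h3]
    all_goals simp [fx]
  | ha x y hx hy => rw [gx_add, map_add, fx_add, hx, hy]
  | hm x y hx hy =>
    rw [d0_mul, fx_add, fx_mul, fx_mul, (evM_d0 s hτ X Y x).1,
    (evM_d0 s hτ X Y y).2, gx_mul, hx, hy]
    simp [add_comm]

end Derivation
end Eval
end TA
end Duflo

namespace Duflo

/-- The truncation of `(exp x - 1) / x`. -/
def nf {R : Type*} [Ring R] [Algebra ℂ R] (N : ℕ) (x : R) : R :=
  ∑ k ∈ Finset.range N, (((k + 1).factorial : ℂ))⁻¹ • x ^ k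

lemma map_nexp {R S : Type*} [Ring R] [Algebra ℂ R] [Ring S] [Algebra ℂ S] (f : R →ₐ[ℂ] S) (N : ℕ) (x : R) :
    f (nexp N x) = nexp N (f x) := by
  simp [nexp]

lemma conj_pow {R : Type*} [Ring R] {a ai : R} (h : ai * a = 1) (x : R) (k : ℕ) (h' : a * ai = 1) :
    (a * x * ai) ^ k = a * x ^ k * ai := by
  induction k with
  | zero => simp [h']
  | succ k ih =>
    rw [pow_succ, ih, pow_succ]
    calc a * x ^ k * ai * (a * x * ai) = a * x ^ k * (ai * a) * x * ai := by simp only [mul_assoc]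
      _ = _ := by rw [h]; simp only [mul_assoc, mul_one, one_mul]

lemma conj_nexp {R : Type*} [Ring R] [Algebra ℂ R] {a ai : R} (h : ai * a = 1) (h' : a * ai = 1) (x : R)
    (N : ℕ) : nexp N (a * x * ai) = a * nexp N x * ai := by
  simp only [nexp, conj_pow h x _ h', Finset.mul_sum, Finset.sum_mul, mul_smul_comm, smul_mul_assoc]

lemma conj_nf {R : Type*} [Ring R] [Algebra ℂ R] {a ai : R} (h : ai * a = 1) (h' : a * ai = 1) (x : R)
    (N : ℕ) : nf N (a * x * ai) = a * nf N x * ai := by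
  simp only [nf, conj_pow h x _ h', Finset.mul_sum, Finset.sum_mul, mul_smul_comm, smul_mul_assoc]

namespace TA

variable {M : ℕ} {ε : ℂ} (g : Geo M ε)

section Eval

variable {Λ 𝒪 : Type*} [CommRing Λ] [CommRing 𝒪] [Algebra Λ 𝒪] [Algebra ℂ Λ] [Algebra ℂ 𝒪]
  [IsScalarTower ℂ Λ 𝒪] {m : ℕ} (s : SC Λ m) {τ : Λ} (hτ : τ ^ M = 0) (X Y : Fin m → 𝒪)
  (p q : Fin m → 𝒪)

section Alg

variable {T : Type*} [Ring T] [Algebra 𝒪 T] [Algebra Λ T] [Algebra ℂ T] [IsScalarTower Λ 𝒪 T]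
  [IsScalarTower ℂ 𝒪 T] {ι : (Fin m → 𝒪) →ₗ[𝒪] T}
  (hι : ∀ v w, ι v * ι w - ι w * ι v = ι ((adM s v).mulVec w))

include hι in
lemma evs_ad (x y : TA M) (v : Fin m → 𝒪) (h : evs hτ ![ι X, ι Y, 0, 0] y = ι v) :
    evs hτ ![ι X, ι Y, 0, 0] (ad x y) = ι ((evM s hτ X Y x).mulVec v) := by
  induction x using induction_lt generalizing y v with
  | h1 c =>
    have e : ad (algebraMap ℂ (TA M) c) y = c • y := by
      rw [AlgHom.commutes, Algebra.algebraMap_eq_smul_one]; rfl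
    rw [e, map_smul, h, AlgHom.commutes, Algebra.algebraMap_eq_smul_one, Matrix.smul_mulVec,
        Matrix.one_mulVec, ← algebraMap_smul 𝒪 c v, map_smul, algebraMap_smul]
  | h2 i =>
    have e : ad (lt i) y = lt i * y - y * lt i := by rw [ad_lt]; exact cm_apply _ _
    rw [e, map_sub, map_mul, map_mul, evs_lt, h, evM_lt, Matrix.smul_mulVec,
      ← algebraMap_smul 𝒪 τ (Matrix.mulVec _ _), map_smul, algebraMap_smul, smul_mul_assoc,
      mul_smul_comm, ← smul_sub]
    congr 1
    fin_cases i <;> simp [hι]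
  | ha x y hx hy =>
    rw [map_add, add_apply, map_add, hx _ _ h, hy _ _ h, map_add, Matrix.add_mulVec, map_add]
  | hm x' y' hx hy =>
    rw [map_mul, show ∀ z, (ad x' * ad y') z = ad x' (ad y' z) from fun _ => rfl, hx _ _ (hy _ _ h), map_mul, Matrix.mulVec_mulVec]

lemma ad_a_apply (x : TA M) : g.a * x * g.ai = ad g.a x := by rw [g.ad_a, lr_apply]

lemma ad_ci_apply (x : TA M) : g.ci * x * g.c = ad g.ci x := by rw [g.ad_ci, lr_apply]

/-- The first deformed vector. -/
def vX : Fin m → 𝒪 := (evM s hτ X Y g.a).mulVec X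

/-- The second deformed vector. -/
def vY : Fin m → 𝒪 := (evM s hτ X Y g.ci).mulVec Y

include hι in
lemma evs_conj_a : evs hτ ![ι X, ι Y, 0, 0] (g.a * lt 0 * g.ai) = τ • ι (vX g s hτ X Y) := by
  rw [ad_a_apply, evs_ad s hτ X Y hι _ _ (algebraMap Λ 𝒪 τ • X), Matrix.mulVec_smul, map_smul,
    algebraMap_smul, vX]
  rw [evs_lt, map_smul, algebraMap_smul]
  rfl

include hι in
lemma evs_conj_ci : evs hτ ![ι X, ι Y, 0, 0] (g.ci * lt 1 * g.c) = τ • ι (vY g s hτ X Y) := by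
  rw [ad_ci_apply, evs_ad s hτ X Y hι _ _ (algebraMap Λ 𝒪 τ • Y), Matrix.mulVec_smul, map_smul,
    algebraMap_smul, vY]
  rw [evs_lt, map_smul, algebraMap_smul]
  rfl

lemma hexagon' : nexp (M + 1) ((2 * ε * (Real.pi * Complex.I)) • sm M)
    = nexp (M + 1) ((2 * ε * (Real.pi * Complex.I)) • (g.a * lt 0 * g.ai)) *
      nexp (M + 1) ((2 * ε * (Real.pi * Complex.I)) • (g.ci * lt 1 * g.c)) := by
  rw [g.hexagon, ← conj_nexp g.ai_a g.a_ai, ← conj_nexp g.c_ci g.ci_c]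
  simp only [mul_smul_comm, smul_mul_assoc]

include hι in
/-- The product of exponentials. -/
theorem nexp_mul : nexp (M + 1) ((2 * ε * (Real.pi * Complex.I)) • τ • ι (X + Y))
    = nexp (M + 1) ((2 * ε * (Real.pi * Complex.I)) • τ • ι (vX g s hτ X Y)) *
      nexp (M + 1) ((2 * ε * (Real.pi * Complex.I)) • τ • ι (vY g s hτ X Y)) := by
  have h := congrArg (evs hτ ![ι X, ι Y, 0, 0]) (hexagon' g)
  rw [map_mul, map_nexp, map_nexp, map_nexp, map_smul, map_smul, map_smul, evs_conj_a g s hτ X Y hι,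
    evs_conj_ci g s hτ X Y hι, sm, map_add, evs_lt, evs_lt, ← smul_add] at h
  simpa using h

end Alg

lemma evM_conj_a : evM s hτ X Y (g.a * lt 0 * g.ai) = τ • adM s (vX g s hτ X Y) :=
  evs_conj_a g s hτ X Y fun v w => (adM_jacobi s v w).symm

lemma evM_conj_ci : evM s hτ X Y (g.ci * lt 1 * g.c) = τ • adM s (vY g s hτ X Y) :=
  evs_conj_ci g s hτ X Y fun v w => (adM_jacobi s v w).symm

lemma evM_sub_mem (I : Ideal 𝒪) (hX : ∀ i, τ • X i ∈ I) (hY : ∀ i, τ • Y i ∈ I) (x : TA M) (i j : Fin m) :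
    (evM s hτ X Y x - aug x • (1 : Matrix (Fin m) (Fin m) 𝒪)) i j ∈ I := by
  have hc (c : ℂ) {z : 𝒪} (hz : z ∈ I) : c • z ∈ I := by
    rw [← algebraMap_smul 𝒪 c, smul_eq_mul]; exact I.mul_mem_left _ hz
  have had (v : Fin m → 𝒪) (hv : ∀ i, τ • v i ∈ I) (i j : Fin m) : τ • adM s v i j ∈ I := by
    rw [adM_apply, Finset.smul_sum]
    refine I.sum_mem fun k _ => ?_
    rw [← smul_mul_assoc]
    exact I.mul_mem_right _ (hv k)
  induction x using induction_lt generalizing i j with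
  | h1 c => simp [AlgHom.commutes, Algebra.algebraMap_eq_smul_one]
  | h2 k =>
    rw [evM_lt, aug_lt, zero_smul, sub_zero]
    fin_cases k
    · exact had X hX i j
    · exact had Y hY i j
    · simp
    · simp
  | ha x y hx hy =>
    have e : evM s hτ X Y (x + y) - aug (x + y) • (1 : Matrix (Fin m) (Fin m) 𝒪)
      = (evM s hτ X Y x - aug x • 1) + (evM s hτ X Y y - aug y • 1) := by
      rw [map_add, map_add, add_smul]; abel
    rw [e]
    exact I.add_mem (hx i j) (hy i j)
  | hm x y hx hy =>
    have e : evM s hτ X Y (x * y) - aug (x * y) • (1 : Matrix (Fin m) (Fin m) 𝒪)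
      = (evM s hτ X Y x - aug x • 1) * evM s hτ X Y y + aug x • (evM s hτ X Y y - aug y • 1) := by
      rw [map_mul, map_mul, sub_mul, smul_sub, smul_mul_assoc, one_mul, smul_smul]; abel
    rw [e, Matrix.add_apply, Matrix.mul_apply, Matrix.smul_apply]
    exact I.add_mem (I.sum_mem fun k _ => I.mul_mem_right _ (hx i k)) (hc _ (hy i j))

section Gx

lemma gx_pow {x : TA M} (hx : aug x = 0) (k : ℕ) : gx s hτ X Y p q (x ^ (k + 1))
    = (evM s hτ X Y x ^ k).mulVec (gx s hτ X Y p q x) := by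
  induction k with
  | zero => simp
  | succ k ih =>
    rw [pow_succ' x, gx_mul, ih, map_pow, hx, pow_succ' (evM s hτ X Y x),
      zero_pow k.succ_ne_zero, zero_smul, add_zero, Matrix.mulVec_mulVec]

lemma gx_nexp {x : TA M} (hx : aug x = 0) (N : ℕ) : gx s hτ X Y p q (nexp (N + 1) x)
    = (nf N (evM s hτ X Y x)).mulVec (gx s hτ X Y p q x) := by
  let G : TA M →ₗ[ℂ] (Fin m → 𝒪) := ⟨⟨gx s hτ X Y p q, gx_add s hτ X Y p q⟩, gx_smul s hτ X Y p q⟩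
  change G (nexp (N + 1) x) = _
  rw [nexp, Finset.sum_range_succ', map_add, map_sum, pow_zero, map_smul]
  have e1 : G 1 = 0 := gx_one s hτ X Y p q
  rw [e1, smul_zero, add_zero, nf, Matrix.sum_mulVec]
  refine Finset.sum_congr rfl fun k _ => ?_
  rw [map_smul, Matrix.smul_mulVec]
  congr 1
  exact gx_pow s hτ X Y p q hx k

lemma aug_nexp {x : TA M} (hx : aug x = 0) (N : ℕ) : aug (nexp (N + 1) x) = 1 := by
  rw [map_nexp, hx, nexp, Finset.sum_range_succ', Finset.sum_eq_zero]
  · simp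
  · intro k _; simp

end Gx

section Derivation

variable (δ : Derivation Λ 𝒪 𝒪)

/-- The first connection form. -/
def w1 : Fin m → 𝒪 := fx s hτ X Y (δ ∘ X) (δ ∘ Y) (g.ai * dG M g.a)

/-- The second connection form. -/
def w2 : Fin m → 𝒪 := fx s hτ X Y (δ ∘ X) (δ ∘ Y) (g.c * dG M g.ci)

lemma map_a : (evM s hτ X Y g.a).map δ = evM s hτ X Y g.a * τ • adM s (w1 g s hτ X Y δ) := by
  have h := sd_lie1 s hτ X Y (δ ∘ X) (δ ∘ Y) g.da_mem
  rw [sd_mul, sd_dG, (evM_dG s hτ X Y g.a).1, mul_zero, add_zero] at h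
  rw [w1, ← h, ← mul_assoc, ← map_mul, g.a_ai, map_one, one_mul]

lemma map_ci : (evM s hτ X Y g.ci).map δ = evM s hτ X Y g.ci * τ • adM s (w2 g s hτ X Y δ) := by
  have h := sd_lie1 s hτ X Y (δ ∘ X) (δ ∘ Y) g.dc_mem
  rw [sd_mul, sd_dG, (evM_dG s hτ X Y g.ci).1, mul_zero, add_zero] at h
  rw [w2, ← h, ← mul_assoc, ← map_mul, g.ci_c, map_one, one_mul]

lemma der_vX : δ ∘ vX g s hτ X Y = (evM s hτ X Y g.a).mulVec
    (δ ∘ X + τ • (adM s (w1 g s hτ X Y δ)).mulVec X) := by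
  rw [vX, map_der_mulVec, map_a, Matrix.mulVec_add, add_comm, ← Matrix.mulVec_mulVec, Matrix.smul_mulVec]

lemma der_vY : δ ∘ vY g s hτ X Y = (evM s hτ X Y g.ci).mulVec
    (δ ∘ Y + τ • (adM s (w2 g s hτ X Y δ)).mulVec Y) := by
  rw [vY, map_der_mulVec, map_ci, Matrix.mulVec_add, add_comm, ← Matrix.mulVec_mulVec, Matrix.smul_mulVec]

lemma trace_w2 : Matrix.trace (τ • adM s (w2 g s hτ X Y δ)) = 0 := by
  rw [w2, ← sd_lie1 s hτ X Y (δ ∘ X) (δ ∘ Y) g.dc_mem]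
  exact trace_sd_com s hτ X Y _ _ g.dc_com

lemma trace_w1 : Matrix.trace (τ • adM s (w1 g s hτ X Y δ))
    = (ε * (Real.pi * Complex.I)) • Matrix.trace (τ • adM s (δ ∘ Y)) := by
  rw [w1, ← sd_lie1 s hτ X Y (δ ∘ X) (δ ∘ Y) g.da_mem]
  have h := trace_sd_com s hτ X Y (δ ∘ X) (δ ∘ Y) g.da_com
  rw [map_sub, map_smul, sd_lt, Matrix.trace_sub, Matrix.trace_smul, sub_eq_zero] at h
  exact h

lemma gx_conj_a : gx s hτ X Y (δ ∘ X) (δ ∘ Y) (g.a * lt 0 * g.ai) = δ ∘ vX g s hτ X Y := by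
  have h1 : gx s hτ X Y (δ ∘ X) (δ ∘ Y) (g.a * g.ai) = 0 := by rw [g.a_ai, gx_one]
  have hai : aug g.ai = 1 := by
    have := congrArg aug g.a_ai
    rwa [map_mul, g.aug_a, one_mul, map_one] at this
  rw [gx_mul, hai, one_smul] at h1
  have h2 : gx s hτ X Y (δ ∘ X) (δ ∘ Y) g.ai = -w1 g s hτ X Y δ := by
    have := congrArg (evM s hτ X Y g.ai).mulVec h1
    rw [Matrix.mulVec_add, Matrix.mulVec_mulVec, ← map_mul, g.ai_a, map_one, Matrix.one_mulVec,
      Matrix.mulVec_zero] at this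
    rw [w1, fx_mul, (evM_dG s hτ X Y g.a).2, zero_smul, add_zero]
    exact eq_neg_of_add_eq_zero_left this
  rw [mul_assoc, gx_mul, gx_mul, h2, hai, map_mul, hai, aug_lt, gx_lt, evM_lt, der_vX]
  simp [Matrix.smul_mulVec, adM_antisymm s X, add_comm, Matrix.mulVec_neg]

lemma gx_conj_ci : gx s hτ X Y (δ ∘ X) (δ ∘ Y) (g.ci * lt 1 * g.c) = δ ∘ vY g s hτ X Y := by
  have h1 : gx s hτ X Y (δ ∘ X) (δ ∘ Y) (g.ci * g.c) = 0 := by rw [g.ci_c, gx_one]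
  have hai : aug g.c = 1 := by
    have := congrArg aug g.ci_c
    rwa [map_mul, g.aug_ci, one_mul, map_one] at this
  rw [gx_mul, hai, one_smul] at h1
  have h2 : gx s hτ X Y (δ ∘ X) (δ ∘ Y) g.c = -w2 g s hτ X Y δ := by
    have := congrArg (evM s hτ X Y g.c).mulVec h1
    rw [Matrix.mulVec_add, Matrix.mulVec_mulVec, ← map_mul, g.c_ci, map_one, Matrix.one_mulVec,
      Matrix.mulVec_zero] at this
    rw [w2, fx_mul, (evM_dG s hτ X Y g.ci).2, zero_smul, add_zero]
    exact eq_neg_of_add_eq_zero_left this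
  rw [mul_assoc, gx_mul, gx_mul, h2, hai, map_mul, hai, aug_lt, gx_lt, evM_lt, der_vY]
  simp [Matrix.smul_mulVec, adM_antisymm s Y, add_comm, Matrix.mulVec_neg]

/-- The differential of the product formula. -/
theorem der_product (hε : ε ≠ 0) :
    (nf M ((2 * ε * (Real.pi * Complex.I)) • τ • adM s (vX g s hτ X Y))).mulVec (δ ∘ vX g s hτ X Y) +
    (nexp (M + 1) ((2 * ε * (Real.pi * Complex.I)) • τ • adM s (vX g s hτ X Y))).mulVec
      ((nf M ((2 * ε * (Real.pi * Complex.I)) • τ • adM s (vY g s hτ X Y))).mulVec (δ ∘ vY g s hτ X Y))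
    = (nf M ((2 * ε * (Real.pi * Complex.I)) • τ • adM s (X + Y))).mulVec (δ ∘ (X + Y)) := by
  have h := congrArg (gx s hτ X Y (δ ∘ X) (δ ∘ Y)) (hexagon' g)
  have hκ : 2 * ε * (Real.pi * Complex.I) ≠ 0 := by
    simp [hε, Real.pi_ne_zero, Complex.I_ne_zero]
  set κ := 2 * ε * (Real.pi * Complex.I)
  have a1 : aug (κ • sm M) = 0 := by simp [sm, aug_lt]
  have a2 : aug (κ • (g.a * lt 0 * g.ai)) = 0 := by simp [aug_lt]
  have a3 : aug (κ • (g.ci * lt 1 * g.c)) = 0 := by simp [aug_lt]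
  rw [gx_mul, gx_nexp s hτ X Y _ _ a1, gx_nexp s hτ X Y _ _ a2, gx_nexp s hτ X Y _ _ a3,
    aug_nexp a3, one_smul, map_nexp, gx_smul, gx_smul, gx_smul, map_smul, map_smul, map_smul,
    evM_conj_a, evM_conj_ci, gx_conj_a, gx_conj_ci, Matrix.mulVec_smul, Matrix.mulVec_smul,
    Matrix.mulVec_smul, Matrix.mulVec_smul, ← smul_add] at h
  have h' := congrArg (κ⁻¹ • ·) h
  simp only [smul_smul, inv_mul_cancel₀ hκ, one_smul] at h'
  rw [add_comm, ← h']
  congr 1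
  · simp [sm, evM_lt]
  · simp only [sm, gx_add, gx_lt]
    ext i
    simp

lemma der_vY_of_neg (h : δ ∘ X = -(δ ∘ Y)) : δ ∘ vY g s hτ X Y
    = (evM s hτ X Y (g.ci * (1 + lt 1 * g.q))).mulVec (δ ∘ Y) := by
  have hc : gx s hτ X Y (-(δ ∘ Y)) (δ ∘ Y) g.c = (evM s hτ X Y g.q).mulVec (δ ∘ Y) := by
    rw [← fx_ad_lt3 s hτ X Y (δ ∘ Y) (δ ∘ Y), ← g.d0_c, fx_mul, (evM_d0 s hτ X Y g.c).1, g.aug_ci,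
      Matrix.zero_mulVec, zero_add, one_smul, fx_d0]
  have h1 : gx s hτ X Y (δ ∘ X) (δ ∘ Y) (g.c * g.ci) = 0 := by rw [g.c_ci, gx_one]
  have h2 : w2 g s hτ X Y δ = -(evM s hτ X Y g.q).mulVec (δ ∘ Y) := by
    rw [gx_mul, g.aug_ci, one_smul, h, hc] at h1
    rw [w2, fx_mul, (evM_dG s hτ X Y g.ci).2, zero_smul, add_zero]
    refine eq_neg_of_add_eq_zero_left ?_
    rw [← h1, h]; rfl
  rw [der_vY, h2, map_mul, ← Matrix.mulVec_mulVec, adM_antisymm, Matrix.mulVec_neg, neg_neg]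
  simp [Matrix.add_mulVec, evM_lt, Matrix.smul_mulVec]

lemma trace_T : Matrix.trace (evM s hτ X Y g.Ti * (evM s hτ X Y (1 + lt 1 * g.q)).map δ)
    = ∑ i ∈ Finset.Ico 1 (M + 1), zt i • (
      Matrix.trace ((-(τ • adM s (X + Y))) ^ i * (-(τ • adM s (δ ∘ (X + Y))))) +
      Matrix.trace ((τ • adM s Y) ^ i * (τ • adM s (δ ∘ Y))) -
      Matrix.trace ((-(τ • adM s X)) ^ i * (-(τ • adM s (δ ∘ X))))) := by
  have h := trace_sd_com s hτ X Y (δ ∘ X) (δ ∘ Y) g.trace_T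
  have e (x y : TA M) : sd s hτ X Y (δ ∘ X) (δ ∘ Y) (x * dG M y)
      = evM s hτ X Y x * (evM s hτ X Y y).map δ := by
    rw [sd_mul, (evM_dG s hτ X Y y).1, mul_zero, add_zero, sd_dG]
  rw [map_sub, Matrix.trace_sub, sub_eq_zero, e, map_sum, Matrix.trace_sum] at h
  rw [h]
  refine Finset.sum_congr rfl fun i _ => ?_
  rw [map_smul, Matrix.trace_smul, map_sub, map_add, e, e, e, Matrix.trace_sub, Matrix.trace_add]
  have n (x : Matrix (Fin m) (Fin m) 𝒪) : (-x).map δ = -x.map δ := by ext; simp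
  simp only [map_neg, map_pow, n, sm, map_add, evM_lt, map_der_add, map_der_smul]
  simp [adM_der]

end Derivation
end Eval
end TA
end Duflo

namespace Duflo

section Pse

variable {R : Type*} [Ring R] [Algebra ℂ R]

/-- Evaluation of a truncated power series. -/
def pse (M : ℕ) (F : PowerSeries ℂ) (x : R) : R := ∑ k ∈ Finset.range M, PowerSeries.coeff k F • x ^ k

lemma pse_eq_aeval (M : ℕ) (F : PowerSeries ℂ) (x : R) : pse M F x = Polynomial.aeval x (F.trunc M) := by
  rw [Polynomial.aeval_def, PowerSeries.eval₂_trunc_eq_sum_range, pse]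
  simp only [Algebra.smul_def]

lemma pse_mul {M : ℕ} {x : R} (hx : x ^ M = 0) (F G : PowerSeries ℂ) :
    pse M (F * G) x = pse M F x * pse M G x := by
  have key : ∀ P : Polynomial ℂ, Polynomial.aeval x (PowerSeries.trunc M (P : PowerSeries ℂ))
      = Polynomial.aeval x P := by
    intro P
    rw [← pse_eq_aeval, pse, Polynomial.aeval_eq_sum_range' (n := M + (P.natDegree + 1)) (by omega),
      Finset.sum_range_add]
    simp only [Polynomial.coeff_coe, left_eq_add]
    refine Finset.sum_eq_zero fun k _ => ?_
    rw [pow_add, hx, zero_mul, smul_zero]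
  rw [pse_eq_aeval, pse_eq_aeval, pse_eq_aeval, ← map_mul, ← PowerSeries.trunc_trunc_mul_trunc,
    ← Polynomial.coe_mul, key]

lemma pse_one {M : ℕ} {x : R} (hx : x ^ M = 0) : pse M 1 x = 1 := by
  rcases M with _ | M
  · rw [pow_zero] at hx
    rw [pse, Finset.sum_range_zero, hx]
  · rw [pse, Finset.sum_range_succ']
    simp [PowerSeries.coeff_one]

/-- The series of `(exp x - 1) / x`. -/
def fser : PowerSeries ℂ := PowerSeries.mk fun k => (((k + 1).factorial : ℂ))⁻¹

lemma nf_eq_pse (M : ℕ) (x : R) : nf M x = pse M fser x := by simp [nf, pse, fser]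

lemma fser_mul_inv : fser * fser⁻¹ = 1 := PowerSeries.mul_inv_cancel _ (by simp [fser])

lemma commute_pse (M : ℕ) (F : PowerSeries ℂ) (x : R) : Commute x (pse M F x) :=
  Commute.sum_right _ _ _ fun _ _ => ((Commute.refl x).pow_right _).smul_right _

end Pse

section Mld

variable {Λ 𝒪 : Type*} [CommRing Λ] [CommRing 𝒪] [Algebra Λ 𝒪] {n p : Type*} [Fintype n] [DecidableEq n]
  [Fintype p] [DecidableEq p] (δ : Derivation Λ 𝒪 𝒪)

/-- The trace of the logarithmic derivative of a matrix. -/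
def mld (A : Matrix n n 𝒪) : 𝒪 := Matrix.trace (A⁻¹ * A.map δ)

lemma mld_eq {A B : Matrix n n 𝒪} (h : B * A = 1) : mld δ A = Matrix.trace (B * A.map δ) := by
  rw [mld, Matrix.inv_eq_left_inv h]

lemma mld_mul {A B : Matrix n n 𝒪} (hA : IsUnit A) (hB : IsUnit B) :
    mld δ (A * B) = mld δ A + mld δ B := by
  obtain ⟨u, rfl⟩ := hA
  obtain ⟨v, rfl⟩ := hB
  rw [mld_eq δ (B := (↑v⁻¹ : Matrix n n 𝒪) * (↑u⁻¹ : Matrix n n 𝒪)), mld_eq δ u.inv_mul, mld_eq δ v.inv_mul, map_der_mul,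
    mul_add, Matrix.trace_add]
  · congr 1
    · rw [mul_assoc, Matrix.trace_mul_comm, mul_assoc, mul_assoc, Units.mul_inv, mul_one]
    · rw [mul_assoc, ← mul_assoc (↑u⁻¹ : Matrix n n 𝒪) ↑u, Units.inv_mul, one_mul]
  · rw [mul_assoc, ← mul_assoc (↑u⁻¹ : Matrix n n 𝒪) ↑u, Units.inv_mul, one_mul, Units.inv_mul]

lemma mld_one : mld δ (1 : Matrix n n 𝒪) = 0 := by rw [mld, map_der_one, mul_zero, Matrix.trace_zero]

lemma mld_conj {A Ai B : Matrix n n 𝒪} (h : A * Ai = 1) (hB : IsUnit B) : mld δ (A * B * Ai) = mld δ B := by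
  have h' : Ai * A = 1 := mul_eq_one_comm.mp h
  have uA : IsUnit A := ⟨⟨A, Ai, h, h'⟩, rfl⟩
  have uAi : IsUnit Ai := ⟨⟨Ai, A, h', h⟩, rfl⟩
  have := mld_mul δ uA uAi
  rw [h, mld_one] at this
  rw [mld_mul δ (uA.mul hB) uAi, mld_mul δ uA hB]
  linear_combination -this

lemma trace_fromBlocks' (A : Matrix n n 𝒪) (B : Matrix n p 𝒪) (C : Matrix p n 𝒪) (E : Matrix p p 𝒪) :
    Matrix.trace (Matrix.fromBlocks A B C E) = Matrix.trace A + Matrix.trace E := by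
  simp [Matrix.trace]

lemma mld_blocks₂₁ {A Ai : Matrix n n 𝒪} (B : Matrix n p 𝒪) {C Ci : Matrix p p 𝒪} (hA : Ai * A = 1)
    (hC : Ci * C = 1) : mld δ (Matrix.fromBlocks A B 0 C) = mld δ A + mld δ C := by
  have hA' : A * Ai = 1 := mul_eq_one_comm.mp hA
  rw [mld_eq δ (B := Matrix.fromBlocks Ai (-(Ai * B * Ci)) 0 Ci), mld_eq δ hA, mld_eq δ hC,
    Matrix.fromBlocks_map, Matrix.fromBlocks_multiply, trace_fromBlocks']
  · have : (0 : Matrix p n 𝒪).map δ = 0 := by ext; simp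
    simp [this]
  · rw [Matrix.fromBlocks_multiply, hA, hC]
    simp [Matrix.mul_assoc, hC]

lemma mld_blocks₁₂ {A Ai : Matrix n n 𝒪} (B : Matrix p n 𝒪) {C Ci : Matrix p p 𝒪} (hA : Ai * A = 1)
    (hC : Ci * C = 1) : mld δ (Matrix.fromBlocks A 0 B C) = mld δ A + mld δ C := by
  rw [mld_eq δ (B := Matrix.fromBlocks Ai 0 (-(Ci * B * Ai)) Ci), mld_eq δ hA, mld_eq δ hC,
    Matrix.fromBlocks_map, Matrix.fromBlocks_multiply, trace_fromBlocks']
  · have : (0 : Matrix n p 𝒪).map δ = 0 := by ext; simp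
    simp [this]
  · rw [Matrix.fromBlocks_multiply, hA, hC]
    simp [Matrix.mul_assoc, hA]

lemma trace_mul_map_pow {x B : Matrix n n 𝒪} (hB : Commute x B) (k : ℕ) :
    Matrix.trace (B * (x ^ k).map δ) = k • Matrix.trace (B * x ^ (k - 1) * x.map δ) := by
  induction k generalizing B with
  | zero => simp [map_der_one]
  | succ k ih =>
    rw [pow_succ, map_der_mul, mul_add, Matrix.trace_add, ← mul_assoc, Matrix.trace_mul_comm, ← mul_assoc,
      ih ((Commute.refl x).mul_right hB), hB.eq, succ_nsmul, ← mul_assoc]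
    congr 1
    rcases k with _ | k
    · simp
    · rw [Nat.add_sub_cancel, mul_assoc B, ← pow_succ', Nat.add_sub_cancel]

variable [Algebra ℂ Λ] [Algebra ℂ 𝒪] [IsScalarTower ℂ Λ 𝒪]

lemma trace_mul_map_pse {M : ℕ} {x B : Matrix n n 𝒪} (hx : x ^ M = 0) (hB : Commute x B)
    (F : PowerSeries ℂ) : Matrix.trace (B * (pse M F x).map δ)
      = Matrix.trace (B * pse M (PowerSeries.derivative ℂ F) x * x.map δ) := by
  have e : pse M F x = pse (M + 1) F x := by rw [pse, pse, Finset.sum_range_succ, hx, smul_zero, add_zero]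
  have e2 : (pse (M + 1) F x).map δ
      = ∑ k ∈ Finset.range (M + 1), PowerSeries.coeff k F • (x ^ k).map δ := by
    ext i j
    simp only [pse, Matrix.map_apply, Matrix.sum_apply, Matrix.smul_apply, map_sum]
    refine Finset.sum_congr rfl fun k _ => ?_
    rw [← algebraMap_smul Λ, Derivation.map_smul, algebraMap_smul]
  rw [e, e2, Finset.mul_sum, Matrix.trace_sum, Finset.sum_range_succ', pse, Finset.mul_sum, Finset.sum_mul,
    Matrix.trace_sum, pow_zero, map_der_one]
  simp only [mul_smul_comm, Matrix.trace_smul, trace_mul_map_pow δ hB, smul_mul_assoc, mul_zero,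
    smul_zero, add_zero, Nat.add_sub_cancel, PowerSeries.coeff_derivative, Matrix.trace_zero]
  refine Finset.sum_congr rfl fun k _ => ?_
  rw [mul_smul, ← Nat.cast_succ, Nat.cast_smul_eq_nsmul]

lemma mld_nf {M : ℕ} {x : Matrix n n 𝒪} (hx : x ^ M = 0) : IsUnit (nf M x) ∧ mld δ (nf M x)
    = ∑ k ∈ Finset.range M, PowerSeries.coeff k (fser⁻¹ * PowerSeries.derivative ℂ fser) •
      Matrix.trace (x ^ k * x.map δ) := by
  have h1 : pse M fser x * pse M fser⁻¹ x = 1 := by rw [← pse_mul hx, fser_mul_inv, pse_one hx]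
  have h2 : pse M fser⁻¹ x * pse M fser x = 1 := mul_eq_one_comm.mp h1
  rw [nf_eq_pse]
  refine ⟨⟨⟨_, _, h1, h2⟩, rfl⟩, ?_⟩
  rw [mld_eq δ h2, trace_mul_map_pse δ hx (commute_pse _ _ _), ← pse_mul hx, pse, Finset.sum_mul,
    Matrix.trace_sum]
  simp only [smul_mul_assoc, Matrix.trace_smul]

end Mld
end Duflo

namespace Duflo

/-- The logarithmic derivative of `fser`. -/
def phi (k : ℕ) : ℂ := PowerSeries.coeff k (fser⁻¹ * PowerSeries.derivative ℂ fser)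

lemma X_mul_fser : PowerSeries.X * fser = PowerSeries.exp ℂ - 1 := by
  ext n
  rcases n with _ | n
  · simp
  · rw [PowerSeries.coeff_succ_X_mul]
    simp [fser, PowerSeries.coeff_one, PowerSeries.coeff_exp]

lemma bernoulli_mul_fser : bernoulliPowerSeries ℂ * fser = 1 := by
  have h := bernoulliPowerSeries_mul_exp_sub_one ℂ
  rw [← X_mul_fser, mul_left_comm] at h
  exact mul_left_cancel₀ PowerSeries.X_ne_zero (h.trans (mul_one _).symm)

lemma inv_fser : fser⁻¹ = bernoulliPowerSeries ℂ := by
  have h := congrArg (· * fser⁻¹) bernoulli_mul_fser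
  simpa [mul_assoc, fser_mul_inv] using h.symm

lemma X_mul_phi : PowerSeries.X * (fser⁻¹ * PowerSeries.derivative ℂ fser)
    = PowerSeries.X + bernoulliPowerSeries ℂ - 1 := by
  have h : PowerSeries.X * PowerSeries.derivative ℂ fser = PowerSeries.exp ℂ - fser := by
    have h := congrArg (PowerSeries.derivative ℂ) X_mul_fser
    have e : PowerSeries.derivative ℂ (PowerSeries.exp ℂ) = PowerSeries.exp ℂ := by
      ext n; simp [PowerSeries.coeff_derivative, PowerSeries.coeff_exp, Nat.factorial_succ]
      field_simp
    rw [map_sub, e, Derivation.leibniz] at h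
    simp only [PowerSeries.derivative_X, smul_eq_mul, mul_one, Derivation.map_one_eq_zero, sub_zero] at h
    rw [← h]; simp
  rw [mul_left_comm, h, inv_fser, show PowerSeries.exp ℂ = PowerSeries.X * fser + 1 by
    rw [X_mul_fser]; ring]
  linear_combination (PowerSeries.X - 1) * bernoulli_mul_fser

lemma phi_eq (k : ℕ) : phi k = (if k = 0 then 1 else 0) + ((bernoulli (k + 1) : ℚ) : ℂ) / (k + 1).factorial := by
  have h := congrArg (PowerSeries.coeff (k + 1)) X_mul_phi
  rw [PowerSeries.coeff_succ_X_mul] at h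
  rw [phi, h]
  simp [PowerSeries.coeff_X, PowerSeries.coeff_one, bernoulliPowerSeries]

lemma phi_zero : phi 0 = 1 / 2 := by
  rw [phi_eq]; norm_num [bernoulli_one]

lemma phi_odd {k : ℕ} (hk : k ≠ 0) (h : Odd (k + 1)) : phi k = 0 := by
  rw [phi_eq, if_neg hk, bernoulli_eq_zero_of_odd h (by omega)]; simp

lemma phi_even {k : ℕ} (h : Even (k + 1)) {ε : ℂ} (hε : ε = 1 ∨ ε = -1) :
    phi k * (2 * ε * (Real.pi * Complex.I)) ^ (k + 1) = -2 * zt k := by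
  obtain ⟨j, hj⟩ := h
  have hk : k ≠ 0 := by omega
  have hj0 : j ≠ 0 := by omega
  have h1 := hasSum_zeta_nat hj0
  have h2 := (hasSum_nat_add_iff' 1).mpr h1
  have h3 := (Complex.hasSum_ofReal.mpr h2)
  have h4 : zt k = _ := (hasSum_zt (by omega : 1 ≤ k)).unique (by
    convert! h3 using 2 with n
    push_cast
    rw [hj, two_mul])
  rw [h4, phi_eq, if_neg hk, show k + 1 = 2 * j by omega]
  have e1 : (2 * ε * (Real.pi * Complex.I)) ^ (2 * j) = 2 ^ (2 * j) * (Real.pi : ℂ) ^ (2 * j) * (-1) ^ j := by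
    rw [mul_pow, mul_pow, mul_pow, pow_mul ε, pow_mul Complex.I, Complex.I_sq]
    rcases hε with rfl | rfl <;> simp [mul_assoc]
  have e2 : (2 : ℂ) ^ (2 * j) = 2 * 2 ^ (2 * j - 1) := by
    rw [← pow_succ', Nat.sub_add_cancel (by omega)]
  rw [e1, e2]
  push_cast
  simp [hj0]
  ring

end Duflo

namespace Duflo

section Jacobian

variable {Λ : Type*} [CommRing Λ] {σ : Type*} [Fintype σ] [DecidableEq σ]

/-- The Jacobian matrix. -/
def jacM (v : σ → MvPolynomial σ Λ) : Matrix σ σ (MvPolynomial σ Λ) :=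
  Matrix.of fun j l => MvPolynomial.pderiv l (v j)

lemma derivation_sum_apply {ι A : Type*} [CommRing A] [Algebra Λ A] (t : Finset ι) (D : ι → Derivation Λ A A) (f : A) :
    (∑ i ∈ t, D i) f = ∑ i ∈ t, D i f := by
  have h := congrFun (map_sum (Derivation.coeFnAddMonoidHom (R := Λ) (A := A) (M := A)) D t) f
  rwa [Finset.sum_apply] at h

lemma mkDerivation_eq_sum_pderiv (v : σ → MvPolynomial σ Λ) (f : MvPolynomial σ Λ) :
    MvPolynomial.mkDerivation Λ v f = ∑ l, v l * MvPolynomial.pderiv l f := by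
  have : MvPolynomial.mkDerivation Λ v = ∑ l, v l • MvPolynomial.pderiv l := by
    refine MvPolynomial.derivation_ext fun i => ?_
    rw [MvPolynomial.mkDerivation_X, derivation_sum_apply]
    simp [MvPolynomial.pderiv_X, Pi.single_apply]
  rw [this, derivation_sum_apply]
  simp

lemma pderiv_comm' (i j : σ) (f : MvPolynomial σ Λ) :
    MvPolynomial.pderiv i (MvPolynomial.pderiv j f) = MvPolynomial.pderiv j (MvPolynomial.pderiv i f) := by
  have : ⁅(MvPolynomial.pderiv i : Derivation Λ (MvPolynomial σ Λ) (MvPolynomial σ Λ)),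
      (MvPolynomial.pderiv j : Derivation Λ (MvPolynomial σ Λ) (MvPolynomial σ Λ))⁆ = 0 := by
    refine MvPolynomial.derivation_ext fun k => ?_
    rw [Derivation.commutator_apply]
    simp only [MvPolynomial.pderiv_X, Pi.single_apply]
    split_ifs <;> simp
  have h := congrArg (fun δ => δ f) this
  rw [Derivation.commutator_apply] at h
  exact sub_eq_zero.mp h

/-- The divergence of a vector field rescaled to a given family of functions. -/
lemma sum_pderiv_inv_jacM (w : σ → MvPolynomial σ Λ) (hw : IsUnit (jacM w)) (v : σ → MvPolynomial σ Λ)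
    (hv : (jacM w).mulVec v = w) :
    ∑ l, MvPolynomial.pderiv l (MvPolynomial.X l - v l)
      = mld (MvPolynomial.mkDerivation Λ v) (jacM w) := by
  obtain ⟨u, hu⟩ := hw
  have h1 : (jacM w).map (MvPolynomial.mkDerivation Λ v) + jacM w * jacM v = jacM w := by
    ext1 j k
    have h := congrArg (MvPolynomial.pderiv k) (congrFun hv j)
    rw [Matrix.mulVec, dotProduct, map_sum] at h
    simp only [Derivation.leibniz, smul_eq_mul, Finset.sum_add_distrib] at h
    rw [Matrix.add_apply, Matrix.map_apply, Matrix.mul_apply, mkDerivation_eq_sum_pderiv]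
    simp only [jacM, Matrix.of_apply] at h ⊢
    refine (add_comm _ _).trans (Eq.trans ?_ h)
    congr 1
    exact Finset.sum_congr rfl fun l _ => by rw [pderiv_comm']
  rw [mld_eq _ (B := (↑u⁻¹ : Matrix σ σ _)) (by rw [← hu, u.inv_mul]), eq_sub_of_add_eq h1, mul_sub,
    ← mul_assoc, ← hu, u.inv_mul, one_mul, Matrix.trace_sub, Matrix.trace, Matrix.trace, ← Finset.sum_sub_distrib]
  refine Finset.sum_congr rfl fun l _ => ?_
  simp [jacM]

end Jacobian

section Trace

variable {Λ 𝒪 : Type*} [CommRing Λ] [CommRing 𝒪] [Algebra Λ 𝒪] {n : Type*} [Fintype n] [DecidableEq n]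
  (δ : Derivation Λ 𝒪 𝒪)

lemma der_trace (x : Matrix n n 𝒪) : δ (Matrix.trace x) = Matrix.trace (x.map δ) := by
  simp [Matrix.trace]

lemma der_trace_pow (x : Matrix n n 𝒪) (k : ℕ) :
    δ (Matrix.trace (x ^ (k + 1))) = (k + 1) • Matrix.trace (x ^ k * x.map δ) := by
  have h := trace_mul_map_pow δ (x := x) (B := 1) (Commute.one_right x) (k + 1)
  rwa [one_mul, one_mul, ← der_trace, Nat.add_sub_cancel] at h

end Trace

namespace TA

variable {M : ℕ} {ε : ℂ} (g : Geo M ε) {Λ : Type*} [CommRing Λ] [Algebra ℂ Λ] {m : ℕ} (s : SC Λ m)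
  {τ : Λ} (hτ : τ ^ M = 0)

/-- Polynomial functions on pairs of vectors. -/
abbrev Pol2 (Λ : Type*) [CommRing Λ] (m : ℕ) := MvPolynomial (Fin m ⊕ Fin m) Λ

/-- The first coordinate vector. -/
def cX (Λ : Type*) [CommRing Λ] (m : ℕ) : Fin m → Pol2 Λ m := fun i => MvPolynomial.X (Sum.inl i)

/-- The second coordinate vector. -/
def cY (Λ : Type*) [CommRing Λ] (m : ℕ) : Fin m → Pol2 Λ m := fun i => MvPolynomial.X (Sum.inr i)

/-- The deformed coordinates. -/
def mv : Fin m ⊕ Fin m → Pol2 Λ m :=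
  Sum.elim (vX g s hτ (cX Λ m) (cY Λ m)) (vY g s hτ (cX Λ m) (cY Λ m))

lemma pderiv_inl_cX (l : Fin m) : (MvPolynomial.pderiv (Sum.inl l)) ∘ cX Λ m = Pi.single l 1 := by
  ext1 i
  simp [cX, MvPolynomial.pderiv_X, Pi.single_apply, eq_comm]

lemma pderiv_inl_cY (l : Fin m) : (MvPolynomial.pderiv (Sum.inl l)) ∘ cY Λ m = 0 := by
  ext1 i
  simp [cY, MvPolynomial.pderiv_X, Pi.single_apply]

lemma pderiv_inr_cX (l : Fin m) : (MvPolynomial.pderiv (Sum.inr l)) ∘ cX Λ m = 0 := by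
  ext1 i
  simp [cX, MvPolynomial.pderiv_X, Pi.single_apply]

lemma pderiv_inr_cY (l : Fin m) : (MvPolynomial.pderiv (Sum.inr l)) ∘ cY Λ m = Pi.single l 1 := by
  ext1 i
  simp [cY, MvPolynomial.pderiv_X, Pi.single_apply, eq_comm]

lemma der_add_comp {𝒪 : Type*} [CommRing 𝒪] [Algebra Λ 𝒪] (δ : Derivation Λ 𝒪 𝒪) (v w : Fin m → 𝒪) :
    δ ∘ (v + w) = δ ∘ v + δ ∘ w := by ext; simp

include hτ in
lemma smul_adM_pow (κ : ℂ) (v : Fin m → Pol2 Λ m) : (κ • τ • adM s v) ^ M = 0 := by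
  rw [smul_pow, smul_pow, hτ, zero_smul, smul_zero]

lemma nf_conj_X : nf M ((2 * ε * (Real.pi * Complex.I)) • τ • adM s (vX g s hτ (cX Λ m) (cY Λ m)))
    = evM s hτ (cX Λ m) (cY Λ m) g.a * nf M ((2 * ε * (Real.pi * Complex.I)) • τ • adM s (cX Λ m)) *
      evM s hτ (cX Λ m) (cY Λ m) g.ai := by
  rw [← conj_nf]
  · rw [← evM_conj_a, map_mul, map_mul, evM_lt]; simp
  · rw [← map_mul, g.ai_a, map_one]
  · rw [← map_mul, g.a_ai, map_one]

/-- The Jacobian of the deformed coordinates. -/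
theorem isUnit_jacM_mv (hε : ε ≠ 0) : IsUnit (jacM (mv g s hτ)) ∧
    ∀ δ : Derivation Λ (Pol2 Λ m) (Pol2 Λ m), mld δ (jacM (mv g s hτ)) =
      mld δ (nf M ((2 * ε * (Real.pi * Complex.I)) • τ • adM s (cX Λ m + cY Λ m))) -
      mld δ (nf M ((2 * ε * (Real.pi * Complex.I)) • τ • adM s (cX Λ m))) +
      mld δ (evM s hτ (cX Λ m) (cY Λ m) (1 + lt 1 * g.q)) := by
  set κ := 2 * ε * (Real.pi * Complex.I)
  set X := cX Λ m with hX
  set Y := cY Λ m with hY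
  set F' := nf M (κ • τ • adM s (vX g s hτ X Y)) with hF'
  set F'' := nf M (κ • τ • adM s (vY g s hτ X Y)) with hF''
  set e := nexp (M + 1) (κ • τ • adM s (vX g s hτ X Y)) with he
  set Fz := nf M (κ • τ • adM s (X + Y)) with hFz
  set Fx := nf M (κ • τ • adM s X) with hFx
  set C := evM s hτ X Y g.ci with hC
  set S := evM s hτ X Y (1 + lt 1 * g.q) with hS
  set D11 := Matrix.of fun j l => MvPolynomial.pderiv (Sum.inl l) (vX g s hτ X Y j) with h11
  set D12 := Matrix.of fun j l => MvPolynomial.pderiv (Sum.inr l) (vX g s hτ X Y j) with h12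
  set D21 := Matrix.of fun j l => MvPolynomial.pderiv (Sum.inl l) (vY g s hτ X Y j) with h21
  set D22 := Matrix.of fun j l => MvPolynomial.pderiv (Sum.inr l) (vY g s hτ X Y j) with h22
  have hD : jacM (mv g s hτ) = Matrix.fromBlocks D11 D12 D21 D22 := by
    ext1 (i | i) (j | j) <;> rfl
  have uF' : IsUnit F' := (mld_nf (0 : Derivation Λ (Pol2 Λ m) (Pol2 Λ m)) (smul_adM_pow s hτ κ _)).1
  have uFz : IsUnit Fz := (mld_nf (0 : Derivation Λ (Pol2 Λ m) (Pol2 Λ m)) (smul_adM_pow s hτ κ _)).1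
  have uFx : IsUnit Fx := (mld_nf (0 : Derivation Λ (Pol2 Λ m) (Pol2 Λ m)) (smul_adM_pow s hτ κ _)).1
  have uC : IsUnit C := ⟨⟨C, evM s hτ X Y g.c, by rw [← map_mul, g.ci_c, map_one],
    by rw [← map_mul, g.c_ci, map_one]⟩, rfl⟩
  have uS : IsUnit S := ⟨⟨S, evM s hτ X Y g.Ti, by rw [← map_mul, g.mul_Ti, map_one],
    by rw [← map_mul, g.Ti_mul, map_one]⟩, rfl⟩
  have r1 : F' * D11 + e * F'' * D21 = Fz := by
    refine Matrix.ext_of_mulVec_single fun l => ?_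
    have h := der_product g s hτ X Y (MvPolynomial.pderiv (Sum.inl l)) hε
    rw [der_add_comp, hX, hY, pderiv_inl_cX, pderiv_inl_cY, add_zero, Matrix.mulVec_mulVec] at h
    rw [Matrix.add_mulVec, ← Matrix.mulVec_mulVec, ← Matrix.mulVec_mulVec, ← h]
    congr 2
    · ext1 i; simp [h11, hX, hY]
    · ext1 i; simp [h21, hX, hY]
  have r2 : F' * D12 + e * F'' * D22 = Fz := by
    refine Matrix.ext_of_mulVec_single fun l => ?_
    have h := der_product g s hτ X Y (MvPolynomial.pderiv (Sum.inr l)) hε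
    rw [der_add_comp, hX, hY, pderiv_inr_cX, pderiv_inr_cY, zero_add, Matrix.mulVec_mulVec] at h
    rw [Matrix.add_mulVec, ← Matrix.mulVec_mulVec, ← Matrix.mulVec_mulVec, ← h]
    congr 2
    · ext1 i; simp [h12, hX, hY]
    · ext1 i; simp [h22, hX, hY]
  have r3 : D22 - D21 = C * S := by
    refine Matrix.ext_of_mulVec_single fun l => ?_
    have h := der_vY_of_neg g s hτ X Y (MvPolynomial.pderiv (Sum.inr l) - MvPolynomial.pderiv (Sum.inl l)) (by
      have e1 := pderiv_inl_cX (Λ := Λ) l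
      have e2 := pderiv_inr_cX (Λ := Λ) l
      have e3 := pderiv_inl_cY (Λ := Λ) l
      have e4 := pderiv_inr_cY (Λ := Λ) l
      ext1 i
      have f1 := congrFun e1 i
      have f2 := congrFun e2 i
      have f3 := congrFun e3 i
      have f4 := congrFun e4 i
      simp only [Function.comp_apply, Pi.neg_apply, Derivation.sub_apply, hX, hY] at *
      rw [f1, f2, f3, f4]; simp)
    have e3 := pderiv_inl_cY (Λ := Λ) l
    have e4 := pderiv_inr_cY (Λ := Λ) l
    rw [map_mul, show (⇑(MvPolynomial.pderiv (Sum.inr l) - MvPolynomial.pderiv (Sum.inl l)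
      : Derivation Λ (Pol2 Λ m) (Pol2 Λ m)) ∘ Y) = Pi.single l 1 by
      ext1 i
      have f3 := congrFun e3 i
      have f4 := congrFun e4 i
      simp only [Function.comp_apply, Derivation.sub_apply, hY] at *
      rw [f3, f4]; simp] at h
    rw [← h]
    ext1 i
    simp [h21, h22, Matrix.sub_mulVec]
  obtain ⟨F'i, hF'i⟩ := uF'.exists_left_inv
  obtain ⟨Fzi, hFzi⟩ := uFz.exists_left_inv
  obtain ⟨CSi, hCSi⟩ := (uC.mul uS).exists_left_inv
  have ublock (A : Matrix (Fin m) (Fin m) (Pol2 Λ m)) {P Q : Matrix (Fin m ⊕ Fin m) (Fin m ⊕ Fin m) (Pol2 Λ m)}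
      (h : P * Q = 1) : IsUnit Q := ⟨⟨Q, P, mul_eq_one_comm.mp h, h⟩, rfl⟩
  have u1 : IsUnit (Matrix.fromBlocks F' (e * F'') 0 (1 : Matrix (Fin m) (Fin m) (Pol2 Λ m))) := by
    refine ublock 0 (P := Matrix.fromBlocks F'i (-(F'i * (e * F''))) 0 1) ?_
    rw [Matrix.fromBlocks_multiply]; simp [hF'i]
  have u2 : IsUnit (Matrix.fromBlocks 1 (-1) 0 1 : Matrix (Fin m ⊕ Fin m) (Fin m ⊕ Fin m) (Pol2 Λ m)) := by
    refine ublock 0 (P := Matrix.fromBlocks 1 1 0 1) ?_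
    rw [Matrix.fromBlocks_multiply]; simp
  have u3 : IsUnit (Matrix.fromBlocks Fz 0 D21 (C * S)) := by
    refine ublock 0 (P := Matrix.fromBlocks Fzi 0 (-(CSi * D21 * Fzi)) CSi) ?_
    rw [Matrix.fromBlocks_multiply]; simp [hFzi, hCSi, mul_assoc]
  have key : Matrix.fromBlocks F' (e * F'') 0 (1 : Matrix (Fin m) (Fin m) (Pol2 Λ m)) * jacM (mv g s hτ) *
      (Matrix.fromBlocks 1 (-1) 0 1 : Matrix (Fin m ⊕ Fin m) (Fin m ⊕ Fin m) (Pol2 Λ m))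
      = Matrix.fromBlocks Fz 0 D21 (C * S) := by
    rw [hD, Matrix.fromBlocks_multiply, Matrix.fromBlocks_multiply, ← r3, r1, r2]
    simp [sub_eq_add_neg, add_comm]
  have uD : IsUnit (jacM (mv g s hτ)) := by
    rw [← key] at u3
    exact (Units.isUnit_units_mul u1.unit _).mp ((Units.isUnit_mul_units _ u2.unit).mp u3)
  refine ⟨uD, fun δ => ?_⟩
  have h := congrArg (mld δ) key
  have hC0 : mld δ C = 0 := by
    rw [mld_eq δ (B := evM s hτ X Y g.c) (by rw [← map_mul, g.c_ci, map_one]), map_ci, ← mul_assoc,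
      ← map_mul, g.c_ci, map_one, one_mul, trace_w2]
  rw [mld_mul δ (u1.mul uD) u2, mld_mul δ u1 uD, mld_blocks₂₁ δ (Ci := 1) _ hF'i (one_mul 1),
    mld_blocks₂₁ δ (Ai := 1) (Ci := 1) _ (one_mul 1) (one_mul 1), mld_blocks₁₂ δ _ hFzi hCSi, mld_one,
    mld_mul δ uC uS, hC0, hF', nf_conj_X, mld_conj δ (by rw [← map_mul, g.a_ai, map_one]) uFx] at h
  linear_combination h

end TA
end Duflo

namespace Duflo

/-- The logarithm of the Jacobian factor. -/
def rho {Λ 𝒪 : Type*} [CommRing Λ] [CommRing 𝒪] [Algebra Λ 𝒪] [Algebra ℂ 𝒪] {m : ℕ} (s : SC Λ m) (M : ℕ)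
    (τ : Λ) (v : Fin m → 𝒪) : 𝒪 :=
  ∑ k ∈ Finset.Ico 1 M, (-(zt k / (k + 1))) • Matrix.trace ((τ • adM s v) ^ (k + 1))

lemma der_rho {Λ 𝒪 : Type*} [CommRing Λ] [CommRing 𝒪] [Algebra Λ 𝒪] [Algebra ℂ 𝒪] [Algebra ℂ Λ]
    [IsScalarTower ℂ Λ 𝒪] {m : ℕ} (s : SC Λ m) (M : ℕ)
    (τ : Λ) (v : Fin m → 𝒪) (δ : Derivation Λ 𝒪 𝒪) : δ (rho s M τ v)
      = ∑ k ∈ Finset.Ico 1 M, (-zt k) • Matrix.trace ((τ • adM s v) ^ k * (τ • adM s (δ ∘ v))) := by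
  rw [rho, map_sum]
  refine Finset.sum_congr rfl fun k _ => ?_
  have hc (c : ℂ) (x : 𝒪) : δ (c • x) = c • δ x := by
    rw [← algebraMap_smul Λ c, δ.map_smul, algebraMap_smul]
  rw [hc, der_trace_pow, map_der_smul, adM_der, ← Nat.cast_smul_eq_nsmul ℂ, smul_smul]
  congr 1
  have : (k + 1 : ℂ) ≠ 0 := by exact_mod_cast k.succ_ne_zero
  push_cast
  field_simp

namespace TA

variable {M : ℕ} {ε : ℂ} (g : Geo M ε) {Λ : Type*} [CommRing Λ] [Algebra ℂ Λ] {m : ℕ} (s : SC Λ m)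
  {τ : Λ} (hτ : τ ^ M = 0)

/-- The logarithm of the density. -/
def logJ (s : SC Λ m) (M : ℕ) (τ : Λ) : Pol2 Λ m :=
  rho s M τ (cX Λ m + cY Λ m) - rho s M τ (cX Λ m) - rho s M τ (cY Λ m)

lemma mld_nf_smul (hτ : τ ^ M = 0) (κ : ℂ) (v : Fin m → Pol2 Λ m) (δ : Derivation Λ (Pol2 Λ m) (Pol2 Λ m)) :
    mld δ (nf M (κ • τ • adM s v)) = ∑ k ∈ Finset.range M, (phi k * κ ^ (k + 1)) •
      Matrix.trace ((τ • adM s v) ^ k * (τ • adM s (δ ∘ v))) := by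
  rw [(mld_nf δ (smul_adM_pow s hτ κ v)).2]
  refine Finset.sum_congr rfl fun k _ => ?_
  have hc : (κ • τ • adM s v).map δ = κ • τ • adM s (δ ∘ v) := by
    rw [← adM_der, ← map_der_smul]
    ext1 i j
    simp only [Matrix.map_apply, Matrix.smul_apply]
    rw [← algebraMap_smul Λ κ, δ.map_smul, algebraMap_smul]
  rw [hc, smul_pow, smul_mul_smul_comm, Matrix.trace_smul, smul_smul, ← pow_succ]
  rfl

theorem der_logJ (hM : 1 ≤ M) (hε : ε = 1 ∨ ε = -1) (δ : Derivation Λ (Pol2 Λ m) (Pol2 Λ m)) :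
    δ (logJ s M τ) = mld δ (jacM (mv g s hτ)) -
      Matrix.trace (τ • adM s (w1 g s hτ (cX Λ m) (cY Λ m) δ)) := by
  have hε0 : ε ≠ 0 := by rcases hε with rfl | rfl <;> simp
  rw [(isUnit_jacM_mv g s hτ hε0).2, trace_w1, mld_nf_smul s hτ, mld_nf_smul s hτ,
    mld_eq δ (B := evM s hτ (cX Λ m) (cY Λ m) g.Ti) (by rw [← map_mul, g.Ti_mul, map_one]), trace_T,
    Finset.sum_Ico_succ_top hM]
  have hz (A : Matrix (Fin m) (Fin m) (Pol2 Λ m)) : (τ • A) ^ M = 0 := by rw [smul_pow, hτ, zero_smul]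
  have hz' (A : Matrix (Fin m) (Fin m) (Pol2 Λ m)) : (-(τ • A)) ^ M = 0 := by rw [← smul_neg, hz]
  rw [hz, hz', hz']
  rw [Finset.sum_range_eq_add_Ico _ (by omega), Finset.sum_range_eq_add_Ico _ (by omega), logJ,
    map_sub, map_sub, der_rho, der_rho, der_rho]
  simp only [zero_mul, Matrix.trace_zero, add_zero, sub_zero, smul_zero, pow_zero, one_mul, zero_add,
    pow_one, phi_zero, der_add_comp]
  have e0 : (1 / 2 * (2 * ε * (Real.pi * Complex.I)) : ℂ) = ε * (Real.pi * Complex.I) := by ring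
  have hk : ∀ k ∈ Finset.Ico 1 M, ∀ a b c : Pol2 Λ m,
      (-zt k) • a - (-zt k) • b - (-zt k) • c
        = (phi k * (2 * ε * (Real.pi * Complex.I)) ^ (k + 1)) • a
          - (phi k * (2 * ε * (Real.pi * Complex.I)) ^ (k + 1)) • b
          + zt k • ((-1 : ℂ) ^ (k + 1) • a + c - (-1 : ℂ) ^ (k + 1) • b) := by
    intro k hk a b c
    have hk0 : k ≠ 0 := by rw [Finset.mem_Ico] at hk; omega
    rcases Nat.even_or_odd (k + 1) with h | h
    · rw [phi_even h hε, h.neg_one_pow]; module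
    · rw [phi_odd hk0 h, h.neg_one_pow]; module
  have hs (A B : Matrix (Fin m) (Fin m) (Pol2 Λ m)) (k : ℕ) :
      Matrix.trace ((-A) ^ k * -B) = (-1 : ℂ) ^ (k + 1) • Matrix.trace (A ^ k * B) := by
    rcases Nat.even_or_odd k with h | h
    · rw [h.neg_pow, (h.add_one).neg_one_pow]; simp
    · rw [h.neg_pow, (h.add_one).neg_one_pow]; simp
  rw [← Finset.sum_sub_distrib, ← Finset.sum_sub_distrib,
    Finset.sum_congr rfl fun k h => hk k h _ _ _, Finset.sum_add_distrib, Finset.sum_sub_distrib, e0]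
  simp only [hs, map_add, smul_add, Matrix.trace_add]
  abel

/-- The vector field which is the Euler field in the deformed coordinates. -/
def vE : Fin m ⊕ Fin m → Pol2 Λ m := (jacM (mv g s hτ))⁻¹.mulVec (mv g s hτ)

/-- The Euler derivation in the deformed coordinates. -/
def eulD : Derivation Λ (Pol2 Λ m) (Pol2 Λ m) := MvPolynomial.mkDerivation Λ (vE g s hτ)

lemma jacM_mulVec_vE (hε : ε ≠ 0) : (jacM (mv g s hτ)).mulVec (vE g s hτ) = mv g s hτ := by
  obtain ⟨u, hu⟩ := (isUnit_jacM_mv g s hτ hε).1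
  rw [vE, ← hu, Matrix.mulVec_mulVec, Matrix.inv_eq_left_inv u.inv_mul, u.mul_inv, Matrix.one_mulVec]

lemma eulD_mv (hε : ε ≠ 0) (j : Fin m ⊕ Fin m) : eulD g s hτ (mv g s hτ j) = mv g s hτ j := by
  conv_rhs => rw [← jacM_mulVec_vE g s hτ hε]
  rw [eulD, mkDerivation_eq_sum_pderiv, Matrix.mulVec, dotProduct]
  exact Finset.sum_congr rfl fun l _ => mul_comm _ _

lemma eulD_cX (hε : ε ≠ 0) : eulD g s hτ ∘ cX Λ m = cX Λ m -
    τ • (adM s (w1 g s hτ (cX Λ m) (cY Λ m) (eulD g s hτ))).mulVec (cX Λ m) := by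
  have h := der_vX g s hτ (cX Λ m) (cY Λ m) (eulD g s hτ)
  have e : eulD g s hτ ∘ vX g s hτ (cX Λ m) (cY Λ m) = vX g s hτ (cX Λ m) (cY Λ m) :=
    funext fun j => eulD_mv g s hτ hε (Sum.inl j)
  rw [e, vX] at h
  have h' := congrArg (evM s hτ (cX Λ m) (cY Λ m) g.ai).mulVec h
  rw [Matrix.mulVec_mulVec, Matrix.mulVec_mulVec, ← map_mul, g.ai_a, map_one, Matrix.one_mulVec,
    Matrix.one_mulVec] at h'
  exact eq_sub_of_add_eq h'.symm

lemma eulD_cY (hε : ε ≠ 0) : eulD g s hτ ∘ cY Λ m = cY Λ m -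
    τ • (adM s (w2 g s hτ (cX Λ m) (cY Λ m) (eulD g s hτ))).mulVec (cY Λ m) := by
  have h := der_vY g s hτ (cX Λ m) (cY Λ m) (eulD g s hτ)
  have e : eulD g s hτ ∘ vY g s hτ (cX Λ m) (cY Λ m) = vY g s hτ (cX Λ m) (cY Λ m) :=
    funext fun j => eulD_mv g s hτ hε (Sum.inr j)
  rw [e, vY] at h
  have h' := congrArg (evM s hτ (cX Λ m) (cY Λ m) g.c).mulVec h
  rw [Matrix.mulVec_mulVec, Matrix.mulVec_mulVec, ← map_mul, g.c_ci, map_one, Matrix.one_mulVec,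
    Matrix.one_mulVec] at h'
  exact eq_sub_of_add_eq h'.symm

/-- The infinitesimal adjoint action on the first variable. -/
def lieX (s : SC Λ m) (b : Fin m) : Derivation Λ (Pol2 Λ m) (Pol2 Λ m) :=
  MvPolynomial.mkDerivation Λ (Sum.elim ((gm s b).mulVec (cX Λ m)) 0)

/-- The infinitesimal adjoint action on the second variable. -/
def lieY (s : SC Λ m) (b : Fin m) : Derivation Λ (Pol2 Λ m) (Pol2 Λ m) :=
  MvPolynomial.mkDerivation Λ (Sum.elim 0 ((gm s b).mulVec (cY Λ m)))

/-- The Euler derivation. -/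
def eul (Λ : Type*) [CommRing Λ] (m : ℕ) : Derivation Λ (Pol2 Λ m) (Pol2 Λ m) :=
  MvPolynomial.mkDerivation Λ MvPolynomial.X

lemma adM_mulVec_eq_sum {𝒪 : Type*} [CommRing 𝒪] [Algebra Λ 𝒪] (w v : Fin m → 𝒪) :
    (adM s w).mulVec v = ∑ b, w b • (gm s b).mulVec v := by
  rw [adM_eq_sum, Matrix.sum_mulVec]
  simp only [Matrix.smul_mulVec]

lemma eul_sub_eulD (hε : ε ≠ 0) (f : Pol2 Λ m) : eul Λ m f - eulD g s hτ f =
    τ • ∑ b, (w1 g s hτ (cX Λ m) (cY Λ m) (eulD g s hτ) b * lieX s b f +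
      w2 g s hτ (cX Λ m) (cY Λ m) (eulD g s hτ) b * lieY s b f) := by
  set u1 := w1 g s hτ (cX Λ m) (cY Λ m) (eulD g s hτ)
  set u2 := w2 g s hτ (cX Λ m) (cY Λ m) (eulD g s hτ)
  have key : eul Λ m - eulD g s hτ = τ • ∑ b, (u1 b • lieX s b + u2 b • lieY s b) := by
    refine MvPolynomial.derivation_ext fun i => ?_
    rw [Derivation.sub_apply, Derivation.smul_apply, derivation_sum_apply]
    rcases i with i | i
    · have h := congrFun (eulD_cX g s hτ hε) i
      rw [Function.comp_apply, adM_mulVec_eq_sum] at h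
      rw [show (MvPolynomial.X (Sum.inl i) : Pol2 Λ m) = cX Λ m i from rfl, h]
      simp [eul, lieX, lieY, cX, Finset.sum_apply, u1, u2]
    · have h := congrFun (eulD_cY g s hτ hε) i
      rw [Function.comp_apply, adM_mulVec_eq_sum] at h
      rw [show (MvPolynomial.X (Sum.inr i) : Pol2 Λ m) = cY Λ m i from rfl, h]
      simp [eul, lieX, lieY, cY, Finset.sum_apply, u1, u2]
  have h := congrArg (fun δ => δ f) key
  rwa [Derivation.sub_apply, Derivation.smul_apply, derivation_sum_apply] at h

end TA
end Duflo

namespace Duflo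

lemma nexp_add {R : Type*} [Ring R] [Algebra ℂ R] {M : ℕ} {a b : R} (h : Commute a b) (ha : a ^ M = 0)
    (hb : b ^ M = 0) (hab : (a + b) ^ M = 0) : nexp (M + 1) (a + b) = nexp (M + 1) a * nexp (M + 1) b := by
  letI : Module ℚ R := Module.compHom R (algebraMap ℚ ℂ)
  have e : ∀ x : R, x ^ M = 0 → nexp (M + 1) x = IsNilpotent.exp x := by
    intro x hx
    rw [IsNilpotent.exp_eq_sum (k := M + 1) (by rw [pow_succ, hx, zero_mul]), nexp]
    refine Finset.sum_congr rfl fun k _ => ?_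
    change _ = (algebraMap ℚ ℂ ((k.factorial : ℚ)⁻¹)) • x ^ k
    simp
  rw [e _ ha, e _ hb, e _ hab, IsNilpotent.exp_add_of_commute h ⟨M, ha⟩ ⟨M, hb⟩]

lemma der_nexp {Λ 𝒪 : Type*} [CommRing Λ] [CommRing 𝒪] [Algebra Λ 𝒪] [Algebra ℂ Λ] [Algebra ℂ 𝒪]
    [IsScalarTower ℂ Λ 𝒪] (δ : Derivation Λ 𝒪 𝒪) {M : ℕ} {x : 𝒪} (hx : x ^ M = 0) :
    δ (nexp (M + 1) x) = nexp (M + 1) x * δ x := by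
  have hc (c : ℂ) (x : 𝒪) : δ (c • x) = c • δ x := by
    rw [← algebraMap_smul Λ c, δ.map_smul, algebraMap_smul]
  have h1 : δ (nexp (M + 1) x) = ∑ k ∈ Finset.range M, δ (((k + 1).factorial : ℂ)⁻¹ • x ^ (k + 1)) := by
    rw [nexp, Finset.sum_range_succ', map_add, map_sum, pow_zero, hc, Derivation.map_one_eq_zero, smul_zero,
      add_zero]
  rw [h1, nexp, Finset.sum_range_succ, hx, smul_zero, add_zero, Finset.sum_mul]
  refine Finset.sum_congr rfl fun k _ => ?_
  rw [hc, Derivation.leibniz_pow, Nat.add_sub_cancel, ← Nat.cast_smul_eq_nsmul ℂ, smul_smul, smul_mul_assoc,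
    smul_eq_mul]
  congr 1
  have : (k + 1 : ℂ) ≠ 0 := by exact_mod_cast k.succ_ne_zero
  rw [Nat.factorial_succ]
  push_cast
  field_simp

lemma sum_pderiv_mul {Λ σ : Type*} [CommRing Λ] [Fintype σ] [DecidableEq σ] (w : MvPolynomial σ Λ)
    (v : σ → MvPolynomial σ Λ) : ∑ l, MvPolynomial.pderiv l (w * v l)
      = MvPolynomial.mkDerivation Λ v w + w * ∑ l, MvPolynomial.pderiv l (v l) := by
  rw [mkDerivation_eq_sum_pderiv, Finset.mul_sum, ← Finset.sum_add_distrib]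
  refine Finset.sum_congr rfl fun l _ => ?_
  rw [Derivation.leibniz, smul_eq_mul, smul_eq_mul, add_comm]

lemma rho_mem_smul {Λ 𝒪 : Type*} [CommRing Λ] [CommRing 𝒪] [Algebra Λ 𝒪] [Algebra ℂ 𝒪] [Algebra ℂ Λ]
    [IsScalarTower ℂ Λ 𝒪] {m : ℕ} (s : SC Λ m) (M : ℕ) (τ : Λ) (v : Fin m → 𝒪) :
    ∃ z, rho s M τ v = τ • z := by
  refine ⟨∑ k ∈ Finset.Ico 1 M, (-(zt k / (k + 1))) • τ ^ k • Matrix.trace ((adM s v) ^ (k + 1)), ?_⟩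
  rw [rho, Finset.smul_sum]
  refine Finset.sum_congr rfl fun k _ => ?_
  rw [smul_pow, Matrix.trace_smul, smul_comm τ, smul_smul τ, pow_succ' τ]

lemma smul_pow_eq_zero {Λ 𝒪 : Type*} [CommRing Λ] [Ring 𝒪] [Algebra Λ 𝒪] {M : ℕ} {τ : Λ} (hτ : τ ^ M = 0)
    {x : 𝒪} (h : ∃ z, x = τ • z) : x ^ M = 0 := by
  obtain ⟨z, rfl⟩ := h
  rw [smul_pow, hτ, zero_smul]

namespace TA

variable {M : ℕ} {ε : ℂ} (g : Geo M ε) {Λ : Type*} [CommRing Λ] [Algebra ℂ Λ] {m : ℕ} (s : SC Λ m)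
  {τ : Λ} (hτ : τ ^ M = 0)

lemma logJ_mem_smul : ∃ z, logJ s M τ = τ • z := by
  obtain ⟨z1, h1⟩ := rho_mem_smul s M τ (cX Λ m + cY Λ m)
  obtain ⟨z2, h2⟩ := rho_mem_smul s M τ (cX Λ m)
  obtain ⟨z3, h3⟩ := rho_mem_smul s M τ (cY Λ m)
  exact ⟨z1 - z2 - z3, by rw [logJ, h1, h2, h3, smul_sub, smul_sub]⟩

lemma sum_pderiv_lieX (b : Fin m) : ∑ l, MvPolynomial.pderiv l
    ((Sum.elim ((gm s b).mulVec (cX Λ m)) 0 : Fin m ⊕ Fin m → Pol2 Λ m) l) = Matrix.trace (gm s b) := by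
  rw [Fintype.sum_sum_type]
  simp only [Sum.elim_inl, Sum.elim_inr, Pi.zero_apply, map_zero, Finset.sum_const_zero, add_zero]
  refine Finset.sum_congr rfl fun l _ => ?_
  simp [Matrix.mulVec, dotProduct, gm, cX, MvPolynomial.pderiv_X, Pi.single_apply, Matrix.diag]

lemma sum_pderiv_lieY (b : Fin m) : ∑ l, MvPolynomial.pderiv l
    ((Sum.elim 0 ((gm s b).mulVec (cY Λ m)) : Fin m ⊕ Fin m → Pol2 Λ m) l) = Matrix.trace (gm s b) := by
  rw [Fintype.sum_sum_type]
  simp only [Sum.elim_inl, Sum.elim_inr, Pi.zero_apply, map_zero, Finset.sum_const_zero, zero_add]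
  refine Finset.sum_congr rfl fun l _ => ?_
  simp [Matrix.mulVec, dotProduct, gm, cY, MvPolynomial.pderiv_X, Pi.single_apply, Matrix.diag]

theorem eulD_logJ (hM : 1 ≤ M) (hε : ε = 1 ∨ ε = -1) : eulD g s hτ (logJ s M τ)
    = τ • ∑ b, (lieX s b (w1 g s hτ (cX Λ m) (cY Λ m) (eulD g s hτ) b)
      + lieY s b (w2 g s hτ (cX Λ m) (cY Λ m) (eulD g s hτ) b)) := by
  have hε0 : ε ≠ 0 := by rcases hε with rfl | rfl <;> simp
  have h2 := trace_w2 g s hτ (cX Λ m) (cY Λ m) (eulD g s hτ)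
  rw [der_logJ g s hτ hM hε, eulD,
    ← sum_pderiv_inv_jacM _ (isUnit_jacM_mv g s hτ hε0).1 _ (jacM_mulVec_vE g s hτ hε0),
    ← eulD, sub_eq_iff_eq_add, ← add_zero (_ + _), ← h2, Matrix.trace_smul, Matrix.trace_smul, add_assoc, ← smul_add,
    ← smul_add, adM_eq_sum, adM_eq_sum, Matrix.trace_sum, Matrix.trace_sum, ← Finset.sum_add_distrib,
    ← Finset.sum_add_distrib]
  have e (l : Fin m ⊕ Fin m) : (MvPolynomial.X l - vE g s hτ l : Pol2 Λ m)
      = eul Λ m (MvPolynomial.X l) - eulD g s hτ (MvPolynomial.X l) := by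
    rw [eul, eulD, MvPolynomial.mkDerivation_X, MvPolynomial.mkDerivation_X]
  simp only [e, eul_sub_eulD g s hτ hε0, Derivation.map_smul, map_sum, map_add, ← Finset.smul_sum]
  rw [Finset.sum_comm]
  congr 1
  refine Finset.sum_congr rfl fun b _ => ?_
  rw [Finset.sum_add_distrib]
  simp only [lieX, lieY, MvPolynomial.mkDerivation_X]
  rw [sum_pderiv_mul, sum_pderiv_mul, sum_pderiv_lieX, sum_pderiv_lieY, Matrix.trace_smul, Matrix.trace_smul,
    smul_eq_mul, smul_eq_mul]
  abel

/-- The substitution of the deformed coordinates. -/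
def subst : Pol2 Λ m →ₐ[Λ] Pol2 Λ m := MvPolynomial.aeval (mv g s hτ)

lemma eulD_subst (hε : ε ≠ 0) (f : Pol2 Λ m) :
    eulD g s hτ (subst g s hτ f) = subst g s hτ (eul Λ m f) := by
  induction f using MvPolynomial.induction_on with
  | C a =>
    rw [subst, MvPolynomial.aeval_C, Derivation.map_algebraMap, ← MvPolynomial.algebraMap_eq,
      Derivation.map_algebraMap, map_zero]
  | add p q hp hq => rw [map_add, map_add, map_add, map_add, hp, hq]
  | mul_X p i hp =>
    have h1 : subst g s hτ (MvPolynomial.X i) = mv g s hτ i := MvPolynomial.aeval_X _ _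
    rw [map_mul, Derivation.leibniz, Derivation.leibniz, hp, h1, eulD_mv g s hτ hε, smul_eq_mul, smul_eq_mul,
      smul_eq_mul, smul_eq_mul, map_add, map_mul, map_mul, h1, eul, MvPolynomial.mkDerivation_X, h1]

lemma adM_mem (I : Ideal (Pol2 Λ m)) {v : Fin m → Pol2 Λ m} (hv : ∀ i, v i ∈ I) (i j : Fin m) :
    adM s v i j ∈ I := by
  rw [adM_apply]
  exact I.sum_mem fun k _ => I.mul_mem_right _ (hv k)

lemma ℂ_smul_mem {𝒪 : Type*} [CommRing 𝒪] [Algebra ℂ 𝒪] (I : Ideal 𝒪) (c : ℂ) {z : 𝒪} (hz : z ∈ I) : c • z ∈ I := by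
  rw [← algebraMap_smul 𝒪 c, smul_eq_mul]; exact I.mul_mem_left _ hz

lemma Λ_smul_mem {Λ 𝒪 : Type*} [CommRing Λ] [CommRing 𝒪] [Algebra Λ 𝒪] (I : Ideal 𝒪) (c : Λ) {z : 𝒪} (hz : z ∈ I) :
    c • z ∈ I := by
  rw [← algebraMap_smul 𝒪 c, smul_eq_mul]; exact I.mul_mem_left _ hz

lemma rho_mem (I : Ideal (Pol2 Λ m)) {v : Fin m → Pol2 Λ m} (hv : ∀ i, v i ∈ I) : rho s M τ v ∈ I := by
  refine I.sum_mem fun k _ => ℂ_smul_mem I _ (I.sum_mem fun i _ => ?_)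
  rw [Matrix.diag_apply, pow_succ, Matrix.mul_apply]
  exact I.sum_mem fun j _ => I.mul_mem_left _ (by rw [Matrix.smul_apply]; exact Λ_smul_mem I _ (adM_mem s I hv j i))

lemma cX_mem (i : Fin m) : cX Λ m i ∈ MvPolynomial.idealOfVars (Fin m ⊕ Fin m) Λ :=
  Ideal.subset_span ⟨_, rfl⟩

lemma cY_mem (i : Fin m) : cY Λ m i ∈ MvPolynomial.idealOfVars (Fin m ⊕ Fin m) Λ :=
  Ideal.subset_span ⟨_, rfl⟩

lemma nexp_logJ_sub_one_mem : nexp (M + 1) (logJ s M τ) - 1 ∈ MvPolynomial.idealOfVars (Fin m ⊕ Fin m) Λ := by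
  set I := MvPolynomial.idealOfVars (Fin m ⊕ Fin m) Λ
  have h : logJ s M τ ∈ I := I.sub_mem (I.sub_mem (rho_mem s I fun i => I.add_mem (cX_mem i) (cY_mem i))
    (rho_mem s I cX_mem)) (rho_mem s I cY_mem)
  rw [nexp, Finset.sum_range_succ']
  simp only [pow_zero, Nat.factorial_zero, Nat.cast_one, inv_one, one_smul, add_sub_cancel_right]
  refine I.sum_mem fun k _ => ℂ_smul_mem I _ ?_
  rw [pow_succ]
  exact I.mul_mem_left _ h

lemma mv_sub_X_mem (j : Fin m ⊕ Fin m) :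
    mv g s hτ j - MvPolynomial.X j ∈ MvPolynomial.idealOfVars (Fin m ⊕ Fin m) Λ ^ 2 := by
  set I := MvPolynomial.idealOfVars (Fin m ⊕ Fin m) Λ
  have key (x : TA M) (hx : aug x = 1) (v : Fin m → Pol2 Λ m) (hv : ∀ i, v i ∈ I) (i : Fin m) :
      (evM s hτ (cX Λ m) (cY Λ m) x).mulVec v i - v i ∈ I ^ 2 := by
    have e : (evM s hτ (cX Λ m) (cY Λ m) x).mulVec v i - v i
        = (evM s hτ (cX Λ m) (cY Λ m) x - aug x • 1).mulVec v i := by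
      rw [hx, one_smul, Matrix.sub_mulVec, Matrix.one_mulVec, Pi.sub_apply]
    rw [e, Matrix.mulVec, dotProduct, sq]
    refine Ideal.sum_mem _ fun k _ => Ideal.mul_mem_mul ?_ (hv k)
    exact evM_sub_mem s hτ _ _ I (fun i => Λ_smul_mem I _ (cX_mem i)) (fun i => Λ_smul_mem I _ (cY_mem i)) _ _ _
  rcases j with j | j
  · exact key g.a g.aug_a _ cX_mem j
  · exact key g.ci g.aug_ci _ cY_mem j

lemma subst_sub_mem (q : ℕ) {f : Pol2 Λ m} (hf : f ∈ MvPolynomial.idealOfVars (Fin m ⊕ Fin m) Λ ^ q) :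
    subst g s hτ f - f ∈ MvPolynomial.idealOfVars (Fin m ⊕ Fin m) Λ ^ (q + 1) := by
  set I := MvPolynomial.idealOfVars (Fin m ⊕ Fin m) Λ
  have hX (i) : (MvPolynomial.X i : Pol2 Λ m) ∈ I := Ideal.subset_span ⟨_, rfl⟩
  have h1 (i) : subst g s hτ (MvPolynomial.X i) = mv g s hτ i := MvPolynomial.aeval_X _ _
  have hA : ∀ f, subst g s hτ f - f ∈ I := by
    intro f
    induction f using MvPolynomial.induction_on with
    | C a => simp [subst]
    | add p q hp hq => rw [map_add, add_sub_add_comm]; exact I.add_mem hp hq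
    | mul_X p i hp =>
      rw [map_mul, h1, show subst g s hτ p * mv g s hτ i - p * MvPolynomial.X i
        = subst g s hτ p * (mv g s hτ i - MvPolynomial.X i) + (subst g s hτ p - p) * MvPolynomial.X i by ring]
      exact I.add_mem (I.mul_mem_left _ (Ideal.pow_le_self two_ne_zero (mv_sub_X_mem g s hτ i))) (I.mul_mem_left _ (hX i))
  have hB : ∀ x ∈ I, subst g s hτ x - x ∈ I ^ 2 := by
    intro x hx
    induction hx using Submodule.span_induction with
    | mem x hx => obtain ⟨i, rfl⟩ := hx; rw [h1]; exact mv_sub_X_mem g s hτ i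
    | zero => simp
    | add x y _ _ hx hy => rw [map_add, add_sub_add_comm]; exact Ideal.add_mem _ hx hy
    | smul a x hx' hx =>
      rw [smul_eq_mul, map_mul, show subst g s hτ a * subst g s hτ x - a * x
        = subst g s hτ a * (subst g s hτ x - x) + (subst g s hτ a - a) * x by ring]
      refine Ideal.add_mem _ (Ideal.mul_mem_left _ _ hx) ?_
      rw [sq]
      exact Ideal.mul_mem_mul (hA a) hx'
  induction q generalizing f with
  | zero => rw [zero_add, pow_one]; exact hA f
  | succ q ih =>
    rw [pow_succ'] at hf
    induction hf using Submodule.mul_induction_on' with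
    | mem_mul_mem x hx y hy =>
      rw [map_mul, show subst g s hτ x * subst g s hτ y - x * y
        = (subst g s hτ x - x) * (subst g s hτ y - y) + (subst g s hτ x - x) * y
          + x * (subst g s hτ y - y) by ring]
      refine Ideal.add_mem _ (Ideal.add_mem _ ?_ ?_) ?_
      · rw [pow_succ']; exact Ideal.mul_mem_mul (hA x) (ih hy)
      · rw [show q + 1 + 1 = 2 + q by ring, pow_add]; exact Ideal.mul_mem_mul (hB x hx) hy
      · rw [pow_succ']; exact Ideal.mul_mem_mul hx (ih hy)
    | add x _ y _ hx hy => rw [map_add, add_sub_add_comm]; exact Ideal.add_mem _ hx hy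

section Functional

variable {φ : Pol2 Λ m →ₗ[Λ] Λ} {p : ℕ} (hE : ∀ f, φ (eul Λ m f) = (p : ℂ) • φ f)

lemma eul_homogeneous {f : Pol2 Λ m} {q : ℕ} (hf : f.IsHomogeneous q) : eul Λ m f = (q : ℂ) • f := by
  rw [eul, mkDerivation_eq_sum_pderiv, hf.sum_X_mul_pderiv, Nat.cast_smul_eq_nsmul]

lemma φ_ℂ (φ : Pol2 Λ m →ₗ[Λ] Λ) (c : ℂ) (x : Pol2 Λ m) : φ (c • x) = c • φ x := by
  rw [← algebraMap_smul Λ c, map_smul, algebraMap_smul]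

lemma eq_zero_of_smul_eq {N : Type*} [AddCommGroup N] [Module ℂ N] {p q : ℕ} (hpq : p ≠ q) {x : N}
    (h : (p : ℂ) • x = (q : ℂ) • x) : x = 0 := by
  rw [← sub_eq_zero, ← sub_smul] at h
  have : (p : ℂ) - q ≠ 0 := sub_ne_zero.mpr (by exact_mod_cast hpq)
  have h' := congrArg ((p - q : ℂ)⁻¹ • ·) h
  simpa [smul_smul, inv_mul_cancel₀ this] using h'

include hE in
lemma φ_homogeneous {f : Pol2 Λ m} {q : ℕ} (hf : f.IsHomogeneous q) (hq : p ≠ q) : φ f = 0 := by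
  have h := hE f
  rw [eul_homogeneous hf, φ_ℂ] at h
  exact eq_zero_of_smul_eq hq h.symm

include hE in
lemma φ_mem {f : Pol2 Λ m} (hf : f ∈ MvPolynomial.idealOfVars (Fin m ⊕ Fin m) Λ ^ (p + 1)) : φ f = 0 := by
  rw [MvPolynomial.mem_pow_idealOfVars_iff] at hf
  rw [← f.support_sum_monomial_coeff, map_sum]
  refine Finset.sum_eq_zero fun α hα => φ_homogeneous hE (MvPolynomial.isHomogeneous_monomial _ rfl) ?_
  have := hf α hα
  omega

include hE in
/-- Invariant homogeneous functionals do not see the deformation of the coordinates. -/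
theorem φ_subst (hM : 1 ≤ M) (hε : ε = 1 ∨ ε = -1) (hX : ∀ b f, φ (lieX s b f) = 0)
    (hY : ∀ b f, φ (lieY s b f) = 0) (f : Pol2 Λ m) :
    φ (nexp (M + 1) (logJ s M τ) * subst g s hτ f) = φ f := by
  have hε0 : ε ≠ 0 := by rcases hε with rfl | rfl <;> simp
  set J := nexp (M + 1) (logJ s M τ) with hJ
  have key : ∀ f, φ (eul Λ m (J * subst g s hτ f)) = φ (J * subst g s hτ (eul Λ m f)) := by
    intro f
    have h := eul_sub_eulD g s hτ hε0 (J * subst g s hτ f)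
    rw [(eulD g s hτ).leibniz, eulD_subst g s hτ hε0, hJ, der_nexp _ (smul_pow_eq_zero hτ (logJ_mem_smul s)),
      eulD_logJ g s hτ hM hε, ← hJ, sub_eq_iff_eq_add] at h
    rw [h]
    have e (b : Fin m) (u1 u2 : Pol2 Λ m) (z : Pol2 Λ m) : u1 * lieX s b z + u2 * lieY s b z
        = lieX s b (u1 * z) + lieY s b (u2 * z) - z * (lieX s b u1 + lieY s b u2) := by
      rw [Derivation.leibniz, Derivation.leibniz]
      simp only [smul_eq_mul]; ring
    simp only [e]
    rw [Finset.sum_sub_distrib, ← Finset.mul_sum]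
    have hz (u1 u2 : Fin m → Pol2 Λ m) (z : Pol2 Λ m) :
        φ (∑ b, (lieX s b (u1 b * z) + lieY s b (u2 b * z))) = 0 := by
      rw [map_sum]
      exact Finset.sum_eq_zero fun b _ => by rw [map_add, hX, hY, add_zero]
    have hz' := hz (w1 g s hτ (cX Λ m) (cY Λ m) (eulD g s hτ)) (w2 g s hτ (cX Λ m) (cY Λ m) (eulD g s hτ))
      (J * subst g s hτ f)
    generalize (∑ b : Fin m, (lieX s b (_ * _) + lieY s b (_ * _)) : Pol2 Λ m) = S1 at hz' ⊢
    generalize (∑ b : Fin m, (lieX s b _ + lieY s b _) : Pol2 Λ m) = S2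
    rw [← sub_eq_zero, ← map_sub, show ∀ w : Pol2 Λ m, w = τ • S1 → φ w = 0 from
      fun w hw => by rw [hw, map_smul, hz', smul_zero]]
    rw [← sub_eq_zero]
    simp only [← algebraMap_smul (Pol2 Λ m) τ, smul_eq_mul]
    ring
  rw [← f.support_sum_monomial_coeff]
  simp only [map_sum, Finset.mul_sum]
  refine Finset.sum_congr rfl fun α _ => ?_
  generalize hz : MvPolynomial.monomial α (f.coeff α) = z
  have hh : z.IsHomogeneous α.degree := hz ▸ MvPolynomial.isHomogeneous_monomial _ rfl
  by_cases hp : p = α.degree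
  · have hm : z ∈ MvPolynomial.idealOfVars (Fin m ⊕ Fin m) Λ ^ p := by
      rw [MvPolynomial.mem_pow_idealOfVars_iff]
      intro β hβ
      rw [← hz] at hβ
      have := Finset.mem_singleton.mp (MvPolynomial.support_monomial_subset hβ)
      rw [this, hp]
    have h1 := subst_sub_mem g s hτ p hm
    rw [← sub_eq_zero, ← map_sub]
    refine φ_mem hE ?_
    rw [show J * subst g s hτ z - z = J * (subst g s hτ z - z) + (J - 1) * z by ring]
    refine Ideal.add_mem _ (Ideal.mul_mem_left _ _ h1) ?_
    rw [pow_succ']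
    exact Ideal.mul_mem_mul (nexp_logJ_sub_one_mem s) hm
  · rw [φ_homogeneous hE hh hp]
    have h := key z
    rw [hE, eul_homogeneous hh, ← algebraMap_smul Λ ((α.degree : ℕ) : ℂ) z, map_smul, algebraMap_smul, mul_smul_comm, φ_ℂ] at h
    exact eq_zero_of_smul_eq hp h

end Functional

end TA
end Duflo

open scoped TensorProduct

namespace Duflo

section Iot

variable {K Λ 𝒪 𝒪' U : Type*} [CommRing K] [CommRing Λ] [CommRing 𝒪] [CommRing 𝒪'] [Ring U] [Algebra K Λ]
  [Algebra K 𝒪] [Algebra K 𝒪'] [Algebra Λ 𝒪] [Algebra Λ 𝒪'] [IsScalarTower K Λ 𝒪] [IsScalarTower K Λ 𝒪']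
  [Algebra K U] {m : ℕ}

/-- The element `∑ v i ⊗ e i`. -/
def iot (K : Type*) {𝒪 U : Type*} [CommRing K] [CommRing 𝒪] [Ring U] [Algebra K 𝒪] [Algebra K U] {m : ℕ}
    (e : Fin m → U) : (Fin m → 𝒪) →ₗ[𝒪] 𝒪 ⊗[K] U :=
  ∑ i, (TensorProduct.AlgebraTensorModule.mk K 𝒪 𝒪 U).flip (e i) ∘ₗ LinearMap.proj i

lemma iot_apply (e : Fin m → U) (v : Fin m → 𝒪) : iot K e v = ∑ i, v i ⊗ₜ[K] e i := by
  simp [iot]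

lemma iot_comm (s : SC Λ m) (e : Fin m → U) (c : Fin m → Fin m → Fin m → K)
    (hs : ∀ i j k, s.γ i j k = algebraMap K Λ (c i j k)) (he : ∀ i j, e i * e j - e j * e i = ∑ k, c i j k • e k)
    (v w : Fin m → 𝒪) : iot K e v * iot K e w - iot K e w * iot K e v = iot K e ((adM s v).mulVec w) := by
  simp only [iot_apply, Finset.sum_mul, Finset.mul_sum, Algebra.TensorProduct.tmul_mul_tmul]
  rw [Finset.sum_comm (f := fun i j => (w j * v i) ⊗ₜ[K] (e j * e i))]
  simp only [← Finset.sum_sub_distrib]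
  have h (i j k : Fin m) (x : 𝒪) : x ⊗ₜ[K] (c i j k • e k) = (x * algebraMap Λ 𝒪 (s.γ i j k)) ⊗ₜ[K] e k := by
    rw [TensorProduct.tmul_smul, TensorProduct.smul_tmul', hs, ← IsScalarTower.algebraMap_apply, mul_comm,
      Algebra.smul_def]
  calc _ = ∑ i, ∑ j, ∑ k, (v j * w i * algebraMap Λ 𝒪 (s.γ j i k)) ⊗ₜ[K] e k := by
        refine Finset.sum_congr rfl fun i _ => Finset.sum_congr rfl fun j _ => ?_
        rw [mul_comm (w i), ← TensorProduct.tmul_sub, he, TensorProduct.tmul_sum]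
        simp only [h]
    _ = _ := by
        rw [Finset.sum_comm]
        simp only [Finset.sum_comm (s := Finset.univ (α := Fin m)) (f := fun i k => (v _ * w i * _) ⊗ₜ[K] e k)]
        rw [Finset.sum_comm]
        refine Finset.sum_congr rfl fun k _ => ?_
        rw [Finset.sum_comm]
        simp only [← TensorProduct.sum_tmul, Matrix.mulVec, dotProduct, adM_apply, Finset.sum_mul]
        refine congrArg (· ⊗ₜ[K] e k) (Finset.sum_congr rfl fun i _ => Finset.sum_congr rfl fun j _ => by ring)

lemma map_iot (f : 𝒪 →ₐ[Λ] 𝒪') (e : Fin m → U) (v : Fin m → 𝒪) :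
    Algebra.TensorProduct.map f (AlgHom.id K U) (iot K e v) = iot K e (f ∘ v) := by
  simp [iot_apply]

lemma map_rho [Algebra ℂ Λ] [Algebra ℂ 𝒪] [Algebra ℂ 𝒪'] [IsScalarTower ℂ Λ 𝒪] [IsScalarTower ℂ Λ 𝒪']
    (f : 𝒪 →ₐ[Λ] 𝒪') (s : SC Λ m) (M : ℕ) (τ : Λ) (v : Fin m → 𝒪) :
    f (rho s M τ v) = rho s M τ (f ∘ v) := by
  have hc (c : ℂ) (x : 𝒪) : f (c • x) = c • f x := by
    rw [← algebraMap_smul Λ c, map_smul, algebraMap_smul]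
  rw [rho, rho, map_sum]
  refine Finset.sum_congr rfl fun k _ => ?_
  rw [hc]
  congr 1
  have e : (τ • adM s (f ∘ v)) = f.mapMatrix (τ • adM s v) := by
    rw [map_smul, AlgHom.mapMatrix_apply, adM_map]
  rw [e, ← map_pow, AlgHom.mapMatrix_apply]
  exact AddMonoidHom.map_trace f.toRingHom.toAddMonoidHom _

end Iot

namespace TA

variable {M : ℕ} {ε : ℂ} (g : Geo M ε) {Λ : Type*} [CommRing Λ] [Algebra ℂ Λ] {m : ℕ} (s : SC Λ m)
  {τ : Λ} (hτ : τ ^ M = 0)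

lemma rho_vX : rho s M τ (vX g s hτ (cX Λ m) (cY Λ m)) = rho s M τ (cX Λ m) := by
  refine Finset.sum_congr rfl fun k _ => ?_
  have h1 : evM s hτ (cX Λ m) (cY Λ m) g.ai * evM s hτ (cX Λ m) (cY Λ m) g.a = 1 := by
    rw [← map_mul, g.ai_a, map_one]
  have h2 : evM s hτ (cX Λ m) (cY Λ m) g.a * evM s hτ (cX Λ m) (cY Λ m) g.ai = 1 := by
    rw [← map_mul, g.a_ai, map_one]
  rw [← evM_conj_a g s hτ, map_mul, map_mul, evM_lt, conj_pow h1 _ _ h2, Matrix.trace_mul_comm, ← mul_assoc, h1, one_mul]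
  rfl

lemma rho_vY : rho s M τ (vY g s hτ (cX Λ m) (cY Λ m)) = rho s M τ (cY Λ m) := by
  refine Finset.sum_congr rfl fun k _ => ?_
  have h1 : evM s hτ (cX Λ m) (cY Λ m) g.c * evM s hτ (cX Λ m) (cY Λ m) g.ci = 1 := by
    rw [← map_mul, g.c_ci, map_one]
  have h2 : evM s hτ (cX Λ m) (cY Λ m) g.ci * evM s hτ (cX Λ m) (cY Λ m) g.c = 1 := by
    rw [← map_mul, g.ci_c, map_one]
  rw [← evM_conj_ci g s hτ, map_mul, map_mul, evM_lt, conj_pow h1 _ _ h2, Matrix.trace_mul_comm, ← mul_assoc, h1, one_mul]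
  rfl

variable {K U : Type*} [CommRing K] [Ring U] [Algebra K Λ] [Algebra K U] (e : Fin m → U)
  (c : Fin m → Fin m → Fin m → K)
  (hs : ∀ i j k, s.γ i j k = algebraMap K Λ (c i j k)) (he : ∀ i j, e i * e j - e j * e i = ∑ k, c i j k • e k)

/-- The generating function of a product of symmetrizations. -/
def genProd (K : Type*) [CommRing K] [Algebra K Λ] [Algebra K U] (e : Fin m → U) (M : ℕ) (τ : Λ) (κ : ℂ) : Pol2 Λ m ⊗[K] U :=
  nexp (M + 1) (rho s M τ (cX Λ m) + rho s M τ (cY Λ m)) ⊗ₜ 1 *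
    (nexp (M + 1) (κ • τ • iot K e (cX Λ m)) * nexp (M + 1) (κ • τ • iot K e (cY Λ m)))

/-- The generating function of the symmetrization of a product. -/
def genSum (K : Type*) [CommRing K] [Algebra K Λ] [Algebra K U] (e : Fin m → U) (M : ℕ) (τ : Λ) (κ : ℂ) : Pol2 Λ m ⊗[K] U :=
  nexp (M + 1) (rho s M τ (cX Λ m + cY Λ m)) ⊗ₜ 1 * nexp (M + 1) (κ • τ • iot K e (cX Λ m + cY Λ m))

include hτ in
lemma nexp_logJ_mul : nexp (M + 1) (logJ s M τ) * nexp (M + 1) (rho s M τ (cX Λ m) + rho s M τ (cY Λ m))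
    = nexp (M + 1) (rho s M τ (cX Λ m + cY Λ m)) := by
  obtain ⟨z1, h1⟩ := logJ_mem_smul s (M := M) (τ := τ)
  obtain ⟨z2, h2⟩ := rho_mem_smul s M τ (cX Λ m)
  obtain ⟨z3, h3⟩ := rho_mem_smul s M τ (cY Λ m)
  have e1 : logJ s M τ ^ M = 0 := smul_pow_eq_zero hτ ⟨z1, h1⟩
  have e2 : (rho s M τ (cX Λ m) + rho s M τ (cY Λ m)) ^ M = 0 :=
    smul_pow_eq_zero hτ ⟨z2 + z3, by rw [h2, h3, smul_add]⟩
  have e3 : (logJ s M τ + (rho s M τ (cX Λ m) + rho s M τ (cY Λ m))) ^ M = 0 :=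
    smul_pow_eq_zero hτ ⟨z1 + (z2 + z3), by rw [h1, h2, h3, smul_add, smul_add]⟩
  have h := nexp_add (Commute.all _ _) e1 e2 e3
  rw [show logJ s M τ + (rho s M τ (cX Λ m) + rho s M τ (cY Λ m)) = rho s M τ (cX Λ m + cY Λ m) by
    rw [logJ, sub_sub, sub_add_cancel]] at h
  exact h.symm

include hs he in
lemma nexp_mul_iot : nexp (M + 1) ((2 * ε * (Real.pi * Complex.I)) • τ • iot K e (cX Λ m + cY Λ m))
    = nexp (M + 1) ((2 * ε * (Real.pi * Complex.I)) • τ • iot K e (vX g s hτ (cX Λ m) (cY Λ m))) *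
      nexp (M + 1) ((2 * ε * (Real.pi * Complex.I)) • τ • iot K e (vY g s hτ (cX Λ m) (cY Λ m))) := by
  have h0 : ∀ v w : Fin m → Pol2 Λ m, iot K e v * iot K e w - iot K e w * iot K e v = iot K e ((adM s v).mulVec w) :=
    iot_comm s e c hs he
  generalize (iot K e : (Fin m → Pol2 Λ m) →ₗ[Pol2 Λ m] Pol2 Λ m ⊗[K] U) = ι at *
  haveI : IsScalarTower Λ (Pol2 Λ m) (Pol2 Λ m ⊗[K] U) := inferInstance
  haveI : IsScalarTower ℂ (Pol2 Λ m) (Pol2 Λ m ⊗[K] U) := inferInstance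
  exact nexp_mul (T := Pol2 Λ m ⊗[K] U) g s hτ (cX Λ m) (cY Λ m) h0

include hs he in
lemma logJ_mul_map_genProd :
    ((nexp (M + 1) (logJ s M τ) : Pol2 Λ m) ⊗ₜ[K] (1 : U)) * Algebra.TensorProduct.map (subst g s hτ) (AlgHom.id K U)
      (genProd s K e M τ (2 * ε * (Real.pi * Complex.I)))
      = genSum s K e M τ (2 * ε * (Real.pi * Complex.I)) := by
  set F := Algebra.TensorProduct.map (subst g s hτ) (AlgHom.id K U) with hF
  have hFn (x : Pol2 Λ m ⊗[K] U) : F (nexp (M + 1) x) = nexp (M + 1) (F x) := map_nexp (F.restrictScalars ℂ) _ _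
  have hS (x : Pol2 Λ m) : subst g s hτ (nexp (M + 1) x) = nexp (M + 1) (subst g s hτ x) :=
    map_nexp ((subst g s hτ).restrictScalars ℂ) _ _
  have hc (c : ℂ) (x : Pol2 Λ m ⊗[K] U) : F (c • x) = c • F x := map_smul (F.restrictScalars ℂ) c x
  have hvX : subst g s hτ ∘ cX Λ m = vX g s hτ (cX Λ m) (cY Λ m) := by
    ext1 i
    simp [subst, cX, mv]
  have hvY : subst g s hτ ∘ cY Λ m = vY g s hτ (cX Λ m) (cY Λ m) := by
    ext1 i
    simp [subst, cY, mv]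
  have h1 : F (nexp (M + 1) ((2 * ε * (Real.pi * Complex.I)) • τ • iot K e (cX Λ m)))
      = nexp (M + 1) ((2 * ε * (Real.pi * Complex.I)) • τ • iot K e (vX g s hτ (cX Λ m) (cY Λ m))) := by
    rw [hFn, hc, map_smul, hF, map_iot, hvX]
  have h2 : F (nexp (M + 1) ((2 * ε * (Real.pi * Complex.I)) • τ • iot K e (cY Λ m)))
      = nexp (M + 1) ((2 * ε * (Real.pi * Complex.I)) • τ • iot K e (vY g s hτ (cX Λ m) (cY Λ m))) := by
    rw [hFn, hc, map_smul, hF, map_iot, hvY]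
  have h3 := nexp_mul_iot g s hτ e c hs he
  have h4 : F ((nexp (M + 1) (rho s M τ (cX Λ m) + rho s M τ (cY Λ m)) : Pol2 Λ m) ⊗ₜ[K] (1 : U))
      = (nexp (M + 1) (rho s M τ (cX Λ m) + rho s M τ (cY Λ m)) : Pol2 Λ m) ⊗ₜ[K] (1 : U) := by
    rw [hF, Algebra.TensorProduct.map_tmul, map_one, hS, map_add, map_rho, map_rho, hvX, hvY, rho_vX, rho_vY]
  have h5 : nexp (M + 1) (logJ s M τ) * nexp (M + 1) (rho s M τ (cX Λ m) + rho s M τ (cY Λ m))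
      = nexp (M + 1) (rho s M τ (cX Λ m + cY Λ m)) := by
    exact nexp_logJ_mul s hτ
  rw [genProd, map_mul, map_mul, h1, h2, h4, ← h3, ← mul_assoc, Algebra.TensorProduct.tmul_mul_tmul, one_mul, h5,
    genSum]

include hτ hs he in
theorem rTensor_genProd (φ : Pol2 Λ m →ₗ[Λ] Λ) {p : ℕ} (hE : ∀ f, φ (eul Λ m f) = (p : ℂ) • φ f) (hM : 1 ≤ M)
    (hε : ε = 1 ∨ ε = -1) (hX : ∀ b f, φ (lieX s b f) = 0) (hY : ∀ b f, φ (lieY s b f) = 0) :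
    (φ.restrictScalars K).rTensor U (genProd s K e M τ (2 * ε * (Real.pi * Complex.I)))
      = (φ.restrictScalars K).rTensor U (genSum s K e M τ (2 * ε * (Real.pi * Complex.I))) := by
  obtain ⟨g⟩ := nonempty_geo M hε
  rw [← logJ_mul_map_genProd (K := K) (U := U) g s hτ e c hs he]
  generalize genProd s K e M τ (2 * ε * (Real.pi * Complex.I)) = z
  induction z using TensorProduct.induction_on with
  | zero => simp
  | tmul x y =>
    rw [Algebra.TensorProduct.map_tmul, Algebra.TensorProduct.tmul_mul_tmul, LinearMap.rTensor_tmul,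
      LinearMap.rTensor_tmul, one_mul, LinearMap.restrictScalars_apply, LinearMap.restrictScalars_apply,
      φ_subst g s hτ hE hM hε hX hY]
    rfl
  | add x y hx hy => rw [map_add, map_add, mul_add, map_add, hx, hy]

end TA
end Duflo

open scoped TensorProduct

namespace Duflo

section Pair

open MvPolynomial

variable {R σ : Type*} [CommRing R] [Fintype σ] [DecidableEq σ]

/-- The factorial of a multi-index. -/
def mfact (α : σ →₀ ℕ) : ℕ := ∏ i, (α i).factorial

lemma mfact_add_single (α : σ →₀ ℕ) (i : σ) :
    mfact (α + Finsupp.single i 1) = (α i + 1) * mfact α := by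
  rw [mfact, mfact, ← Finset.mul_prod_erase _ _ (Finset.mem_univ i),
    ← Finset.mul_prod_erase _ (fun j => (α j).factorial) (Finset.mem_univ i), ← mul_assoc]
  congr 1
  · simp [Nat.factorial_succ]
  · refine Finset.prod_congr rfl fun j hj => ?_
    simp [Finsupp.single_apply, (Finset.ne_of_mem_erase hj).symm]

/-- The pairing of polynomials in which monomials are orthogonal and `⟨X ^ α, X ^ α⟩ = α!`. -/
def pair : MvPolynomial σ R →ₗ[R] MvPolynomial σ R →ₗ[R] R :=
  (basisMonomials σ R).constr R fun α => (mfact α : R) • lcoeff R α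

lemma pair_monomial (α : σ →₀ ℕ) (a : R) (f : MvPolynomial σ R) :
    pair (monomial α a) f = a * (mfact α * coeff α f) := by
  have h : monomial α a = a • basisMonomials σ R α := by
    rw [coe_basisMonomials, smul_monomial, smul_eq_mul, mul_one]
  rw [h, map_smul, LinearMap.smul_apply, pair, Module.Basis.constr_basis]
  rfl

lemma pair_eq_sum (P f : MvPolynomial σ R) :
    pair P f = ∑ α ∈ P.support, coeff α P * (mfact α * coeff α f) := by
  conv_lhs => rw [← P.support_sum_monomial_coeff]
  rw [map_sum, LinearMap.sum_apply]
  exact Finset.sum_congr rfl fun α _ => pair_monomial _ _ _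

lemma pair_comm (P f : MvPolynomial σ R) : pair P f = pair f P := by
  induction P using MvPolynomial.induction_on' with
  | add p q hp hq => rw [map_add, LinearMap.add_apply, hp, hq, map_add]
  | monomial α a =>
    induction f using MvPolynomial.induction_on' with
    | add p q hp hq => rw [map_add, map_add, LinearMap.add_apply, hp, hq]
    | monomial β b =>
      rw [pair_monomial, pair_monomial, coeff_monomial, coeff_monomial]
      by_cases h : α = β
      · subst h; simp; ring
      · simp [h, Ne.symm h]

lemma pair_X_mul (i : σ) (P f : MvPolynomial σ R) : pair (X i * P) f = pair P (pderiv i f) := by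
  induction P using MvPolynomial.induction_on' with
  | add p q hp hq => rw [mul_add, map_add, LinearMap.add_apply, hp, hq, map_add, LinearMap.add_apply]
  | monomial α a =>
    rw [X, monomial_mul, one_mul, pair_monomial, pair_monomial, coeff_pderiv, add_comm, mfact_add_single]
    push_cast
    ring

lemma pair_pderiv (i : σ) (P f : MvPolynomial σ R) : pair (pderiv i P) f = pair P (X i * f) := by
  rw [pair_comm, ← pair_X_mul, pair_comm]

lemma pair_C (a : R) (f : MvPolynomial σ R) : pair (C a) f = a * constantCoeff f := by
  rw [C_apply, pair_monomial, constantCoeff_eq]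
  simp [mfact]

lemma pair_right_injective [Algebra ℚ R] {P Q : MvPolynomial σ R} (h : ∀ f, pair P f = pair Q f) : P = Q := by
  ext α
  have h' := h (monomial α 1)
  rw [pair_comm, pair_monomial, one_mul, pair_comm, pair_monomial, one_mul] at h'
  have : IsUnit (mfact α : R) := by
    have h0 : (mfact α : ℚ) ≠ 0 := by exact_mod_cast (Finset.prod_pos fun i _ => Nat.factorial_pos _).ne'
    simpa using (IsUnit.mk0 _ h0).map (algebraMap ℚ R)
  exact this.mul_left_cancel h'

lemma pair_eq_zero_of_mem {P f : MvPolynomial σ R} {M : ℕ} (hP : P.totalDegree < M)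
    (hf : f ∈ idealOfVars σ R ^ M) : pair P f = 0 := by
  rw [pair_eq_sum]
  refine Finset.sum_eq_zero fun α hα => ?_
  have : coeff α f = 0 := by
    by_contra h
    have h1 := (mem_pow_idealOfVars_iff _ _).mp hf α (mem_support_iff.mpr h)
    have h2 := le_totalDegree hα
    rw [Finsupp.sum_fintype _ _ (fun _ => rfl)] at h2
    rw [Finsupp.degree_eq_sum] at h1
    omega
  rw [this, mul_zero, mul_zero]

/-- The derivation given by a linear vector field. -/
def linDer (a : σ → σ → R) : Derivation R (MvPolynomial σ R) (MvPolynomial σ R) :=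
  mkDerivation R fun i => ∑ j, a i j • X j

lemma linDer_X (a : σ → σ → R) (i : σ) : linDer a (X i) = ∑ j, a i j • X j := mkDerivation_X _ _ _

lemma linDer_apply (a : σ → σ → R) (f : MvPolynomial σ R) :
    linDer a f = ∑ i, ∑ j, a i j • (X j * pderiv i f) := by
  rw [linDer, mkDerivation_eq_sum_pderiv]
  simp only [Finset.sum_mul, smul_mul_assoc]

lemma pair_linDer (a : σ → σ → R) (P f : MvPolynomial σ R) :
    pair P (linDer a f) = pair (linDer (fun i j => a j i) P) f := by
  rw [linDer_apply, linDer_apply, Finset.sum_comm]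
  simp only [map_sum, map_smul, LinearMap.sum_apply, LinearMap.smul_apply]
  refine Finset.sum_congr rfl fun i _ => Finset.sum_congr rfl fun j _ => ?_
  rw [pair_X_mul, pair_pderiv]

/-- The constant coefficient differential operator attached to a monomial. -/
def dOp {m : ℕ} (α : Fin m →₀ ℕ) : Module.End R (MvPolynomial (Fin m) R) :=
  ((List.finRange m).map fun i =>
    (((pderiv i).toLinearMap : Module.End R (MvPolynomial (Fin m) R)) ^ (α i))).prod

/-- The constant coefficient differential operator attached to a polynomial. -/
def contr {m : ℕ} (f P : MvPolynomial (Fin m) R) : MvPolynomial (Fin m) R :=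
  ∑ α ∈ f.support, coeff α f • dOp α P

lemma pair_dOp {m : ℕ} (α : Fin m →₀ ℕ) (P f : MvPolynomial (Fin m) R) :
    pair (dOp α P) f = pair P (monomial α 1 * f) := by
  have h : ∀ (l : List (Fin m)) (P f : MvPolynomial (Fin m) R),
      pair ((l.map fun i => (((pderiv i).toLinearMap : Module.End R (MvPolynomial (Fin m) R)) ^ (α i))).prod P) f
        = pair P ((l.map fun i => (X i : MvPolynomial (Fin m) R) ^ α i).prod * f) := by
    intro l
    induction l with
    | nil => simp
    | cons i l ih =>
      intro P f
      have h1 : ∀ (k : ℕ) (P f : MvPolynomial (Fin m) R),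
          pair ((((pderiv i).toLinearMap : Module.End R (MvPolynomial (Fin m) R)) ^ k) P) f
            = pair P (X i ^ k * f) := by
        intro k
        induction k with
        | zero => simp
        | succ k ih =>
          intro P f
          rw [pow_succ, Module.End.mul_apply, ih, Derivation.coeFn_coe, pair_pderiv,
            pow_succ', mul_assoc]
      rw [List.map_cons, List.prod_cons, Module.End.mul_apply, h1, ih, List.map_cons, List.prod_cons]
      congr 1
      ring
  rw [dOp, h]
  congr 2
  rw [monomial_eq, C_1, one_mul, Finsupp.prod_fintype _ _ (fun i => pow_zero _), ← List.prod_ofFn, List.ofFn_eq_map]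

lemma pair_contr {m : ℕ} (f P g : MvPolynomial (Fin m) R) : pair (contr f P) g = pair P (f * g) := by
  conv_rhs => rw [← f.support_sum_monomial_coeff]
  rw [contr, map_sum, LinearMap.sum_apply, Finset.sum_mul, map_sum]
  refine Finset.sum_congr rfl fun α _ => ?_
  rw [map_smul, LinearMap.smul_apply, pair_dOp, ← map_smul, ← smul_mul_assoc, smul_monomial, smul_eq_mul, mul_one]

lemma linDer_contr [Algebra ℚ R] {m : ℕ} (a : Fin m → Fin m → R) {f P : MvPolynomial (Fin m) R}
    (hf : linDer (fun i j => a j i) f = 0) (hP : linDer a P = 0) : linDer a (contr f P) = 0 := by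
  refine pair_right_injective fun g => ?_
  rw [map_zero, LinearMap.zero_apply]
  have h := pair_linDer (fun i j => a j i) (contr f P) g
  rw [← h, pair_contr]
  have h1 : f * linDer (fun i j => a j i) g = linDer (fun i j => a j i) (f * g) := by
    rw [Derivation.leibniz, hf, smul_zero, add_zero, smul_eq_mul]
  rw [h1, pair_linDer, hP, map_zero, LinearMap.zero_apply]

section Two

variable {m : ℕ}

/-- The exterior product of polynomials. -/
def ext2 (P Q : MvPolynomial (Fin m) R) : MvPolynomial (Fin m ⊕ Fin m) R :=
  rename Sum.inl P * rename Sum.inr Q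

lemma pair_aeval_add (S : MvPolynomial (Fin m ⊕ Fin m) R) (f : MvPolynomial (Fin m) R) :
    pair S (aeval (TA.cX R m + TA.cY R m) f) = pair (rename (Sum.elim id id) S) f := by
  have hd (i : Fin m ⊕ Fin m) (f : MvPolynomial (Fin m) R) : pderiv i (aeval (TA.cX R m + TA.cY R m) f)
      = aeval (TA.cX R m + TA.cY R m) (pderiv (Sum.elim id id i) f) := by
    induction f using MvPolynomial.induction_on with
    | C a => simp
    | add p q hp hq => rw [map_add, map_add, hp, hq, map_add, map_add]
    | mul_X p j hp =>
      have e : pderiv i ((TA.cX R m + TA.cY R m) j)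
          = aeval (TA.cX R m + TA.cY R m) (pderiv (Sum.elim id id i) (X j : MvPolynomial (Fin m) R)) := by
        rcases i with i | i <;> simp [TA.cX, TA.cY, pderiv_X, Pi.single_apply]
      rw [map_mul, aeval_X, pderiv_mul, pderiv_mul, hp, e, map_add, map_mul, map_mul, aeval_X]
  induction S using MvPolynomial.induction_on generalizing f with
  | C a =>
    rw [rename_C, pair_C, pair_C]
    congr 1
    induction f using MvPolynomial.induction_on with
    | C a => simp
    | add p q hp hq => rw [map_add, map_add, hp, hq, map_add]
    | mul_X p j hp => simp [TA.cX, TA.cY]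
  | add p q hp hq => rw [map_add, map_add, map_add, LinearMap.add_apply, LinearMap.add_apply, hp, hq]
  | mul_X p i hp => rw [mul_comm, pair_X_mul, hd, hp, map_mul, rename_X, pair_X_mul]

lemma rename_ext2 (P Q : MvPolynomial (Fin m) R) : rename (Sum.elim id id) (ext2 P Q) = P * Q := by
  rw [ext2, map_mul, rename_rename, rename_rename, Sum.elim_comp_inl, Sum.elim_comp_inr, rename_id_apply,
    rename_id_apply]

lemma pair_ext2 (P Q f g : MvPolynomial (Fin m) R) :
    pair (ext2 P Q) (rename Sum.inl f * rename Sum.inr g) = pair P f * pair Q g := by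
  have hl (i : Fin m) (f : MvPolynomial (Fin m) R) :
      pderiv (Sum.inr i) (rename (Sum.inl : Fin m → Fin m ⊕ Fin m) f) = 0 :=
    pderiv_eq_zero_of_notMem_vars fun h => by
      have := vars_rename Sum.inl f h
      simp at this
  have hr (i : Fin m) (f : MvPolynomial (Fin m) R) :
      pderiv (Sum.inl i) (rename (Sum.inr : Fin m → Fin m ⊕ Fin m) f) = 0 :=
    pderiv_eq_zero_of_notMem_vars fun h => by
      have := vars_rename Sum.inr f h
      simp at this
  induction P using MvPolynomial.induction_on generalizing f with
  | add p q hp hq =>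
    rw [ext2, map_add, add_mul, map_add, LinearMap.add_apply, map_add, LinearMap.add_apply, add_mul]
    exact congrArg₂ (· + ·) (hp f) (hq f)
  | mul_X p i hp =>
    have : ext2 (p * X i) Q = X (Sum.inl i) * ext2 p Q := by
      rw [ext2, ext2, map_mul, rename_X]; ring
    rw [this, pair_X_mul, pderiv_mul, hr, mul_zero, add_zero, pderiv_rename Sum.inl_injective, hp, mul_comm p,
      pair_X_mul]
  | C a =>
    induction Q using MvPolynomial.induction_on generalizing g with
    | add p q hp hq =>
      rw [ext2, map_add, mul_add, map_add, LinearMap.add_apply, map_add, LinearMap.add_apply, mul_add]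
      exact congrArg₂ (· + ·) (hp g) (hq g)
    | mul_X p i hp =>
      have : ext2 (C a) (p * X i) = X (Sum.inr i) * ext2 (C a) p := by
        rw [ext2, ext2, map_mul, rename_X]; ring
      rw [this, pair_X_mul, pderiv_mul, hl, zero_mul, zero_add, pderiv_rename Sum.inr_injective, hp, mul_comm p,
        pair_X_mul]
    | C b =>
      rw [ext2, rename_C, rename_C, ← C_mul, pair_C, pair_C, pair_C, map_mul, constantCoeff_rename,
        constantCoeff_rename]
      ring

lemma linDer_ext2 (a b : Fin m → Fin m → R) (P Q : MvPolynomial (Fin m) R) :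
    linDer (Sum.elim (fun i => Sum.elim (a i) 0) (fun i => Sum.elim 0 (b i))) (ext2 P Q)
      = rename Sum.inl (linDer a P) * rename Sum.inr Q + rename Sum.inl P * rename Sum.inr (linDer b Q) := by
  have hl : ∀ P : MvPolynomial (Fin m) R,
      linDer (Sum.elim (fun i => Sum.elim (a i) 0) (fun i => Sum.elim 0 (b i))) (rename Sum.inl P)
        = rename Sum.inl (linDer a P) := by
    intro P
    induction P using MvPolynomial.induction_on with
    | C r => rw [rename_C, ← algebraMap_eq, ← algebraMap_eq, Derivation.map_algebraMap, Derivation.map_algebraMap, map_zero]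
    | add p q hp hq => rw [map_add, map_add, map_add, hp, hq, map_add]
    | mul_X p j hp =>
      rw [map_mul, Derivation.leibniz, hp, Derivation.leibniz, rename_X, linDer_X, linDer_X]
      simp [map_sum]
  have hr : ∀ P : MvPolynomial (Fin m) R,
      linDer (Sum.elim (fun i => Sum.elim (a i) 0) (fun i => Sum.elim 0 (b i))) (rename Sum.inr P)
        = rename Sum.inr (linDer b P) := by
    intro P
    induction P using MvPolynomial.induction_on with
    | C r => rw [rename_C, ← algebraMap_eq, ← algebraMap_eq, Derivation.map_algebraMap, Derivation.map_algebraMap, map_zero]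
    | add p q hp hq => rw [map_add, map_add, map_add, hp, hq, map_add]
    | mul_X p j hp =>
      rw [map_mul, Derivation.leibniz, hp, Derivation.leibniz, rename_X, linDer_X, linDer_X]
      simp [map_sum]
  rw [ext2, Derivation.leibniz, hl, hr, smul_eq_mul, smul_eq_mul]
  ring

end Two

lemma linDer_one_apply (f : MvPolynomial σ R) :
    linDer (fun i j => if i = j then (1 : R) else 0) f = mkDerivation R X f := by
  have : (fun i : σ => ∑ j, (if i = j then (1 : R) else 0) • (X j : MvPolynomial σ R)) = X := by
    funext i
    simp
  rw [linDer, this]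

lemma pair_euler {P : MvPolynomial σ R} {p : ℕ} (hP : P.IsHomogeneous p) (f : MvPolynomial σ R) :
    pair P (mkDerivation R X f) = p * pair P f := by
  rw [← linDer_one_apply, pair_linDer]
  have : (fun i j : σ => if j = i then (1 : R) else 0) = fun i j => if i = j then (1 : R) else 0 := by
    funext i j; simp [eq_comm]
  have h1 : mkDerivation R X P = p • P := by
    rw [mkDerivation_eq_sum_pderiv]
    exact hP.sum_X_mul_pderiv
  rw [this, linDer_one_apply, h1, map_nsmul, LinearMap.smul_apply, nsmul_eq_mul]

end Pair

end Duflo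

open scoped TensorProduct

namespace Duflo

open MvPolynomial

section Base

variable {Λ : Type*} [CommRing Λ] [Algebra ℂ Λ] {m : ℕ} (s : SC Λ m) {K U : Type*} [CommRing K] [Ring U]
  [Algebra K Λ] [Algebra K U] (e : Fin m → U) (M : ℕ) (τ : Λ) (κ : ℂ)

/-- The generating function of deformed symmetrizations. -/
def gen1 (K : Type*) [CommRing K] [Algebra K Λ] [Algebra K U] (e : Fin m → U) (M : ℕ) (τ : Λ) (κ : ℂ) :
    MvPolynomial (Fin m) Λ ⊗[K] U :=
  nexp (M + 1) (rho s M τ (X : Fin m → MvPolynomial (Fin m) Λ)) ⊗ₜ 1 *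
    nexp (M + 1) (κ • τ • iot K e (X : Fin m → MvPolynomial (Fin m) Λ))

lemma map_gen1 (f : MvPolynomial (Fin m) Λ →ₐ[Λ] TA.Pol2 Λ m) :
    Algebra.TensorProduct.map f (AlgHom.id K U) (gen1 s K e M τ κ)
      = (nexp (M + 1) (rho s M τ (f ∘ X)) : TA.Pol2 Λ m) ⊗ₜ[K] (1 : U) *
        nexp (M + 1) (κ • τ • iot K e (f ∘ X)) := by
  set F := Algebra.TensorProduct.map f (AlgHom.id K U) with hF
  have hFn (x : MvPolynomial (Fin m) Λ ⊗[K] U) : F (nexp (M + 1) x) = nexp (M + 1) (F x) :=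
    map_nexp (F.restrictScalars ℂ) _ _
  have hS (x : MvPolynomial (Fin m) Λ) : f (nexp (M + 1) x) = nexp (M + 1) (f x) :=
    map_nexp (f.restrictScalars ℂ) _ _
  have hc (c : ℂ) (x : MvPolynomial (Fin m) Λ ⊗[K] U) : F (c • x) = c • F x := map_smul (F.restrictScalars ℂ) c x
  have h1 : F (nexp (M + 1) (κ • τ • iot K e (X : Fin m → MvPolynomial (Fin m) Λ)))
      = nexp (M + 1) (κ • τ • iot K e (f ∘ X)) := by
    rw [hFn, hc, map_smul, hF, map_iot]
  have h2 : F ((nexp (M + 1) (rho s M τ (X : Fin m → MvPolynomial (Fin m) Λ)) : MvPolynomial (Fin m) Λ) ⊗ₜ[K] (1 : U))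
      = (nexp (M + 1) (rho s M τ (f ∘ X)) : TA.Pol2 Λ m) ⊗ₜ[K] (1 : U) := by
    rw [hF, Algebra.TensorProduct.map_tmul, map_one, hS, map_rho]
  exact (map_mul F _ _).trans (congrArg₂ (· * ·) h2 h1)

lemma genSum_eq : TA.genSum s K e M τ κ
    = Algebra.TensorProduct.map (aeval (TA.cX Λ m + TA.cY Λ m)) (AlgHom.id K U) (gen1 s K e M τ κ) := by
  have : (aeval (TA.cX Λ m + TA.cY Λ m) : MvPolynomial (Fin m) Λ →ₐ[Λ] TA.Pol2 Λ m) ∘ X = TA.cX Λ m + TA.cY Λ m :=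
    funext fun i => by rw [Function.comp_apply, aeval_X]
  rw [map_gen1, this, TA.genSum]

lemma genProd_eq (hτ : τ ^ M = 0) : TA.genProd s K e M τ κ
    = Algebra.TensorProduct.map (rename Sum.inl) (AlgHom.id K U) (gen1 s K e M τ κ) *
      Algebra.TensorProduct.map (rename Sum.inr) (AlgHom.id K U) (gen1 s K e M τ κ) := by
  have h1 : (rename Sum.inl : MvPolynomial (Fin m) Λ →ₐ[Λ] TA.Pol2 Λ m) ∘ X = TA.cX Λ m :=
    funext fun i => rename_X _ _
  have h2 : (rename Sum.inr : MvPolynomial (Fin m) Λ →ₐ[Λ] TA.Pol2 Λ m) ∘ X = TA.cY Λ m :=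
    funext fun i => rename_X _ _
  rw [map_gen1, map_gen1, h1, h2, TA.genProd]
  obtain ⟨z2, h2⟩ := rho_mem_smul s M τ (TA.cX Λ m)
  obtain ⟨z3, h3⟩ := rho_mem_smul s M τ (TA.cY Λ m)
  have e2 : rho s M τ (TA.cX Λ m) ^ M = 0 := smul_pow_eq_zero hτ ⟨z2, h2⟩
  have e3 : rho s M τ (TA.cY Λ m) ^ M = 0 := smul_pow_eq_zero hτ ⟨z3, h3⟩
  have e4 : (rho s M τ (TA.cX Λ m) + rho s M τ (TA.cY Λ m)) ^ M = 0 :=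
    smul_pow_eq_zero hτ ⟨z2 + z3, by rw [h2, h3, smul_add]⟩
  rw [nexp_add (Commute.all _ _) e2 e3 e4]
  generalize nexp (M + 1) (rho s M τ (TA.cX Λ m)) = a
  generalize nexp (M + 1) (rho s M τ (TA.cY Λ m)) = b
  generalize nexp (M + 1) (κ • τ • iot K e (TA.cX Λ m)) = x
  generalize nexp (M + 1) (κ • τ • iot K e (TA.cY Λ m)) = y
  have hab : ((a * b) ⊗ₜ[K] (1 : U) : TA.Pol2 Λ m ⊗[K] U) = (a ⊗ₜ 1) * (b ⊗ₜ 1) := by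
    rw [Algebra.TensorProduct.tmul_mul_tmul, one_mul]
  have hc : (b ⊗ₜ[K] (1 : U)) * x = x * (b ⊗ₜ[K] (1 : U)) := by
    have := Algebra.commutes b x
    rwa [Algebra.TensorProduct.algebraMap_apply] at this
  rw [hab, mul_assoc, ← mul_assoc (b ⊗ₜ[K] (1 : U)), hc, mul_assoc, mul_assoc]

lemma rTensor_pair_ext2 (P Q : MvPolynomial (Fin m) Λ) (F G : MvPolynomial (Fin m) Λ ⊗[K] U) :
    ((pair (ext2 P Q)).restrictScalars K).rTensor U
        (Algebra.TensorProduct.map (rename Sum.inl : MvPolynomial (Fin m) Λ →ₐ[Λ] TA.Pol2 Λ m) (AlgHom.id K U) F *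
          Algebra.TensorProduct.map (rename Sum.inr : MvPolynomial (Fin m) Λ →ₐ[Λ] TA.Pol2 Λ m) (AlgHom.id K U) G)
      = ((pair P).restrictScalars K).rTensor U F * ((pair Q).restrictScalars K).rTensor U G := by
  induction F using TensorProduct.induction_on with
  | zero => simp
  | add x y hx hy => simp only [map_add, add_mul, hx, hy]
  | tmul x y =>
    induction G using TensorProduct.induction_on with
    | zero => simp
    | add x y hx hy => simp only [map_add, mul_add, hx, hy]
    | tmul u v =>
      rw [Algebra.TensorProduct.map_tmul, Algebra.TensorProduct.map_tmul, Algebra.TensorProduct.tmul_mul_tmul,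
        LinearMap.rTensor_tmul, LinearMap.rTensor_tmul, LinearMap.rTensor_tmul, Algebra.TensorProduct.tmul_mul_tmul]
      simp only [LinearMap.coe_restrictScalars]
      rw [pair_ext2]
      rfl

lemma rTensor_pair_aeval (S : TA.Pol2 Λ m) (F : MvPolynomial (Fin m) Λ ⊗[K] U) :
    ((pair S).restrictScalars K).rTensor U
        (Algebra.TensorProduct.map (aeval (TA.cX Λ m + TA.cY Λ m)) (AlgHom.id K U) F)
      = ((pair (rename (Sum.elim id id) S)).restrictScalars K).rTensor U F := by
  induction F using TensorProduct.induction_on with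
  | zero => simp
  | add x y hx hy => simp only [map_add, hx, hy]
  | tmul x y =>
    rw [Algebra.TensorProduct.map_tmul, LinearMap.rTensor_tmul, LinearMap.rTensor_tmul]
    simp only [LinearMap.coe_restrictScalars]
    rw [pair_aeval_add]
    rfl

lemma lieX_eq_linDer (b : Fin m) : TA.lieX s b
    = linDer (Sum.elim (fun i => Sum.elim (fun j => s.γ b j i) 0) (fun i => Sum.elim 0 ((0 : Fin m → Fin m → Λ) i))) := by
  rw [TA.lieX, linDer]
  congr 1
  funext i
  rcases i with i | i
  · simp [Matrix.mulVec, dotProduct, gm, TA.cX, Algebra.smul_def]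
  · simp

lemma lieY_eq_linDer (b : Fin m) : TA.lieY s b
    = linDer (Sum.elim (fun i => Sum.elim ((0 : Fin m → Fin m → Λ) i) 0) (fun i => Sum.elim 0 (fun j => s.γ b j i))) := by
  rw [TA.lieY, linDer]
  congr 1
  funext i
  rcases i with i | i
  · simp
  · simp [Matrix.mulVec, dotProduct, gm, TA.cY, Algebra.smul_def]

end Base

end Duflo

open scoped TensorProduct

namespace Duflo

open MvPolynomial

section Base

variable {Λ : Type*} [CommRing Λ] [Algebra ℂ Λ] {m : ℕ} (s : SC Λ m) {K U : Type*} [CommRing K] [Ring U]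
  [Algebra K Λ] [Algebra K U] (e : Fin m → U) {M : ℕ} {τ : Λ} {ε : ℂ} (c : Fin m → Fin m → Fin m → K)

theorem rTensor_gen1_mul (hτ : τ ^ M = 0)
    (hs : ∀ i j k, s.γ i j k = algebraMap K Λ (c i j k)) (he : ∀ i j, e i * e j - e j * e i = ∑ k, c i j k • e k)
    (hM : 1 ≤ M) (hε : ε = 1 ∨ ε = -1) {P Q : MvPolynomial (Fin m) Λ} {p q : ℕ}
    (hp : P.IsHomogeneous p) (hq : Q.IsHomogeneous q) (hP : ∀ b, linDer (s.γ b) P = 0) (hQ : ∀ b, linDer (s.γ b) Q = 0) :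
    ((pair P).restrictScalars K).rTensor U (gen1 s K e M τ (2 * ε * (Real.pi * Complex.I))) *
        ((pair Q).restrictScalars K).rTensor U (gen1 s K e M τ (2 * ε * (Real.pi * Complex.I)))
      = ((pair (P * Q)).restrictScalars K).rTensor U (gen1 s K e M τ (2 * ε * (Real.pi * Complex.I))) := by
  rw [← rTensor_pair_ext2, ← genProd_eq _ _ _ _ _ hτ, ← rename_ext2 P Q, ← rTensor_pair_aeval, ← genSum_eq]
  have hh : (ext2 P Q).IsHomogeneous (p + q) :=
    (hp.rename_isHomogeneous).mul (hq.rename_isHomogeneous)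
  refine TA.rTensor_genProd (p := p + q) s hτ e c hs he _ (fun f => ?_) hM hε (fun b f => ?_) (fun b f => ?_)
  · rw [TA.eul, pair_euler hh, Nat.cast_smul_eq_nsmul, nsmul_eq_mul]
  · rw [lieX_eq_linDer, pair_linDer]
    have h := linDer_ext2 (s.γ b) 0 P Q
    have h0 : linDer (0 : Fin m → Fin m → Λ) Q = 0 := by
      rw [linDer_apply]; simp
    rw [hP, h0, map_zero, map_zero, zero_mul, mul_zero, add_zero] at h
    have e1 : (fun i j => (Sum.elim (fun i => Sum.elim (fun j => s.γ b j i) 0) (fun i => Sum.elim 0 ((0 : Fin m → Fin m → Λ) i)) :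
          Fin m ⊕ Fin m → Fin m ⊕ Fin m → Λ) j i)
        = Sum.elim (fun i => Sum.elim (s.γ b i) 0) (fun i => Sum.elim 0 ((0 : Fin m → Fin m → Λ) i)) := by
      funext i j
      rcases i with i | i <;> rcases j with j | j <;> rfl
    rw [e1, h, map_zero, LinearMap.zero_apply]
  · rw [lieY_eq_linDer, pair_linDer]
    have h := linDer_ext2 0 (s.γ b) P Q
    have h0 : linDer (0 : Fin m → Fin m → Λ) P = 0 := by
      rw [linDer_apply]; simp
    rw [hQ, h0, map_zero, map_zero, zero_mul, mul_zero, add_zero] at h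
    have e1 : (fun i j => (Sum.elim (fun i => Sum.elim ((0 : Fin m → Fin m → Λ) i) 0) (fun i => Sum.elim 0 (fun j => s.γ b j i)) :
          Fin m ⊕ Fin m → Fin m ⊕ Fin m → Λ) j i)
        = Sum.elim (fun i => Sum.elim ((0 : Fin m → Fin m → Λ) i) 0) (fun i => Sum.elim 0 (s.γ b i)) := by
      funext i j
      rcases i with i | i <;> rcases j with j | j <;> rfl
    rw [e1, h, map_zero, LinearMap.zero_apply]

end Base

/-- Base change of structure constants. -/
def SC.map {K : Type*} [CommRing K] {m : ℕ} (s : SC K m) (R : Type*) [CommRing R] [Algebra K R] : SC R m where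
  γ i j k := algebraMap K R (s.γ i j k)
  anti i j k := by rw [s.anti, map_neg]
  jac i j k p := by
    have := congrArg (algebraMap K R) (s.jac i j k p)
    simpa [map_sum] using this

section Change

variable {K R Λ U : Type*} [CommRing K] [CommRing R] [CommRing Λ] [Ring U] [Algebra K R] [Algebra K Λ] [Algebra R Λ]
  [Algebra ℂ R] [Algebra ℂ Λ] [IsScalarTower K R Λ] [IsScalarTower ℂ R Λ] [Algebra K U] {m : ℕ} (s : SC K m)
  (e : Fin m → U) (M : ℕ)

/-- The polynomial function `v ↦ tr (ad v) ^ k`. -/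
def trPoly (s : SC K m) (R : Type*) [CommRing R] [Algebra K R] (k : ℕ) : MvPolynomial (Fin m) R :=
  Matrix.trace (adM (s.map R) (X : Fin m → MvPolynomial (Fin m) R) ^ k)

variable (K) in
/-- The generating function of symmetrizations twisted by `exp r`. -/
def genW (e : Fin m → U) (M : ℕ) (r : MvPolynomial (Fin m) R) : MvPolynomial (Fin m) R ⊗[K] U :=
  nexp (M + 1) r ⊗ₜ 1 * nexp (M + 1) (iot K e (X : Fin m → MvPolynomial (Fin m) R))

variable (K) in
/-- The twisted symmetrization. -/
def quant (e : Fin m → U) (M : ℕ) (r P : MvPolynomial (Fin m) R) : R ⊗[K] U :=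
  ((pair P).restrictScalars K).rTensor U (genW K e M r)

/-- The substitution scaling all the variables. -/
def scl (h : Λ) : MvPolynomial (Fin m) R →ₐ[R] MvPolynomial (Fin m) Λ := aeval fun i => h • X i

lemma pair_scl (h : Λ) {P : MvPolynomial (Fin m) R} {p : ℕ} (hP : P.IsHomogeneous p) (f : MvPolynomial (Fin m) R) :
    pair (map (algebraMap R Λ) P) (scl h f) = h ^ p * algebraMap R Λ (pair P f) := by
  induction f using MvPolynomial.induction_on' with
  | add f g hf hg => rw [map_add, map_add, hf, hg, map_add, map_add, mul_add]
  | monomial α a =>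
    have h1 : scl h (monomial α a : MvPolynomial (Fin m) R) = monomial α (algebraMap R Λ a * h ^ α.degree) := by
      rw [scl, aeval_monomial, monomial_eq, C_mul, mul_assoc, Finsupp.prod_fintype _ _ (fun i => pow_zero _),
        Finsupp.prod_fintype _ _ (fun i => pow_zero _), Finsupp.degree_eq_sum]
      congr 1
      simp only [smul_eq_C_mul, mul_pow, Finset.prod_mul_distrib, ← C_pow, Finset.prod_pow_eq_pow_sum, ← map_prod]
    rw [h1, pair_comm, pair_monomial, pair_comm, pair_monomial, coeff_map]
    by_cases h0 : coeff α P = 0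
    · simp [h0]
    · have : α.degree = p := by
        rw [Finsupp.degree_eq_weight_one]
        exact hP h0
      rw [this]
      simp only [map_mul, map_natCast]
      ring

lemma adM_scl (h : Λ) : (adM (s.map R) (X : Fin m → MvPolynomial (Fin m) R)).map (scl h)
    = h • adM (s.map Λ) (X : Fin m → MvPolynomial (Fin m) Λ) := by
  ext1 i j
  rw [Matrix.map_apply, adM_apply, Matrix.smul_apply, adM_apply, map_sum, Finset.smul_sum]
  refine Finset.sum_congr rfl fun l _ => ?_
  rw [map_mul, scl, aeval_X, AlgHom.commutes, smul_mul_assoc]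
  congr 2
  rw [IsScalarTower.algebraMap_apply R Λ (MvPolynomial (Fin m) Λ)]
  congr 1
  exact (IsScalarTower.algebraMap_apply K R Λ _).symm

/-- The logarithm of the twist provided by the loop calculus. -/
def rhoPoly (s : SC K m) (R : Type*) [CommRing R] [Algebra K R] [Algebra ℂ R] (M : ℕ) (κ : ℂ) : MvPolynomial (Fin m) R :=
  ∑ k ∈ Finset.Ico 1 M, (-(zt k / (k + 1)) * κ⁻¹ ^ (k + 1)) • trPoly s R (k + 1)

lemma scl_rhoPoly (h : Λ) (κ : ℂ) : scl h (rhoPoly s R M κ) = rho (s.map Λ) M (κ⁻¹ • h) X := by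
  rw [rhoPoly, map_sum, rho]
  refine Finset.sum_congr rfl fun k _ => ?_
  have hc (c : ℂ) (x : MvPolynomial (Fin m) R) : scl h (c • x) = c • scl h x :=
    map_smul ((scl h).restrictScalars ℂ) c x
  have ht (x : Matrix (Fin m) (Fin m) (MvPolynomial (Fin m) R)) :
      scl h (Matrix.trace x) = Matrix.trace ((scl h).mapMatrix x) := by
    simp [Matrix.trace]
  rw [hc, trPoly, ht, map_pow, AlgHom.mapMatrix_apply, adM_scl, smul_assoc, smul_pow κ⁻¹, Matrix.trace_smul, smul_smul]

lemma map_scl_genW (h : Λ) {κ : ℂ} (hκ : κ ≠ 0) :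
    Algebra.TensorProduct.map (scl (R := R) h) (AlgHom.id K U) (genW K e M (rhoPoly s R M κ))
      = gen1 (s.map Λ) K e M (κ⁻¹ • h) κ := by
  set F := Algebra.TensorProduct.map (scl (R := R) h) (AlgHom.id K U) with hF
  have hFn (x : MvPolynomial (Fin m) R ⊗[K] U) : F (nexp (M + 1) x) = nexp (M + 1) (F x) :=
    map_nexp (F.restrictScalars ℂ) _ _
  have hS (x : MvPolynomial (Fin m) R) : scl h (nexp (M + 1) x) = nexp (M + 1) (scl h x) :=
    map_nexp ((scl h).restrictScalars ℂ) _ _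
  have hi : F (iot K e (X : Fin m → MvPolynomial (Fin m) R))
      = κ • (κ⁻¹ • h) • iot K e (X : Fin m → MvPolynomial (Fin m) Λ) := by
    rw [← smul_assoc, smul_smul, mul_inv_cancel₀ hκ, one_smul, iot_apply, iot_apply, map_sum, Finset.smul_sum]
    refine Finset.sum_congr rfl fun i _ => ?_
    rw [hF, Algebra.TensorProduct.map_tmul, scl, aeval_X, TensorProduct.smul_tmul', AlgHom.id_apply]
  have h1 : F (nexp (M + 1) (iot K e (X : Fin m → MvPolynomial (Fin m) R)))
      = nexp (M + 1) (κ • (κ⁻¹ • h) • iot K e (X : Fin m → MvPolynomial (Fin m) Λ)) := by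
    rw [hFn, hi]
  have h2 : F ((nexp (M + 1) (rhoPoly s R M κ) : MvPolynomial (Fin m) R) ⊗ₜ[K] (1 : U))
      = (nexp (M + 1) (rho (s.map Λ) M (κ⁻¹ • h) (X : Fin m → MvPolynomial (Fin m) Λ)) : MvPolynomial (Fin m) Λ) ⊗ₜ[K] (1 : U) := by
    rw [hF, Algebra.TensorProduct.map_tmul, map_one, hS, scl_rhoPoly]
  exact (map_mul F _ _).trans (congrArg₂ (· * ·) h2 h1)

variable (K R) in
/-- Multiplication by a power of the deformation parameter. -/
def mulPow (h : Λ) (p : ℕ) : R →ₗ[K] Λ :=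
  (LinearMap.mulLeft K (h ^ p)).comp (IsScalarTower.toAlgHom K R Λ).toLinearMap

lemma mulPow_apply (h : Λ) (p : ℕ) (x : R) : mulPow K R h p x = h ^ p * algebraMap R Λ x := rfl

lemma rTensor_pair_scl (h : Λ) {P : MvPolynomial (Fin m) R} {p : ℕ} (hP : P.IsHomogeneous p)
    (z : MvPolynomial (Fin m) R ⊗[K] U) :
    ((pair (MvPolynomial.map (algebraMap R Λ) P)).restrictScalars K).rTensor U
        (Algebra.TensorProduct.map (scl h) (AlgHom.id K U) z)
      = (mulPow K R h p).rTensor U (((pair P).restrictScalars K).rTensor U z) := by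
  induction z using TensorProduct.induction_on with
  | zero => simp
  | add x y hx hy => simp only [map_add, hx, hy]
  | tmul x y =>
    rw [Algebra.TensorProduct.map_tmul, LinearMap.rTensor_tmul, LinearMap.rTensor_tmul, LinearMap.rTensor_tmul]
    simp only [LinearMap.coe_restrictScalars]
    rw [pair_scl h hP, mulPow_apply]
    rfl

lemma mulPow_mul (h : Λ) (p q : ℕ) (x y : R ⊗[K] U) : (mulPow K R h p).rTensor U x * (mulPow K R h q).rTensor U y
    = (mulPow K R h (p + q)).rTensor U (x * y) := by
  induction x using TensorProduct.induction_on with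
  | zero => simp
  | add x y hx hy => simp only [map_add, add_mul, hx, hy]
  | tmul a b =>
    induction y using TensorProduct.induction_on with
    | zero => simp
    | add x y hx hy => simp only [map_add, mul_add, hx, hy]
    | tmul u v =>
      rw [Algebra.TensorProduct.tmul_mul_tmul, LinearMap.rTensor_tmul, LinearMap.rTensor_tmul, LinearMap.rTensor_tmul,
        Algebra.TensorProduct.tmul_mul_tmul]
      congr 1
      rw [mulPow_apply, mulPow_apply, mulPow_apply, pow_add, map_mul]
      ring

theorem quant_mul_of_deformation {ε : ℂ} (he : ∀ i j, e i * e j - e j * e i = ∑ k, s.γ i j k • e k)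
    (hM : 1 ≤ M) (hε : ε = 1 ∨ ε = -1) {P Q : MvPolynomial (Fin m) R} {p q : ℕ}
    (hp : P.IsHomogeneous p) (hq : Q.IsHomogeneous q) (hP : ∀ b, linDer ((s.map R).γ b) P = 0)
    (hQ : ∀ b, linDer ((s.map R).γ b) Q = 0) {h : Λ} (hh : h ^ M = 0) (ψ : Λ →ₗ[R] R)
    (hψ : ∀ x, ψ (h ^ (p + q) * algebraMap R Λ x) = x) :
    quant K e M (rhoPoly s R M (2 * ε * (Real.pi * Complex.I))) P * quant K e M (rhoPoly s R M (2 * ε * (Real.pi * Complex.I))) Q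
      = quant K e M (rhoPoly s R M (2 * ε * (Real.pi * Complex.I))) (P * Q) := by
  set κ := 2 * ε * (Real.pi * Complex.I) with hκ
  have hκ0 : κ ≠ 0 := by
    have : ε ≠ 0 := by rcases hε with rfl | rfl <;> norm_num
    have hpi : (Real.pi : ℂ) ≠ 0 := by exact_mod_cast Real.pi_ne_zero
    simp [hκ, this, hpi]
  have hτ : (κ⁻¹ • h) ^ M = 0 := by rw [smul_pow, hh, smul_zero]
  have hl : ∀ {P : MvPolynomial (Fin m) R}, (∀ b, linDer ((s.map R).γ b) P = 0) → ∀ b, linDer ((s.map Λ).γ b)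
      (MvPolynomial.map (algebraMap R Λ) P) = 0 := by
    intro P hP b
    have h := congrArg (MvPolynomial.map (algebraMap R Λ)) (hP b)
    rw [linDer_apply, map_zero, map_sum] at h
    rw [linDer_apply, ← h]
    refine Finset.sum_congr rfl fun i _ => ?_
    rw [map_sum]
    refine Finset.sum_congr rfl fun j _ => ?_
    rw [smul_eq_C_mul, smul_eq_C_mul, map_mul, map_mul, map_C, map_X, pderiv_map]
    congr 2
    exact IsScalarTower.algebraMap_apply K R Λ _
  have key := rTensor_gen1_mul (s.map Λ) e (M := M) (τ := κ⁻¹ • h) s.γ hτ (fun _ _ _ => rfl) he hM hε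
    (hp.map (algebraMap R Λ)) (hq.map (algebraMap R Λ)) (hl hP) (hl hQ)
  rw [← hκ, ← map_scl_genW (R := R) s e M h hκ0, ← map_mul (MvPolynomial.map (algebraMap R Λ)), rTensor_pair_scl h hp, rTensor_pair_scl h hq,
    rTensor_pair_scl h (hp.mul hq), mulPow_mul] at key
  have hi : ∀ z : R ⊗[K] U, (ψ.restrictScalars K).rTensor U ((mulPow K R h (p + q)).rTensor U z) = z := by
    intro z
    rw [← LinearMap.comp_apply, ← LinearMap.rTensor_comp]
    have : (ψ.restrictScalars K).comp (mulPow K R h (p + q)) = LinearMap.id :=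
      LinearMap.ext fun x => hψ x
    rw [this, LinearMap.rTensor_id, LinearMap.id_apply]
  have := congrArg ((ψ.restrictScalars K).rTensor U) key
  rwa [hi, hi] at this

end Change

end Duflo

open scoped TensorProduct

namespace Duflo

open MvPolynomial

section Hom

variable {R σ : Type*} [CommRing R] [Fintype σ] [DecidableEq σ]

lemma isHomogeneous_linDer (a : σ → σ → R) {P : MvPolynomial σ R} {n : ℕ} (hP : P.IsHomogeneous n) :
    (linDer a P).IsHomogeneous n := by
  rw [linDer_apply]
  refine IsHomogeneous.sum _ _ _ fun i _ => IsHomogeneous.sum _ _ _ fun j _ => ?_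
  rw [smul_eq_C_mul]
  rcases Nat.eq_zero_or_pos n with rfl | hn
  · obtain ⟨c, rfl⟩ : ∃ c, P = C c := ⟨_, totalDegree_eq_zero_iff_eq_C.mp
      (Nat.le_zero.mp hP.totalDegree_le)⟩
    rw [pderiv_C, mul_zero, mul_zero]
    exact isHomogeneous_zero _ _ _
  · have h := ((isHomogeneous_X R j).mul (hP.pderiv (i := i))).C_mul (a i j)
    rwa [show 1 + (n - 1) = n by omega] at h

lemma linDer_homogeneousComponent (a : σ → σ → R) {P : MvPolynomial σ R} (hP : linDer a P = 0) (n : ℕ) :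
    linDer a (homogeneousComponent n P) = 0 := by
  have h := congrArg (homogeneousComponent n) hP
  conv_lhs at h => rw [← sum_homogeneousComponent P, map_sum, map_sum]
  rw [map_zero] at h
  have h1 (k : ℕ) : homogeneousComponent n (linDer a (homogeneousComponent k P))
      = if n = k then linDer a (homogeneousComponent k P) else 0 :=
    homogeneousComponent_of_mem (isHomogeneous_linDer a (homogeneousComponent_isHomogeneous k P))
  simp only [h1, Finset.sum_ite_eq, Finset.mem_range] at h
  by_cases hn : n < P.totalDegree + 1
  · rwa [if_pos hn] at h
  · rw [homogeneousComponent_eq_zero _ _ (by omega), map_zero]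

end Hom

section Trunc

variable (R : Type*) [CommRing R] (M : ℕ)

/-- Truncated polynomials in the deformation parameter. -/
abbrev Trunc := Polynomial R ⧸ Ideal.span {(Polynomial.X : Polynomial R) ^ M}

/-- The deformation parameter. -/
def hbar : Trunc R M := Ideal.Quotient.mk _ Polynomial.X

lemma hbar_pow : hbar R M ^ M = 0 := by
  rw [hbar, ← map_pow, Ideal.Quotient.eq_zero_iff_mem]
  exact Ideal.mem_span_singleton_self _

/-- Extraction of a coefficient. -/
def tcoeff {n : ℕ} (hn : n < M) : Trunc R M →ₗ[R] R :=
  Submodule.liftQ ((Ideal.span {(Polynomial.X : Polynomial R) ^ M}).restrictScalars R) (Polynomial.lcoeff R n)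
    fun f hf => by
      have : (Polynomial.X : Polynomial R) ^ M ∣ f := Ideal.mem_span_singleton.mp hf
      exact (Polynomial.X_pow_dvd_iff.mp this) n hn

lemma tcoeff_hbar_pow {n k : ℕ} (hn : n < M) (x : R) :
    tcoeff R M hn (hbar R M ^ k * algebraMap R (Trunc R M) x) = if n = k then x else 0 := by
  have : hbar R M ^ k * algebraMap R (Trunc R M) x
      = Ideal.Quotient.mk _ (Polynomial.X ^ k * Polynomial.C x) := by
    rw [map_mul, map_pow]
    rfl
  rw [this]
  change Polynomial.coeff (Polynomial.X ^ k * Polynomial.C x) n = _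
  rw [mul_comm, Polynomial.coeff_C_mul_X_pow]

end Trunc

section Quant

variable {K R U : Type*} [CommRing K] [CommRing R] [Ring U] [Algebra K R]
  [Algebra ℂ R] [Algebra K U] {m : ℕ} (s : SC K m)
  (e : Fin m → U) (M : ℕ)

lemma quant_zero (r : MvPolynomial (Fin m) R) : quant K e M r 0 = 0 := by
  rw [quant, map_zero]
  exact LinearMap.congr_fun (LinearMap.rTensor_zero _) _

lemma quant_add (r P Q : MvPolynomial (Fin m) R) : quant K e M r (P + Q) = quant K e M r P + quant K e M r Q := by
  rw [quant, map_add]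
  exact LinearMap.congr_fun (LinearMap.rTensor_add _ ((pair P).restrictScalars K) ((pair Q).restrictScalars K)) _

lemma quant_sum {ι : Type*} (t : Finset ι) (r : MvPolynomial (Fin m) R) (P : ι → MvPolynomial (Fin m) R) :
    quant K e M r (∑ i ∈ t, P i) = ∑ i ∈ t, quant K e M r (P i) :=
  map_sum (⟨⟨quant K e M r, quant_zero e M r⟩, quant_add e M r⟩ : MvPolynomial (Fin m) R →+ R ⊗[K] U) _ _

theorem quant_mul {ε : ℂ} (he : ∀ i j, e i * e j - e j * e i = ∑ k, s.γ i j k • e k)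
    (hε : ε = 1 ∨ ε = -1) {P Q : MvPolynomial (Fin m) R} (hPQ : P.totalDegree + Q.totalDegree < M)
    (hP : ∀ b, linDer ((s.map R).γ b) P = 0) (hQ : ∀ b, linDer ((s.map R).γ b) Q = 0) :
    quant K e M (rhoPoly s R M (2 * ε * (Real.pi * Complex.I))) P * quant K e M (rhoPoly s R M (2 * ε * (Real.pi * Complex.I))) Q
      = quant K e M (rhoPoly s R M (2 * ε * (Real.pi * Complex.I))) (P * Q) := by
  conv_lhs => rw [← sum_homogeneousComponent P, ← sum_homogeneousComponent Q]
  conv_rhs => rw [← sum_homogeneousComponent P, ← sum_homogeneousComponent Q]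
  rw [quant_sum, quant_sum, Finset.sum_mul_sum, Finset.sum_mul_sum, quant_sum]
  refine Finset.sum_congr rfl fun p hp => ?_
  rw [quant_sum]
  refine Finset.sum_congr rfl fun q hq => ?_
  rw [Finset.mem_range] at hp hq
  exact quant_mul_of_deformation (Λ := Trunc R M) s e M he (by omega) hε (homogeneousComponent_isHomogeneous p P)
    (homogeneousComponent_isHomogeneous q Q) (fun b => linDer_homogeneousComponent _ (hP b) p)
    (fun b => linDer_homogeneousComponent _ (hQ b) q) (hbar_pow R M) (tcoeff R M (n := p + q) (by omega))
    fun x => by rw [tcoeff_hbar_pow, if_pos rfl]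

end Quant

end Duflo

open scoped TensorProduct

namespace Duflo

open MvPolynomial

section ContrBasic

variable {R : Type*} [CommRing R] [Algebra ℚ R] {m : ℕ}

lemma contr_add (f g P : MvPolynomial (Fin m) R) : contr (f + g) P = contr f P + contr g P :=
  pair_right_injective fun h => by
    rw [map_add, LinearMap.add_apply, pair_contr, pair_contr, pair_contr, add_mul, map_add]

lemma contr_zero (P : MvPolynomial (Fin m) R) : contr 0 P = 0 :=
  pair_right_injective fun h => by rw [pair_contr, zero_mul, map_zero, map_zero, LinearMap.zero_apply]

lemma contr_one (P : MvPolynomial (Fin m) R) : contr 1 P = P :=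
  pair_right_injective fun h => by rw [pair_contr, one_mul]

lemma contr_sum {ι : Type*} (t : Finset ι) (f : ι → MvPolynomial (Fin m) R) (P : MvPolynomial (Fin m) R) :
    contr (∑ i ∈ t, f i) P = ∑ i ∈ t, contr (f i) P :=
  map_sum (⟨⟨fun f => contr f P, contr_zero P⟩, fun f g => contr_add f g P⟩ :
    MvPolynomial (Fin m) R →+ MvPolynomial (Fin m) R) _ _

lemma contr_contr (f g P : MvPolynomial (Fin m) R) : contr f (contr g P) = contr (f * g) P :=
  pair_right_injective fun h => by rw [pair_contr, pair_contr, pair_contr, mul_left_comm, mul_assoc]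

lemma contr_congr {f g P : MvPolynomial (Fin m) R} {M : ℕ} (hP : P.totalDegree < M)
    (h : f - g ∈ idealOfVars (Fin m) R ^ M) : contr f P = contr g P :=
  pair_right_injective fun x => by
    rw [pair_contr, pair_contr, ← sub_eq_zero, ← map_sub, ← sub_mul]
    exact pair_eq_zero_of_mem hP (Ideal.mul_mem_right _ _ h)

lemma totalDegree_contr_le (f P : MvPolynomial (Fin m) R) : (contr f P).totalDegree ≤ P.totalDegree := by
  refine Finset.sup_le fun α hα => ?_
  by_contra hlt
  rw [Finsupp.sum_fintype _ _ (fun _ => rfl)] at hlt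
  have h0 : pair (contr f P) (monomial α 1) = 0 := by
    rw [pair_contr]
    refine pair_eq_zero_of_mem (Nat.lt_succ_self _) (Ideal.mul_mem_left _ _ ?_)
    refine (mem_pow_idealOfVars_iff _ _).mpr fun β hβ => ?_
    have : β = α := by
      by_contra hne
      exact (mem_support_iff.mp hβ) (by rw [coeff_monomial, if_neg (Ne.symm hne)])
    rw [this, Finsupp.degree_eq_sum]
    omega
  rw [pair_comm, pair_monomial, one_mul] at h0
  have hu : IsUnit (mfact α : R) := by
    have h0 : (mfact α : ℚ) ≠ 0 := by exact_mod_cast (Finset.prod_pos fun i _ => Nat.factorial_pos _).ne'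
    simpa using (IsUnit.mk0 _ h0).map (algebraMap ℚ R)
  exact mem_support_iff.mp hα (hu.mul_right_eq_zero.mp h0)

end ContrBasic

section ContrC

variable {R : Type*} [CommRing R] [Algebra ℂ R] [Algebra ℚ R] {m : ℕ} {K U : Type*} [CommRing K] [Ring U] [Algebra K R]
  [Algebra K U] (e : Fin m → U) (M : ℕ)

lemma contr_smul (c : ℂ) (f P : MvPolynomial (Fin m) R) : contr (c • f) P = c • contr f P := by
  rw [← algebraMap_smul R c f, ← algebraMap_smul R c (contr f P)]
  refine pair_right_injective fun h => ?_
  rw [map_smul, LinearMap.smul_apply, pair_contr, pair_contr, smul_mul_assoc, map_smul]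

lemma nexp_mul_sub_mem {f g : MvPolynomial (Fin m) R} (hf : f ∈ idealOfVars (Fin m) R)
    (hg : g ∈ idealOfVars (Fin m) R) :
    nexp (M + 1) f * nexp (M + 1) g - nexp (M + 1) (f + g) ∈ idealOfVars (Fin m) R ^ M := by
  rw [← Ideal.Quotient.eq_zero_iff_mem, map_sub, sub_eq_zero, map_mul]
  have hn (x : MvPolynomial (Fin m) R) : Ideal.Quotient.mk (idealOfVars (Fin m) R ^ M) (nexp (M + 1) x)
      = nexp (M + 1) (Ideal.Quotient.mk (idealOfVars (Fin m) R ^ M) x) :=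
    map_nexp (Ideal.Quotient.mkₐ ℂ (idealOfVars (Fin m) R ^ M)) _ _
  have h0 {x : MvPolynomial (Fin m) R} (hx : x ∈ idealOfVars (Fin m) R) :
      (Ideal.Quotient.mk (idealOfVars (Fin m) R ^ M) x) ^ M = 0 := by
    rw [← map_pow, Ideal.Quotient.eq_zero_iff_mem]
    exact Ideal.pow_mem_pow hx M
  rw [hn, hn, hn, map_add]
  refine (nexp_add (Commute.all _ _) (h0 hf) (h0 hg) ?_).symm
  rw [← map_add]
  exact h0 (Ideal.add_mem _ hf hg)

lemma rTensor_pair_contr (f P : MvPolynomial (Fin m) R) (z : MvPolynomial (Fin m) R ⊗[K] U) :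
    ((pair (contr f P)).restrictScalars K).rTensor U z
      = ((pair P).restrictScalars K).rTensor U (f ⊗ₜ 1 * z) := by
  induction z using TensorProduct.induction_on with
  | zero => simp
  | add x y hx hy => simp only [map_add, mul_add, hx, hy]
  | tmul x y =>
    rw [Algebra.TensorProduct.tmul_mul_tmul, LinearMap.rTensor_tmul, LinearMap.rTensor_tmul, one_mul]
    simp only [LinearMap.coe_restrictScalars]
    rw [pair_contr]

lemma quant_contr {f g P : MvPolynomial (Fin m) R} (hf : f ∈ idealOfVars (Fin m) R)
    (hg : g ∈ idealOfVars (Fin m) R) (hP : P.totalDegree < M) :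
    quant K e M f (contr (nexp (M + 1) g) P) = quant K e M (f + g) P := by
  have h : contr (nexp (M + 1) f) (contr (nexp (M + 1) g) P) = contr (nexp (M + 1) (f + g)) P := by
    rw [contr_contr]
    exact contr_congr hP (nexp_mul_sub_mem M hf hg)
  rw [quant, quant, genW, genW, ← rTensor_pair_contr, h, rTensor_pair_contr]

lemma contr_nexp_add {f g P : MvPolynomial (Fin m) R} (hf : f ∈ idealOfVars (Fin m) R)
    (hg : g ∈ idealOfVars (Fin m) R) (hP : P.totalDegree < M) :
    contr (nexp (M + 1) f) (contr (nexp (M + 1) g) P) = contr (nexp (M + 1) (f + g)) P := by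
  rw [contr_contr]
  exact contr_congr hP (nexp_mul_sub_mem M hf hg)

lemma nexp_zero_arg {S : Type*} [Ring S] [Algebra ℂ S] : nexp (M + 1) (0 : S) = 1 := by
  rw [nexp, Finset.sum_range_succ']
  simp

lemma quant_injective {f : MvPolynomial (Fin m) R} (hf : f ∈ idealOfVars (Fin m) R)
    (hinj : ∀ P : MvPolynomial (Fin m) R, P.totalDegree < M → quant K e M 0 P = 0 → P = 0)
    {P : MvPolynomial (Fin m) R} (hP : P.totalDegree < M) (h : quant K e M f P = 0) : P = 0 := by
  have h1 := quant_contr (K := K) e M (Ideal.zero_mem _) hf hP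
  rw [zero_add, h] at h1
  have h2 := hinj _ ((totalDegree_contr_le _ _).trans_lt hP) h1
  have h3 := contr_nexp_add M ((Ideal.neg_mem_iff _).mpr hf) hf hP
  rw [h2, neg_add_cancel, nexp_zero_arg, contr_one] at h3
  rw [← h3]
  refine pair_right_injective fun x => ?_
  rw [pair_contr, map_zero, LinearMap.zero_apply, LinearMap.zero_apply]

end ContrC

end Duflo

open scoped TensorProduct

namespace Duflo

open MvPolynomial

section Inv

variable {K R : Type*} [CommRing K] [CommRing R] [Algebra K R] {m : ℕ} (s : SC K m)

lemma linDer_trPoly (b : Fin m) (k : ℕ) : linDer (fun i j => (s.map R).γ b j i) (trPoly s R (k + 1)) = 0 := by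
  set δ := linDer (fun i j => (s.map R).γ b j i) with hδ
  have h1 : (δ ∘ X : Fin m → MvPolynomial (Fin m) R)
      = (adM (s.map R) (Pi.single b (1 : MvPolynomial (Fin m) R))).mulVec X := by
    funext i
    rw [Function.comp_apply, hδ, linDer_X]
    simp [Matrix.mulVec, dotProduct, adM_apply, Pi.single_apply, Algebra.smul_def]
  rw [trPoly, der_trace_pow, adM_der, h1, adM_jacobi, mul_sub, Matrix.trace_sub, ← mul_assoc, ← mul_assoc,
    Matrix.trace_mul_comm (_ * adM (s.map R) (Pi.single b 1)), ← mul_assoc, ← pow_succ', ← pow_succ, 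
    Matrix.trace_mul_comm, sub_eq_zero.mpr, smul_zero]
  rw [Matrix.trace_mul_comm]

lemma trPoly_mem (k : ℕ) : trPoly s R (k + 1) ∈ idealOfVars (Fin m) R := by
  rw [trPoly, Matrix.trace]
  refine Ideal.sum_mem _ fun i _ => ?_
  rw [Matrix.diag_apply, pow_succ, Matrix.mul_apply]
  refine Ideal.sum_mem _ fun j _ => Ideal.mul_mem_left _ _ ?_
  rw [adM_apply]
  exact Ideal.sum_mem _ fun l _ => Ideal.mul_mem_right _ _ (Ideal.subset_span ⟨l, rfl⟩)

variable [Algebra ℂ R]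

lemma linDer_smul (a : Fin m → Fin m → R) (c : ℂ) (f : MvPolynomial (Fin m) R) : linDer a (c • f) = c • linDer a f := by
  rw [← algebraMap_smul R c f, ← algebraMap_smul R c (linDer a f), Derivation.map_smul]

lemma linDer_rhoPoly (b : Fin m) (M : ℕ) (κ : ℂ) : linDer (fun i j => (s.map R).γ b j i) (rhoPoly s R M κ) = 0 := by
  rw [rhoPoly, map_sum]
  refine Finset.sum_eq_zero fun k _ => ?_
  rw [linDer_smul, linDer_trPoly, smul_zero]

lemma rhoPoly_mem (M : ℕ) (κ : ℂ) : rhoPoly s R M κ ∈ idealOfVars (Fin m) R :=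
  Ideal.sum_mem _ fun k _ => TA.ℂ_smul_mem _ _ (trPoly_mem s k)

lemma linDer_nexp (a : Fin m → Fin m → R) (N : ℕ) {f : MvPolynomial (Fin m) R} (hf : linDer a f = 0) :
    linDer a (nexp N f) = 0 := by
  rw [nexp, map_sum]
  refine Finset.sum_eq_zero fun k _ => ?_
  rw [linDer_smul, Derivation.leibniz_pow, hf, smul_zero, smul_zero, smul_zero]

end Inv

section Even

variable {K R U : Type*} [CommRing K] [Field R] [CharZero R] [Ring U] [Algebra K R]
  [Algebra ℂ R] [Algebra K U] {m : ℕ} (s : SC K m) (e : Fin m → U) (M : ℕ)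

lemma quant_sub (r P Q : MvPolynomial (Fin m) R) : quant K e M r (P - Q) = quant K e M r P - quant K e M r Q := by
  rw [eq_sub_iff_add_eq, ← quant_add, sub_add_cancel]

/-- A one-parameter family of operators `contr (exp (t o))`, as a polynomial in the parameter. -/
def famPoly (o P : MvPolynomial (Fin m) R) : Polynomial (MvPolynomial (Fin m) R) :=
  ∑ k ∈ Finset.range (M + 1), Polynomial.monomial k (((k.factorial : ℂ))⁻¹ • contr (o ^ k) P)

lemma eval_famPoly (o P : MvPolynomial (Fin m) R) (t : ℕ) :
    (famPoly M o P).eval (t : MvPolynomial (Fin m) R) = contr (nexp (M + 1) ((t : ℂ) • o)) P := by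
  rw [famPoly, Polynomial.eval_finset_sum, nexp, contr_sum]
  refine Finset.sum_congr rfl fun k _ => ?_
  rw [Polynomial.eval_monomial, smul_pow, smul_comm, contr_smul, contr_smul, Algebra.smul_def ((t : ℂ) ^ k), mul_comm]
  simp

lemma contr_nexp_mul {o P Q : MvPolynomial (Fin m) R} (ho : o ∈ idealOfVars (Fin m) R)
    (hPQ : P.totalDegree + Q.totalDegree < M)
    (h : ∀ P' Q' : MvPolynomial (Fin m) R, (∃ k : ℕ, P' = contr (nexp (M + 1) (((2 * k : ℕ) : ℂ) • o)) P) →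
      (∃ k : ℕ, Q' = contr (nexp (M + 1) (((2 * k : ℕ) : ℂ) • o)) Q) →
      contr (nexp (M + 1) ((2 : ℂ) • o)) (P' * Q')
        = contr (nexp (M + 1) ((2 : ℂ) • o)) P' * contr (nexp (M + 1) ((2 : ℂ) • o)) Q') :
    contr (nexp (M + 1) o) (P * Q) = contr (nexp (M + 1) o) P * contr (nexp (M + 1) o) Q := by
  have hPM : P.totalDegree < M := by omega
  have hQM : Q.totalDegree < M := by omega
  have hPQM : (P * Q).totalDegree < M := (totalDegree_mul P Q).trans_lt hPQ
  have hst {S : MvPolynomial (Fin m) R} (hS : S.totalDegree < M) (k : ℕ) :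
      contr (nexp (M + 1) ((2 : ℂ) • o)) (contr (nexp (M + 1) (((2 * k : ℕ) : ℂ) • o)) S)
        = contr (nexp (M + 1) (((2 * (k + 1) : ℕ) : ℂ) • o)) S := by
    rw [contr_nexp_add M (TA.ℂ_smul_mem _ _ ho) (TA.ℂ_smul_mem _ _ ho) hS, ← add_smul]
    congr 3
    push_cast
    ring
  have hk : ∀ k : ℕ, contr (nexp (M + 1) (((2 * k : ℕ) : ℂ) • o)) (P * Q)
      = contr (nexp (M + 1) (((2 * k : ℕ) : ℂ) • o)) P * contr (nexp (M + 1) (((2 * k : ℕ) : ℂ) • o)) Q := by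
    intro k
    induction k with
    | zero => simp only [mul_zero, Nat.cast_zero, zero_smul, nexp_zero_arg, contr_one]
    | succ k ih => rw [← hst hPQM, ← hst hPM, ← hst hQM, ih, h _ _ ⟨k, rfl⟩ ⟨k, rfl⟩]
  have hz : famPoly M o (P * Q) - famPoly M o P * famPoly M o Q = 0 := by
    refine Polynomial.eq_zero_of_infinite_isRoot _ (Set.Infinite.mono (s := Set.range fun k : ℕ =>
      ((2 * k : ℕ) : MvPolynomial (Fin m) R)) ?_ (Set.infinite_range_of_injective fun a b hab => ?_))
    · rintro _ ⟨k, rfl⟩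
      rw [Set.mem_setOf_eq, Polynomial.IsRoot.def, Polynomial.eval_sub, Polynomial.eval_mul, eval_famPoly,
        eval_famPoly, eval_famPoly, hk, sub_self]
    · have : 2 * a = 2 * b := Nat.cast_injective hab
      omega
  have h1 := congrArg (Polynomial.eval ((1 : ℕ) : MvPolynomial (Fin m) R)) hz
  rw [Polynomial.eval_sub, Polynomial.eval_mul, eval_famPoly, eval_famPoly, eval_famPoly, Polynomial.eval_zero,
    sub_eq_zero] at h1
  simpa only [Nat.cast_one, one_smul] using h1

/-- The even part of the logarithm of the twist. -/
def evenPoly (s : SC K m) (R : Type*) [CommRing R] [Algebra K R] [Algebra ℂ R] (M : ℕ) : MvPolynomial (Fin m) R :=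
  (2⁻¹ : ℂ) • (rhoPoly s R M (2 * 1 * (Real.pi * Complex.I)) + rhoPoly s R M (2 * (-1) * (Real.pi * Complex.I)))

theorem quant_evenPoly_mul (he : ∀ i j, e i * e j - e j * e i = ∑ k, s.γ i j k • e k)
    {P Q : MvPolynomial (Fin m) R} (hPQ : P.totalDegree + Q.totalDegree < M)
    (hP : ∀ b, linDer ((s.map R).γ b) P = 0) (hQ : ∀ b, linDer ((s.map R).γ b) Q = 0)
    (hinj : ∀ P : MvPolynomial (Fin m) R, P.totalDegree < M → quant K e M 0 P = 0 → P = 0) :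
    quant K e M (evenPoly s R M) P * quant K e M (evenPoly s R M) Q = quant K e M (evenPoly s R M) (P * Q) := by
  have hp := fun P Q => quant_mul (R := R) s e M he (Or.inl rfl) (P := P) (Q := Q)
  have hn := fun P Q => quant_mul (R := R) s e M he (Or.inr rfl) (P := P) (Q := Q)
  set rp := rhoPoly s R M (2 * 1 * (Real.pi * Complex.I)) with hrp
  set rn := rhoPoly s R M (2 * (-1) * (Real.pi * Complex.I)) with hrn
  have hrpm : rp ∈ idealOfVars (Fin m) R := rhoPoly_mem s M _
  have hrnm : rn ∈ idealOfVars (Fin m) R := rhoPoly_mem s M _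
  set o : MvPolynomial (Fin m) R := (2⁻¹ : ℂ) • (rp - rn) with ho
  have hom : o ∈ idealOfVars (Fin m) R := TA.ℂ_smul_mem _ _ (Ideal.sub_mem _ hrpm hrnm)
  have he1 : evenPoly s R M = rn + o := by
    rw [evenPoly, ← hrp, ← hrn, ho]
    module
  have he2 : rp = rn + (2 : ℂ) • o := by
    rw [ho]
    module
  have hoi : ∀ (t : ℂ) b, linDer (fun i j => (s.map R).γ b j i) (nexp (M + 1) (t • o)) = 0 := by
    intro t b
    refine linDer_nexp _ _ ?_
    rw [linDer_smul, ho, linDer_smul, map_sub, hrp, hrn, linDer_rhoPoly, linDer_rhoPoly, sub_zero, smul_zero, smul_zero]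
  have hinv : ∀ (t : ℂ) (P : MvPolynomial (Fin m) R), (∀ b, linDer ((s.map R).γ b) P = 0) →
      ∀ b, linDer ((s.map R).γ b) (contr (nexp (M + 1) (t • o)) P) = 0 :=
    fun t P hP b => linDer_contr _ (hoi t b) (hP b)
  have h2m : (2 : ℂ) • o ∈ idealOfVars (Fin m) R := TA.ℂ_smul_mem _ _ hom
  have hmul : ∀ P Q : MvPolynomial (Fin m) R, P.totalDegree + Q.totalDegree < M →
      (∀ b, linDer ((s.map R).γ b) P = 0) → (∀ b, linDer ((s.map R).γ b) Q = 0) →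
      contr (nexp (M + 1) ((2 : ℂ) • o)) (P * Q)
        = contr (nexp (M + 1) ((2 : ℂ) • o)) P * contr (nexp (M + 1) ((2 : ℂ) • o)) Q := by
    intro P Q hPQ hP hQ
    have hPQM : (P * Q).totalDegree < M := (totalDegree_mul P Q).trans_lt hPQ
    have hd : (contr (nexp (M + 1) ((2 : ℂ) • o)) P).totalDegree + (contr (nexp (M + 1) ((2 : ℂ) • o)) Q).totalDegree < M :=
      (add_le_add (totalDegree_contr_le _ _) (totalDegree_contr_le _ _)).trans_lt hPQ
    have h := hp P Q hPQ hP hQ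
    rw [he2, ← quant_contr e M hrnm h2m (by omega), ← quant_contr e M hrnm h2m (by omega),
      ← quant_contr e M hrnm h2m hPQM, hn _ _ hd (hinv _ _ hP) (hinv _ _ hQ)] at h
    refine sub_eq_zero.mp (quant_injective (K := K) e M hrnm hinj ?_ ?_)
    · refine (totalDegree_sub _ _).trans_lt (max_lt ?_ ?_)
      · exact (totalDegree_contr_le _ _).trans_lt hPQM
      · exact (totalDegree_mul _ _).trans_lt hd
    · rw [← sub_eq_zero] at h
      rw [quant_sub, ← neg_eq_zero, neg_sub]
      exact h
  have hone := contr_nexp_mul M (P := P) (Q := Q) hom hPQ (by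
    rintro _ _ ⟨k, rfl⟩ ⟨l, rfl⟩
    exact hmul _ _ ((add_le_add (totalDegree_contr_le _ _) (totalDegree_contr_le _ _)).trans_lt hPQ)
      (hinv _ _ hP) (hinv _ _ hQ))
  have hPQM : (P * Q).totalDegree < M := (totalDegree_mul P Q).trans_lt hPQ
  have hi1 : ∀ (P : MvPolynomial (Fin m) R), (∀ b, linDer ((s.map R).γ b) P = 0) →
      ∀ b, linDer ((s.map R).γ b) (contr (nexp (M + 1) o) P) = 0 := fun P hP => by
    simpa only [one_smul] using hinv 1 P hP
  rw [he1, ← quant_contr e M hrnm hom (by omega), ← quant_contr e M hrnm hom (by omega),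
    ← quant_contr e M hrnm hom hPQM, hone]
  exact hn _ _ ((add_le_add (totalDegree_contr_le _ _) (totalDegree_contr_le _ _)).trans_lt hPQ) (hi1 _ hP) (hi1 _ hQ)

end Even

end Duflo

open scoped TensorProduct

namespace Duflo

section Order

variable {K : Type*} [Field K] {m : ℕ}

/-- A power series all of whose terms have degree at least `n`. -/
def OrdGE (n : ℕ) (f : MvPowerSeries (Fin m) K) : Prop := ∀ α : Fin m →₀ ℕ, α.degree < n → MvPowerSeries.coeff α f = 0

lemma ordGE_zero (f : MvPowerSeries (Fin m) K) : OrdGE 0 f := fun _ h => absurd h (Nat.not_lt_zero _)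

lemma OrdGE.neg {n : ℕ} {f : MvPowerSeries (Fin m) K} (hf : OrdGE n f) : OrdGE n (-f) :=
  fun α h => by rw [map_neg, hf α h, neg_zero]

lemma OrdGE.sum {ι : Type*} {n : ℕ} (t : Finset ι) {f : ι → MvPowerSeries (Fin m) K} (hf : ∀ i ∈ t, OrdGE n (f i)) :
    OrdGE n (∑ i ∈ t, f i) :=
  fun α h => by rw [map_sum]; exact Finset.sum_eq_zero fun i hi => hf i hi α h

lemma OrdGE.mul {k n : ℕ} {f g : MvPowerSeries (Fin m) K} (hf : OrdGE k f) (hg : OrdGE n g) : OrdGE (k + n) (f * g) := by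
  classical
  intro α h
  rw [MvPowerSeries.coeff_mul]
  refine Finset.sum_eq_zero fun p hp => ?_
  rw [← Finset.HasAntidiagonal.mem_antidiagonal.mp hp, map_add] at h
  by_cases h1 : p.1.degree < k
  · rw [hf _ h1, zero_mul]
  · rw [hg _ (by omega), mul_zero]

lemma OrdGE.mul_left {n : ℕ} (f : MvPowerSeries (Fin m) K) {g : MvPowerSeries (Fin m) K} (hg : OrdGE n g) : OrdGE n (f * g) := by
  simpa using (ordGE_zero f).mul hg

lemma OrdGE.pderiv {n : ℕ} {f : MvPowerSeries (Fin m) K} (hf : OrdGE (n + 1) f) (i : Fin m) :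
    OrdGE n (MvPowerSeries.pderiv K i f) := by
  intro α h
  rw [MvPowerSeries.coeff_pderiv, hf _ (by rw [map_add, Finsupp.degree_single]; omega), zero_mul]

lemma ordGE_X (i : Fin m) : OrdGE 1 (MvPowerSeries.X i : MvPowerSeries (Fin m) K) := by
  classical
  intro α h
  rw [MvPowerSeries.coeff_X, if_neg]
  rintro rfl
  rw [Finsupp.degree_single] at h
  exact lt_irrefl _ h

lemma eq_zero_of_ordGE {f : MvPowerSeries (Fin m) K} (h : ∀ n, OrdGE n f) : f = 0 :=
  MvPowerSeries.ext fun α => h (α.degree + 1) α (Nat.lt_succ_self _)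

end Order

section Euler

variable (K : Type*) [Field K] (m : ℕ)

/-- The Euler derivation. -/
def eulerD : Derivation K (MvPowerSeries (Fin m) K) (MvPowerSeries (Fin m) K) :=
  ∑ i, (MvPowerSeries.X i : MvPowerSeries (Fin m) K) • MvPowerSeries.pderiv K i

variable {K m}

lemma coeff_X_mul_pderiv (i : Fin m) (f : MvPowerSeries (Fin m) K) (α : Fin m →₀ ℕ) :
    MvPowerSeries.coeff α (MvPowerSeries.X i * MvPowerSeries.pderiv K i f) = α i * MvPowerSeries.coeff α f := by
  rw [MvPowerSeries.X, MvPowerSeries.coeff_monomial_mul, one_mul, MvPowerSeries.coeff_pderiv]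
  split_ifs with h
  · have h1 : 1 ≤ α i := by simpa using h i
    rw [tsub_add_cancel_of_le h, mul_comm, Finsupp.tsub_apply, Finsupp.single_eq_same, Nat.cast_sub h1]
    simp
  · have h1 : α i = 0 := by
      by_contra h2
      refine h (Finsupp.single_le_iff.mpr (Nat.one_le_iff_ne_zero.mpr h2))
    rw [h1, Nat.cast_zero, zero_mul]

lemma coeff_eulerD (f : MvPowerSeries (Fin m) K) (α : Fin m →₀ ℕ) :
    MvPowerSeries.coeff α (eulerD K m f) = α.degree * MvPowerSeries.coeff α f := by
  rw [eulerD, derivation_sum_apply, map_sum, Finsupp.degree_eq_sum, Nat.cast_sum, Finset.sum_mul]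
  exact Finset.sum_congr rfl fun i _ => coeff_X_mul_pderiv i f α

lemma OrdGE.of_eulerD [CharZero K] {n k : ℕ} {f : MvPowerSeries (Fin m) K} (h : OrdGE n (eulerD K m f + (k + 1) • f)) :
    OrdGE n f := by
  intro α hα
  have h1 := h α hα
  rw [map_add, map_nsmul, coeff_eulerD, nsmul_eq_mul, ← add_mul, ← Nat.cast_add] at h1
  exact (mul_eq_zero.mp h1).resolve_left (Nat.cast_ne_zero.mpr (by omega))

lemma ps_pderiv_comm (i j : Fin m) (f : MvPowerSeries (Fin m) K) :
    MvPowerSeries.pderiv K i (MvPowerSeries.pderiv K j f) = MvPowerSeries.pderiv K j (MvPowerSeries.pderiv K i f) := by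
  ext α
  simp only [MvPowerSeries.coeff_pderiv, add_right_comm _ (Finsupp.single j 1)]
  by_cases h : i = j
  · rw [h]
  · simp [h, Ne.symm h]
    ring

lemma eulerD_pderiv (i : Fin m) (f : MvPowerSeries (Fin m) K) :
    MvPowerSeries.pderiv K i (eulerD K m f) = eulerD K m (MvPowerSeries.pderiv K i f) + MvPowerSeries.pderiv K i f := by
  rw [eulerD, derivation_sum_apply, derivation_sum_apply, map_sum]
  simp only [Derivation.smul_apply, Derivation.leibniz, smul_eq_mul, Finset.sum_add_distrib, MvPowerSeries.pderiv_X]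
  congr 1
  · exact Finset.sum_congr rfl fun l _ => by rw [ps_pderiv_comm]
  · simp [Pi.single_apply]

end Euler

section MC

variable {K : Type*} [Field K] [CharZero K] {m : ℕ} (s : SC K m)

/-- The Maurer–Cartan form in exponential coordinates. -/
def mcT : Matrix (Fin m) (Fin m) (MvPowerSeries (Fin m) K) := Matrix.of fun i j α =>
  ((α.degree + 1).factorial : K)⁻¹ * MvPolynomial.coeff α (((-adM s MvPolynomial.X : Matrix (Fin m) (Fin m) (MvPolynomial (Fin m) K)) ^ α.degree) i j)

lemma coeff_mcT (i j : Fin m) (α : Fin m →₀ ℕ) : MvPowerSeries.coeff α (mcT s i j) = ((α.degree + 1).factorial : K)⁻¹ *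
    MvPolynomial.coeff α (((-adM s MvPolynomial.X : Matrix (Fin m) (Fin m) (MvPolynomial (Fin m) K)) ^ α.degree) i j) := rfl

lemma coeff_X_mul_mcT (p l j : Fin m) (α : Fin m →₀ ℕ) : MvPowerSeries.coeff α (MvPowerSeries.X p * mcT s l j)
    = ((α.degree - 1 + 1).factorial : K)⁻¹ * MvPolynomial.coeff α (MvPolynomial.X p *
      (((-adM s MvPolynomial.X : Matrix (Fin m) (Fin m) (MvPolynomial (Fin m) K)) ^ (α.degree - 1)) l j)) := by
  rw [MvPowerSeries.X, MvPowerSeries.coeff_monomial_mul, one_mul, MvPolynomial.X, MvPolynomial.coeff_monomial_mul', one_mul]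
  split_ifs with h
  · have h1 : (α - Finsupp.single p 1).degree = α.degree - 1 := by
      have h2 := congrArg Finsupp.degree (tsub_add_cancel_of_le h)
      rw [map_add, Finsupp.degree_single] at h2
      omega
    rw [coeff_mcT, h1]
  · rw [mul_zero]

lemma mcT_euler : (mcT s).map (eulerD K m) + mcT s = 1 - adM s MvPowerSeries.X * mcT s := by
  ext i j α
  have hR : MvPowerSeries.coeff α ((adM s (MvPowerSeries.X : Fin m → MvPowerSeries (Fin m) K) * mcT s) i j)
      = -(((α.degree - 1 + 1).factorial : K)⁻¹ * MvPolynomial.coeff α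
        (((-adM s MvPolynomial.X : Matrix (Fin m) (Fin m) (MvPolynomial (Fin m) K)) ^ (α.degree - 1 + 1)) i j)) := by
    rw [pow_succ', Matrix.mul_apply, Matrix.mul_apply, map_sum, MvPolynomial.coeff_sum, Finset.mul_sum, ← Finset.sum_neg_distrib]
    refine Finset.sum_congr rfl fun l _ => ?_
    rw [Matrix.neg_apply, neg_mul, MvPolynomial.coeff_neg, mul_neg, neg_neg, adM_apply, adM_apply, Finset.sum_mul,
      Finset.sum_mul, map_sum, MvPolynomial.coeff_sum, Finset.mul_sum]
    refine Finset.sum_congr rfl fun p _ => ?_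
    rw [mul_right_comm, mul_comm, ← Algebra.smul_def, map_smul, coeff_X_mul_mcT, mul_right_comm, mul_comm (_ * _) (algebraMap _ _ _),
      ← Algebra.smul_def, MvPolynomial.coeff_smul, smul_eq_mul, smul_eq_mul]
    ring
  have hL : ((α.degree : K) + 1) * ((α.degree + 1).factorial : K)⁻¹ = (α.degree.factorial : K)⁻¹ := by
    have := Nat.factorial_ne_zero α.degree
    rw [Nat.factorial_succ]
    push_cast
    field_simp
  rw [Matrix.add_apply, Matrix.sub_apply, Matrix.map_apply, map_add, map_sub, coeff_eulerD, hR, coeff_mcT, ← add_one_mul, ← mul_assoc, hL]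
  rcases Nat.eq_zero_or_pos α.degree with h | h
  · have h0 : α = 0 := (Finsupp.degree_eq_zero_iff α).mp h
    have h1 : MvPolynomial.coeff 0 (((-adM s MvPolynomial.X : Matrix (Fin m) (Fin m) (MvPolynomial (Fin m) K)) ^ (0 - 1 + 1)) i j) = 0 := by
      rw [zero_tsub, zero_add, pow_one, Matrix.neg_apply, MvPolynomial.coeff_neg, adM_apply, MvPolynomial.coeff_sum,
        Finset.sum_eq_zero fun p _ => ?_, neg_zero]
      rw [MvPolynomial.algebraMap_eq, mul_comm, MvPolynomial.coeff_C_mul, MvPolynomial.coeff_zero_X, mul_zero]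
    rw [h0, map_zero, h1]
    rw [pow_zero, Nat.factorial_zero, Matrix.one_apply, Matrix.one_apply]
    split_ifs <;> simp
  · have h1 : MvPowerSeries.coeff α ((1 : Matrix (Fin m) (Fin m) (MvPowerSeries (Fin m) K)) i j) = 0 := by
      classical
      have h0 : α ≠ 0 := by rintro rfl; simp at h
      rw [Matrix.one_apply]
      split_ifs
      · rw [MvPowerSeries.coeff_one, if_neg h0]
      · exact map_zero _
    rw [h1, Nat.sub_add_cancel h, zero_sub, neg_neg]

lemma constantCoeff_mcT : (MvPowerSeries.constantCoeff (R := K) (σ := Fin m)).mapMatrix (mcT s) = 1 := by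
  ext i j
  rw [RingHom.mapMatrix_apply, Matrix.map_apply, ← MvPowerSeries.coeff_zero_eq_constantCoeff_apply, coeff_mcT]
  simp only [map_zero, zero_add, Nat.factorial_one, Nat.cast_one, inv_one, one_mul, pow_zero]
  rw [Matrix.one_apply, Matrix.one_apply]
  split_ifs <;> simp

lemma isUnit_mcT : IsUnit (mcT s) := by
  rw [Matrix.isUnit_iff_isUnit_det, MvPowerSeries.isUnit_iff_constantCoeff, RingHom.map_det, constantCoeff_mcT, Matrix.det_one]
  exact isUnit_one

/-- The columns of the Maurer–Cartan form. -/
def mcC (j : Fin m) : Fin m → MvPowerSeries (Fin m) K := fun i => mcT s i j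

lemma mcC_euler (j : Fin m) : eulerD K m ∘ mcC s j + mcC s j
    = Pi.single j 1 - (adM s MvPowerSeries.X).mulVec (mcC s j) := by
  funext i
  refine (congrFun (congrFun (mcT_euler s) i) j).trans ?_
  rw [Pi.sub_apply]
  change (1 : Matrix (Fin m) (Fin m) (MvPowerSeries (Fin m) K)) i j - _ = _
  rw [Matrix.one_apply, Pi.single_apply]
  rfl

/-- The curvature of the Maurer–Cartan form. -/
def mcO (i j : Fin m) : Fin m → MvPowerSeries (Fin m) K :=
  MvPowerSeries.pderiv K i ∘ mcC s j - MvPowerSeries.pderiv K j ∘ mcC s i + (adM s (mcC s i)).mulVec (mcC s j)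

lemma mcO_euler (i j : Fin m) :
    eulerD K m ∘ mcO s i j + 2 • mcO s i j = -((adM s MvPowerSeries.X).mulVec (mcO s i j)) := by
  have hp (i j : Fin m) : eulerD K m ∘ (MvPowerSeries.pderiv K i ∘ mcC s j) + 2 • (MvPowerSeries.pderiv K i ∘ mcC s j)
      = -((adM s (Pi.single i 1)).mulVec (mcC s j) + (adM s MvPowerSeries.X).mulVec (MvPowerSeries.pderiv K i ∘ mcC s j)) := by
    have h1 := congrArg (fun v => MvPowerSeries.pderiv K i ∘ v) (mcC_euler s j)
    have h2 : MvPowerSeries.pderiv K i ∘ (Pi.single j 1 - (adM s MvPowerSeries.X).mulVec (mcC s j))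
        = -((adM s (Pi.single i 1)).mulVec (mcC s j) + (adM s MvPowerSeries.X).mulVec (MvPowerSeries.pderiv K i ∘ mcC s j)) := by
      have h3 := map_der_mulVec (MvPowerSeries.pderiv K i) (adM s MvPowerSeries.X) (mcC s j)
      rw [adM_der] at h3
      have h4 : MvPowerSeries.pderiv K i ∘ MvPowerSeries.X = Pi.single i 1 := by
        funext l
        rw [Function.comp_apply, MvPowerSeries.pderiv_X]
      rw [h4] at h3
      rw [← h3]
      funext l
      have h5 : MvPowerSeries.pderiv K i ((Pi.single j 1 : Fin m → MvPowerSeries (Fin m) K) l) = 0 := by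
        rw [Pi.single_apply]; split_ifs <;> simp
      simp only [Function.comp_apply, Pi.sub_apply, map_sub, h5, zero_sub, Pi.neg_apply]
    rw [← h2, ← h1]
    funext l
    simp only [Function.comp_apply, Pi.add_apply, map_add, eulerD_pderiv, Pi.smul_apply, two_smul]
    ring
  have hb : eulerD K m ∘ ((adM s (mcC s i)).mulVec (mcC s j)) + 2 • (adM s (mcC s i)).mulVec (mcC s j)
      = (adM s (Pi.single i 1)).mulVec (mcC s j) - (adM s (Pi.single j 1)).mulVec (mcC s i)
        - (adM s MvPowerSeries.X).mulVec ((adM s (mcC s i)).mulVec (mcC s j)) := by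
    have e1 : eulerD K m ∘ mcC s i = Pi.single i 1 - (adM s MvPowerSeries.X).mulVec (mcC s i) - mcC s i :=
      eq_sub_of_add_eq (mcC_euler s i)
    have e2 : eulerD K m ∘ mcC s j = Pi.single j 1 - (adM s MvPowerSeries.X).mulVec (mcC s j) - mcC s j :=
      eq_sub_of_add_eq (mcC_euler s j)
    rw [map_der_mulVec, adM_der, e1, e2, map_sub, map_sub, adM_jacobi, adM_antisymm s (Pi.single j 1)]
    simp only [Matrix.sub_mulVec, Matrix.mulVec_sub, two_smul, ← Matrix.mulVec_mulVec]
    abel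
  have hE (v w : Fin m → MvPowerSeries (Fin m) K) : eulerD K m ∘ (v + w) = eulerD K m ∘ v + eulerD K m ∘ w := by
    funext; simp
  have hE' (v w : Fin m → MvPowerSeries (Fin m) K) : eulerD K m ∘ (v - w) = eulerD K m ∘ v - eulerD K m ∘ w := by
    funext; simp
  have hpi := hp i j
  have hpj := hp j i
  rw [mcO, hE, hE', Matrix.mulVec_add, Matrix.mulVec_sub]
  simp only [smul_add, smul_sub] at *
  linear_combination (exp := 1) hpi - hpj + hb

lemma mcO_eq_zero (i j : Fin m) : mcO s i j = 0 := by
  have key (k : ℕ) : ∀ l, OrdGE k (mcO s i j l) := by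
    induction k with
    | zero => exact fun l => ordGE_zero _
    | succ k ih =>
      intro l
      refine OrdGE.of_eulerD (k := 1) ?_
      have h1 := congrFun (mcO_euler s i j) l
      simp only [Pi.add_apply, Function.comp_apply, Pi.smul_apply, Pi.neg_apply] at h1
      rw [show 1 + 1 = 2 from rfl, h1, Matrix.mulVec, dotProduct]
      refine (OrdGE.sum _ fun q _ => ?_).neg
      rw [add_comm k 1, adM_apply]
      refine OrdGE.mul (OrdGE.sum _ fun p _ => ?_) (ih q)
      rw [mul_comm]
      exact (ordGE_X p).mul_left _
  funext l
  exact eq_zero_of_ordGE fun k => key k l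

end MC

end Duflo

open scoped TensorProduct

namespace Duflo

section Frame

variable {K : Type*} [Field K] [CharZero K] {m : ℕ} (s : SC K m)

/-- The inverse of the Maurer–Cartan form. -/
def mcU : Matrix (Fin m) (Fin m) (MvPowerSeries (Fin m) K) := Ring.inverse (mcT s)

/-- The left-invariant frame. -/
def mcV (j : Fin m) : Derivation K (MvPowerSeries (Fin m) K) (MvPowerSeries (Fin m) K) :=
  ∑ i, mcU s i j • MvPowerSeries.pderiv K i

lemma mcT_mul_mcU : mcT s * mcU s = 1 := Ring.mul_inverse_cancel _ (isUnit_mcT s)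

lemma mcU_mul_mcT : mcU s * mcT s = 1 := Ring.inverse_mul_cancel _ (isUnit_mcT s)

lemma mcV_apply (j : Fin m) (f : MvPowerSeries (Fin m) K) : mcV s j f = ∑ i, mcU s i j * MvPowerSeries.pderiv K i f := by
  rw [mcV, derivation_sum_apply]; rfl

lemma sum_mcT_mcV (i j a : Fin m) :
    ∑ l, mcT s a l * mcV s i (mcU s l j) = -∑ n, ∑ l, mcU s n i * mcU s l j * MvPowerSeries.pderiv K n (mcT s a l) := by
  have h1 := map_der_mul (mcV s i) (mcT s) (mcU s)
  rw [mcT_mul_mcU, map_der_one] at h1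
  have h2 := congrFun (congrFun h1.symm a) j
  rw [Matrix.add_apply, Matrix.mul_apply, Matrix.mul_apply, Matrix.zero_apply] at h2
  simp only [Matrix.map_apply] at h2
  rw [eq_neg_of_add_eq_zero_right h2, Finset.sum_comm]
  congr 1
  refine Finset.sum_congr rfl fun l _ => ?_
  rw [mcV_apply, Finset.sum_mul]
  exact Finset.sum_congr rfl fun n _ => by ring

lemma mcT_mcV_sub (i j a : Fin m) :
    ∑ l, mcT s a l * (mcV s i (mcU s l j) - mcV s j (mcU s l i)) = algebraMap K _ (s.γ i j a) := by
  simp only [mul_sub, Finset.sum_sub_distrib]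
  rw [sum_mcT_mcV s, sum_mcT_mcV s, Finset.sum_comm (f := fun n l => mcU s n j * mcU s l i * _),
    neg_sub_neg, ← Finset.sum_sub_distrib]
  have h1 (n l : Fin m) : MvPowerSeries.pderiv K l (mcT s a n) - MvPowerSeries.pderiv K n (mcT s a l)
      = ∑ q, (∑ p, mcT s p n * algebraMap K _ (s.γ p q a)) * mcT s q l := by
    have h2 := congrFun (mcO_eq_zero s n l) a
    rw [mcO, Pi.add_apply, Pi.sub_apply, Pi.zero_apply] at h2
    have h3 := (neg_eq_of_add_eq_zero_right h2)
    rw [neg_sub] at h3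
    exact h3
  have h4 (n l : Fin m) : ∑ p, mcT s n p * mcU s p l = if n = l then 1 else 0 := by
    have := congrFun (congrFun (mcT_mul_mcU s) n) l
    rwa [Matrix.mul_apply, Matrix.one_apply] at this
  calc _ = ∑ n, ∑ l, mcU s n i * mcU s l j * (MvPowerSeries.pderiv K l (mcT s a n) - MvPowerSeries.pderiv K n (mcT s a l)) := by
        refine Finset.sum_congr rfl fun n _ => ?_
        rw [← Finset.sum_sub_distrib]
        exact Finset.sum_congr rfl fun l _ => by ring
    _ = ∑ q, ∑ p, (∑ n, mcT s p n * mcU s n i) * (∑ l, mcT s q l * mcU s l j) * algebraMap K _ (s.γ p q a) := by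
        simp only [h1, Finset.mul_sum, Finset.sum_mul]
        have e (F : Fin m → Fin m → Fin m → Fin m → MvPowerSeries (Fin m) K) :
            ∑ n, ∑ l, ∑ q, ∑ p, F n l q p = ∑ q, ∑ p, ∑ l, ∑ n, F n l q p := by
          calc _ = ∑ n, ∑ q, ∑ p, ∑ l, F n l q p := by
                refine Finset.sum_congr rfl fun n _ => ?_
                rw [Finset.sum_comm]
                exact Finset.sum_congr rfl fun q _ => Finset.sum_comm
            _ = _ := by
                rw [Finset.sum_comm]
                refine Finset.sum_congr rfl fun q _ => ?_
                rw [Finset.sum_comm]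
                refine Finset.sum_congr rfl fun p _ => ?_
                exact Finset.sum_comm
        refine Eq.trans ?_ (e _)
        refine Finset.sum_congr rfl fun n _ => Finset.sum_congr rfl fun l _ => ?_
        refine Finset.sum_congr rfl fun q _ => Finset.sum_congr rfl fun p _ => ?_
        ring
    _ = _ := by
        simp only [h4]
        simp

lemma mcV_mcU_sub (i j l : Fin m) : mcV s i (mcU s l j) - mcV s j (mcU s l i) = ∑ k, s.γ i j k • mcU s l k := by
  have h1 : (fun l => mcV s i (mcU s l j) - mcV s j (mcU s l i))
      = (mcU s).mulVec ((mcT s).mulVec fun l => mcV s i (mcU s l j) - mcV s j (mcU s l i)) := by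
    rw [Matrix.mulVec_mulVec, mcU_mul_mcT, Matrix.one_mulVec]
  have h3 : ((mcT s).mulVec fun l => mcV s i (mcU s l j) - mcV s j (mcU s l i))
      = fun a => algebraMap K _ (s.γ i j a) := funext (mcT_mcV_sub s i j)
  rw [h3] at h1
  refine (congrFun h1 l).trans ?_
  rw [Matrix.mulVec, dotProduct]
  refine Finset.sum_congr rfl fun k _ => ?_
  rw [Algebra.smul_def, mul_comm]

theorem mcV_comm (i j : Fin m) (f : MvPowerSeries (Fin m) K) :
    mcV s i (mcV s j f) - mcV s j (mcV s i f) = ∑ k, s.γ i j k • mcV s k f := by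
  have h (i j : Fin m) : mcV s i (mcV s j f) = ∑ l, mcV s i (mcU s l j) * MvPowerSeries.pderiv K l f
      + ∑ l, ∑ n, mcU s l j * mcU s n i * MvPowerSeries.pderiv K n (MvPowerSeries.pderiv K l f) := by
    rw [mcV_apply s j, map_sum, ← Finset.sum_add_distrib]
    refine Finset.sum_congr rfl fun l _ => ?_
    rw [Derivation.leibniz, smul_eq_mul, smul_eq_mul, add_comm, mul_comm]
    congr 1
    rw [mcV_apply, Finset.mul_sum]
    exact Finset.sum_congr rfl fun n _ => (mul_assoc _ _ _).symm
  rw [h i j, h j i, Finset.sum_comm (f := fun l n => mcU s l i * mcU s n j * _)]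
  have h2 : ∑ l, ∑ n, mcU s l j * mcU s n i * MvPowerSeries.pderiv K n (MvPowerSeries.pderiv K l f)
      = ∑ y, ∑ x, mcU s x i * mcU s y j * MvPowerSeries.pderiv K y (MvPowerSeries.pderiv K x f) :=
    Finset.sum_congr rfl fun l _ => Finset.sum_congr rfl fun n _ => by
      rw [ps_pderiv_comm, mul_comm (mcU s l j)]
  rw [h2, add_sub_add_right_eq_sub, ← Finset.sum_sub_distrib]
  simp only [← sub_mul, mcV_mcU_sub]
  simp only [mcV_apply, Finset.sum_mul, Finset.smul_sum, smul_mul_assoc]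
  have e (F : Fin m → Fin m → MvPowerSeries (Fin m) K) : ∑ l, ∑ k, F l k = ∑ k, ∑ l, F l k := Finset.sum_comm
  exact e _

lemma ordGE_mcU (i j : Fin m) : OrdGE 1 (mcU s i j - (1 : Matrix (Fin m) (Fin m) (MvPowerSeries (Fin m) K)) i j) := by
  intro α hα
  have h0 : α = 0 := (Finsupp.degree_eq_zero_iff α).mp (by omega)
  have h1 := congrArg (MvPowerSeries.constantCoeff (R := K) (σ := Fin m)).mapMatrix (mcT_mul_mcU s)
  rw [map_mul, constantCoeff_mcT, one_mul, map_one] at h1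
  have h2 := congrFun (congrFun h1 i) j
  rw [RingHom.mapMatrix_apply, Matrix.map_apply] at h2
  rw [h0, map_sub, MvPowerSeries.coeff_zero_eq_constantCoeff_apply, h2, MvPowerSeries.coeff_zero_eq_constantCoeff_apply,
    Matrix.one_apply, Matrix.one_apply]
  split_ifs <;> simp

lemma OrdGE.mcV {n : ℕ} {f : MvPowerSeries (Fin m) K} (hf : OrdGE (n + 1) f) (i : Fin m) : OrdGE n (mcV s i f) := by
  rw [mcV_apply]
  exact OrdGE.sum _ fun l _ => (hf.pderiv l).mul_left _

lemma OrdGE.mcV_sub {n : ℕ} {f : MvPowerSeries (Fin m) K} (hf : OrdGE n f) (i : Fin m) :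
    OrdGE n (Duflo.mcV s i f - MvPowerSeries.pderiv K i f) := by
  have h : Duflo.mcV s i f - MvPowerSeries.pderiv K i f = ∑ l, (mcU s l i - (1 : Matrix (Fin m) (Fin m) (MvPowerSeries (Fin m) K)) l i) *
      MvPowerSeries.pderiv K l f := by
    rw [mcV_apply]
    simp [sub_mul, Finset.sum_sub_distrib, Matrix.one_apply]
  rw [h]
  refine OrdGE.sum _ fun l _ => ?_
  rcases n with _ | n
  · exact ordGE_zero _
  · rw [add_comm]
    exact (ordGE_mcU s l i).mul (hf.pderiv l)

end Frame

section Hinj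

open MvPolynomial

variable {K : Type*} [Field K] [CharZero K] {m : ℕ} (s : SC K m) {U : Type*} [Ring U] [Algebra K U] (e : Fin m → U)
  (ρ : U →ₐ[K] Module.End K (MvPowerSeries (Fin m) K)) {R : Type*} [Field R] [CharZero R] [Algebra K R] [Algebra ℂ R]

/-- The matrix coefficient of a representation on power series at the origin. -/
def mcoef (f : MvPowerSeries (Fin m) K) : U →ₗ[K] K where
  toFun u := MvPowerSeries.coeff 0 (ρ u f)
  map_add' u v := by rw [map_add, LinearMap.add_apply, map_add]
  map_smul' c u := by rw [map_smul, LinearMap.smul_apply, map_smul, RingHom.id_apply]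

variable (R) in
/-- The generating function of the matrix coefficients on symmetrized words. -/
def mgen (f : MvPowerSeries (Fin m) K) : MvPolynomial (Fin m) R ⊗[K] U →ₗ[K] MvPolynomial (Fin m) R :=
  (TensorProduct.rid K _).toLinearMap ∘ₗ (mcoef ρ f).lTensor _

lemma mgen_tmul (f : MvPowerSeries (Fin m) K) (a : MvPolynomial (Fin m) R) (u : U) :
    mgen ρ R f (a ⊗ₜ u) = mcoef ρ f u • a := by
  rw [mgen, LinearMap.comp_apply, LinearMap.lTensor_tmul]
  exact TensorProduct.rid_tmul _ _

lemma mgen_mul_iot (hρ : ∀ i, ρ (e i) = (mcV s i).toLinearMap) (f : MvPowerSeries (Fin m) K) (w : MvPolynomial (Fin m) R ⊗[K] U) :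
    mgen ρ R f (w * iot K e X) = ∑ i, X i * mgen ρ R (mcV s i f) w := by
  induction w using TensorProduct.induction_on with
  | zero => simp
  | add a b ha hb => rw [add_mul, map_add, ha, hb, ← Finset.sum_add_distrib]; simp only [map_add, mul_add]
  | tmul a u =>
    rw [iot_apply, Finset.mul_sum, map_sum]
    refine Finset.sum_congr rfl fun i _ => ?_
    rw [Algebra.TensorProduct.tmul_mul_tmul, mgen_tmul, mgen_tmul, mul_smul_comm, mul_comm a]
    congr 1
    change MvPowerSeries.coeff 0 (ρ (u * e i) f) = MvPowerSeries.coeff 0 (ρ u (mcV s i f))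
    rw [map_mul, hρ]
    rfl

lemma mgen_pow_eq_zero (hρ : ∀ i, ρ (e i) = (mcV s i).toLinearMap) (k : ℕ) (f : MvPowerSeries (Fin m) K) (hf : OrdGE (k + 1) f) :
    mgen ρ R f (iot K e X ^ k) = 0 := by
  induction k generalizing f with
  | zero =>
    rw [pow_zero, Algebra.TensorProduct.one_def, mgen_tmul]
    have : mcoef ρ f 1 = 0 := by
      change MvPowerSeries.coeff 0 (ρ 1 f) = 0
      rw [map_one, Module.End.one_apply]
      exact hf 0 (by simp)
    rw [this, zero_smul]
  | succ k ih =>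
    rw [pow_succ, mgen_mul_iot s e ρ hρ]
    exact Finset.sum_eq_zero fun i _ => by rw [ih _ (hf.mcV s i), mul_zero]

lemma mgen_sub (f g : MvPowerSeries (Fin m) K) (w : MvPolynomial (Fin m) R ⊗[K] U) :
    mgen ρ R (f - g) w = mgen ρ R f w - mgen ρ R g w := by
  induction w using TensorProduct.induction_on with
  | zero => simp
  | add a b ha hb => rw [map_add, ha, hb, map_add, map_add]; ring
  | tmul a u =>
    rw [mgen_tmul, mgen_tmul, mgen_tmul, ← sub_smul]
    congr 1
    change MvPowerSeries.coeff 0 (ρ u (f - g)) = _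
    rw [map_sub, map_sub]
    rfl

lemma mgen_pow_of_isHomogeneous (hρ : ∀ i, ρ (e i) = (mcV s i).toLinearMap) (k : ℕ) (f : MvPolynomial (Fin m) K)
    (hf : f.IsHomogeneous k) : mgen ρ R (f : MvPowerSeries (Fin m) K) (iot K e X ^ k) = (k.factorial : R) • map (algebraMap K R) f := by
  induction k generalizing f with
  | zero =>
    obtain ⟨c, rfl⟩ : ∃ c, f = C c := ⟨_, totalDegree_eq_zero_iff_eq_C.mp
      (Nat.le_zero.mp hf.totalDegree_le)⟩
    rw [pow_zero, Algebra.TensorProduct.one_def, mgen_tmul, map_C, Nat.factorial_zero, Nat.cast_one, one_smul]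
    have : mcoef ρ ((C c : MvPolynomial (Fin m) K) : MvPowerSeries (Fin m) K) 1 = c := by
      change MvPowerSeries.coeff 0 (ρ 1 _) = c
      rw [map_one, Module.End.one_apply, coeff_coe, coeff_zero_C]
    rw [this, Algebra.smul_def, mul_one]
    rfl
  | succ k ih =>
    have ho : OrdGE (k + 1) (f : MvPowerSeries (Fin m) K) := by
      intro α hα
      rw [coeff_coe]
      exact hf.coeff_eq_zero (by omega)
    have h1 (i : Fin m) : mgen ρ R (mcV s i f) (iot K e X ^ k) = (k.factorial : R) • map (algebraMap K R) (pderiv i f) := by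
      rw [← ih (pderiv i f) (hf.pderiv (i := i)), ← sub_eq_zero, ← mgen_sub, ← MvPowerSeries.pderiv_coe]
      exact mgen_pow_eq_zero s e ρ hρ k _ (ho.mcV_sub s i)
    rw [pow_succ, mgen_mul_iot s e ρ hρ]
    simp only [h1, mul_smul_comm, ← Finset.smul_sum]
    have h2 := congrArg (MvPolynomial.map (algebraMap K R)) hf.sum_X_mul_pderiv
    simp only [map_sum, map_mul, map_X] at h2
    rw [h2, map_nsmul, ← Nat.cast_smul_eq_nsmul R, smul_smul, Nat.factorial_succ, mul_comm, Nat.cast_mul]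

lemma isHomogeneous_mgen_pow (hρ : ∀ i, ρ (e i) = (mcV s i).toLinearMap) (k : ℕ) (f : MvPowerSeries (Fin m) K) :
    (mgen ρ R f (iot K e X ^ k)).IsHomogeneous k := by
  induction k generalizing f with
  | zero =>
    rw [pow_zero, Algebra.TensorProduct.one_def, mgen_tmul, Algebra.smul_def, mul_one,
      IsScalarTower.algebraMap_apply K R (MvPolynomial (Fin m) R)]
    exact isHomogeneous_C _ _
  | succ k ih =>
    rw [pow_succ, mgen_mul_iot s e ρ hρ, add_comm]
    exact IsHomogeneous.sum _ _ _ fun i _ => (isHomogeneous_X R i).mul (ih _)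

theorem quant_zero_injective (hρ : ∀ i, ρ (e i) = (mcV s i).toLinearMap) (M : ℕ) (P : MvPolynomial (Fin m) R)
    (hP : P.totalDegree < M) (h : quant K e M 0 P = 0) : P = 0 := by
  by_contra hne
  obtain ⟨α, hα, hd⟩ := Finset.exists_mem_eq_sup P.support (support_nonempty.mpr hne) fun α => α.degree
  replace hd : P.totalDegree = α.degree := by rw [← hd, totalDegree]; rfl
  set n := P.totalDegree with hn
  set f : MvPowerSeries (Fin m) K := ((monomial α 1 : MvPolynomial (Fin m) K) : MvPowerSeries (Fin m) K) with hf
  have h1 (w : MvPolynomial (Fin m) R ⊗[K] U) :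
      TensorProduct.rid K R ((mcoef ρ f).lTensor R (((pair P).restrictScalars K).rTensor U w)) = pair P (mgen ρ R f w) := by
    induction w using TensorProduct.induction_on with
    | zero => simp
    | add a b ha hb => simp only [map_add, ha, hb]
    | tmul a u =>
      rw [mgen_tmul, LinearMap.rTensor_tmul, LinearMap.lTensor_tmul, TensorProduct.rid_tmul]
      exact (map_smul ((pair P).restrictScalars K) _ _).symm
  have h2 := h1 (genW K e M 0)
  rw [quant] at h
  rw [h, map_zero, map_zero, genW, nexp_zero_arg, ← Algebra.TensorProduct.one_def, one_mul, nexp, map_sum, map_sum] at h2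
  have hc (z : ℂ) (w : MvPolynomial (Fin m) R ⊗[K] U) : mgen ρ R f (z • w) = z • mgen ρ R f w := by
    induction w using TensorProduct.induction_on with
    | zero => simp
    | add a b ha hb => simp only [smul_add, map_add, ha, hb]
    | tmul a u => rw [TensorProduct.smul_tmul', mgen_tmul, mgen_tmul, smul_comm]
  have hp (z : ℂ) (g : MvPolynomial (Fin m) R) : pair P (z • g) = algebraMap ℂ R z * pair P g := by
    rw [← algebraMap_smul R z g, map_smul, smul_eq_mul]
  have hfo : OrdGE n f := by
    intro β hβ
    rw [hf, coeff_coe, coeff_monomial, if_neg]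
    rintro rfl
    omega
  have h3 : ∀ k ∈ Finset.range (M + 1), k ≠ n → pair P (mgen ρ R f ((k.factorial : ℂ)⁻¹ • iot K e X ^ k)) = 0 := by
    intro k _ hk
    rw [hc, hp]
    rcases lt_or_gt_of_ne hk with hk | hk
    · rw [mgen_pow_eq_zero s e ρ hρ k f (fun β hβ => hfo β (by omega)), map_zero, mul_zero]
    · have h4 : pair P (mgen ρ R f (iot K e X ^ k)) = 0 := by
        rw [pair_eq_sum]
        refine Finset.sum_eq_zero fun β hβ => ?_
        rw [(isHomogeneous_mgen_pow s e ρ hρ k f).coeff_eq_zero, mul_zero, mul_zero]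
        have : β.degree ≤ P.totalDegree := le_totalDegree hβ
        omega
      rw [h4, mul_zero]
  rw [Finset.sum_eq_single_of_mem n (Finset.mem_range.mpr (by omega)) h3, hc, hp, hf,
    mgen_pow_of_isHomogeneous s e ρ hρ n _ (isHomogeneous_monomial _ hd.symm), map_smul, smul_eq_mul, map_monomial, map_one,
    pair_comm, pair_monomial, one_mul] at h2
  have h5 : algebraMap ℂ R ((n.factorial : ℂ)⁻¹) ≠ 0 := by
    rw [Ne, map_eq_zero]
    exact inv_ne_zero (Nat.cast_ne_zero.mpr n.factorial_ne_zero)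
  have h6 : (n.factorial : R) ≠ 0 := Nat.cast_ne_zero.mpr n.factorial_ne_zero
  have h7 : (mfact α : R) ≠ 0 := by
    exact Nat.cast_ne_zero.mpr (Finset.prod_pos fun i _ => Nat.factorial_pos _).ne'
  exact mul_ne_zero h5 (mul_ne_zero h6 (mul_ne_zero h7 (mem_support_iff.mp hα))) h2.symm

end Hinj

end Duflo

open scoped TensorProduct

namespace Duflo

section LieSC

attribute [local instance 100] LieRing.ofAssociativeRing

variable {K L : Type*} [Field K] [CharZero K] [LieRing L] [LieAlgebra K L] {m : ℕ} (b : Module.Basis (Fin m) K L)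

lemma repr_lie_left (x y : L) (p : Fin m) : b.repr ⁅x, y⁆ p = ∑ l, b.repr x l * b.repr ⁅b l, y⁆ p := by
  conv_lhs => rw [← b.sum_repr x]
  rw [sum_lie, map_sum, Finsupp.finsetSum_apply]
  exact Finset.sum_congr rfl fun l _ => by rw [smul_lie, map_smul]; rfl

lemma repr_lie_right (x y : L) (p : Fin m) : b.repr ⁅x, y⁆ p = ∑ l, b.repr ⁅x, b l⁆ p * b.repr y l := by
  conv_lhs => rw [← b.sum_repr y]
  rw [lie_sum, map_sum, Finsupp.finsetSum_apply]
  exact Finset.sum_congr rfl fun l _ => by rw [lie_smul, map_smul, mul_comm]; rfl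

/-- The structure constants of a Lie algebra with a basis. -/
def lieSC : SC K m where
  γ i j k := b.repr ⁅b i, b j⁆ k
  anti i j k := by rw [← lie_skew, map_neg]; rfl
  jac i j k p := by
    rw [← repr_lie_left, Finset.sum_sub_distrib, ← repr_lie_right, ← repr_lie_right, lie_lie, map_sub]
    rfl

lemma lieSC_smul {N : Type*} [AddCommGroup N] [Module K N] (f : L →ₗ[K] N) (i j : Fin m) :
    ∑ k, (lieSC b).γ i j k • f (b k) = f ⁅b i, b j⁆ := by
  conv_rhs => rw [← b.sum_repr ⁅b i, b j⁆]
  rw [map_sum]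
  exact Finset.sum_congr rfl fun k _ => (map_smul f _ _).symm

/-- The generators of the enveloping algebra. -/
def envGen (i : Fin m) : UniversalEnvelopingAlgebra K L := UniversalEnvelopingAlgebra.ι K (b i)

lemma envGen_comm (i j : Fin m) :
    envGen b i * envGen b j - envGen b j * envGen b i = ∑ k, (lieSC b).γ i j k • envGen b k := by
  refine Eq.trans ?_ (lieSC_smul b (UniversalEnvelopingAlgebra.ι K : L →ₗ⁅K⁆ _).toLinearMap i j).symm
  exact ((UniversalEnvelopingAlgebra.ι K : L →ₗ⁅K⁆ UniversalEnvelopingAlgebra K L).map_lie (b i) (b j)).symm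

/-- The action of the Lie algebra by left-invariant formal vector fields. -/
def frameHom : L →ₗ⁅K⁆ Module.End K (MvPowerSeries (Fin m) K) where
  toLinearMap := b.constr K fun i => (mcV (lieSC b) i).toLinearMap
  map_lie' {x y} := by
    set F : L →ₗ[K] Module.End K (MvPowerSeries (Fin m) K) := b.constr K fun i => (mcV (lieSC b) i).toLinearMap with hF
    change F ⁅x, y⁆ = ⁅F x, F y⁆
    have hb (i : Fin m) : F (b i) = (mcV (lieSC b) i).toLinearMap := b.constr_basis _ _ _
    have h : (LieModule.toEnd K L L : L →ₗ[K] _).compr₂ F = (LieModule.toEnd K (Module.End K (MvPowerSeries (Fin m) K))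
        (Module.End K (MvPowerSeries (Fin m) K)) : _ →ₗ[K] _).compl₁₂ F F := by
      refine b.ext fun i => b.ext fun j => ?_
      change F ⁅b i, b j⁆ = ⁅F (b i), F (b j)⁆
      rw [← lieSC_smul, Ring.lie_def]
      simp only [hb]
      refine LinearMap.ext fun f => ?_
      rw [LinearMap.sum_apply]
      exact (mcV_comm (lieSC b) i j f).symm
    exact LinearMap.congr_fun (LinearMap.congr_fun h x) y

/-- The action of the enveloping algebra by left-invariant differential operators. -/
def frameRep : UniversalEnvelopingAlgebra K L →ₐ[K] Module.End K (MvPowerSeries (Fin m) K) :=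
  UniversalEnvelopingAlgebra.lift K (frameHom b)

lemma frameRep_envGen (i : Fin m) : frameRep b (envGen b i) = (mcV (lieSC b) i).toLinearMap := by
  rw [frameRep, envGen, UniversalEnvelopingAlgebra.lift_ι_apply]
  exact b.constr_basis _ _ _

open MvPolynomial

theorem quant_envGen_injective {R : Type*} [Field R] [CharZero R] [Algebra K R] [Algebra ℂ R] (M : ℕ)
    (P : MvPolynomial (Fin m) R) (hP : P.totalDegree < M) (h : quant K (envGen b) M 0 P = 0) : P = 0 :=
  quant_zero_injective (lieSC b) (envGen b) (frameRep b) (frameRep_envGen b) M P hP h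

end LieSC

end Duflo

open scoped TensorProduct

namespace Duflo

section Words

variable {m n : ℕ}

/-- The exponent vector of a word. -/
def wtype (f : Fin n → Fin m) : Fin m →₀ ℕ := ∑ j, Finsupp.single (f j) 1

lemma wtype_apply (f : Fin n → Fin m) (i : Fin m) : wtype f i = Fintype.card {a // f a = i} := by
  rw [wtype, Finsupp.finsetSum_apply, Fintype.card_subtype, Finset.card_filter]
  exact Finset.sum_congr rfl fun j _ => Finsupp.single_apply

lemma degree_wtype (f : Fin n → Fin m) : (wtype f).degree = n := by
  rw [wtype, map_sum]
  simp

lemma card_filter_comp (g f : Fin n → Fin m) :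
    (Finset.univ.filter fun σ : Equiv.Perm (Fin n) => g ∘ σ = f).card = if wtype f = wtype g then mfact (wtype g) else 0 := by
  split_ifs with h
  · have hc (i : Fin m) : Fintype.card {a // f a = i} = Fintype.card {a // g a = i} := by
      rw [← wtype_apply, ← wtype_apply, h]
    have he : ∃ τ : Equiv.Perm (Fin n), g ∘ τ = f :=
      ⟨Equiv.ofFiberEquiv fun i => Fintype.equivOfCardEq (hc i), funext fun a => Equiv.ofFiberEquiv_map _ a⟩
    obtain ⟨τ, hτ⟩ := he
    rw [mfact]
    simp only [wtype_apply]
    rw [← DomMulAct.stabilizer_card g, Fintype.card_subtype]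
    refine Finset.card_bij' (fun σ _ => σ * τ⁻¹) (fun σ _ => σ * τ) ?_ ?_ ?_ ?_
    · intro σ hσ
      rw [Finset.mem_filter] at hσ ⊢
      refine ⟨Finset.mem_univ _, funext fun a => ?_⟩
      have h1 := congrFun hσ.2 (τ⁻¹ a)
      rw [← hτ] at h1
      simpa using h1
    · intro σ hσ
      rw [Finset.mem_filter] at hσ ⊢
      refine ⟨Finset.mem_univ _, ?_⟩
      rw [← hτ, Equiv.Perm.coe_mul, ← Function.comp_assoc, hσ.2]
    · intro σ _; simp
    · intro σ _; simp
  · rw [Finset.card_eq_zero, Finset.filter_eq_empty_iff]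
    rintro σ _ rfl
    refine h (Finsupp.ext fun i => ?_)
    rw [wtype, wtype]
    exact congrArg (fun u : Fin m →₀ ℕ => u i) (Equiv.sum_comp σ fun j => Finsupp.single (g j) 1)

lemma sum_perm_comp {A : Type*} [AddCommMonoid A] (g : Fin n → Fin m) (W : (Fin n → Fin m) → A) :
    ∑ σ : Equiv.Perm (Fin n), W (g ∘ σ) = ∑ f, if wtype f = wtype g then mfact (wtype g) • W f else 0 := by
  rw [← Finset.sum_fiberwise Finset.univ (fun σ : Equiv.Perm (Fin n) => g ∘ σ)]
  refine Finset.sum_congr rfl fun f _ => ?_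
  rw [Finset.sum_congr rfl (g := fun _ => W f) (fun σ hσ => by rw [(Finset.mem_filter.mp hσ).2]), Finset.sum_const,
    card_filter_comp]
  split_ifs <;> simp

lemma sum_pow_eq_sum_words {A : Type*} [Semiring A] (g : Fin m → A) (n : ℕ) :
    (∑ i, g i) ^ n = ∑ f : Fin n → Fin m, (List.ofFn fun j => g (f j)).prod := by
  induction n with
  | zero => simp
  | succ n ih =>
    rw [pow_succ', ih, ← (Fin.consEquiv fun _ : Fin (n + 1) => Fin m).sum_comp, Fintype.sum_prod_type, Finset.sum_mul]
    refine Finset.sum_congr rfl fun i _ => ?_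
    rw [Finset.mul_sum]
    refine Finset.sum_congr rfl fun f _ => ?_
    rw [List.ofFn_succ, List.prod_cons]
    rfl

lemma list_prod_tmul {K A B : Type*} [CommRing K] [CommRing A] [Ring B] [Algebra K A] [Algebra K B] (n : ℕ) (x : Fin n → A) (y : Fin n → B) :
    (List.ofFn fun j => x j ⊗ₜ[K] y j).prod = (∏ j, x j) ⊗ₜ[K] (List.ofFn y).prod := by
  induction n with
  | zero => simp [Algebra.TensorProduct.one_def]
  | succ n ih =>
    rw [List.ofFn_succ, List.prod_cons, ih, Algebra.TensorProduct.tmul_mul_tmul, Fin.prod_univ_succ, List.ofFn_succ,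
      List.prod_cons]

open MvPolynomial

lemma prod_X_word {R : Type*} [CommRing R] (f : Fin n → Fin m) :
    ∏ j, (X (f j) : MvPolynomial (Fin m) R) = monomial (wtype f) 1 := by
  rw [wtype, monomial_sum_one]; rfl

lemma wtype_list (l : List (Fin m)) : wtype l.get = Multiset.toFinsupp (l : Multiset (Fin m)) := by
  induction l with
  | nil => simp [wtype]
  | cons x l ih =>
    rw [← Multiset.cons_coe, ← Multiset.singleton_add, map_add, Multiset.toFinsupp_singleton, ← ih, wtype, wtype]
    exact Fin.sum_univ_succ _

end Words

section Symm

open MvPolynomial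

variable {K : Type*} [Field K] [CharZero K] {m : ℕ} {U : Type*} [Ring U] [Algebra K U] (e : Fin m → U)
  {R : Type*} [Field R] [CharZero R] [Algebra K R] [Algebra ℂ R]

lemma quant_monomial {n : ℕ} (g : Fin n → Fin m) (M : ℕ) (hn : n ≤ M) (a : R) :
    quant K e M 0 (monomial (wtype g) a) = a ⊗ₜ ((n.factorial : K)⁻¹ • ∑ σ : Equiv.Perm (Fin n), (List.ofFn fun j => e (g (σ j))).prod) := by
  have h1 (k : ℕ) : iot K e (X : Fin m → MvPolynomial (Fin m) R) ^ k
      = ∑ f : Fin k → Fin m, monomial (wtype f) (1 : R) ⊗ₜ[K] (List.ofFn fun j => e (f j)).prod := by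
    rw [iot_apply, sum_pow_eq_sum_words]
    refine Finset.sum_congr rfl fun f _ => ?_
    rw [list_prod_tmul, prod_X_word]
  have h2 (k : ℕ) (f : Fin k → Fin m) (u : U) :
      ((pair (monomial (wtype g) a)).restrictScalars K).rTensor U ((k.factorial : ℂ)⁻¹ • (monomial (wtype f) (1 : R) ⊗ₜ[K] u))
        = (if wtype f = wtype g then a * mfact (wtype g) * (k.factorial : R)⁻¹ else 0) ⊗ₜ u := by
    rw [TensorProduct.smul_tmul', LinearMap.rTensor_tmul, LinearMap.restrictScalars_apply, ← algebraMap_smul R, map_smul,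
      pair_monomial, coeff_monomial, map_inv₀, map_natCast, smul_eq_mul]
    split_ifs
    · congr 1; ring
    · simp
  rw [quant, genW, nexp_zero_arg, ← Algebra.TensorProduct.one_def, one_mul, nexp, map_sum]
  simp only [h1, Finset.smul_sum, map_sum, h2]
  rw [Finset.sum_eq_single_of_mem n (Finset.mem_range.mpr (by omega)), ← Finset.smul_sum]
  · rw [show (∑ σ : Equiv.Perm (Fin n), (List.ofFn fun j => e (g (σ j))).prod) = _ from
      sum_perm_comp g fun f => (List.ofFn fun j => e (f j)).prod, ← TensorProduct.smul_tmul, TensorProduct.tmul_sum]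
    refine Finset.sum_congr rfl fun f _ => ?_
    split_ifs
    · rw [← Nat.cast_smul_eq_nsmul K, ← TensorProduct.smul_tmul, smul_smul, Algebra.smul_def, map_mul, map_inv₀, map_natCast,
        map_natCast]
      congr 1; ring
    · rw [TensorProduct.zero_tmul, TensorProduct.tmul_zero]
  · intro k _ hk
    refine Finset.sum_eq_zero fun f _ => ?_
    rw [if_neg, TensorProduct.zero_tmul]
    intro h
    apply hk
    rw [← degree_wtype f, h, degree_wtype]

end Symm

section Link

open MvPolynomial

variable {K : Type} [Field K] [CharZero K] {L : Type} [LieRing L] [LieAlgebra K L] {m : ℕ} (b : Module.Basis (Fin m) K L)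
  {R : Type*} [Field R] [CharZero R] [Algebra K R] [Algebra ℂ R]

theorem quant_zero_map (M : ℕ) (P : MvPolynomial (Fin m) K) (hP : P.totalDegree ≤ M) :
    quant K (envGen b) M 0 (MvPolynomial.map (algebraMap K R) P) = (1 : R) ⊗ₜ[K] symmetrization b P := by
  conv_lhs => rw [← P.support_sum_monomial_coeff]
  rw [map_sum, quant_sum, symmetrization, TensorProduct.tmul_sum]
  refine Finset.sum_congr rfl fun α hα => ?_
  have hw : wtype α.toMultiset.toList.get = α := by
    rw [wtype_list, Multiset.coe_toList]; exact Finsupp.toMultiset_toFinsupp α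
  have hl : α.toMultiset.toList.length ≤ M := by
    rw [← degree_wtype α.toMultiset.toList.get, hw]
    exact (le_totalDegree hα).trans hP
  have h1 := quant_monomial (K := K) (envGen b) α.toMultiset.toList.get M hl (algebraMap K R (coeff α P))
  rw [hw] at h1
  rw [map_monomial, h1, Algebra.algebraMap_eq_smul_one, TensorProduct.smul_tmul]
  rfl

end Link

end Duflo

open scoped TensorProduct

namespace Duflo

open MvPolynomial

section Base

variable {K R : Type*} [Field K] [Field R] [Algebra K R] {m : ℕ}

lemma dOp_map (α : Fin m →₀ ℕ) (P : MvPolynomial (Fin m) K) :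
    dOp α (MvPolynomial.map (algebraMap K R) P) = MvPolynomial.map (algebraMap K R) (dOp α P) := by
  have h1 (i : Fin m) (k : ℕ) (P : MvPolynomial (Fin m) K) :
      (((pderiv i).toLinearMap : Module.End R (MvPolynomial (Fin m) R)) ^ k) (MvPolynomial.map (algebraMap K R) P)
        = MvPolynomial.map (algebraMap K R) ((((pderiv i).toLinearMap : Module.End K (MvPolynomial (Fin m) K)) ^ k) P) := by
    induction k generalizing P with
    | zero => rfl
    | succ k ih =>
      rw [pow_succ, pow_succ, Module.End.mul_apply, Module.End.mul_apply, ← ih]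
      exact congrArg _ pderiv_map
  rw [dOp, dOp]
  induction List.finRange m with
  | nil => rfl
  | cons i l ih => rw [List.map_cons, List.map_cons, List.prod_cons, List.prod_cons, Module.End.mul_apply, Module.End.mul_apply, ih, h1]

lemma contr_map (f P : MvPolynomial (Fin m) K) :
    contr (MvPolynomial.map (algebraMap K R) f) (MvPolynomial.map (algebraMap K R) P) = MvPolynomial.map (algebraMap K R) (contr f P) := by
  rw [contr, contr, map_sum, support_map_of_injective _ (algebraMap K R).injective]
  refine Finset.sum_congr rfl fun α _ => ?_
  rw [coeff_map, dOp_map, smul_eq_C_mul, smul_eq_C_mul, map_mul, map_C]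

end Base

section Trace

variable {K : Type} [Field K] [CharZero K] {L : Type} [LieRing L] [LieAlgebra K L] {m : ℕ} (b : Module.Basis (Fin m) K L)
  {R : Type*} [Field R] [CharZero R] [Algebra K R] [Algebra ℂ R]

lemma toMatrix_ad (i : Fin m) : LinearMap.toMatrix b b (LieAlgebra.ad K L (b i)) = gm (lieSC b) i := by
  ext k j
  rw [LinearMap.toMatrix_apply]
  rfl

lemma trace_ad_word {n : ℕ} (f : Fin n → Fin m) :
    LinearMap.trace K L (List.ofFn fun j => (LieAlgebra.ad K L (b (f j)) : Module.End K L)).prod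
      = Matrix.trace (List.ofFn fun j => (gm (lieSC b) (f j) : Matrix (Fin m) (Fin m) K)).prod := by
  rw [LinearMap.trace_eq_matrix_trace K b]
  congr 1
  refine (map_list_prod (LinearMap.toMatrixAlgEquiv b) _).trans ?_
  rw [List.map_ofFn]
  congr 2
  funext j
  exact toMatrix_ad b (f j)

lemma gm_map (i : Fin m) : (gm ((lieSC b).map R) i : Matrix (Fin m) (Fin m) (MvPolynomial (Fin m) R))
    = (algebraMap K (MvPolynomial (Fin m) R)).mapMatrix (gm (lieSC b) i) := by
  refine Matrix.ext fun k j => ?_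
  exact (IsScalarTower.algebraMap_apply K R (MvPolynomial (Fin m) R) _).symm

lemma list_prod_smul {A B : Type*} [CommRing A] [Ring B] [Algebra A B] (n : ℕ) (x : Fin n → A) (y : Fin n → B) :
    (List.ofFn fun j => x j • y j).prod = (∏ j, x j) • (List.ofFn y).prod := by
  induction n with
  | zero => simp
  | succ n ih =>
    rw [List.ofFn_succ, List.prod_cons, ih, smul_mul_smul_comm, Fin.prod_univ_succ, List.ofFn_succ, List.prod_cons]

theorem map_adTracePoly (n : ℕ) : MvPolynomial.map (algebraMap K R) (adTracePoly b n) = trPoly (lieSC b) R n := by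
  rw [adTracePoly, trPoly, adM_eq_sum, sum_pow_eq_sum_words, Matrix.trace_sum, map_sum]
  refine Finset.sum_congr rfl fun f _ => ?_
  have h1 : (List.ofFn fun j => (gm ((lieSC b).map R) (f j) : Matrix (Fin m) (Fin m) (MvPolynomial (Fin m) R))).prod
      = (algebraMap K (MvPolynomial (Fin m) R)).mapMatrix (List.ofFn fun j => (gm (lieSC b) (f j) : Matrix (Fin m) (Fin m) K)).prod := by
    rw [map_list_prod, List.map_ofFn]
    exact congrArg (fun u => (List.ofFn u).prod) (funext fun j => gm_map b (f j))
  rw [list_prod_smul, Matrix.trace_smul, h1, trace_ad_word, smul_eq_C_mul, map_mul, map_C, map_prod, smul_eq_mul, mul_comm]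
  simp only [map_X]
  congr 1
  rw [RingHom.mapMatrix_apply, ← AddMonoidHom.map_trace, IsScalarTower.algebraMap_apply K R (MvPolynomial (Fin m) R)]
  rfl

end Trace

end Duflo

open scoped TensorProduct

namespace Duflo

open MvPolynomial

lemma totalDegree_map_algebraMap {K R : Type*} [Field K] [Field R] [Algebra K R] {m : ℕ} (P : MvPolynomial (Fin m) K) :
    (MvPolynomial.map (algebraMap K R) P).totalDegree = P.totalDegree := by
  rw [totalDegree, totalDegree, support_map_of_injective _ (algebraMap K R).injective]

section Symbol

variable {K : Type} [Field K] [CharZero K] {L : Type} [LieRing L] [LieAlgebra K L] {m : ℕ} (b : Module.Basis (Fin m) K L)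
  (c : ℕ → ℚ)

/-- A partial sum of the exponent of the Duflo symbol. -/
def dufloExponent (N : ℕ) : MvPolynomial (Fin m) K :=
  ∑ n ∈ Finset.Icc 1 N, ((2 * c (2 * n) : ℚ) : K) • adTracePoly b (2 * n)

lemma adTracePoly_mem (n : ℕ) : adTracePoly b n ∈ idealOfVars (Fin m) K ^ n := by
  refine Ideal.sum_mem _ fun f _ => ?_
  rw [prod_X_word, mem_pow_idealOfVars_iff']
  intro α hα
  rw [coeff_smul, coeff_monomial, if_neg, smul_zero]
  rintro rfl
  rw [degree_wtype] at hα
  exact lt_irrefl _ hα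

lemma smul_mem_ideal {R : Type*} [CommRing R] {S : Type*} [CommRing S] [Algebra R S] (I : Ideal S) (a : R) {x : S} (hx : x ∈ I) :
    a • x ∈ I := by
  rw [Algebra.smul_def]; exact I.mul_mem_left _ hx

lemma dufloExponent_sub_mem {A N r : ℕ} (hA : A ≤ N) (hr : r < 2 * (A + 1)) :
    dufloExponent b c N - dufloExponent b c A ∈ idealOfVars (Fin m) K ^ (r + 1) := by
  have h : Finset.Icc 1 A ⊆ Finset.Icc 1 N := Finset.Icc_subset_Icc_right hA
  rw [dufloExponent, dufloExponent, ← Finset.sum_sdiff h, add_sub_cancel_right]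
  refine Ideal.sum_mem _ fun n hn => smul_mem_ideal _ _ (Ideal.pow_le_pow_right ?_ (adTracePoly_mem b (2 * n)))
  simp only [Finset.mem_sdiff, Finset.mem_Icc] at hn
  omega

lemma dufloExponent_mem (N : ℕ) : dufloExponent b c N ∈ idealOfVars (Fin m) K := by
  have h := dufloExponent_sub_mem b c (A := 0) (N := N) (r := 0) (Nat.zero_le _) (by norm_num)
  rw [zero_add, pow_one] at h
  simpa [dufloExponent] using h

lemma sum_exp_sub_mem {S : Type*} [CommRing S] [Algebra K S] (I : Ideal S) {x y : S} {r M : ℕ} (hr : r ≤ M) (hx : x ∈ I)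
    (h : x - y ∈ I ^ (r + 1)) :
    (∑ k ∈ Finset.range (M + 1), (k.factorial : K)⁻¹ • x ^ k) - ∑ k ∈ Finset.range (r + 1), (k.factorial : K)⁻¹ • y ^ k
      ∈ I ^ (r + 1) := by
  have hs : Finset.range (r + 1) ⊆ Finset.range (M + 1) := Finset.range_subset_range.mpr (by omega)
  rw [← Finset.sum_sdiff hs, add_sub_assoc, ← Finset.sum_sub_distrib]
  refine Ideal.add_mem _ (Ideal.sum_mem _ fun k hk => smul_mem_ideal _ _ (Ideal.pow_le_pow_right ?_ (Ideal.pow_mem_pow hx k)))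
    (Ideal.sum_mem _ fun k _ => ?_)
  · simp only [Finset.mem_sdiff, Finset.mem_range] at hk
    omega
  · rw [← smul_sub]
    exact smul_mem_ideal _ _ (Ideal.mem_of_dvd _ (sub_dvd_pow_sub_pow x y k) h)

/-- A partial sum of the exponential of the exponent of the Duflo symbol. -/
def dufloExp (M : ℕ) : MvPolynomial (Fin m) K :=
  ∑ k ∈ Finset.range (M + 1), (k.factorial : K)⁻¹ • dufloExponent b c (M / 2) ^ k

lemma coeff_dufloExp {M r : ℕ} (hr : r ≤ M) (α : Fin m →₀ ℕ) (hα : α.degree = r) :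
    coeff α (dufloExp b c M) = coeff α (dufloSymbol b c r) := by
  have h1 : dufloExponent b c (M / 2) - dufloExponent b c r ∈ idealOfVars (Fin m) K ^ (r + 1) := by
    have h2 := dufloExponent_sub_mem b c (A := M / 2) (N := max (M / 2) r) (r := r) (le_max_left _ _) (by omega)
    have h3 := dufloExponent_sub_mem b c (A := r) (N := max (M / 2) r) (r := r) (le_max_right _ _) (by omega)
    have := Ideal.sub_mem _ h3 h2
    rwa [sub_sub_sub_cancel_left] at this
  have h4 := sum_exp_sub_mem (K := K) (idealOfVars (Fin m) K) hr (dufloExponent_mem b c (M / 2)) h1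
  rw [mem_pow_idealOfVars_iff'] at h4
  have h5 := h4 α (by omega)
  rw [coeff_sub, sub_eq_zero] at h5
  rw [dufloExp, h5, dufloSymbol, coeff_homogeneousComponent, if_pos hα]
  rfl

lemma dufloExp_sub_mem {M d : ℕ} (hd : d ≤ M) :
    dufloExp b c M - ∑ r ∈ Finset.range (d + 1), dufloSymbol b c r ∈ idealOfVars (Fin m) K ^ (d + 1) := by
  rw [mem_pow_idealOfVars_iff']
  intro α hα
  rw [coeff_sub, coeff_dufloExp b c (r := α.degree) (by omega) α rfl, coeff_sum,
    Finset.sum_eq_single_of_mem α.degree (Finset.mem_range.mpr hα), sub_self]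
  intro r _ hr
  rw [dufloSymbol, coeff_homogeneousComponent, if_neg hr.symm]

theorem quant_map_eq_duflo {R : Type*} [Field R] [CharZero R] [Algebra K R] [Algebra ℂ R] (M : ℕ) (P : MvPolynomial (Fin m) K)
    (hP : P.totalDegree < M) :
    quant K (envGen b) M (MvPolynomial.map (algebraMap K R) (dufloExponent b c (M / 2))) (MvPolynomial.map (algebraMap K R) P)
      = (1 : R) ⊗ₜ[K] duflo b c P := by
  have hd : (MvPolynomial.map (algebraMap K R) P).totalDegree = P.totalDegree :=
    totalDegree_map_algebraMap P
  have hI (k : ℕ) {f : MvPolynomial (Fin m) K} (hf : f ∈ idealOfVars (Fin m) K ^ k) :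
      MvPolynomial.map (algebraMap K R) f ∈ idealOfVars (Fin m) R ^ k := by
    rw [mem_pow_idealOfVars_iff'] at hf ⊢
    intro α hα
    rw [coeff_map, hf α hα, map_zero]
  have he : nexp (M + 1) (MvPolynomial.map (algebraMap K R) (dufloExponent b c (M / 2)))
      = MvPolynomial.map (algebraMap K R) (dufloExp b c M) := by
    rw [nexp, dufloExp, map_sum]
    refine Finset.sum_congr rfl fun k _ => ?_
    rw [smul_eq_C_mul, map_mul, map_C, map_pow, ← algebraMap_smul R ((k.factorial : ℂ)⁻¹), smul_eq_C_mul,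
      map_inv₀ (algebraMap ℂ R), map_natCast, map_inv₀ (algebraMap K R), map_natCast]
  have hm := hI 1 (by rw [pow_one]; exact dufloExponent_mem b c (M / 2))
  rw [pow_one] at hm
  have h1 := quant_contr (K := K) (envGen b) M (f := 0) (Ideal.zero_mem _) hm (hd.trans_lt hP)
  rw [zero_add] at h1
  rw [← h1, he, contr_congr (M := P.totalDegree + 1) (hd.trans_lt (Nat.lt_succ_self _))
    (g := ∑ r ∈ Finset.range (P.totalDegree + 1), MvPolynomial.map (algebraMap K R) (dufloSymbol b c r)), contr_sum, quant_sum, duflo,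
    TensorProduct.tmul_sum]
  · refine Finset.sum_congr rfl fun r _ => ?_
    rw [contr_map]
    exact quant_zero_map b M _ (by
      rw [← totalDegree_map_algebraMap (R := R), ← contr_map]
      exact (totalDegree_contr_le _ _).trans (hd.le.trans hP.le))
  · rw [← map_sum, ← map_sub]
    exact hI _ (dufloExp_sub_mem b c hP.le)

end Symbol

end Duflo

open scoped TensorProduct

namespace Duflo

section Series

open PowerSeries

lemma expPS_sub_dvd {F : PowerSeries ℚ} (hF : constantCoeff F = 0) (N : ℕ) :
    (X : PowerSeries ℚ) ^ N ∣ expPS F - ∑ k ∈ Finset.range N, (k.factorial : ℚ)⁻¹ • F ^ k := by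
  rw [X_pow_dvd_iff]
  intro n hn
  have hs : Finset.range (n + 1) ⊆ Finset.range N := Finset.range_subset_range.mpr hn
  rw [map_sub, map_sum, expPS, coeff_mk, ← Finset.sum_sdiff hs, sub_eq_zero]
  simp only [coeff_smul, smul_eq_mul]
  rw [Finset.sum_eq_zero (s := Finset.range N \ Finset.range (n + 1)), zero_add]
  intro k hk
  simp only [Finset.mem_sdiff, Finset.mem_range] at hk
  have h1 : (X : PowerSeries ℚ) ^ k ∣ F ^ k := pow_dvd_pow_of_dvd (X_dvd_iff.mpr hF) k
  rw [X_pow_dvd_iff.mp h1 n (by omega), mul_zero]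

lemma derivative_expPS {F : PowerSeries ℚ} (hF : constantCoeff F = 0) : derivative ℚ (expPS F) = derivative ℚ F * expPS F := by
  ext n
  obtain ⟨g, hg⟩ := expPS_sub_dvd hF (n + 2)
  obtain ⟨g', hg'⟩ := expPS_sub_dvd hF (n + 1)
  have h1 : derivative ℚ (∑ k ∈ Finset.range (n + 2), (k.factorial : ℚ)⁻¹ • F ^ k)
      = derivative ℚ F * ∑ k ∈ Finset.range (n + 1), (k.factorial : ℚ)⁻¹ • F ^ k := by
    rw [Finset.sum_range_succ', map_add, map_sum, Finset.mul_sum]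
    have h2 : derivative ℚ (((0 : ℕ).factorial : ℚ)⁻¹ • F ^ 0) = 0 := by
      rw [pow_zero, Derivation.map_smul, Derivation.map_one_eq_zero, smul_zero]
    rw [h2, add_zero]
    refine Finset.sum_congr rfl fun k _ => ?_
    have hk : (k.factorial : ℚ) ≠ 0 := Nat.cast_ne_zero.mpr k.factorial_ne_zero
    have hk' : (k : ℚ) + 1 ≠ 0 := by positivity
    rw [Derivation.map_smul, Derivation.leibniz_pow, Nat.add_sub_cancel, smul_eq_mul, ← Nat.cast_smul_eq_nsmul ℚ, smul_smul, mul_smul_comm,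
      Nat.factorial_succ, mul_comm (F ^ k)]
    congr 1
    push_cast
    field_simp
  rw [sub_eq_iff_eq_add] at hg hg'
  conv_lhs => rw [hg]
  conv_rhs => rw [hg']
  rw [map_add, h1, mul_add, map_add, map_add, Derivation.leibniz, Derivation.leibniz_pow]
  congr 1
  have hz (f : PowerSeries ℚ) (hf : (X : PowerSeries ℚ) ^ (n + 1) ∣ f) : coeff n f = 0 := X_pow_dvd_iff.mp hf n (Nat.lt_succ_self n)
  rw [hz, hz]
  · exact Dvd.intro _ (mul_left_comm _ _ _)
  · rw [smul_eq_mul, smul_eq_mul, smul_eq_mul, nsmul_eq_mul]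
    exact ⟨X * derivative ℚ g + g * (((n + 2 : ℕ) : PowerSeries ℚ) * derivative ℚ X), by rw [show n + 2 - 1 = n + 1 from rfl]; ring⟩

lemma X_mul_sinhHalfSeries : X * sinhHalfSeries = rescale (1 / 2 : ℚ) (exp ℚ) - rescale (-(1 / 2) : ℚ) (exp ℚ) := by
  ext n
  rcases n with _ | n
  · rw [coeff_zero_X_mul, map_sub, coeff_rescale, coeff_rescale, pow_zero, pow_zero, sub_self]
  rw [coeff_succ_X_mul, sinhHalfSeries, coeff_mk, map_sub, coeff_rescale, coeff_rescale, coeff_exp, ← sub_mul]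
  rcases Nat.even_or_odd' n with ⟨j, rfl | rfl⟩
  · rw [if_pos (by omega), Nat.mul_div_cancel_left j two_pos, Odd.neg_pow ⟨j, rfl⟩, pow_succ, pow_mul]
    norm_num
    rw [one_div, inv_pow]
    ring
  · rw [if_neg (by omega), Even.neg_pow ⟨j + 1, by ring⟩, sub_self, zero_mul]

theorem X_mul_derivative_of_expPS_eq {F : PowerSeries ℚ} (hF : constantCoeff F = 0) (h : expPS F = sinhHalfSeries) :
    X * derivative ℚ F = (1 / 2 : ℚ) • X + bernoulliPowerSeries ℚ - 1 := by
  have hd := derivative_expPS hF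
  rw [h] at hd
  set S := sinhHalfSeries
  set A := rescale (1 / 2 : ℚ) (exp ℚ) with hA
  set B := bernoulliPowerSeries ℚ
  have h1 : X * S * A = exp ℚ - 1 := by
    rw [X_mul_sinhHalfSeries, sub_mul, exp_mul_exp_eq_exp_add, exp_mul_exp_eq_exp_add]
    norm_num
  have h2 : B * (exp ℚ - 1) = X := bernoulliPowerSeries_mul_exp_sub_one ℚ
  have h3 : B * S * A = 1 := by
    rw [← h1] at h2
    have : X * (B * S * A) = X * 1 := by rw [mul_one]; linear_combination h2
    exact mul_left_cancel₀ X_ne_zero this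
  have h4 : derivative ℚ A = (1 / 2 : ℚ) • A := by
    ext n
    rw [coeff_derivative, coeff_smul, hA, coeff_rescale, coeff_rescale, coeff_exp, coeff_exp, Nat.factorial_succ, smul_eq_mul]
    have hk : (n.factorial : ℚ) ≠ 0 := Nat.cast_ne_zero.mpr n.factorial_ne_zero
    simp
    field_simp
    ring
  have h5 := congrArg (derivative ℚ) h1
  have h6 : derivative ℚ (exp ℚ) = exp ℚ := derivative_exp ℚ
  rw [Derivation.leibniz, Derivation.leibniz, map_sub, h6, Derivation.map_one_eq_zero, hd, h4] at h5
  simp only [smul_eq_mul, derivative_X, sub_zero, Algebra.smul_def] at h5 ⊢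
  have h7 : algebraMap ℚ (PowerSeries ℚ) (1 / 2) + algebraMap ℚ (PowerSeries ℚ) (1 / 2) = 1 := by
    rw [← map_add]; norm_num
  linear_combination B * h5 - (X * algebraMap ℚ (PowerSeries ℚ) (1 / 2) + X * derivative ℚ F + 1) * h3 + h2 - X * h7

theorem coeff_eq_bernoulli {c : ℕ → ℚ} (hc0 : c 0 = 0) (hc : expPS (PowerSeries.mk fun n => 4 * c n) = sinhHalfSeries) {n : ℕ}
    (hn : 2 ≤ n) : 4 * n * c n = bernoulli n / n.factorial := by
  obtain ⟨k, rfl⟩ : ∃ k, n = k + 1 := ⟨n - 1, by omega⟩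
  have h := congrArg (coeff (k + 1)) (X_mul_derivative_of_expPS_eq (by simp [hc0]) hc)
  rw [coeff_succ_X_mul, coeff_derivative, coeff_mk, map_sub, map_add, coeff_smul, coeff_X, if_neg (by omega), smul_zero, zero_add,
    coeff_one, if_neg (by omega), sub_zero, bernoulliPowerSeries, coeff_mk] at h
  push_cast
  rw [← mul_right_comm, h]
  rfl

end Series

section Even

open MvPolynomial

variable {K : Type} [Field K] [CharZero K] {L : Type} [LieRing L] [LieAlgebra K L] {m : ℕ} (b : Module.Basis (Fin m) K L)
  {R : Type*} [Field R] [CharZero R] [Algebra K R] [Algebra ℂ R]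

lemma pi_mul_I_pow_ne_zero {ε : ℂ} (hε : ε = 1 ∨ ε = -1) (n : ℕ) : (2 * ε * (Real.pi * Complex.I)) ^ n ≠ 0 := by
  refine pow_ne_zero _ (mul_ne_zero (mul_ne_zero two_ne_zero ?_) (mul_ne_zero (Complex.ofReal_ne_zero.mpr Real.pi_ne_zero) Complex.I_ne_zero))
  rcases hε with rfl | rfl <;> norm_num

lemma rho_coeff_even {k : ℕ} (h : Even (k + 1)) {ε : ℂ} (hε : ε = 1 ∨ ε = -1) :
    -(zt k / (k + 1)) * (2 * ε * (Real.pi * Complex.I))⁻¹ ^ (k + 1) = phi k / (2 * (k + 1)) := by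
  have h1 := phi_even h hε
  have h2 := pi_mul_I_pow_ne_zero hε (k + 1)
  have h3 : (k : ℂ) + 1 ≠ 0 := Nat.cast_add_one_ne_zero k
  rw [inv_pow]
  generalize (2 * ε * (Real.pi * Complex.I)) ^ (k + 1) = κ at *
  field_simp
  linear_combination -h1

theorem evenPoly_eq {c : ℕ → ℚ} (hc0 : c 0 = 0) (hc : expPS (PowerSeries.mk fun n => 4 * c n) = sinhHalfSeries) (M : ℕ) :
    evenPoly (lieSC b) R M = MvPolynomial.map (algebraMap K R) (dufloExponent b c (M / 2)) := by
  have h1 : evenPoly (lieSC b) R M = ∑ k ∈ Finset.Ico 1 M, if Even (k + 1) then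
      ((2 * c (k + 1) : ℚ) : R) • trPoly (lieSC b) R (k + 1) else 0 := by
    rw [evenPoly, rhoPoly, rhoPoly, ← Finset.sum_add_distrib, Finset.smul_sum]
    refine Finset.sum_congr rfl fun k hk => ?_
    rw [Finset.mem_Ico] at hk
    rw [← add_smul, smul_smul]
    split_ifs with he
    · rw [rho_coeff_even he (Or.inl rfl), rho_coeff_even he (Or.inr rfl), phi_eq, if_neg (by omega), zero_add,
        ← algebraMap_smul R]
      congr 1
      rw [← map_ratCast (algebraMap ℂ R)]
      congr 1
      have h2 := congrArg (fun q : ℚ => (q : ℂ)) (coeff_eq_bernoulli hc0 hc (n := k + 1) (by omega))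
      push_cast at h2 ⊢
      rw [← h2]
      have h3 : (k : ℂ) + 1 ≠ 0 := Nat.cast_add_one_ne_zero k
      field_simp
      ring
    · have ho : Odd (k + 1) := Nat.not_even_iff_odd.mp he
      have hκ : (2 * (-1) * (Real.pi * Complex.I) : ℂ) = -(2 * 1 * (Real.pi * Complex.I)) := by ring
      rw [hκ, inv_neg, ho.neg_pow, mul_neg, add_neg_cancel, mul_zero, zero_smul]
  rw [h1, dufloExponent, map_sum, ← Finset.sum_filter]
  symm
  refine Finset.sum_bij' (fun n _ => 2 * n - 1) (fun k _ => (k + 1) / 2) ?_ ?_ ?_ ?_ ?_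
  · intro n hn
    rw [Finset.mem_Icc] at hn
    rw [Finset.mem_filter, Finset.mem_Ico]
    exact ⟨by omega, n, by omega⟩
  · intro k hk
    rw [Finset.mem_filter, Finset.mem_Ico] at hk
    obtain ⟨_, j, hj⟩ := hk
    rw [Finset.mem_Icc]
    omega
  · intro n hn
    rw [Finset.mem_Icc] at hn
    omega
  · intro k hk
    rw [Finset.mem_filter] at hk
    obtain ⟨_, j, hj⟩ := hk
    omega
  · intro n hn
    rw [Finset.mem_Icc] at hn
    rw [show 2 * n - 1 + 1 = 2 * n by omega, smul_eq_C_mul, map_mul, map_C, map_adTracePoly, ← smul_eq_C_mul, map_ratCast]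

end Even

end Duflo

open scoped TensorProduct

namespace Duflo

section Conclusion

open MvPolynomial

variable {K : Type} [Field K] [CharZero K] {L : Type} [LieRing L] [LieAlgebra K L] {m : ℕ} (b : Module.Basis (Fin m) K L)
  {R : Type*} [Field R] [CharZero R] [Algebra K R] [Algebra ℂ R]

lemma linDer_map_lieSC (i : Fin m) (P : MvPolynomial (Fin m) K) :
    linDer (((lieSC b).map R).γ i) (MvPolynomial.map (algebraMap K R) P) = MvPolynomial.map (algebraMap K R) (adS b (b i) P) := by
  change _ = MvPolynomial.map (algebraMap K R) (mkDerivation K (fun j => linPoly b ⁅b i, b j⁆) P)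
  induction P using MvPolynomial.induction_on with
  | C a => rw [map_C, ← algebraMap_eq, ← algebraMap_eq, Derivation.map_algebraMap, Derivation.map_algebraMap, map_zero]
  | add p q hp hq => rw [map_add, map_add, map_add, map_add, hp, hq]
  | mul_X p j hp =>
    rw [map_mul, Derivation.leibniz, Derivation.leibniz, map_add, hp, map_X, linDer_X, mkDerivation_X, smul_eq_mul, smul_eq_mul,
      smul_eq_mul, smul_eq_mul, map_mul, map_mul, map_X, linPoly, map_sum]
    congr 2
    refine Finset.sum_congr rfl fun k _ => ?_
    rw [smul_eq_C_mul, smul_eq_C_mul, map_mul, map_C, map_X]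
    rfl

theorem one_tmul_duflo_mul {c : ℕ → ℚ} (hc0 : c 0 = 0) (hc : expPS (PowerSeries.mk fun n => 4 * c n) = sinhHalfSeries)
    {P Q : MvPolynomial (Fin m) K} (hP : ∀ x : L, adS b x P = 0) (hQ : ∀ x : L, adS b x Q = 0) :
    (1 : R) ⊗ₜ[K] duflo b c (P * Q) = (1 : R) ⊗ₜ[K] (duflo b c P * duflo b c Q) := by
  set M := P.totalDegree + Q.totalDegree + 1
  have hpq := totalDegree_mul P Q
  have h := quant_evenPoly_mul (R := R) (lieSC b) (envGen b) M (envGen_comm b)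
    (P := MvPolynomial.map (algebraMap K R) P) (Q := MvPolynomial.map (algebraMap K R) Q)
    (by rw [totalDegree_map_algebraMap, totalDegree_map_algebraMap]; omega)
    (fun i => by rw [linDer_map_lieSC, hP, map_zero]) (fun i => by rw [linDer_map_lieSC, hQ, map_zero])
    (quant_envGen_injective b M)
  rw [evenPoly_eq b hc0 hc, ← map_mul, quant_map_eq_duflo b c M P (by omega), quant_map_eq_duflo b c M Q (by omega),
    quant_map_eq_duflo b c M (P * Q) (by omega), Algebra.TensorProduct.tmul_mul_tmul, one_mul] at h
  exact h.symm

lemma exists_common_extension (K : Type) [Field K] [CharZero K] :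
    ∃ (R : Type) (_ : Field R) (_ : CharZero R) (_ : Algebra K R), Nonempty (Algebra ℂ R) := by
  obtain ⟨I, hI⟩ := Ideal.exists_maximal (K ⊗[ℚ] ℂ)
  let := Ideal.Quotient.field I
  let : Algebra K ((K ⊗[ℚ] ℂ) ⧸ I) :=
    ((Ideal.Quotient.mk I).comp (algebraMap K (K ⊗[ℚ] ℂ))).toAlgebra
  exact ⟨(K ⊗[ℚ] ℂ) ⧸ I, inferInstance, charZero_of_injective_algebraMap (algebraMap K _).injective, inferInstance,
    ⟨((Ideal.Quotient.mk I).comp (Algebra.TensorProduct.includeRight : ℂ →ₐ[ℚ] K ⊗[ℚ] ℂ).toRingHom).toAlgebra⟩⟩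

end Conclusion

end Duflo

end

noncomputable section

variable {K : Type} [Field K] [CharZero K]
variable {L : Type} [LieRing L] [LieAlgebra K L]
variable {m : ℕ}

/-- **The Duflo problem.**  For a finite dimensional Lie algebra `g` over a field of
characteristic zero (given by a basis `b`), the Duflo map `D : S(g) → U(g)` is multiplicative
on `g`-invariants: `D(PQ) = D(P)·D(Q)` for all `P, Q ∈ S(g)^g`.  Here `c` is the sequence of
coefficients determined by `Σ_n c_n x^n = (1/4)·log(sinh(x/2)/(x/2))`, i.e. by
`c_0 = 0` and `exp(Σ 4 c_n x^n) = sinh(x/2)/(x/2)`. -/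
theorem duflo_map_multiplicative
    (b : Module.Basis (Fin m) K L)
    (c : ℕ → ℚ) (hc0 : c 0 = 0)
    (hc : expPS (PowerSeries.mk fun n => 4 * c n) = sinhHalfSeries)
    (P Q : MvPolynomial (Fin m) K)
    (hP : ∀ x : L, adS b x P = 0) (hQ : ∀ x : L, adS b x Q = 0) :
    duflo b c (P * Q) = duflo b c P * duflo b c Q := by
  obtain ⟨R, _, _, _, ⟨_⟩⟩ := Duflo.exists_common_extension K
  exact Algebra.TensorProduct.includeRight_injective (A := R) (R := K) (B := UniversalEnvelopingAlgebra K L)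
    (algebraMap K R).injective (Duflo.one_tmul_duflo_mul (R := R) b hc0 hc hP hQ)

end
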